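/- (Integral test for the lower class at infinity.) Let ξ : [e^e, ∞) → (0, ∞) be a nondecreasing continuous function. Then ξ belongs to the lower-lower class of M at infinity (i.e. almost surely there exists t₀ such that M(t) ≥ ξ(t) for every t > t₀) if and only if the function t ↦ ξ(t)/t^{H+θ} is bounded on [e^e, ∞) and the integral I_∞(ξ) := ∫_{e^e}^{∞} (ξ(t)/t^{H+θ})^{−1/β} · φ(ξ(t)/t^{H+θ}) · dt/t is finite. -/

import Mathlib

open MeasureTheory ProbabilityTheory Real Set Filter

/-- A process is a centered Gaussian process if every finite linear combination of its
values has a centered Gaussian distribution. -/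
def IsCenteredGaussianProcess {Ω : Type*} [MeasurableSpace Ω] (P : Measure Ω)
    (X : ℝ → Ω → ℝ) : Prop :=
  ∀ (n : ℕ) (t : Fin n → ℝ) (c : Fin n → ℝ), ∃ v : NNReal,
    P.map (fun ω => ∑ i, c i * X (t i) ω) = ProbabilityTheory.gaussianReal 0 v

/-- The covariance function of the generalized fractional Brownian motion:
`E[X s X t] = ∫_ℝ ((s−u)₊^α − (−u)₊^α)((t−u)₊^α − (−u)₊^α)|u|^{−γ} du`. -/
noncomputable def gfbmCov (α γ s t : ℝ) : ℝ :=
  ∫ u : ℝ, ((max (s - u) 0) ^ α - (max (-u) 0) ^ α) *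
    ((max (t - u) 0) ^ α - (max (-u) 0) ^ α) * |u| ^ (-γ)

/-- `X` is a generalized fractional Brownian motion with parameters `(α, γ)` under `P`. -/
def IsGFBM {Ω : Type*} [MeasurableSpace Ω] (P : Measure Ω) (α γ : ℝ)
    (X : ℝ → Ω → ℝ) : Prop :=
  IsCenteredGaussianProcess P X ∧
  (∀ ω, ContinuousOn (fun t => X t ω) (Set.Ici 0)) ∧
  (∀ ω, X 0 ω = 0) ∧
  (∀ s t : ℝ, 0 ≤ s → 0 ≤ t → ∫ ω, X s ω * X t ω ∂P = gfbmCov α γ s t)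

/-- The fractional integral `Y(t) = (1/Γ(θ)) ∫₀^t (t−u)^{θ−1} X(u) du` of a process `X`. -/
noncomputable def fracInt {Ω : Type*} (θ : ℝ) (X : ℝ → Ω → ℝ) (t : ℝ) (ω : Ω) : ℝ :=
  (Real.Gamma θ)⁻¹ * ∫ u in (0:ℝ)..t, (t - u) ^ (θ - 1) * X u ω

/-- The running maximum `M(t) = sup_{0 ≤ s ≤ t} |Y(s)|`. -/
noncomputable def runSup {Ω : Type*} (Y : ℝ → Ω → ℝ) (t : ℝ) (ω : Ω) : ℝ :=
  ⨆ s : Set.Icc (0:ℝ) t, |Y s.1 ω|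

/-- The small ball function `φ(ε) = P(M(1) ≤ ε)`. -/
noncomputable def smallBall {Ω : Type*} [MeasurableSpace Ω] (P : Measure Ω)
    (Y : ℝ → Ω → ℝ) (ε : ℝ) : ℝ :=
  (P {ω | runSup Y 1 ω ≤ ε}).toReal

open scoped Pointwise in
theorem volume_convexCombo_of_isCompact {l : ℝ} (hl : l ∈ Ioo (0:ℝ) 1) {K L C : Set ℝ}
    (hK : IsCompact K) (hL : IsCompact L) (hK0 : K.Nonempty) (hL0 : L.Nonempty)
    (h : ∀ a ∈ K, ∀ b ∈ L, l * a + (1 - l) * b ∈ C) :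
    ENNReal.ofReal l * volume K + ENNReal.ofReal (1 - l) * volume L ≤ volume C := by
  obtain ⟨a, ha, hamax⟩ := hK.exists_isGreatest hK0
  obtain ⟨b, hb, hbmin⟩ := hL.exists_isLeast hL0
  have h1l : 0 < 1 - l := by linarith [hl.2]
  set S := (fun x => l * x + (1 - l) * b) '' K
  set T := (fun y => l * a + (1 - l) * y) '' L
  have hS : volume S = ENNReal.ofReal l * volume K := by
    have : S = (fun x => (1 - l) * b + x) '' (l • K) := by
      ext x; simp only [S, mem_image, Set.mem_smul_set, smul_eq_mul, exists_exists_and_eq_and]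
      constructor <;> rintro ⟨y, hy, rfl⟩ <;> exact ⟨y, hy, by ring⟩
    rw [this, image_add_left, measure_preimage_add, Measure.addHaar_smul]
    simp [abs_of_pos hl.1]
  have hT : volume T = ENNReal.ofReal (1 - l) * volume L := by
    have : T = (fun x => l * a + x) '' ((1 - l) • L) := by
      ext x; simp only [T, mem_image, Set.mem_smul_set, smul_eq_mul, exists_exists_and_eq_and]
    rw [this, image_add_left, measure_preimage_add, Measure.addHaar_smul]
    simp [abs_of_pos h1l]
  have hTm : MeasurableSet T := (hL.image (by fun_prop)).measurableSet
  have hdisj : AEDisjoint volume S T := by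
    refine measure_mono_null (t := {l * a + (1 - l) * b}) ?_ (by simp)
    rintro x ⟨⟨y, hy, rfl⟩, ⟨z, hz, hzy⟩⟩
    simp only at hzy ⊢
    have h1 := mul_le_mul_of_nonneg_left (hamax hy) hl.1.le
    have h2 := mul_le_mul_of_nonneg_left (hbmin hz) h1l.le
    simp only [mem_singleton_iff]
    linarith
  rw [← hS, ← hT, ← measure_union₀ hTm.nullMeasurableSet hdisj]
  refine measure_mono (union_subset ?_ ?_)
  · rintro _ ⟨x, hx, rfl⟩; exact h x hx b hb
  · rintro _ ⟨x, hx, rfl⟩; exact h a ha x hx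

theorem volume_convexCombo {l : ℝ} (hl : l ∈ Ioo (0:ℝ) 1) {A B C : Set ℝ}
    (hA : MeasurableSet A) (hB : MeasurableSet B) (hA0 : A.Nonempty) (hB0 : B.Nonempty)
    (h : ∀ a ∈ A, ∀ b ∈ B, l * a + (1 - l) * b ∈ C) :
    ENNReal.ofReal l * volume A + ENNReal.ofReal (1 - l) * volume B ≤ volume C := by
  obtain ⟨a, ha⟩ := hA0
  obtain ⟨b, hb⟩ := hB0
  have key : ∀ K ⊆ A, IsCompact K → ∀ L ⊆ B, IsCompact L →
      ENNReal.ofReal l * volume K + ENNReal.ofReal (1 - l) * volume L ≤ volume C := by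
    intro K hKA hK L hLB hL
    refine le_trans ?_ (volume_convexCombo_of_isCompact hl (hK.insert a) (hL.insert b)
      (insert_nonempty _ _) (insert_nonempty _ _) ?_)
    · gcongr <;> exact subset_insert _ _
    · intro x hx y hy
      exact h x (insert_subset ha hKA hx) y (insert_subset hb hLB hy)
  rw [hA.measure_eq_iSup_isCompact, hB.measure_eq_iSup_isCompact]
  simp only [ENNReal.mul_iSup, iSup_and']
  exact ENNReal.biSup_add_biSup_le' ⟨∅, by simp⟩ ⟨∅, by simp⟩
    fun K hK L hL => key K hK.1 hK.2 L hL.1 hL.2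

theorem ENNReal.geom_mean_le_arith_mean2_of_mem_Ioo {l : ℝ} (hl : l ∈ Ioo (0:ℝ) 1) (a b : ENNReal) :
    a ^ l * b ^ (1 - l) ≤ ENNReal.ofReal l * a + ENNReal.ofReal (1 - l) * b := by
  have h1l : 0 < 1 - l := by linarith [hl.2]
  rcases eq_or_ne a ⊤ with rfl | ha
  · simp [ENNReal.mul_top, hl.1]
  rcases eq_or_ne b ⊤ with rfl | hb
  · rw [ENNReal.mul_top (by simpa using h1l), add_top]; exact le_top
  lift a to NNReal using ha
  lift b to NNReal using hb
  have := NNReal.geom_mean_le_arith_mean2_weighted l.toNNReal (1 - l).toNNReal a b (by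
    rw [← Real.toNNReal_add hl.1.le h1l.le]; simp)
  rw [Real.coe_toNNReal _ hl.1.le, Real.coe_toNNReal _ h1l.le] at this
  rw [← ENNReal.coe_rpow_of_nonneg _ hl.1.le, ← ENNReal.coe_rpow_of_nonneg _ h1l.le]
  simp only [ENNReal.ofReal]
  exact_mod_cast this

theorem lintegral_convexCombo_of_iSup_eq_one {l : ℝ} (hl : l ∈ Ioo (0:ℝ) 1) {f g h : ℝ → ENNReal}
    (hf : Measurable f) (hg : Measurable g) (hh : Measurable h)
    (hf1 : ⨆ x, f x = 1) (hg1 : ⨆ x, g x = 1)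
    (H : ∀ x y, f x ^ l * g y ^ (1 - l) ≤ h (l * x + (1 - l) * y)) :
    ENNReal.ofReal l * (∫⁻ x, f x) + ENNReal.ofReal (1 - l) * (∫⁻ x, g x) ≤ ∫⁻ x, h x := by
  have h1l : 0 < 1 - l := by linarith [hl.2]
  have layer : ∀ F : ℝ → ENNReal, Measurable F → (∀ x, F x ≤ 1) →
      ∫⁻ x, F x = ∫⁻ t in Ioo (0:ℝ) 1, volume {x | ENNReal.ofReal t < F x} := by
    intro F hF hF1
    have e1 : ∀ x, F x = ENNReal.ofReal (F x).toReal := fun x =>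
      (ENNReal.ofReal_toReal ((hF1 x).trans_lt ENNReal.one_lt_top).ne).symm
    have e2 : ∫⁻ x, F x = ∫⁻ x, ENNReal.ofReal (F x).toReal := lintegral_congr e1
    rw [e2, lintegral_eq_lintegral_meas_lt _ (ae_of_all _ fun x => ENNReal.toReal_nonneg)
      hF.ennreal_toReal.aemeasurable]
    have e3 : ∀ t ∈ Ioi (0:ℝ), volume {x | t < (F x).toReal}
        = (Ioo (0:ℝ) 1).indicator (fun t => volume {x | ENNReal.ofReal t < F x}) t := by
      intro t ht
      by_cases h1 : t < 1
      · rw [indicator_of_mem (show t ∈ Ioo (0:ℝ) 1 from ⟨ht, h1⟩)]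
        congr 1; ext x
        simp only [mem_ofPred_eq]
        rw [ENNReal.ofReal_lt_iff_lt_toReal (le_of_lt ht) ((hF1 x).trans_lt ENNReal.one_lt_top).ne]
      · rw [indicator_of_notMem (fun hx => h1 hx.2)]
        convert measure_empty (μ := (volume : Measure ℝ))
        ext x
        simp only [mem_ofPred_eq, mem_empty_iff_false, iff_false, not_lt]
        refine le_trans ?_ (not_lt.1 h1)
        exact ENNReal.toReal_mono (by simp) (hF1 x)
    rw [setLIntegral_congr_fun measurableSet_Ioi e3, setLIntegral_indicator measurableSet_Ioo]
    congr 2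
    ext t; simp +contextual
  have hf' : ∀ x, f x ≤ 1 := fun x => hf1 ▸ le_iSup f x
  have hg' : ∀ x, g x ≤ 1 := fun x => hg1 ▸ le_iSup g x
  calc _ ≤ ∫⁻ x, min (h x) 1 := by
        rw [layer f hf hf', layer g hg hg', layer (fun x => min (h x) 1) (by fun_prop) (fun x => min_le_right _ _)]
        rw [← lintegral_const_mul' _ _ (by simp), ← lintegral_const_mul' _ _ (by simp)]
        refine (le_lintegral_add _ _).trans ?_
        refine setLIntegral_mono' measurableSet_Ioo ?_
        intro t ht
        have ht1 : ENNReal.ofReal t < 1 := by simpa using ht.2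
        refine volume_convexCombo hl (measurableSet_lt measurable_const hf)
          (measurableSet_lt measurable_const hg) ?_ ?_ ?_
        · exact lt_iSup_iff.1 (hf1 ▸ ht1)
        · exact lt_iSup_iff.1 (hg1 ▸ ht1)
        · intro a ha b hb
          simp only [mem_ofPred_eq] at ha hb ⊢
          refine lt_min (lt_of_lt_of_le ?_ (H a b)) ht1
          have hb0 : ENNReal.ofReal t ≠ 0 := by simpa using ht.1
          calc ENNReal.ofReal t = ENNReal.ofReal t ^ l * ENNReal.ofReal t ^ (1 - l) := by
                rw [← ENNReal.rpow_add _ _ hb0 (by simp)]; simp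
            _ < _ := ENNReal.mul_lt_mul (ENNReal.rpow_lt_rpow ha hl.1) (ENNReal.rpow_lt_rpow hb h1l)
    _ ≤ _ := lintegral_mono fun x => min_le_left _ _

/-- The Prékopa–Leindler property of a measure, for bounded functions. -/
def PrekopaLeindler {E : Type*} [AddCommGroup E] [Module ℝ E] [MeasurableSpace E]
    (μ : Measure E) : Prop :=
  ∀ l ∈ Ioo (0:ℝ) 1, ∀ (M : NNReal) (f g h : E → ENNReal), Measurable f → Measurable g → Measurable h →
    (∀ x, f x ≤ M) → (∀ x, g x ≤ M) →
    (∀ x y, f x ^ l * g y ^ (1 - l) ≤ h (l • x + (1 - l) • y)) →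
    (∫⁻ x, f x ∂μ) ^ l * (∫⁻ x, g x ∂μ) ^ (1 - l) ≤ ∫⁻ x, h x ∂μ

theorem prekopaLeindler_volume : PrekopaLeindler (volume : Measure ℝ) := by
  intro l hl M f g h hf hg hh hfM hgM H
  have h1l : 0 < 1 - l := by linarith [hl.2]
  set F := ⨆ x, f x with hF
  set G := ⨆ x, g x with hG
  have hFt : F ≠ ⊤ := ne_top_of_le_ne_top (b := (M : ENNReal)) (by simp) (iSup_le hfM)
  have hGt : G ≠ ⊤ := ne_top_of_le_ne_top (b := (M : ENNReal)) (by simp) (iSup_le hgM)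
  rcases eq_or_ne F 0 with hF0 | hF0
  · have : ∀ x, f x = 0 := fun x => le_antisymm (hF0 ▸ le_iSup f x) bot_le
    simp [this, hl.1]
  rcases eq_or_ne G 0 with hG0 | hG0
  · have : ∀ x, g x = 0 := fun x => le_antisymm (hG0 ▸ le_iSup g x) bot_le
    simp only [this, lintegral_zero, ENNReal.zero_rpow_of_pos h1l, mul_zero, zero_le]
  set N := F ^ l * G ^ (1 - l)
  have hN0 : N ≠ 0 := mul_ne_zero (by simp [hF0, hFt]) (by simp [hG0, hGt])
  have hNt : N ≠ ⊤ := ENNReal.mul_ne_top (by simp [hFt, hF0]) (by simp [hGt, hG0])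
  have hinv : N⁻¹ = (F⁻¹) ^ l * (G⁻¹) ^ (1 - l) := by
    rw [ENNReal.inv_rpow, ENNReal.inv_rpow, ENNReal.mul_inv] <;> simp [hF0, hG0, hFt, hGt]
  have key := lintegral_convexCombo_of_iSup_eq_one hl (f := fun x => F⁻¹ * f x)
    (g := fun x => G⁻¹ * g x) (h := fun x => N⁻¹ * h x) (by fun_prop) (by fun_prop) (by fun_prop)
    (by rw [← ENNReal.mul_iSup, ENNReal.inv_mul_cancel hF0 hFt])
    (by rw [← ENNReal.mul_iSup, ENNReal.inv_mul_cancel hG0 hGt]) (by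
      intro x y
      rw [ENNReal.mul_rpow_of_nonneg _ _ hl.1.le, ENNReal.mul_rpow_of_nonneg _ _ h1l.le, hinv]
      calc _ = (F⁻¹) ^ l * (G⁻¹) ^ (1 - l) * (f x ^ l * g y ^ (1 - l)) := by ring
        _ ≤ _ := by gcongr; exact H x y)
  rw [lintegral_const_mul _ hf, lintegral_const_mul _ hg, lintegral_const_mul _ hh] at key
  have k2 := (ENNReal.geom_mean_le_arith_mean2_of_mem_Ioo hl _ _).trans key
  rw [ENNReal.mul_rpow_of_nonneg _ _ hl.1.le, ENNReal.mul_rpow_of_nonneg _ _ h1l.le] at k2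
  have k3 : N⁻¹ * ((∫⁻ x, f x) ^ l * (∫⁻ x, g x) ^ (1 - l)) ≤ N⁻¹ * ∫⁻ x, h x := by
    refine le_trans (le_of_eq ?_) k2
    rw [hinv]; ring
  rwa [ENNReal.mul_le_mul_iff_right (by simpa using hNt) (by simpa using hN0)] at k3

theorem gaussianPDF_logConcave {l : ℝ} (hl : l ∈ Ioo (0:ℝ) 1) (x y : ℝ) :
    gaussianPDF 0 1 x ^ l * gaussianPDF 0 1 y ^ (1 - l) ≤ gaussianPDF 0 1 (l * x + (1 - l) * y) := by
  have h1l : 0 < 1 - l := by linarith [hl.2]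
  simp only [gaussianPDF]
  rw [ENNReal.ofReal_rpow_of_nonneg (gaussianPDFReal_nonneg _ _ _) hl.1.le,
    ENNReal.ofReal_rpow_of_nonneg (gaussianPDFReal_nonneg _ _ _) h1l.le, ← ENNReal.ofReal_mul
    (Real.rpow_nonneg (gaussianPDFReal_nonneg _ _ _) _)]
  refine ENNReal.ofReal_le_ofReal ?_
  simp only [gaussianPDFReal, NNReal.coe_one, mul_one, sub_zero]
  set c := (√(2 * π))⁻¹
  have hc : 0 < c := by positivity
  rw [Real.mul_rpow hc.le (exp_nonneg _), Real.mul_rpow hc.le (exp_nonneg _), ← Real.exp_mul,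
    ← Real.exp_mul]
  calc _ = (c ^ l * c ^ (1 - l)) * (rexp (-x ^ 2 / 2 * l) * rexp (-y ^ 2 / 2 * (1 - l))) := by ring
    _ = c * rexp (-x ^ 2 / 2 * l + -y ^ 2 / 2 * (1 - l)) := by
      rw [← Real.rpow_add hc, ← Real.exp_add]; simp
    _ ≤ _ := by
      gcongr
      nlinarith [mul_nonneg (mul_nonneg hl.1.le h1l.le) (sq_nonneg (x - y))]

theorem prekopaLeindler_gaussianReal : PrekopaLeindler (gaussianReal 0 1) := by
  intro l hl M f g h hf hg hh hfM hgM H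
  have h1l : 0 < 1 - l := by linarith [hl.2]
  rw [gaussianReal_of_var_ne_zero _ one_ne_zero]
  have hm := measurable_gaussianPDF 0 1
  rw [lintegral_withDensity_eq_lintegral_mul _ hm hf, lintegral_withDensity_eq_lintegral_mul _ hm hg,
    lintegral_withDensity_eq_lintegral_mul _ hm hh]
  have hb : ∀ x, gaussianPDF 0 1 x ≤ (1 : NNReal) := by
    intro x
    simp only [gaussianPDF, ENNReal.coe_one]
    refine ENNReal.ofReal_le_one.2 ?_
    simp only [gaussianPDFReal, NNReal.coe_one, mul_one, sub_zero]
    refine mul_le_one₀ (inv_le_one_of_one_le₀ ?_) (exp_nonneg _) (Real.exp_le_one_iff.2 ?_)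
    · rw [Real.one_le_sqrt]; nlinarith [Real.pi_gt_three]
    · nlinarith [sq_nonneg x]
  refine prekopaLeindler_volume l hl M _ _ _ (hm.mul hf) (hm.mul hg) (hm.mul hh) ?_ ?_ ?_
  · intro x; simpa using mul_le_mul' (hb x) (hfM x)
  · intro x; simpa using mul_le_mul' (hb x) (hgM x)
  · intro x y
    simp only [Pi.mul_apply]
    rw [ENNReal.mul_rpow_of_nonneg _ _ hl.1.le, ENNReal.mul_rpow_of_nonneg _ _ h1l.le]
    calc _ = (gaussianPDF 0 1 x ^ l * gaussianPDF 0 1 y ^ (1 - l)) * (f x ^ l * g y ^ (1 - l)) := by ring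
      _ ≤ _ := mul_le_mul' (gaussianPDF_logConcave hl x y) (H x y)

theorem PrekopaLeindler.prod {E F : Type*} [AddCommGroup E] [Module ℝ E] [MeasurableSpace E]
    [AddCommGroup F] [Module ℝ F] [MeasurableSpace F] {μ : Measure E} {ν : Measure F}
    [IsProbabilityMeasure μ] [IsProbabilityMeasure ν]
    (hμ : PrekopaLeindler μ) (hν : PrekopaLeindler ν) : PrekopaLeindler (μ.prod ν) := by
  intro l hl M f g h hf hg hh hfM hgM H
  rw [lintegral_prod _ hf.aemeasurable, lintegral_prod _ hg.aemeasurable,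
    lintegral_prod _ hh.aemeasurable]
  have hbound : ∀ F' : E × F → ENNReal, (∀ x, F' x ≤ M) → ∀ x, ∫⁻ y, F' (x, y) ∂ν ≤ M := by
    intro F' hF' x
    calc _ ≤ ∫⁻ _, (M : ENNReal) ∂ν := lintegral_mono fun y => hF' _
      _ = M := by simp
  refine hμ l hl M _ _ _ hf.lintegral_prod_right' hg.lintegral_prod_right' hh.lintegral_prod_right'
    (hbound f hfM) (hbound g hgM) ?_
  intro x x'
  refine hν l hl M _ _ _ (by fun_prop) (by fun_prop) (by fun_prop) (fun y => hfM _) (fun y => hgM _) ?_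
  intro y y'
  exact H (x, y) (x', y')

theorem PrekopaLeindler.map {E F : Type*} [AddCommGroup E] [Module ℝ E] [MeasurableSpace E]
    [AddCommGroup F] [Module ℝ F] [MeasurableSpace F] {μ : Measure E}
    (hμ : PrekopaLeindler μ) (T : E →ₗ[ℝ] F) (hT : Measurable T) : PrekopaLeindler (μ.map T) := by
  intro l hl M f g h hf hg hh hfM hgM H
  rw [lintegral_map hf hT, lintegral_map hg hT, lintegral_map hh hT]
  refine hμ l hl M _ _ _ (hf.comp hT) (hg.comp hT) (hh.comp hT) (fun x => hfM _) (fun x => hgM _) ?_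
  intro x y
  simpa using H (T x) (T y)

theorem prekopaLeindler_pi_fin (n : ℕ) :
    PrekopaLeindler (Measure.pi fun _ : Fin n => gaussianReal 0 1) := by
  induction n with
  | zero =>
    intro l hl M f g h hf hg hh hfM hgM H
    rw [Measure.pi_of_empty, lintegral_dirac' _ hf, lintegral_dirac' _ hg, lintegral_dirac' _ hh]
    convert H _ _
  | succ n ih =>
    have hp := (measurePreserving_piFinSuccAbove (fun _ : Fin (n + 1) => gaussianReal 0 1) 0).symm
    rw [← hp.map_eq]
    refine (prekopaLeindler_gaussianReal.prod ih).map
      (F := Fin (n + 1) → ℝ) { toFun := (MeasurableEquiv.piFinSuccAbove (fun _ => ℝ) 0).symm, map_add' := ?_, map_smul' := ?_ } hp.measurable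
    · intro x y
      ext i
      refine Fin.cases ?_ (fun j => ?_) i <;> simp [MeasurableEquiv.piFinSuccAbove]
    · intro c x
      ext i
      refine Fin.cases ?_ (fun j => ?_) i <;> simp [MeasurableEquiv.piFinSuccAbove]

theorem prekopaLeindler_stdGaussian (E : Type*) [NormedAddCommGroup E] [InnerProductSpace ℝ E]
    [FiniteDimensional ℝ E] [MeasurableSpace E] [BorelSpace E] : PrekopaLeindler (stdGaussian E) := by
  rw [stdGaussian_eq_map_pi_orthonormalBasis (stdOrthonormalBasis ℝ E)]
  let T : (Fin (Module.finrank ℝ E) → ℝ) →ₗ[ℝ] E :=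
    { toFun := fun x => ∑ i, x i • stdOrthonormalBasis ℝ E i
      map_add' := fun x y => by simp [add_smul, Finset.sum_add_distrib]
      map_smul' := fun c x => by simp [mul_smul, Finset.smul_sum] }
  have hT : Measurable T := by
    change Measurable fun x : Fin (Module.finrank ℝ E) → ℝ => ∑ i, x i • stdOrthonormalBasis ℝ E i
    fun_prop
  exact (prekopaLeindler_pi_fin _).map T hT

/-- A measure is log-concave if it satisfies the multiplicative Brunn–Minkowski inequality. -/
def LogConcaveMeasure {E : Type*} [AddCommGroup E] [Module ℝ E] [MeasurableSpace E]
    (μ : Measure E) : Prop :=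
  ∀ l ∈ Ioo (0:ℝ) 1, ∀ A B C : Set E, MeasurableSet A → MeasurableSet B → MeasurableSet C →
    (∀ x ∈ A, ∀ y ∈ B, l • x + (1 - l) • y ∈ C) → μ A ^ l * μ B ^ (1 - l) ≤ μ C

theorem PrekopaLeindler.logConcaveMeasure {E : Type*} [AddCommGroup E] [Module ℝ E]
    [MeasurableSpace E] {μ : Measure E} (hμ : PrekopaLeindler μ) : LogConcaveMeasure μ := by
  intro l hl A B C hA hB hC H
  have h1l : 0 < 1 - l := by linarith [hl.2]
  have := hμ l hl 1 (A.indicator 1) (B.indicator 1) (C.indicator 1) (measurable_one.indicator hA)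
    (measurable_one.indicator hB) (measurable_one.indicator hC) (fun x => ?_) (fun x => ?_) ?_
  · simpa [lintegral_indicator_one, hA, hB, hC] using this
  · by_cases h : x ∈ A <;> simp [h]
  · by_cases h : x ∈ B <;> simp [h]
  · intro x y
    by_cases hx : x ∈ A
    · by_cases hy : y ∈ B
      · simp [hx, hy, H x hx y hy]
      · simp [hy, ENNReal.zero_rpow_of_pos h1l]
    · simp [hx, hl.1]

/-- A probability law on `κ → ℝ` is the centered Gaussian law with the Gram matrix of `h`. -/
def IsGaussLaw {κ E : Type*} [Fintype κ] [NormedAddCommGroup E] [InnerProductSpace ℝ E]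
    (μ : Measure (κ → ℝ)) (h : κ → E) : Prop :=
  ∀ c : κ → ℝ, μ.map (fun x => ∑ i, c i * x i) = gaussianReal 0 (‖∑ i, c i • h i‖₊ ^ 2)

section GaussLaw

variable {κ E F : Type*} [Fintype κ] [NormedAddCommGroup E] [InnerProductSpace ℝ E]
  [NormedAddCommGroup F] [InnerProductSpace ℝ F]

theorem IsGaussLaw.isProbabilityMeasure {μ : Measure (κ → ℝ)} {h : κ → E} (hμ : IsGaussLaw μ h) :
    IsProbabilityMeasure μ := by
  have h0 := hμ 0
  constructor
  have : (μ.map (fun x => ∑ i, (0 : κ → ℝ) i * x i)) univ = 1 := by rw [h0]; simp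
  rwa [Measure.map_apply (by fun_prop) MeasurableSet.univ] at this

theorem IsGaussLaw.ext {μ ν : Measure (κ → ℝ)} {h : κ → E} {k : κ → F} (hμ : IsGaussLaw μ h)
    (hν : IsGaussLaw ν k) (hk : ∀ c : κ → ℝ, ‖∑ i, c i • h i‖ = ‖∑ i, c i • k i‖) : μ = ν := by
  classical
  have := hμ.isProbabilityMeasure
  have := hν.isProbabilityMeasure
  refine Measure.ext_of_charFunDual ?_
  ext L
  rw [charFunDual_eq_charFun_map_one, charFunDual_eq_charFun_map_one]
  have hL : (L : (κ → ℝ) → ℝ) = fun x => ∑ i, L (Pi.single i 1) * x i := by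
    ext x
    conv_lhs => rw [← Finset.univ_sum_single x]
    rw [map_sum]
    refine Finset.sum_congr rfl fun i _ => ?_
    have : Pi.single i (x i) = x i • (Pi.single i 1 : κ → ℝ) := by
      rw [← Pi.single_smul]; simp
    rw [this, map_smul, smul_eq_mul, mul_comm]
  rw [hL, hμ, hν]
  have : ‖∑ i, L (Pi.single i 1) • h i‖₊ = ‖∑ i, L (Pi.single i 1) • k i‖₊ := by
    ext; exact hk _
  rw [this]

theorem map_inner_stdGaussian {V : Type*} [NormedAddCommGroup V] [InnerProductSpace ℝ V]
    [FiniteDimensional ℝ V] [MeasurableSpace V] [BorelSpace V] (v : V) :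
    (stdGaussian V).map (fun x => inner ℝ v x) = gaussianReal 0 (‖v‖₊ ^ 2) := by
  have : IsProbabilityMeasure ((stdGaussian V).map (fun x => inner ℝ v x)) :=
    Measure.isProbabilityMeasure_map (by fun_prop)
  refine Measure.ext_of_charFun ?_
  ext s
  rw [charFun_gaussianReal, charFun_apply_real, integral_map (by fun_prop) (by fun_prop)]
  have h2 := charFun_stdGaussian (s • v)
  rw [charFun_apply] at h2
  rw [norm_smul] at h2
  calc _ = ∫ x, Complex.exp (↑(inner ℝ x (s • v)) * Complex.I) ∂(stdGaussian V) := by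
        congr 1; ext x; rw [inner_smul_right, real_inner_comm]; push_cast; ring_nf
    _ = _ := by
        rw [h2]; congr 1
        push_cast
        rw [mul_pow]
        have : ((‖s‖:ℝ):ℂ)^2 = (s:ℂ)^2 := by
          rw [← Complex.ofReal_pow, Real.norm_eq_abs, sq_abs, Complex.ofReal_pow]
        rw [this]
        ring

theorem exists_isGaussLaw (h : κ → E) :
    ∃ μ : Measure (κ → ℝ), IsGaussLaw μ h ∧ PrekopaLeindler μ := by
  classical
  let S := Submodule.span ℝ (range h)
  have : FiniteDimensional ℝ S := FiniteDimensional.span_of_finite ℝ (finite_range h)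
  let V := EuclideanSpace ℝ (Fin (Module.finrank ℝ S))
  let e : S ≃ₗᵢ[ℝ] V := (stdOrthonormalBasis ℝ S).repr
  let g : κ → S := fun i => ⟨h i, Submodule.subset_span (mem_range_self i)⟩
  let T : V →ₗ[ℝ] (κ → ℝ) := LinearMap.pi fun i => (innerSL ℝ (e (g i))).toLinearMap
  have hT : ∀ x i, T x i = inner ℝ (e (g i)) x := fun x i => rfl
  have hTm : Measurable T := by
    refine measurable_pi_lambda _ fun i => ?_
    simp only [hT]; fun_prop
  refine ⟨(stdGaussian V).map T, fun c => ?_, (prekopaLeindler_stdGaussian V).map T hTm⟩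
  rw [Measure.map_map (by fun_prop) hTm]
  have h1 : (fun x : κ → ℝ => ∑ i, c i * x i) ∘ T = fun x => inner ℝ (e (∑ i, c i • g i)) x := by
    ext x
    simp [hT, sum_inner, inner_smul_left]
  rw [h1, map_inner_stdGaussian]
  have h2 : ‖e (∑ i, c i • g i)‖ = ‖∑ i, c i • h i‖ := by
    rw [e.norm_map]
    change ‖((∑ i, c i • g i : S) : E)‖ = _
    rw [AddSubmonoidClass.coe_finsetSum]
    simp [g]
  have h3 : ‖e (∑ i, c i • g i)‖₊ = ‖∑ i, c i • h i‖₊ := by ext; exact h2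
  rw [h3]

theorem IsGaussLaw.prekopaLeindler {μ : Measure (κ → ℝ)} {h : κ → E} (hμ : IsGaussLaw μ h) :
    PrekopaLeindler μ := by
  obtain ⟨ν, hν, hl⟩ := exists_isGaussLaw h
  rwa [hμ.ext hν fun _ => rfl]

theorem IsGaussLaw.map_linear {κ' : Type*} [Fintype κ'] {μ : Measure (κ → ℝ)} {h : κ → E}
    (hμ : IsGaussLaw μ h) (A : κ' → κ → ℝ) :
    IsGaussLaw (μ.map fun x i => ∑ j, A i j * x j) (fun i => ∑ j, A i j • h j) := by
  intro c
  rw [Measure.map_map (by fun_prop) (by fun_prop)]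
  have := hμ fun j => ∑ i, c i * A i j
  have e1 : (fun x : κ' → ℝ => ∑ i, c i * x i) ∘ (fun x i => ∑ j, A i j * x j)
      = fun x : κ → ℝ => ∑ j, (∑ i, c i * A i j) * x j := by
    ext x
    simp only [Function.comp, Finset.mul_sum, Finset.sum_mul]
    rw [Finset.sum_comm]
    simp [mul_assoc]
  have e2 : ∑ i, c i • ∑ j, A i j • h j = ∑ j, (∑ i, c i * A i j) • h j := by
    simp only [Finset.smul_sum, Finset.sum_smul, smul_smul]
    rw [Finset.sum_comm]
  rw [e1, this, e2]

theorem IsGaussLaw.neg {μ : Measure (κ → ℝ)} {h : κ → E} (hμ : IsGaussLaw μ h) :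
    μ.map (fun x => -x) = μ := by
  refine IsGaussLaw.ext (h := fun i => - h i) ?_ hμ fun c => by simp
  intro c
  rw [Measure.map_map (by fun_prop) (by fun_prop)]
  have := hμ (fun i => - c i)
  simpa [Function.comp_def] using this

theorem IsGaussLaw.add {μ ν : Measure (κ → ℝ)} {a b : κ → E} (hμ : IsGaussLaw μ a)
    (hν : IsGaussLaw ν b) (hab : ∀ i j, inner ℝ (a i) (b j) = 0) :
    IsGaussLaw ((μ.prod ν).map fun p => p.1 + p.2) (fun i => a i + b i) := by
  have := hμ.isProbabilityMeasure
  have := hν.isProbabilityMeasure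
  intro c
  rw [Measure.map_map (by fun_prop) (by fun_prop)]
  have e1 : (fun x : κ → ℝ => ∑ i, c i * x i) ∘ (fun p : (κ → ℝ) × (κ → ℝ) => p.1 + p.2)
      = (fun q : ℝ × ℝ => q.1 + q.2) ∘ Prod.map (fun x => ∑ i, c i * x i) (fun x => ∑ i, c i * x i) := by
    ext x
    simp [mul_add, Finset.sum_add_distrib]
  rw [e1, ← Measure.map_map (by fun_prop) (by fun_prop), ← Measure.map_prod_map _ _ (by fun_prop)
    (by fun_prop), hμ, hν]
  have h3 := gaussianReal_conv_gaussianReal (m₁ := 0) (m₂ := 0) (v₁ := ‖∑ i, c i • a i‖₊ ^ 2)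
    (v₂ := ‖∑ i, c i • b i‖₊ ^ 2)
  rw [Measure.conv] at h3
  rw [h3]
  congr 1
  · simp
  · ext
    push_cast
    simp only [smul_add, Finset.sum_add_distrib]
    have := norm_add_sq_eq_norm_sq_add_norm_sq_of_inner_eq_zero (𝕜 := ℝ) (∑ i, c i • a i) (∑ i, c i • b i) (by
      simp [sum_inner, inner_sum, inner_smul_left, inner_smul_right, hab])
    simp only [pow_two]
    linarith

theorem gaussianReal_Icc_le {v : NNReal} (hv : v ≠ 0) {a b : ℝ} (hab : b - a ≤ √v) :
    gaussianReal 0 v (Icc a b) ≤ 1 / 2 := by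
  rw [gaussianReal_of_var_ne_zero _ hv, withDensity_apply _ measurableSet_Icc]
  have hv' : 0 < (v:ℝ) := by positivity
  have hb : ∀ x, gaussianPDF 0 v x ≤ ENNReal.ofReal ((2 * √v)⁻¹) := by
    intro x
    refine ENNReal.ofReal_le_ofReal ?_
    rw [gaussianPDFReal]
    have h1 : (√(2 * π * v))⁻¹ ≤ (2 * √v)⁻¹ := by
      refine inv_anti₀ (by positivity) ?_
      rw [Real.le_sqrt (by positivity) (by positivity), mul_pow, Real.sq_sqrt hv'.le]
      nlinarith [Real.pi_gt_three]
    refine (mul_le_of_le_one_right (by positivity) (Real.exp_le_one_iff.2 ?_)).trans h1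
    rw [neg_div]
    exact neg_nonpos.2 (by positivity)
  calc _ ≤ ∫⁻ _ in Icc a b, ENNReal.ofReal ((2 * √v)⁻¹) := lintegral_mono fun x => hb x
    _ = ENNReal.ofReal ((2 * √v)⁻¹) * ENNReal.ofReal (b - a) := by simp
    _ = ENNReal.ofReal ((2 * √v)⁻¹ * (b - a)) := (ENNReal.ofReal_mul (by positivity)).symm
    _ ≤ ENNReal.ofReal (1 / 2) := by
      refine ENNReal.ofReal_le_ofReal ?_
      have : 0 < √(v:ℝ) := by positivity
      rw [inv_mul_le_iff₀ (by positivity)]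
      linarith
    _ = 1 / 2 := by rw [ENNReal.ofReal_div_of_pos two_pos]; simp

theorem isGaussLaw_map_gaussianReal (s : κ → ℝ) (q : E) :
    IsGaussLaw ((gaussianReal 0 (‖q‖₊ ^ 2)).map fun z i => s i * z) (fun i => s i • q) := by
  intro c
  rw [Measure.map_map (by fun_prop) (by fun_prop)]
  have e1 : (fun x : κ → ℝ => ∑ i, c i * x i) ∘ (fun z i => s i * z) = fun z => (∑ i, c i * s i) * z := by
    ext z
    simp [Finset.sum_mul, mul_assoc]
  rw [e1, gaussianReal_map_const_mul]
  have e2 : ∑ i, c i • s i • q = (∑ i, c i * s i) • q := by simp [Finset.sum_smul, smul_smul]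
  rw [e2, mul_zero]
  congr 1
  ext
  push_cast
  rw [norm_smul, mul_pow, Real.norm_eq_abs, sq_abs]

theorem IsGaussLaw.measure_le_half {μ : Measure (κ → ℝ)} {h : κ → E} (hμ : IsGaussLaw μ h)
    (i₀ : κ) {p q : E} (hpq : h i₀ = p + q) (hq : ∀ j ≠ i₀, inner ℝ (h j) q = 0)
    (hpq0 : inner ℝ p q = 0) {ρ : ℝ} (hρ : 0 < ρ) (hρq : 2 * ρ ≤ ‖q‖) (c : κ → ℝ) :
    μ {x | (∀ j ≠ i₀, |x j| ≤ c j) ∧ |x i₀| ≤ ρ} ≤ 1 / 2 * μ {x | ∀ j ≠ i₀, |x j| ≤ c j} := by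
  classical
  obtain ⟨μa, hμa, -⟩ := exists_isGaussLaw (Function.update h i₀ p)
  have hνb := isGaussLaw_map_gaussianReal (Pi.single i₀ 1 : κ → ℝ) q
  have hadd := hμa.add hνb (by
    intro i j
    rcases eq_or_ne j i₀ with rfl | hj
    · rcases eq_or_ne i j with rfl | hi
      · simp [hpq0]
      · simp [hi, hq i hi]
    · simp [hj])
  have := hμa.isProbabilityMeasure
  have := hνb.isProbabilityMeasure
  have hh : (fun i => Function.update h i₀ p i + (Pi.single i₀ (1:ℝ) : κ → ℝ) i • q) = h := by
    ext i
    rcases eq_or_ne i i₀ with rfl | hi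
    · simp [hpq]
    · simp [hi]
  rw [hh] at hadd
  rw [hμ.ext hadd fun _ => rfl]
  have hmB : MeasurableSet {x : κ → ℝ | ∀ j ≠ i₀, |x j| ≤ c j} := by
    simp only [ofPred_forall]
    exact MeasurableSet.iInter fun j => MeasurableSet.iInter fun _ =>
      measurableSet_le (by fun_prop) measurable_const
  have hmS : MeasurableSet {x : κ → ℝ | (∀ j ≠ i₀, |x j| ≤ c j) ∧ |x i₀| ≤ ρ} :=
    hmB.inter (measurableSet_le (f := fun x : κ → ℝ => |x i₀|) (by fun_prop) measurable_const)
  have hm1 : Measurable fun p : (κ → ℝ) × (κ → ℝ) => p.1 + p.2 := measurable_fst.add measurable_snd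
  rw [Measure.map_apply hm1 hmS,
    Measure.map_apply hm1 hmB,
    Measure.prod_apply (hm1 hmS),
    Measure.prod_apply (hm1 hmB),
    ← lintegral_const_mul' _ _ (by simp)]
  refine lintegral_mono fun x => ?_
  have hsm : Measurable fun (z : ℝ) (i : κ) => (Pi.single i₀ (1:ℝ) : κ → ℝ) i * z := by fun_prop
  rw [Measure.map_apply hsm (measurable_prodMk_left (hm1 hmS)),
    Measure.map_apply hsm (measurable_prodMk_left (hm1 hmB))]
  by_cases hx : ∀ j ≠ i₀, |x j| ≤ c j
  · have e1 : (fun (z : ℝ) (i : κ) => (Pi.single i₀ (1:ℝ) : κ → ℝ) i * z) ⁻¹' (Prod.mk x ⁻¹'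
        ((fun p : (κ → ℝ) × (κ → ℝ) => p.1 + p.2) ⁻¹' {x | ∀ j ≠ i₀, |x j| ≤ c j})) = univ := by
      ext z
      simp only [mem_preimage, mem_ofPred_eq, Pi.add_apply, mem_univ, iff_true]
      intro j hj
      simpa [hj] using hx j hj
    rw [e1, measure_univ, mul_one]
    refine (measure_mono (t := Icc (-ρ - x i₀) (ρ - x i₀)) ?_).trans (gaussianReal_Icc_le ?_ ?_)
    · rintro z ⟨-, hz⟩
      simp only [Pi.add_apply, Pi.single_eq_same, one_mul, abs_le] at hz
      exact ⟨by linarith [hz.1], by linarith [hz.2]⟩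
    · have : ‖q‖₊ ≠ 0 := by
        intro h0
        have : ‖q‖ = 0 := by rw [← coe_nnnorm, h0]; rfl
        linarith
      positivity
    · push_cast
      rw [Real.sqrt_sq (norm_nonneg _)]
      linarith
  · have e1 : (fun (z : ℝ) (i : κ) => (Pi.single i₀ (1:ℝ) : κ → ℝ) i * z) ⁻¹' (Prod.mk x ⁻¹'
        ((fun p : (κ → ℝ) × (κ → ℝ) => p.1 + p.2) ⁻¹' {x | (∀ j ≠ i₀, |x j| ≤ c j) ∧ |x i₀| ≤ ρ})) = ∅ := by
      ext z
      simp only [mem_preimage, mem_ofPred_eq, Pi.add_apply, mem_empty_iff_false, iff_false, not_and]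
      intro hz
      refine absurd (fun j hj => ?_) hx
      simpa [hj] using hz j hj
    rw [e1]; simp

end GaussLaw

/-- The box of vectors whose coordinates in `F` are bounded by `c`. -/
def coordBox {κ : Type*} (F : Finset κ) (c : κ → ℝ) : Set (κ → ℝ) := {x | ∀ i ∈ F, |x i| ≤ c i}

theorem measurableSet_coordBox {κ : Type*} (F : Finset κ) (c : κ → ℝ) :
    MeasurableSet (coordBox F c) := by
  simp only [coordBox, ofPred_forall]
  exact MeasurableSet.biInter F.countable_toSet fun j _ =>
    measurableSet_le (by fun_prop) measurable_const

theorem coordBox_convex {κ : Type*} {F : Finset κ} {c c' : κ → ℝ} {l : ℝ} (hl : l ∈ Ioo (0:ℝ) 1)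
    {x y : κ → ℝ} (hx : x ∈ coordBox F c) (hy : y ∈ coordBox F c') :
    l • x + (1 - l) • y ∈ coordBox F (fun i => l * c i + (1 - l) * c' i) := by
  intro i hi
  have h1l : 0 < 1 - l := by linarith [hl.2]
  simp only [Pi.add_apply, Pi.smul_apply, smul_eq_mul]
  refine (abs_add_le _ _).trans ?_
  rw [abs_mul, abs_mul, abs_of_pos hl.1, abs_of_pos h1l]
  exact add_le_add (mul_le_mul_of_nonneg_left (hx i hi) hl.1.le)
    (mul_le_mul_of_nonneg_left (hy i hi) h1l.le)

theorem lintegral_mul_measure_le_setLIntegral {Z : Type*} [MeasurableSpace Z] {ν : Measure Z}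
    [IsProbabilityMeasure ν] {g : Z → ENNReal} {A : Set Z} (hA : MeasurableSet A)
    (H : ∀ z ∈ A, ∀ z' ∉ A, g z' ≤ g z) : (∫⁻ z, g z ∂ν) * ν A ≤ ∫⁻ z in A, g z ∂ν := by
  set m := ⨆ z' : (Aᶜ : Set Z), g z'
  have h1 : m * ν A ≤ ∫⁻ z in A, g z ∂ν := by
    rw [← setLIntegral_const]
    exact setLIntegral_mono' hA fun z hz => iSup_le fun z' => H z hz z' z'.2
  have h2 : ∫⁻ z in Aᶜ, g z ∂ν ≤ m * ν Aᶜ := by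
    rw [← setLIntegral_const]
    exact setLIntegral_mono' hA.compl fun z hz => le_iSup (fun z' : (Aᶜ : Set Z) => g z') ⟨z, hz⟩
  rw [← lintegral_add_compl g hA, add_mul]
  calc _ ≤ (∫⁻ z in A, g z ∂ν) * ν A + (m * ν Aᶜ) * ν A := by gcongr
    _ = (∫⁻ z in A, g z ∂ν) * ν A + (m * ν A) * ν Aᶜ := by ring
    _ ≤ (∫⁻ z in A, g z ∂ν) * ν A + (∫⁻ z in A, g z ∂ν) * ν Aᶜ := by gcongr
    _ = _ := by rw [← mul_add, measure_add_measure_compl hA, measure_univ, mul_one]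

section GaussLaw

variable {κ E : Type*} [Fintype κ] [NormedAddCommGroup E] [InnerProductSpace ℝ E]

theorem IsGaussLaw.shift_antitone {μ : Measure (κ → ℝ)} {h : κ → E} (hμ : IsGaussLaw μ h)
    (F : Finset κ) (c s : κ → ℝ) {z z' : ℝ} (hz : |z| ≤ |z'|) :
    μ {x | (fun i => x i + s i * z') ∈ coordBox F c} ≤ μ {x | (fun i => x i + s i * z) ∈ coordBox F c} := by
  have hm : ∀ z, MeasurableSet {x : κ → ℝ | (fun i => x i + s i * z) ∈ coordBox F c} := fun z =>
    (show Measurable fun (x : κ → ℝ) i => x i + s i * z by fun_prop) (measurableSet_coordBox F c)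
  have heven : ∀ z, μ {x | (fun i => x i + s i * (-z)) ∈ coordBox F c}
      = μ {x | (fun i => x i + s i * z) ∈ coordBox F c} := by
    intro z
    conv_lhs => rw [← hμ.neg]
    rw [Measure.map_apply (by fun_prop) (hm _)]
    congr 1
    ext x
    simp only [coordBox, mem_preimage, mem_ofPred_eq, Pi.neg_apply]
    refine forall₂_congr fun i _ => ?_
    rw [← abs_neg]
    ring_nf
  rcases hz.lt_or_eq with hlt | heq
  · have hz'0 : z' ≠ 0 := fun h0 => by simp [h0] at hlt; linarith [abs_nonneg z]
    have hq : |z / z'| < 1 := by rw [abs_div]; exact (div_lt_one (abs_pos.2 hz'0)).2 hlt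
    rw [abs_lt] at hq
    have hl : (1 + z / z') / 2 ∈ Ioo (0:ℝ) 1 := ⟨by linarith [hq.1], by linarith [hq.2]⟩
    have := hμ.prekopaLeindler.logConcaveMeasure _ hl _ _ _ (hm z') (hm (-z')) (hm z) (by
      intro x hx y hy
      have := coordBox_convex hl hx hy
      simp only [mem_ofPred_eq]
      convert this using 1
      · congr 1; ext i; ring
      · ext i
        change ((1 + z / z') / 2 * x i + (1 - (1 + z / z') / 2) * y i) + s i * z =
          (1 + z / z') / 2 * (x i + s i * z') + (1 - (1 + z / z') / 2) * (y i + s i * -z')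
        field_simp
        ring)
    rw [heven] at this
    have hp := hμ.isProbabilityMeasure
    rcases eq_or_ne (μ {x | (fun i => x i + s i * z') ∈ coordBox F c}) 0 with h0 | h0
    · rw [h0]; exact bot_le
    rwa [← ENNReal.rpow_add _ _ h0 (measure_ne_top _ _), add_sub_cancel, ENNReal.rpow_one] at this
  · rcases abs_eq_abs.1 heq with rfl | rfl
    · exact le_rfl
    · rw [heven]

theorem IsGaussLaw.mul_le_measure_insert [DecidableEq κ] {μ : Measure (κ → ℝ)} {h : κ → E}
    (hμ : IsGaussLaw μ h) (F : Finset κ) (i₀ : κ) (c : κ → ℝ) :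
    μ (coordBox F c) * μ {x | |x i₀| ≤ c i₀} ≤ μ (coordBox (insert i₀ F) c) := by
  set s : κ → ℝ := fun j => inner ℝ (h j) (h i₀) / ‖h i₀‖ ^ 2 with hs
  obtain ⟨μa, hμa, -⟩ := exists_isGaussLaw (fun j => h j - s j • h i₀)
  have hνb := isGaussLaw_map_gaussianReal s (h i₀)
  have hsi : s i₀ • h i₀ = h i₀ := by
    by_cases h0 : h i₀ = 0
    · simp [h0]
    · simp only [hs, real_inner_self_eq_norm_sq]
      rw [div_self (by simpa using h0), one_smul]
  have hadd := hμa.add hνb (by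
    intro i j
    rw [inner_smul_right, inner_sub_left, inner_smul_left]
    by_cases h0 : h i₀ = 0
    · simp [h0]
    · have : ‖h i₀‖ ^ 2 ≠ 0 := by simpa using h0
      simp only [hs, real_inner_self_eq_norm_sq, conj_trivial]
      field_simp
      simp)
  have := hμa.isProbabilityMeasure
  have := hνb.isProbabilityMeasure
  set γ := gaussianReal 0 (‖h i₀‖₊ ^ 2)
  have hsm : Measurable fun (z : ℝ) (i : κ) => s i * z := by fun_prop
  have hh : (fun i => h i - s i • h i₀ + s i • h i₀) = h := by ext i; simp
  rw [hh] at hadd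
  have hae : ∀ᵐ x ∂μa, x i₀ = 0 := by
    have := hμa (Pi.single i₀ 1)
    simp only [Pi.single_apply, ite_mul, one_mul, zero_mul, Finset.sum_ite_eq', Finset.mem_univ,
      if_true, ite_smul, one_smul, zero_smul, hsi, sub_self, nnnorm_zero] at this
    have h2 : (0 : NNReal) ^ 2 = 0 := by simp
    rw [h2, gaussianReal_zero_var] at this
    have h3 : ∀ᵐ y ∂(μa.map fun x : κ → ℝ => x i₀), y = 0 := by
      rw [this]
      exact (ae_dirac_iff (measurableSet_eq)).2 rfl
    exact ae_of_ae_map (measurable_pi_apply i₀).aemeasurable h3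
  have hm1 : Measurable fun p : (κ → ℝ) × (κ → ℝ) => p.1 + p.2 := measurable_fst.add measurable_snd
  have key : ∀ S : Set (κ → ℝ), MeasurableSet S →
      μ S = ∫⁻ z, μa {x | (fun i => x i + s i * z) ∈ S} ∂γ := by
    intro S hS
    rw [hμ.ext hadd fun _ => rfl, Measure.map_apply hm1 hS, Measure.prod_apply_symm (hm1 hS),
      lintegral_map (measurable_measure_prodMk_right (hm1 hS)) hsm]
    rfl
  have hmA : MeasurableSet {z : ℝ | |s i₀ * z| ≤ c i₀} := measurableSet_le (by fun_prop) measurable_const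
  have e2 : μ {x | |x i₀| ≤ c i₀} = γ {z | |s i₀ * z| ≤ c i₀} := by
    rw [key _ (measurableSet_le (by fun_prop) measurable_const), ← lintegral_indicator_one hmA]
    refine lintegral_congr fun z => ?_
    by_cases hz : |s i₀ * z| ≤ c i₀
    · rw [indicator_of_mem (by exact hz)]
      rw [Pi.one_apply, ← measure_univ (μ := μa)]
      refine measure_congr ?_
      filter_upwards [hae] with x hx
      simp only [eq_iff_iff]
      change (|x i₀ + s i₀ * z| ≤ c i₀) ↔ True
      simp only [hx, zero_add, hz]
    · rw [indicator_of_notMem (by exact hz), ← measure_empty (μ := μa)]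
      refine measure_congr ?_
      filter_upwards [hae] with x hx
      simp only [eq_iff_iff]
      change (|x i₀ + s i₀ * z| ≤ c i₀) ↔ False
      simp only [hx, zero_add, hz]
  rw [key _ (measurableSet_coordBox _ _), key _ (measurableSet_coordBox _ _), e2]
  refine (lintegral_mul_measure_le_setLIntegral hmA ?_).trans ?_
  · intro z hz z' hz'
    refine hμa.shift_antitone F c s ?_
    simp only [mem_ofPred_eq, not_le, abs_mul] at hz hz'
    exact (lt_of_mul_lt_mul_left (hz.trans_lt hz') (abs_nonneg _)).le
  · rw [← lintegral_indicator hmA]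
    refine lintegral_mono fun z => ?_
    by_cases hz : |s i₀ * z| ≤ c i₀
    · rw [indicator_of_mem (by exact hz)]
      refine measure_mono_ae ?_
      filter_upwards [hae] with x hx hxF
      intro i hi
      rcases Finset.mem_insert.1 hi with rfl | hi
      · simp only [hx, zero_add, hz]
      · exact hxF i hi
    · rw [indicator_of_notMem (by exact hz)]; exact bot_le

/-- Šidák's inequality. -/
theorem IsGaussLaw.prod_le_measure_coordBox {μ : Measure (κ → ℝ)} {h : κ → E}
    (hμ : IsGaussLaw μ h) (F : Finset κ) (c : κ → ℝ) :
    ∏ i ∈ F, μ {x | |x i| ≤ c i} ≤ μ (coordBox F c) := by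
  classical
  have := hμ.isProbabilityMeasure
  induction F using Finset.induction_on with
  | empty => simp [coordBox]
  | insert i F hi ih =>
    rw [Finset.prod_insert hi, mul_comm]
    exact (mul_le_mul_left ih _).trans (hμ.mul_le_measure_insert F i c)

theorem IsGaussLaw.map_eval {μ : Measure (κ → ℝ)} {h : κ → E} (hμ : IsGaussLaw μ h) (i : κ) :
    μ.map (fun x => x i) = gaussianReal 0 (‖h i‖₊ ^ 2) := by
  classical
  simpa [Pi.single_apply] using hμ (Pi.single i 1)

theorem gaussianReal_abs_gt_le (v : NNReal) {d : ℝ} (hd : 0 < d) :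
    gaussianReal 0 v {z | d < |z|} ≤ ENNReal.ofReal (v / d ^ 2) := by
  have h := meas_ge_le_variance_div_sq (μ := gaussianReal 0 v) (X := id) (memLp_id_gaussianReal 2) hd
  simp only [id_eq, integral_id_gaussianReal, variance_id_gaussianReal, sub_zero] at h
  exact (measure_mono fun z (hz : d < |z|) => le_of_lt hz).trans h

theorem IsGaussLaw.measure_compl_coordBox_le {μ : Measure (κ → ℝ)} {h : κ → E} (hμ : IsGaussLaw μ h)
    (F : Finset κ) {d : ℝ} (hd : 0 < d) :
    μ (coordBox F fun _ => d)ᶜ ≤ ENNReal.ofReal (∑ i ∈ F, ‖h i‖ ^ 2 / d ^ 2) := by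
  have : (coordBox F fun _ => d)ᶜ ⊆ ⋃ i ∈ F, {x : κ → ℝ | d < |x i|} := by
    intro x hx
    simpa [coordBox] using hx
  refine (measure_mono this).trans ((measure_biUnion_finset_le _ _).trans ?_)
  rw [ENNReal.ofReal_sum_of_nonneg fun i _ => by positivity]
  refine Finset.sum_le_sum fun i _ => ?_
  have h1 := gaussianReal_abs_gt_le (‖h i‖₊ ^ 2) hd
  rw [← hμ.map_eval i, Measure.map_apply (by fun_prop) (measurableSet_lt measurable_const (by fun_prop))] at h1
  simpa using h1

/-- Approximate decoupling of two box events. -/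
theorem IsGaussLaw.measure_inter_le {μ : Measure (κ → ℝ)} {h a b : κ → E} (hμ : IsGaussLaw μ h)
    (hab : ∀ i, h i = a i + b i) (horth : ∀ i j, inner ℝ (a i) (b j) = 0) (F F' : Finset κ)
    {c c' d d' e e' : ℝ} (hd : 0 < d) (hd' : 0 < d') (he : ∑ i ∈ F, ‖b i‖ ^ 2 / d ^ 2 ≤ e)
    (he' : ∑ i ∈ F', ‖a i‖ ^ 2 / d' ^ 2 ≤ e') :
    μ (coordBox F (fun _ => c) ∩ coordBox F' fun _ => c') ≤
      (μ (coordBox F fun _ => c + 2 * d) + ENNReal.ofReal e) *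
      (μ (coordBox F' fun _ => c' + 2 * d') + ENNReal.ofReal e') +
      (ENNReal.ofReal e + ENNReal.ofReal e') := by
  obtain ⟨μa, hμa, -⟩ := exists_isGaussLaw a
  obtain ⟨μb, hμb, -⟩ := exists_isGaussLaw b
  have hadd := hμa.add hμb horth
  rw [← funext hab] at hadd
  have := hμa.isProbabilityMeasure
  have := hμb.isProbabilityMeasure
  have hm1 : Measurable fun p : (κ → ℝ) × (κ → ℝ) => p.1 + p.2 := measurable_fst.add measurable_snd
  set B1 : Set (κ → ℝ) := coordBox F fun _ => d
  set B2 : Set (κ → ℝ) := coordBox F' fun _ => d'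
  set A1 : Set (κ → ℝ) := coordBox F fun _ => c + d
  set A2 : Set (κ → ℝ) := coordBox F' fun _ => c' + d'
  have hB1 : μb B1ᶜ ≤ ENNReal.ofReal e :=
    (hμb.measure_compl_coordBox_le F hd).trans (ENNReal.ofReal_le_ofReal he)
  have hB2 : μa B2ᶜ ≤ ENNReal.ofReal e' :=
    (hμa.measure_compl_coordBox_le F' hd').trans (ENNReal.ofReal_le_ofReal he')
  have key : ∀ (G : Finset κ) (r : ℝ), μ (coordBox G fun _ => r) =
      (μa.prod μb) {p | ∀ i ∈ G, |p.1 i + p.2 i| ≤ r} := by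
    intro G r
    rw [hμ.ext hadd fun _ => rfl, Measure.map_apply hm1 (measurableSet_coordBox _ _)]
    rfl
  have hA1 : μa A1 ≤ μ (coordBox F fun _ => c + 2 * d) + ENNReal.ofReal e := by
    calc μa A1 = (μa.prod μb) (A1 ×ˢ univ) := by rw [Measure.prod_prod]; simp
      _ ≤ (μa.prod μb) ({p | ∀ i ∈ F, |p.1 i + p.2 i| ≤ c + 2 * d} ∪ univ ×ˢ B1ᶜ) := by
        refine measure_mono ?_
        rintro ⟨x, y⟩ ⟨hx, -⟩
        by_cases hy : y ∈ B1
        · left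
          intro i hi
          have := abs_add_le (x i) (y i)
          have h1 := hx i hi
          have h2 := hy i hi
          simp only at h1 h2 ⊢
          linarith
        · right; exact ⟨mem_univ _, hy⟩
      _ ≤ _ := by
        refine (measure_union_le _ _).trans ?_
        rw [Measure.prod_prod, measure_univ, one_mul, key]
        gcongr
  have hA2 : μb A2 ≤ μ (coordBox F' fun _ => c' + 2 * d') + ENNReal.ofReal e' := by
    calc μb A2 = (μa.prod μb) (univ ×ˢ A2) := by rw [Measure.prod_prod]; simp
      _ ≤ (μa.prod μb) ({p | ∀ i ∈ F', |p.1 i + p.2 i| ≤ c' + 2 * d'} ∪ B2ᶜ ×ˢ univ) := by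
        refine measure_mono ?_
        rintro ⟨x, y⟩ ⟨-, hy⟩
        by_cases hx : x ∈ B2
        · left
          intro i hi
          have := abs_add_le (x i) (y i)
          have h1 := hx i hi
          have h2 := hy i hi
          simp only at h1 h2 ⊢
          linarith
        · right; exact ⟨hx, mem_univ _⟩
      _ ≤ _ := by
        refine (measure_union_le _ _).trans ?_
        rw [Measure.prod_prod, measure_univ, mul_one, key]
        gcongr
  calc _ = (μa.prod μb) {p | (∀ i ∈ F, |p.1 i + p.2 i| ≤ c) ∧ ∀ i ∈ F', |p.1 i + p.2 i| ≤ c'} := by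
        rw [hμ.ext hadd fun _ => rfl, Measure.map_apply hm1
          ((measurableSet_coordBox _ _).inter (measurableSet_coordBox _ _))]
        rfl
    _ ≤ (μa.prod μb) (A1 ×ˢ A2 ∪ (univ ×ˢ B1ᶜ ∪ B2ᶜ ×ˢ univ)) := by
        refine measure_mono ?_
        rintro ⟨x, y⟩ ⟨h1, h2⟩
        by_cases hy : y ∈ B1
        · by_cases hx : x ∈ B2
          · left
            refine ⟨fun i hi => ?_, fun i hi => ?_⟩
            · have := abs_sub (x i + y i) (y i)
              have h3 := h1 i hi
              have h4 := hy i hi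
              rw [add_sub_cancel_right] at this
              simp only at h3 h4 this ⊢
              linarith
            · have := abs_sub (x i + y i) (x i)
              have h3 := h2 i hi
              have h4 := hx i hi
              rw [add_sub_cancel_left] at this
              simp only at h3 h4 this ⊢
              linarith
          · right; right; exact ⟨hx, mem_univ _⟩
        · right; left; exact ⟨mem_univ _, hy⟩
    _ ≤ μa A1 * μb A2 + (μb B1ᶜ + μa B2ᶜ) := by
        refine (measure_union_le _ _).trans (add_le_add ?_ ((measure_union_le _ _).trans ?_))
        · rw [Measure.prod_prod]
        · rw [Measure.prod_prod, Measure.prod_prod]; simp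
    _ ≤ _ := by gcongr

/-- Borell's inequality for boxes. -/
theorem IsGaussLaw.measure_compl_coordBox_mul_le {μ : Measure (κ → ℝ)} {h : κ → E}
    (hμ : IsGaussLaw μ h) (F : Finset κ) {r t : ℝ} (ht : 1 < t)
    (hr : 2 / 3 ≤ μ (coordBox F fun _ => r)) :
    μ (coordBox F fun _ => t * r)ᶜ ≤ ENNReal.ofReal ((1 / 2) ^ ((t + 1) / 2)) := by
  have := hμ.isProbabilityMeasure
  have hl : 2 / (t + 1) ∈ Ioo (0:ℝ) 1 := ⟨by positivity, by rw [div_lt_one (by positivity)]; linarith⟩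
  have hlc := hμ.prekopaLeindler.logConcaveMeasure _ hl _ _ _ (measurableSet_coordBox F fun _ => t * r).compl
    (measurableSet_coordBox F fun _ => r) (measurableSet_coordBox F fun _ => r).compl (by
      intro x hx y hy hxy
      refine hx fun i hi => ?_
      have h1 := hxy i hi
      have h2 := hy i hi
      simp only [Pi.add_apply, Pi.smul_apply, smul_eq_mul] at h1 h2 ⊢
      have e : x i = (t + 1) / 2 * ((2 / (t + 1) * x i + (1 - 2 / (t + 1)) * y i)) - (t - 1) / 2 * y i := by
        field_simp; ring
      rw [e]
      refine (abs_sub _ _).trans ?_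
      rw [abs_mul, abs_mul, abs_of_pos (by linarith : 0 < (t+1)/2), abs_of_pos (by linarith : 0 < (t-1)/2)]
      nlinarith)
  set A := μ (coordBox F fun _ => t * r)ᶜ
  have h13 : μ (coordBox F fun _ => r)ᶜ ≤ 1 / 3 := by
    rw [prob_compl_eq_one_sub (measurableSet_coordBox _ _)]
    refine (tsub_le_tsub_left hr _).trans ?_
    rw [tsub_le_iff_right, ENNReal.div_add_div_same]
    norm_num
    rw [ENNReal.div_self] <;> norm_num
  have h23 : (2 / 3 : ENNReal) ≤ μ (coordBox F fun _ => r) ^ (1 - 2 / (t + 1)) := by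
    refine hr.trans ?_
    conv_lhs => rw [← ENNReal.rpow_one (μ (coordBox F fun _ => r))]
    exact ENNReal.rpow_le_rpow_of_exponent_ge prob_le_one (by linarith [hl.1])
  have h3 : A ^ (2 / (t + 1)) * (2 / 3) ≤ 1 / 3 := (by gcongr : _ ≤ _).trans (hlc.trans h13)
  have h4 : A ^ (2 / (t + 1)) ≤ ENNReal.ofReal (1 / 2) := by
    have : (1 / 3 : ENNReal) = ENNReal.ofReal (1/2) * (2 / 3) := by
      rw [show (2 / 3 : ENNReal) = ENNReal.ofReal (2/3) by
        rw [ENNReal.ofReal_div_of_pos (by norm_num)]; simp, ← ENNReal.ofReal_mul (by norm_num)]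
      norm_num
      rw [ENNReal.ofReal_div_of_pos (by norm_num)]; simp
    rw [this] at h3
    exact (ENNReal.mul_le_mul_iff_left (by simp) (ENNReal.div_ne_top (by simp) (by simp))).1 h3
  calc A = (A ^ (2 / (t + 1))) ^ ((t + 1) / 2) := by
        rw [← ENNReal.rpow_mul, div_mul_div_cancel₀' (by norm_num), div_self (by linarith), ENNReal.rpow_one]
    _ ≤ (ENNReal.ofReal (1 / 2)) ^ ((t + 1) / 2) := ENNReal.rpow_le_rpow h4 (by linarith)
    _ = _ := by rw [ENNReal.ofReal_rpow_of_pos (by norm_num)]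

end GaussLaw

/-- `Z`, indexed by `S`, is a centered Gaussian process whose covariance is the Gram kernel of `h`. -/
structure IsGaussProcOn {Ω T E : Type*} [MeasurableSpace Ω] [NormedAddCommGroup E]
    [InnerProductSpace ℝ E] (P : Measure Ω) (Z : T → Ω → ℝ) (h : T → E) (S : Set T) : Prop where
  meas : ∀ t ∈ S, AEMeasurable (Z t) P
  law : ∀ (n : ℕ) (t : Fin n → T), (∀ i, t i ∈ S) → ∀ c : Fin n → ℝ,
    P.map (fun ω => ∑ i, c i * Z (t i) ω) = gaussianReal 0 (‖∑ i, c i • h (t i)‖₊ ^ 2)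

/-- The event that the values of `Z` on `F` are bounded by `c`. -/
def procBox {Ω T : Type*} (Z : T → Ω → ℝ) (F : Finset T) (c : T → ℝ) : Set Ω :=
  {ω | ∀ t ∈ F, |Z t ω| ≤ c t}

section GaussProc

variable {Ω T E : Type*} [MeasurableSpace Ω] [NormedAddCommGroup E]
    [InnerProductSpace ℝ E] {P : Measure Ω} {Z : T → Ω → ℝ} {h : T → E} {S : Set T}

theorem IsGaussProcOn.isGaussLaw {κ : Type*} [Fintype κ] (hZ : IsGaussProcOn P Z h S) (t : κ → T)
    (ht : ∀ i, t i ∈ S) :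
    IsGaussLaw (P.map fun ω i => Z (t i) ω) (fun i => h (t i)) := by
  intro c
  have hm : AEMeasurable (fun ω i => Z (t i) ω) P :=
    aemeasurable_pi_iff.2 fun i => hZ.meas _ (ht i)
  rw [AEMeasurable.map_map_of_aemeasurable
    (show Measurable fun x : κ → ℝ => ∑ i, c i * x i by fun_prop).aemeasurable hm]
  let e := Fintype.equivFin κ
  have := hZ.law _ (t ∘ e.symm) (fun i => ht _) (c ∘ e.symm)
  have e1 : ((fun x : κ → ℝ => ∑ i, c i * x i) ∘ fun ω i => Z (t i) ω)
      = fun ω => ∑ i, (c ∘ e.symm) i * Z ((t ∘ e.symm) i) ω := by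
    ext ω
    exact (Equiv.sum_comp e.symm (fun i => c i * Z (t i) ω)).symm
  have e2 : ∑ i, c i • h (t i) = ∑ i, (c ∘ e.symm) i • h ((t ∘ e.symm) i) :=
    (Equiv.sum_comp e.symm (fun i => c i • h (t i))).symm
  rw [e1, this, e2]

theorem IsGaussProcOn.measure_box {κ : Type*} [Fintype κ] (hZ : IsGaussProcOn P Z h S) (t : κ → T)
    (ht : ∀ i, t i ∈ S) (F : Finset κ) (c : κ → ℝ) :
    P {ω | ∀ i ∈ F, |Z (t i) ω| ≤ c i} = P.map (fun ω i => Z (t i) ω) (coordBox F c) := by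
  rw [Measure.map_apply_of_aemeasurable (aemeasurable_pi_iff.2 fun i => hZ.meas _ (ht i))
    (measurableSet_coordBox _ _)]
  rfl

theorem IsGaussProcOn.measure_procBox (hZ : IsGaussProcOn P Z h S) {F : Finset T}
    (hF : ∀ t ∈ F, t ∈ S) (c : T → ℝ) :
    P (procBox Z F c) = P.map (fun ω (i : F) => Z i ω) (coordBox Finset.univ fun i => c i) := by
  rw [← hZ.measure_box (fun i : F => (i : T)) (fun i => hF _ i.2)]
  congr 1
  ext ω
  simp [procBox]

theorem IsGaussProcOn.nullMeasurableSet_procBox (hZ : IsGaussProcOn P Z h S) {F : Finset T}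
    (hF : ∀ t ∈ F, t ∈ S) (c : T → ℝ) : NullMeasurableSet (procBox Z F c) P := by
  simp only [procBox, ofPred_forall]
  refine NullMeasurableSet.biInter F.countable_toSet fun t ht => ?_
  exact nullMeasurableSet_le (continuous_abs.measurable.comp_aemeasurable (hZ.meas t (hF t ht)))
    aemeasurable_const

theorem IsGaussProcOn.measure_insert_le [DecidableEq T] (hZ : IsGaussProcOn P Z h S) {F : Finset T}
    (hF : ∀ t ∈ F, t ∈ S) {i₀ : T} (hi : i₀ ∈ S) {p q : E} (hpq : h i₀ = p + q)
    (hq : ∀ j ∈ F, inner ℝ (h j) q = 0) (hpq0 : inner ℝ p q = 0) {c : T → ℝ} (hρ : 0 < c i₀)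
    (hρq : 2 * c i₀ ≤ ‖q‖) :
    P (procBox Z (insert i₀ F) c) ≤ 1 / 2 * P (procBox Z F c) := by
  let t : Option F → T := fun o => o.elim i₀ fun i => i
  have htS : ∀ o, t o ∈ S := by rintro (_ | i); exacts [hi, hF _ i.2]
  have hl := hZ.isGaussLaw t htS
  have key := hl.measure_le_half none hpq (by
    rintro (_ | j) hj
    · exact absurd rfl hj
    · exact hq _ j.2) hpq0 hρ hρq (fun o => c (t o))
  have e1 := hZ.measure_box t htS Finset.univ (fun o => c (t o))
  have e2 := hZ.measure_box t htS (Finset.univ.erase none) (fun o => c (t o))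
  have s1 : procBox Z (insert i₀ F) c = {ω | ∀ o ∈ Finset.univ, |Z (t o) ω| ≤ c (t o)} := by
    ext ω
    simp [procBox, t, Option.forall]
  have s2 : procBox Z F c = {ω | ∀ o ∈ Finset.univ.erase none, |Z (t o) ω| ≤ c (t o)} := by
    ext ω
    simp [procBox, t, Option.forall]
  rw [s1, s2, e1, e2]
  convert key using 2
  · ext x
    simp [coordBox, Option.forall, t, and_comm]
  · congr 1
    ext x
    simp [coordBox]

theorem IsGaussProcOn.sqrt_mul_sqrt_le (hZ : IsGaussProcOn P Z h S) {F : Finset T}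
    (hF : ∀ t ∈ F, t ∈ S) (c c' : ℝ) :
    P (procBox Z F fun _ => c) ^ (1 / 2 : ℝ) * P (procBox Z F fun _ => c') ^ (1 / 2 : ℝ) ≤
      P (procBox Z F fun _ => (c + c') / 2) := by
  rw [hZ.measure_procBox hF, hZ.measure_procBox hF, hZ.measure_procBox hF]
  have := (hZ.isGaussLaw (fun i : F => (i : T)) (fun i => hF _ i.2)).prekopaLeindler.logConcaveMeasure
    (1 / 2) (by norm_num) _ _ _ (measurableSet_coordBox Finset.univ fun _ => c)
    (measurableSet_coordBox Finset.univ fun _ => c')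
    (measurableSet_coordBox Finset.univ fun _ => (c + c') / 2) (by
      intro x hx y hy
      have := coordBox_convex (l := 1 / 2) (by norm_num) hx hy
      convert this using 2
      ring)
  convert this using 3
  norm_num

/-- Šidák's inequality for finitely many linear combinations. -/
theorem IsGaussProcOn.prod_le_measure {κ : Type*} [Fintype κ] (hZ : IsGaussProcOn P Z h S)
    (F : Finset T) (hF : ∀ t ∈ F, t ∈ S) (A : κ → T → ℝ) (c : κ → ℝ) :
    ∏ i, gaussianReal 0 (‖∑ t ∈ F, A i t • h t‖₊ ^ 2) (Icc (-c i) (c i)) ≤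
      P {ω | ∀ i, |∑ t ∈ F, A i t * Z t ω| ≤ c i} := by
  have hl := (hZ.isGaussLaw (fun i : F => (i : T)) (fun i => hF _ i.2))
  have hm : AEMeasurable (fun ω (i : F) => Z i ω) P :=
    aemeasurable_pi_iff.2 fun i => hZ.meas _ (hF _ i.2)
  have h2 := hl.map_linear (fun (i : κ) (j : F) => A i j)
  have h3 := h2.prod_le_measure_coordBox Finset.univ c
  rw [Measure.map_apply (by fun_prop) (measurableSet_coordBox _ _),
    Measure.map_apply_of_aemeasurable hm (measurableSet_preimage (by fun_prop)
      (measurableSet_coordBox _ _))] at h3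
  convert h3 using 1
  · refine Finset.prod_congr rfl fun i _ => ?_
    have h4 := h2.map_eval i
    have e : ∑ j : F, A i j • h j = ∑ t ∈ F, A i t • h t :=
      Finset.sum_coe_sort F (fun t => A i t • h t)
    rw [e] at h4
    rw [← h4, Measure.map_apply (by fun_prop) measurableSet_Icc]
    congr 1
    ext x
    simp [abs_le]
  · congr 1
    ext ω
    simp only [coordBox, mem_ofPred_eq, mem_preimage, Finset.mem_univ, forall_const]
    refine forall_congr' fun i => ?_
    rw [Finset.sum_coe_sort F (fun t => A i t * Z t ω)]

theorem IsGaussProcOn.measure_inter_le [DecidableEq T] (hZ : IsGaussProcOn P Z h S) {a b : T → E}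
    (hab : ∀ i ∈ S, h i = a i + b i) (horth : ∀ i ∈ S, ∀ j ∈ S, inner ℝ (a i) (b j) = 0)
    {F F' : Finset T} (hF : ∀ t ∈ F, t ∈ S) (hF' : ∀ t ∈ F', t ∈ S)
    {c c' d d' e e' : ℝ} (hd : 0 < d) (hd' : 0 < d') (he : ∑ i ∈ F, ‖b i‖ ^ 2 / d ^ 2 ≤ e)
    (he' : ∑ i ∈ F', ‖a i‖ ^ 2 / d' ^ 2 ≤ e') :
    P (procBox Z F (fun _ => c) ∩ procBox Z F' fun _ => c') ≤
      (P (procBox Z F fun _ => c + 2 * d) + ENNReal.ofReal e) *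
      (P (procBox Z F' fun _ => c' + 2 * d') + ENNReal.ofReal e') +
      (ENNReal.ofReal e + ENNReal.ofReal e') := by
  let G : Finset T := F ∪ F'
  have hG : ∀ i : G, (i : T) ∈ S := fun i => by
    rcases Finset.mem_union.1 i.2 with h | h
    exacts [hF _ h, hF' _ h]
  have hl := hZ.isGaussLaw (fun i : G => (i : T)) hG
  let FG : Finset G := Finset.univ.filter fun i => (i : T) ∈ F
  let FG' : Finset G := Finset.univ.filter fun i => (i : T) ∈ F'
  have e1 : ∀ r : ℝ, P (procBox Z F fun _ => r) = P.map (fun ω (i : G) => Z i ω) (coordBox FG fun _ => r) := by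
    intro r
    rw [← hZ.measure_box (fun i : G => (i : T)) hG FG]
    congr 1; ext ω
    simp only [procBox, FG, Finset.mem_filter, Finset.mem_univ, true_and, mem_ofPred_eq]
    exact ⟨fun h i hi => h _ hi, fun h t ht => h ⟨t, Finset.mem_union_left _ ht⟩ ht⟩
  have e2 : ∀ r : ℝ, P (procBox Z F' fun _ => r) = P.map (fun ω (i : G) => Z i ω) (coordBox FG' fun _ => r) := by
    intro r
    rw [← hZ.measure_box (fun i : G => (i : T)) hG FG']
    congr 1; ext ω
    simp only [procBox, FG', Finset.mem_filter, Finset.mem_univ, true_and, mem_ofPred_eq]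
    exact ⟨fun h i hi => h _ hi, fun h t ht => h ⟨t, Finset.mem_union_right _ ht⟩ ht⟩
  have e3 : P (procBox Z F (fun _ => c) ∩ procBox Z F' fun _ => c') =
      P.map (fun ω (i : G) => Z i ω) (coordBox FG (fun _ => c) ∩ coordBox FG' fun _ => c') := by
    rw [Measure.map_apply_of_aemeasurable (aemeasurable_pi_iff.2 fun i => hZ.meas _ (hG i))
      ((measurableSet_coordBox _ _).inter (measurableSet_coordBox _ _))]
    congr 1; ext ω
    simp only [procBox, coordBox, FG, FG', Finset.mem_filter, Finset.mem_univ, true_and, mem_ofPred_eq,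
      mem_inter_iff, mem_preimage]
    exact ⟨fun h => ⟨fun i hi => h.1 _ hi, fun i hi => h.2 _ hi⟩,
      fun h => ⟨fun t ht => h.1 ⟨t, Finset.mem_union_left _ ht⟩ ht,
        fun t ht => h.2 ⟨t, Finset.mem_union_right _ ht⟩ ht⟩⟩
  have s1 : ∀ f : T → ℝ, ∑ i ∈ FG, f i = ∑ i ∈ F, f i := by
    intro f
    rw [Finset.sum_filter, Finset.sum_coe_sort G (fun t => if t ∈ F then f t else 0),
      ← Finset.sum_filter]
    congr 1; ext t; simp +contextual [G]
  have s2 : ∀ f : T → ℝ, ∑ i ∈ FG', f i = ∑ i ∈ F', f i := by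
    intro f
    rw [Finset.sum_filter, Finset.sum_coe_sort G (fun t => if t ∈ F' then f t else 0),
      ← Finset.sum_filter]
    congr 1; ext t; simp +contextual [G]
  rw [e1, e2, e3]
  refine hl.measure_inter_le (a := fun i : G => a i) (b := fun i : G => b i) (fun i => hab _ (hG i))
    (fun i j => horth _ (hG i) _ (hG j)) FG FG' hd hd' ?_ ?_
  · rwa [s1 (fun i => ‖b i‖ ^ 2 / d ^ 2)]
  · rwa [s2 (fun i => ‖a i‖ ^ 2 / d' ^ 2)]

theorem IsGaussProcOn.measure_compl_le [IsProbabilityMeasure P] (hZ : IsGaussProcOn P Z h S)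
    {F : Finset T} (hF : ∀ t ∈ F, t ∈ S) {r t : ℝ} (ht : 1 < t)
    (hr : 2 / 3 ≤ P (procBox Z F fun _ => r)) :
    P (procBox Z F fun _ => t * r)ᶜ ≤ ENNReal.ofReal ((1 / 2) ^ ((t + 1) / 2)) := by
  have hl := hZ.isGaussLaw (fun i : F => (i : T)) (fun i => hF _ i.2)
  have := hl.isProbabilityMeasure
  have h1 := hl.measure_compl_coordBox_mul_le Finset.univ ht (r := r) (by
    rwa [← hZ.measure_procBox hF (fun _ => r)])
  rw [prob_compl_eq_one_sub (measurableSet_coordBox _ _)] at h1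
  rw [prob_compl_eq_one_sub₀ (hZ.nullMeasurableSet_procBox hF _)]
  rwa [hZ.measure_procBox hF]

end GaussProc

/-- Paley–Zygmund bound for the probability of a finite union. -/
theorem two_mul_sum_le_measureReal_biUnion {Ω : Type*} [MeasurableSpace Ω] (P : Measure Ω)
    [IsProbabilityMeasure P] {A : ℕ → Set Ω} (hA : ∀ n, NullMeasurableSet (A n) P)
    (F : Finset ℕ) (l : ℝ) :
    2 * l * ∑ n ∈ F, P.real (A n) ≤
      ∑ n ∈ F, ∑ m ∈ F, P.real (A n ∩ A m) + l ^ 2 * P.real (⋃ n ∈ F, A n) := by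
  have hU : NullMeasurableSet (⋃ n ∈ F, A n) P :=
    NullMeasurableSet.biUnion F.countable_toSet fun n _ => hA n
  have hInt : ∀ {s : Set Ω}, NullMeasurableSet s P →
      Integrable (s.indicator fun _ => (1:ℝ)) P := fun hs => (integrable_const 1).indicator₀ hs
  have hval : ∀ {s : Set Ω}, NullMeasurableSet s P →
      ∫ ω, s.indicator (fun _ => (1:ℝ)) ω ∂P = P.real s := fun hs => by
    rw [integral_indicator₀ hs, setIntegral_const]; simp
  have h1 : 2 * l * ∑ n ∈ F, P.real (A n) =
      ∫ ω, 2 * l * ∑ n ∈ F, (A n).indicator (fun _ => (1:ℝ)) ω ∂P := by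
    rw [integral_const_mul, integral_finsetSum _ fun n _ => hInt (hA n)]
    simp_rw [hval (hA _)]
  have h2 : ∑ n ∈ F, ∑ m ∈ F, P.real (A n ∩ A m) + l ^ 2 * P.real (⋃ n ∈ F, A n) =
      ∫ ω, (∑ n ∈ F, ∑ m ∈ F, (A n ∩ A m).indicator (fun _ => (1:ℝ)) ω +
        l ^ 2 * (⋃ n ∈ F, A n).indicator (fun _ => (1:ℝ)) ω) ∂P := by
    rw [integral_add, integral_const_mul, hval hU,
      integral_finsetSum _ fun n _ => integrable_finsetSum _ fun m _ => hInt ((hA n).inter (hA m))]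
    · congr 1
      refine Finset.sum_congr rfl fun n _ => ?_
      rw [integral_finsetSum _ fun m _ => hInt ((hA n).inter (hA m))]
      simp_rw [hval ((hA _).inter (hA _))]
    · exact integrable_finsetSum _ fun n _ => integrable_finsetSum _ fun m _ =>
        hInt ((hA n).inter (hA m))
    · exact (hInt hU).const_mul _
  rw [h1, h2]
  refine integral_mono ((integrable_finsetSum _ fun n _ => hInt (hA n)).const_mul _)
    ((integrable_finsetSum _ fun n _ => integrable_finsetSum _ fun m _ =>
        hInt ((hA n).inter (hA m))).add ((hInt hU).const_mul _)) fun ω => ?_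
  have h3 : ∑ n ∈ F, ∑ m ∈ F, (A n ∩ A m).indicator (fun _ => (1:ℝ)) ω =
      (∑ n ∈ F, (A n).indicator (fun _ => (1:ℝ)) ω) ^ 2 := by
    rw [sq, Finset.sum_mul_sum]
    refine Finset.sum_congr rfl fun n _ => Finset.sum_congr rfl fun m _ => ?_
    by_cases h : ω ∈ A n <;> by_cases h' : ω ∈ A m <;> simp [h, h']
  change 2 * l * ∑ n ∈ F, (A n).indicator (fun _ => (1:ℝ)) ω ≤
    ∑ n ∈ F, ∑ m ∈ F, (A n ∩ A m).indicator (fun _ => (1:ℝ)) ω +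
        l ^ 2 * (⋃ n ∈ F, A n).indicator (fun _ => (1:ℝ)) ω
  rw [h3]
  by_cases hω : ω ∈ ⋃ n ∈ F, A n
  · simp only [hω, indicator_of_mem]
    nlinarith [sq_nonneg (∑ n ∈ F, (A n).indicator (fun _ => (1:ℝ)) ω - l)]
  · have : ∑ n ∈ F, (A n).indicator (fun _ => (1:ℝ)) ω = 0 := by
      refine Finset.sum_eq_zero fun n hn => ?_
      simp only [mem_iUnion, not_exists] at hω
      simp [hω n hn]
    rw [this]
    simp [hω]

/-- A Kochen–Stone lemma: quasi-independent events with divergent probabilities. -/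
theorem exists_pos_le_measureReal_iUnion {Ω : Type*} [MeasurableSpace Ω] (P : Measure Ω)
    [IsProbabilityMeasure P] {A : ℕ → Set Ω} (hA : ∀ n, NullMeasurableSet (A n) P)
    {p : ℕ → ℝ} {c C : ℝ} (hc : 0 < c) (hC : 0 < C) (hp : ∀ n, 0 ≤ p n)
    (hpA : ∀ n, c * p n ≤ P.real (A n))
    (hAA : ∀ F : Finset ℕ, ∑ n ∈ F, ∑ m ∈ F, P.real (A n ∩ A m) ≤
      C * (∑ n ∈ F, p n + (∑ n ∈ F, p n) ^ 2))
    (hdiv : ¬ Summable p) :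
    ∃ δ : ℝ, 0 < δ ∧ ∀ k : ℕ, δ ≤ P.real (⋃ n ∈ Ici k, A n) := by
  refine ⟨c ^ 2 / (2 * C), by positivity, fun k => ?_⟩
  obtain ⟨N, hN⟩ : ∃ N, 1 ≤ ∑ n ∈ Finset.Ico k N, p n := by
    by_contra! h
    refine hdiv ((summable_nat_add_iff k).1 (summable_of_sum_range_le (c := 1) (fun n => hp _) ?_))
    intro n
    have := h (k + n)
    rw [Finset.sum_Ico_eq_sum_range] at this
    simp only [add_tsub_cancel_left] at this
    simp_rw [add_comm _ k]
    exact this.le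
  set S := ∑ n ∈ Finset.Ico k N, p n with hS
  have h1 := two_mul_sum_le_measureReal_biUnion P hA (Finset.Ico k N) (2 * C / c * S)
  have h2 := hAA (Finset.Ico k N)
  have h3 : c * S ≤ ∑ n ∈ Finset.Ico k N, P.real (A n) := by
    rw [hS, Finset.mul_sum]; exact Finset.sum_le_sum fun n _ => hpA n
  have h4 : P.real (⋃ n ∈ Finset.Ico k N, A n) ≤ P.real (⋃ n ∈ Ici k, A n) := by
    refine measureReal_mono ?_ (measure_ne_top _ _)
    refine iUnion₂_mono' fun n hn => ⟨n, ?_, le_rfl⟩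
    exact (Finset.mem_Ico.1 hn).1
  refine le_trans ?_ h4
  set u := P.real (⋃ n ∈ Finset.Ico k N, A n)
  have h5 : 2 * (2 * C / c * S) * (c * S) ≤ 2 * (2 * C / c * S) * ∑ n ∈ Finset.Ico k N, P.real (A n) :=
    mul_le_mul_of_nonneg_left h3 (by positivity)
  have e5 : 2 * (2 * C / c * S) * (c * S) = 4 * C * S ^ 2 := by field_simp; ring
  have h6 : 2 * C * S ^ 2 ≤ (2 * C / c * S) ^ 2 * u := by
    have h7 : C * (S + S ^ 2) ≤ 2 * C * S ^ 2 := by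
      nlinarith [mul_nonneg hC.le (mul_nonneg (sub_nonneg.2 hN) (by linarith : (0:ℝ) ≤ S))]
    linarith
  have e6 : (2 * C / c * S) ^ 2 * u = (2 * C * S ^ 2) * (2 * C / c ^ 2 * u) := by field_simp
  rw [e6] at h6
  have h7 : 1 ≤ 2 * C / c ^ 2 * u := by
    by_contra! h
    nlinarith [show 0 < 2 * C * S ^ 2 by positivity]
  rw [div_le_iff₀ (by positivity)]
  rw [div_mul_eq_mul_div, le_div_iff₀ (by positivity)] at h7
  linarith

/-- Telescoping bound for exponentially weighted sums of increments, forward in time. -/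
theorem sum_step_mul_exp_le {τ : ℕ → ℝ} (hτ : Monotone τ) (hτ1 : ∀ n, τ (n + 1) - τ n ≤ 1) {c : ℝ}
    (hc : 0 < c) (n N : ℕ) :
    ∑ m ∈ Finset.Ico n N, (τ (m + 1) - τ m) * exp (-c * (τ m - τ n)) ≤ (1 + c) / c := by
  rcases le_total N n with h | h
  · rw [Finset.Ico_eq_empty_of_le h]; simp; positivity
  have key : ∀ m, (τ (m + 1) - τ m) * exp (-c * (τ m - τ n)) ≤
      (-((1 + c) / c * exp (-c * (τ (m + 1) - τ n)))) - (-((1 + c) / c * exp (-c * (τ m - τ n)))) := by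
    intro m
    set s := τ (m + 1) - τ m with hs
    have hs0 : 0 ≤ s := sub_nonneg.2 (hτ (Nat.le_succ m))
    have e : exp (-c * (τ (m + 1) - τ n)) = exp (-c * (τ m - τ n)) * exp (-(c * s)) := by
      rw [← exp_add]; congr 1; rw [hs]; ring
    rw [e]
    have h1 : s ≤ (1 + c) / c * (1 - exp (-(c * s))) := by
      have h2 : exp (-(c * s)) ≤ 1 / (1 + c * s) := by
        rw [exp_neg, one_div]
        exact inv_anti₀ (by positivity) (by linarith [add_one_le_exp (c * s)])
      have h3 : 1 - 1 / (1 + c * s) = c * s / (1 + c * s) := by field_simp; ring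
      have h4 : c * s / (1 + c) ≤ c * s / (1 + c * s) := by
        gcongr
        nlinarith [hτ1 m]
      calc s = (1 + c) / c * (c * s / (1 + c)) := by field_simp
        _ ≤ (1 + c) / c * (1 - exp (-(c * s))) := by gcongr; linarith
    nlinarith [exp_pos (-c * (τ m - τ n))]
  refine (Finset.sum_le_sum fun m _ => key m).trans ?_
  rw [Finset.sum_Ico_sub (fun m => -((1 + c) / c * exp (-c * (τ m - τ n)))) h]
  have : 0 ≤ (1 + c) / c * exp (-c * (τ N - τ n)) := by positivity
  simp only [sub_self, mul_zero, exp_zero, mul_one]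
  linarith

/-- Telescoping bound for exponentially weighted sums of increments, backward in time. -/
theorem sum_range_step_mul_exp_le {τ : ℕ → ℝ} {c : ℝ} (hc : 0 < c) (g : ℕ) :
    ∑ n ∈ Finset.range g, (τ (n + 1) - τ n) * exp (-c * (τ g - τ n)) ≤ 1 / c := by
  have key : ∀ n, (τ (n + 1) - τ n) * exp (-c * (τ g - τ n)) ≤
      1 / c * exp (-c * (τ g - τ (n + 1))) - 1 / c * exp (-c * (τ g - τ n)) := by
    intro n
    set s := τ (n + 1) - τ n with hs
    have e : exp (-c * (τ g - τ (n + 1))) = exp (-c * (τ g - τ n)) * exp (c * s) := by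
      rw [← exp_add]; congr 1; rw [hs]; ring
    rw [e]
    have h1 : s ≤ 1 / c * (exp (c * s) - 1) := by
      rw [div_mul_eq_mul_div, le_div_iff₀ hc]
      linarith [add_one_le_exp (c * s)]
    nlinarith [exp_pos (-c * (τ g - τ n))]
  refine (Finset.sum_le_sum fun m _ => key m).trans ?_
  rw [Finset.sum_range_sub (fun n => 1 / c * exp (-c * (τ g - τ n)))]
  have : 0 ≤ 1 / c * exp (-c * (τ g - τ 0)) := by positivity
  simp only [sub_self, mul_zero, exp_zero, mul_one]
  linarith

/-- Every index is good or charged to a good one. -/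
theorem not_summable_good {τ x f : ℕ → ℝ} (hx : ∀ n, 1 ≤ x n)
    (hτ : ∀ n, τ (n + 1) = τ n + 1 / x n) (hτt : Tendsto τ atTop atTop) {B κ c C₁ C₂ : ℝ}
    (hB : 1 ≤ B) (hκ : 0 < κ) (hc : 0 < c) (hC₂ : 0 < C₂) (hBc : C₁ ≤ c / 2 * B)
    (hf1 : ∀ n, exp (-(C₁ * x n)) ≤ f n) (hf2 : ∀ n, f n ≤ C₂ * exp (-(c * x n)))
    (hf : ¬ Summable f) :
    ¬ Summable (indicator {n | ∀ m > n, x n ≤ B * x m + κ * (τ m - τ n)} f) := by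
  classical
  set Gd : Set ℕ := {n | ∀ m > n, x n ≤ B * x m + κ * (τ m - τ n)} with hGd
  have hτm : Monotone τ := monotone_nat_of_le_succ fun n => by
    rw [hτ]; have := hx n; linarith [show 0 ≤ 1 / x n by positivity]
  have hf0 : ∀ n, 0 < f n := fun n => (exp_pos _).trans_le (hf1 n)
  intro hsum
  refine hf ?_
  -- the last dominator
  have hdom : ∀ n, n ∉ Gd → ∃ g ∈ Gd, n < g ∧ B * x g + κ * (τ g - τ n) < x n := by
    intro n hn
    simp only [hGd, mem_ofPred_eq, not_forall, not_le] at hn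
    obtain ⟨m, hm, hmx⟩ := hn
    obtain ⟨N, hN⟩ := (hτt.eventually_ge_atTop (τ n + x n / κ)).exists_forall_of_atTop
    have hlt : ∀ m, B * x m + κ * (τ m - τ n) < x n → m < N := by
      intro m hm
      by_contra! h
      have h1 := hN m h
      have h2 := hx m
      have h3 : x n ≤ κ * (τ m - τ n) := by
        have : x n / κ ≤ τ m - τ n := by linarith
        rw [div_le_iff₀ hκ] at this; linarith
      nlinarith
    let F := (Finset.range N).filter fun m => n < m ∧ B * x m + κ * (τ m - τ n) < x n
    have hF : F.Nonempty := ⟨m, by simp [F, hlt m hmx, hmx, hm]⟩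
    obtain ⟨hg1, hg2, hg3⟩ : F.max' hF < N ∧ n < F.max' hF ∧ _ := by
      have := F.max'_mem hF
      simpa [F] using this
    refine ⟨F.max' hF, ?_, hg2, hg3⟩
    intro k hk
    by_contra! hkx
    have h4 : B * x k + κ * (τ k - τ n) < x n := by
      have h6 : 0 ≤ x (F.max' hF) := by linarith [hx (F.max' hF)]
      have h7 := mul_nonneg (sub_nonneg.2 hB) h6
      linarith
    have h5 : k ∈ F := by simp [F, hlt k h4, h4]; exact hg2.trans hk
    exact absurd (F.le_max' k h5) (not_le.2 hk)
  choose! g hg1 hg2 hg3 using hdom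
  set κ' := c / 2 * κ with hκ'
  have hκ'0 : 0 < κ' := by positivity
  have hcharge : ∀ n, n ∉ Gd → f n ≤ C₂ * (2 / c) * f (g n) * ((τ (n + 1) - τ n) *
      exp (-κ' * (τ (g n) - τ n))) := by
    intro n hn
    have hxn := hx n
    have h1 : exp (-(c * x n)) ≤ exp (-(c / 2 * x n)) *
        (exp (-(C₁ * x (g n))) * exp (-κ' * (τ (g n) - τ n))) := by
      rw [← exp_add, ← exp_add, exp_le_exp]
      have := hg3 n hn
      have h6 : 0 ≤ x (g n) := by linarith [hx (g n)]
      have h7 := mul_le_mul_of_nonneg_right hBc h6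
      have h8 := mul_lt_mul_of_pos_left this (half_pos hc)
      rw [hκ']
      linarith
    have h2 : exp (-(c / 2 * x n)) ≤ 2 / c * (1 / x n) := by
      rw [exp_neg, ← one_div, div_mul_div_comm]
      rw [div_le_div_iff₀ (exp_pos _) (by positivity)]
      nlinarith [add_one_le_exp (c / 2 * x n)]
    have h3 : τ (n + 1) - τ n = 1 / x n := by rw [hτ]; ring
    rw [h3]
    calc f n ≤ C₂ * exp (-(c * x n)) := hf2 n
      _ ≤ C₂ * ((2 / c * (1 / x n)) * (f (g n) * exp (-κ' * (τ (g n) - τ n)))) := by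
          gcongr
          refine h1.trans ?_
          gcongr
          exact hf1 _
      _ = _ := by ring
  set D := C₂ * (2 / c) * (1 / κ') with hD
  have hD0 : 0 ≤ D := by positivity
  have hind0 : ∀ n, 0 ≤ indicator Gd f n := fun n => indicator_nonneg (fun n _ => (hf0 n).le) n
  refine summable_of_sum_range_le (c := (1 + D) * ∑' n, indicator Gd f n) (fun n => (hf0 n).le) ?_
  intro N
  have hsplit : ∑ n ∈ Finset.range N, f n = ∑ n ∈ Finset.range N, indicator Gd f n +
      ∑ n ∈ (Finset.range N).filter (· ∉ Gd), f n := by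
    rw [Finset.sum_filter, ← Finset.sum_add_distrib]
    refine Finset.sum_congr rfl fun n _ => ?_
    by_cases h : n ∈ Gd <;> simp [h]
  rw [hsplit, add_mul, one_mul]
  refine add_le_add (hsum.sum_le_tsum _ fun n _ => hind0 n) ?_
  set Bd := (Finset.range N).filter (· ∉ Gd) with hBd
  rw [← Finset.sum_fiberwise_of_maps_to (s := Bd) (t := Bd.image g) (g := g)
    (fun n hn => Finset.mem_image_of_mem g hn) f]
  calc ∑ k ∈ Bd.image g, ∑ n ∈ Bd with g n = k, f n
      ≤ ∑ k ∈ Bd.image g, D * indicator Gd f k := by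
        refine Finset.sum_le_sum fun k hk => ?_
        obtain ⟨n₀, hn₀, rfl⟩ := Finset.mem_image.1 hk
        have hk' : g n₀ ∈ Gd := hg1 n₀ (Finset.mem_filter.1 hn₀).2
        rw [indicator_of_mem hk']
        set k := g n₀
        calc ∑ n ∈ Bd with g n = k, f n
            ≤ ∑ n ∈ Bd with g n = k, C₂ * (2 / c) * f k * ((τ (n + 1) - τ n) *
                exp (-κ' * (τ k - τ n))) := by
              refine Finset.sum_le_sum fun n hn => ?_
              obtain ⟨h1, h2⟩ := Finset.mem_filter.1 hn
              rw [← h2]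
              exact hcharge n (Finset.mem_filter.1 h1).2
          _ ≤ ∑ n ∈ Finset.range k, C₂ * (2 / c) * f k * ((τ (n + 1) - τ n) *
                exp (-κ' * (τ k - τ n))) := by
              refine Finset.sum_le_sum_of_subset_of_nonneg ?_ fun n _ _ => ?_
              · intro n hn
                obtain ⟨h1, h2⟩ := Finset.mem_filter.1 hn
                rw [Finset.mem_range, ← h2]
                exact hg2 n (Finset.mem_filter.1 h1).2
              · have := sub_nonneg.2 (hτm (Nat.le_succ n))
                have := hf0 k
                positivity
          _ = C₂ * (2 / c) * f k * ∑ n ∈ Finset.range k, ((τ (n + 1) - τ n) *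
                exp (-κ' * (τ k - τ n))) := by rw [Finset.mul_sum]
          _ ≤ C₂ * (2 / c) * f k * (1 / κ') := by
              have := hf0 k
              gcongr
              exact sum_range_step_mul_exp_le hκ'0 k
          _ = D * f k := by rw [hD]; ring
    _ = D * ∑ k ∈ Bd.image g, indicator Gd f k := by rw [Finset.mul_sum]
    _ ≤ D * ∑' n, indicator Gd f n := by
        gcongr
        exact hsum.sum_le_tsum _ fun n _ => hind0 n

/-- Kochen–Stone for events with exponential decay of correlations at the natural time scale. -/
theorem exists_pos_le_measureReal_iUnion_of_decay {Ω : Type*} [MeasurableSpace Ω] (P : Measure Ω)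
    [IsProbabilityMeasure P] {A : ℕ → Set Ω} (hA : ∀ n, NullMeasurableSet (A n) P)
    {τ x f : ℕ → ℝ} (hx : ∀ n, 1 ≤ x n)
    (hτ : ∀ n, τ (n + 1) = τ n + 1 / x n) (hτt : Tendsto τ atTop atTop)
    {q c c₀ c₄ C₁ C₂ C₅ K : ℝ} (hq : 0 ≤ q)
    (hgrow : ∀ n m, n ≤ m → x m ≤ x n * exp (q * (τ m - τ n)))
    (hc : 0 < c) (hc₀ : 0 < c₀) (hc₄ : 0 < c₄) (hC₂ : 0 < C₂) (hC₅ : 0 < C₅) (hK : 0 < K)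
    (hf1 : ∀ n, exp (-(C₁ * x n)) ≤ f n) (hf2 : ∀ n, f n ≤ C₂ * exp (-(c * x n)))
    (hf : ¬ Summable f) (hlow : ∀ n, c₀ * f n ≤ P.real (A n))
    (hup : ∀ n, P.real (A n) ≤ K * f n)
    (h4 : ∀ n m, n < m →
      P.real (A n ∩ A m) ≤ K * f n * exp (-(c₄ * x m * min 1 (τ m - τ n))))
    (h5 : ∀ n m, n < m → C₅ * (x n + x m) ≤ τ m - τ n → P.real (A n ∩ A m) ≤ K * f n * f m) :
    ∃ δ : ℝ, 0 < δ ∧ ∀ k : ℕ, δ ≤ P.real (⋃ n ∈ Ici k, A n) := by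
  classical
  set κ := 1 / (2 * C₅) with hκ
  have hκ0 : 0 < κ := by positivity
  set B := max 1 (2 * C₁ / c) with hB
  have hB1 : 1 ≤ B := le_max_left _ _
  have hBc : C₁ ≤ c / 2 * B := by
    calc C₁ = c / 2 * (2 * C₁ / c) := by field_simp
      _ ≤ _ := by gcongr; exact le_max_right _ _
  have hgood := not_summable_good hx hτ hτt hB1 hκ0 hc hC₂ hBc hf1 hf2 hf
  set Gd : Set ℕ := {n | ∀ m > n, x n ≤ B * x m + κ * (τ m - τ n)} with hGd
  have hf0 : ∀ n, 0 < f n := fun n => (exp_pos _).trans_le (hf1 n)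
  have hτs : ∀ n, τ (n + 1) - τ n = 1 / x n := fun n => by rw [hτ]; ring
  have hτm : Monotone τ := monotone_nat_of_le_succ fun n => by
    rw [hτ]; have := hx n; linarith [show 0 ≤ 1 / x n by positivity]
  have hτ1 : ∀ n, τ (n + 1) - τ n ≤ 1 := fun n => by
    rw [hτs]; rw [div_le_one (by linarith [hx n])]; exact hx n
  -- decay rates
  set a := c₄ * exp (-q) / (B + κ) with ha
  have ha0 : 0 < a := by positivity
  set b := c₄ / (2 * (C₅ * (2 * B + 2))) with hb
  have hb0 : 0 < b := by positivity
  have hpair : ∀ n ∈ Gd, ∀ m > n, P.real (A n ∩ A m) ≤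
      K * f n * (exp (-a * (m - n : ℝ)) +
        2 / c₄ * ((τ (m + 1) - τ m) * exp (-b * (τ m - τ n)))) + K * f n * f m := by
    intro n hn m hm
    have hxn := hx n
    have hxm := hx m
    have hn' := hn m hm
    have hr : 0 ≤ τ m - τ n := sub_nonneg.2 (hτm hm.le)
    have hfn := hf0 n
    have hfm := hf0 m
    have hs0 : 0 ≤ τ (m + 1) - τ m := sub_nonneg.2 (hτm (Nat.le_succ m))
    rcases le_total (τ m - τ n) 1 with h1 | h1
    · have h2 : P.real (A n ∩ A m) ≤ K * f n * exp (-a * (m - n : ℝ)) := by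
        refine (h4 n m hm).trans ?_
        gcongr
        rw [min_eq_right h1]
        have h3 : x n ≤ (B + κ) * x m := by nlinarith
        have h6 : (m - n : ℝ) * (exp (-q) / x n) ≤ τ m - τ n := by
          have : ∀ j, n ≤ j → τ j - τ n ≤ 1 → (j - n : ℝ) * (exp (-q) / x n) ≤ τ j - τ n := by
            intro j hj
            induction j, hj using Nat.le_induction with
            | base => simp
            | succ j hj ih =>
              intro hj1
              have hj0 : τ j - τ n ≤ 1 := by linarith [hτm (Nat.le_succ j)]
              have h7 := ih hj0
              have h8 : exp (-q) / x n ≤ τ (j + 1) - τ j := by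
                rw [hτs]
                have hxj := hx j
                rw [div_le_div_iff₀ (by positivity) (by positivity), one_mul]
                calc exp (-q) * x j ≤ exp (-q) * (x n * exp (q * 1)) := by
                      gcongr
                      refine (hgrow n j hj).trans ?_
                      gcongr
                  _ = x n := by
                      rw [mul_comm (x n), ← mul_assoc, ← exp_add]; simp
              push_cast
              calc (j + 1 - n : ℝ) * (exp (-q) / x n) =
                    (j - n : ℝ) * (exp (-q) / x n) + exp (-q) / x n := by ring
                _ ≤ _ := by linarith
          exact this m hm.le h1
        have h9 : a * (m - n : ℝ) ≤ c₄ * x m * (τ m - τ n) := by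
          calc a * (m - n : ℝ) = c₄ * (x n / (B + κ)) * ((m - n : ℝ) * (exp (-q) / x n)) := by
                rw [ha]; field_simp
            _ ≤ c₄ * x m * (τ m - τ n) := by
                gcongr
                · have : (n:ℝ) ≤ m := by exact_mod_cast hm.le
                  have : 0 ≤ (m - n : ℝ) := by linarith
                  positivity
                · rw [div_le_iff₀ (by positivity)]; linarith
        linarith
      have h3 : 0 ≤ K * f n * (2 / c₄ * ((τ (m + 1) - τ m) * exp (-b * (τ m - τ n)))) := by
        positivity
      have h3' : 0 ≤ K * f n * f m := by positivity
      rw [mul_add]; linarith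
    · rcases le_or_gt (C₅ * (x n + x m)) (τ m - τ n) with h2 | h2
      · have h3 : 0 ≤ K * f n * (exp (-a * (m - n : ℝ)) +
          2 / c₄ * ((τ (m + 1) - τ m) * exp (-b * (τ m - τ n)))) := by positivity
        linarith [h5 n m hm h2]
      · have h3 : P.real (A n ∩ A m) ≤
            K * f n * (2 / c₄ * ((τ (m + 1) - τ m) * exp (-b * (τ m - τ n)))) := by
          refine (h4 n m hm).trans ?_
          gcongr
          rw [min_eq_left h1, mul_one]
          have h6 : x n ≤ (2 * B + 1) * x m := by
            have : κ * (τ m - τ n) ≤ (x n + x m) / 2 := by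
              calc κ * (τ m - τ n) ≤ κ * (C₅ * (x n + x m)) := by gcongr
                _ = _ := by rw [hκ]; field_simp
            linarith
          have h7 : τ m - τ n ≤ C₅ * (2 * B + 2) * x m := by
            calc τ m - τ n ≤ C₅ * (x n + x m) := h2.le
              _ ≤ C₅ * ((2 * B + 1) * x m + x m) := by gcongr
              _ = _ := by ring
          have h8 : b * (τ m - τ n) ≤ c₄ / 2 * x m := by
            calc b * (τ m - τ n) ≤ b * (C₅ * (2 * B + 2) * x m) := by gcongr
              _ = _ := by rw [hb]; field_simp
          have h9 : exp (-(c₄ * x m)) = exp (-(c₄ / 2 * x m)) * exp (-(c₄ / 2 * x m)) := by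
            rw [← exp_add]; congr 1; ring
          rw [h9, hτs, ← mul_assoc]
          gcongr
          · rw [exp_neg, ← one_div, div_mul_div_comm]
            rw [div_le_div_iff₀ (exp_pos _) (by positivity)]
            nlinarith [add_one_le_exp (c₄ / 2 * x m)]
          · linarith
        have h6 : 0 ≤ K * f n * exp (-a * (m - n : ℝ)) := by positivity
        have h7 : 0 ≤ K * f n * f m := by positivity
        rw [mul_add]; linarith
  -- sums of the decay factors
  set D := (1 + a) / a + 2 / c₄ * ((1 + b) / b) with hD
  have hD0 : 0 < D := by positivity
  have hsum : ∀ n N : ℕ, ∑ m ∈ Finset.Ico n N, (exp (-a * (m - n : ℝ)) +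
        2 / c₄ * ((τ (m + 1) - τ m) * exp (-b * (τ m - τ n)))) ≤ D := by
    intro n N
    rw [Finset.sum_add_distrib, ← Finset.mul_sum]
    refine add_le_add ?_ (mul_le_mul_of_nonneg_left ?_ (by positivity))
    · have := sum_step_mul_exp_le (τ := fun n : ℕ => (n:ℝ)) (fun i j h => by simpa using h)
        (fun n => by simp) ha0 n N
      simpa using this
    · exact sum_step_mul_exp_le hτm hτ1 hb0 n N
  let A' : ℕ → Set Ω := fun n => if n ∈ Gd then A n else ∅
  set p := indicator Gd f with hp
  have hp0 : ∀ n, 0 ≤ p n := fun n => indicator_nonneg (fun n _ => (hf0 n).le) n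
  set C := K * (2 * D + 1) with hC
  have hCpos : 0 < C := by positivity
  have main := exists_pos_le_measureReal_iUnion P (A := A') (p := p) (c := c₀) (C := 2 * C)
    (fun n => by
      by_cases h : n ∈ Gd <;> simp [A', h, hA]) hc₀ (by positivity) hp0 (fun n => by
      by_cases h : n ∈ Gd <;> simp [A', h, hp, hlow]) (fun F => by
      -- reduce to ordered pairs
      let w : ℕ → ℕ → ℝ := fun n m => if n ≤ m then P.real (A' n ∩ A' m) else 0
      have hw : ∀ n, ∀ m, P.real (A' n ∩ A' m) ≤ w n m + w m n := by
        intro n m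
        have h0 : ∀ n m, 0 ≤ w n m := fun n m => by
          simp only [w]; split_ifs; exacts [measureReal_nonneg, le_rfl]
        rcases le_total n m with h | h
        · have : w n m = P.real (A' n ∩ A' m) := if_pos h
          linarith [h0 m n]
        · have : w m n = P.real (A' n ∩ A' m) := by rw [inter_comm]; exact if_pos h
          linarith [h0 n m]
      have hrow : ∀ n ∈ F, ∑ m ∈ F, w n m ≤ K * (D + 1) * p n + K * p n * ∑ m ∈ F, p m := by
        intro n hnF
        by_cases hn : n ∈ Gd
        · have hpn : p n = f n := indicator_of_mem hn f
          have hfn := hf0 n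
          obtain ⟨N, hN⟩ : ∃ N, ∀ m ∈ F, m < N :=
            ⟨F.sup id + 1, fun m hm => Nat.lt_succ_of_le (Finset.le_sup (f := id) hm)⟩
          let e : ℕ → ℝ := fun m => exp (-a * (m - n : ℝ)) +
            2 / c₄ * ((τ (m + 1) - τ m) * exp (-b * (τ m - τ n)))
          have he0 : ∀ m, 0 ≤ e m := fun m => by
            have : 0 ≤ τ (m + 1) - τ m := sub_nonneg.2 (hτm (Nat.le_succ m))
            simp only [e]; positivity
          have hpt : ∀ m ∈ F, w n m ≤ (K * f n * (if n ≤ m then e m else 0) +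
              K * f n * (if m = n then 1 else 0)) + K * f n * p m := by
            intro m hm
            by_cases hmn : n ≤ m
            · simp only [w, if_pos hmn]
              rcases hmn.eq_or_lt with rfl | hlt
              · have : P.real (A' n ∩ A' n) ≤ K * f n := by
                  rw [inter_self]; simp only [A', if_pos hn]; exact hup n
                have h1 := mul_nonneg (mul_nonneg hK.le hfn.le) (he0 n)
                have h2 := mul_nonneg (mul_nonneg hK.le hfn.le) (hp0 n)
                simp only [if_true]
                linarith
              · by_cases hmG : m ∈ Gd
                · have h1 := hpair n hn m hlt
                  have hpm : p m = f m := indicator_of_mem hmG f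
                  simp only [A', if_pos hn, if_pos hmG, hpm, if_neg hlt.ne']
                  simp only [e]
                  linarith
                · have h1 := mul_nonneg (mul_nonneg hK.le hfn.le) (he0 m)
                  have h2 := mul_nonneg (mul_nonneg hK.le hfn.le) (hp0 m)
                  simp only [A', if_neg hmG, inter_empty, measureReal_empty, if_neg hlt.ne']
                  linarith
            · have h2 := mul_nonneg (mul_nonneg hK.le hfn.le) (hp0 m)
              have h3 : m ≠ n := by omega
              simp only [w, if_neg hmn, if_neg h3]
              linarith
          refine (Finset.sum_le_sum hpt).trans ?_
          rw [Finset.sum_add_distrib, Finset.sum_add_distrib, ← Finset.mul_sum, ← Finset.mul_sum,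
            ← Finset.mul_sum, hpn]
          have h6 : ∑ m ∈ F, (if n ≤ m then e m else 0) ≤ D := by
            rw [← Finset.sum_filter]
            refine le_trans (Finset.sum_le_sum_of_subset_of_nonneg ?_ fun m _ _ => he0 m) (hsum n N)
            intro m hm
            obtain ⟨h1, h2⟩ := Finset.mem_filter.1 hm
            exact Finset.mem_Ico.2 ⟨h2, hN m h1⟩
          have h7 : ∑ m ∈ F, (if m = n then (1:ℝ) else 0) = 1 := by
            rw [Finset.sum_ite_eq' F n, if_pos hnF]
          rw [h7]
          have h8 : K * f n * ∑ m ∈ F, (if n ≤ m then e m else 0) ≤ K * f n * D := by gcongr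
          linarith
        · have hpn : p n = 0 := indicator_of_notMem hn f
          have : ∀ m ∈ F, w n m = 0 := fun m _ => by simp [w, A', hn]
          rw [Finset.sum_eq_zero this, hpn]; simp
      have htot : ∑ n ∈ F, ∑ m ∈ F, w n m ≤ C * (∑ n ∈ F, p n + (∑ n ∈ F, p n) ^ 2) := by
        refine (Finset.sum_le_sum hrow).trans ?_
        rw [Finset.sum_add_distrib, ← Finset.mul_sum, ← Finset.sum_mul, ← Finset.mul_sum]
        have hS : 0 ≤ ∑ n ∈ F, p n := Finset.sum_nonneg fun n _ => hp0 n
        have h6 := mul_nonneg hK.le hD0.le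
        have h7 := mul_nonneg h6 hS
        have h8 := mul_nonneg h6 (sq_nonneg (∑ n ∈ F, p n))
        rw [hC]
        nlinarith
      calc ∑ n ∈ F, ∑ m ∈ F, P.real (A' n ∩ A' m) ≤ ∑ n ∈ F, ∑ m ∈ F, (w n m + w m n) :=
            Finset.sum_le_sum fun n _ => Finset.sum_le_sum fun m _ => hw n m
        _ = ∑ n ∈ F, ∑ m ∈ F, w n m + ∑ n ∈ F, ∑ m ∈ F, w m n := by
            rw [← Finset.sum_add_distrib]
            exact Finset.sum_congr rfl fun n _ => Finset.sum_add_distrib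
        _ = 2 * ∑ n ∈ F, ∑ m ∈ F, w n m := by
            rw [Finset.sum_comm (f := fun n m => w m n)]; ring
        _ ≤ 2 * C * (∑ n ∈ F, p n + (∑ n ∈ F, p n) ^ 2) := by linarith) hgood
  obtain ⟨δ, hδ, hδ'⟩ := main
  refine ⟨δ, hδ, fun k => (hδ' k).trans (measureReal_mono ?_ (measure_ne_top _ _))⟩
  refine iUnion₂_mono fun n _ => ?_
  by_cases h : n ∈ Gd <;> simp [A', h]

theorem not_ae_eventually_notMem {Ω : Type*} [MeasurableSpace Ω] (P : Measure Ω)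
    [IsProbabilityMeasure P] {A : ℕ → Set Ω} (hA : ∀ n, NullMeasurableSet (A n) P) {δ : ℝ}
    (hδ : 0 < δ) (h : ∀ k : ℕ, δ ≤ P.real (⋃ n ∈ Ici k, A n)) :
    ¬ ∀ᵐ ω ∂P, ∃ N, ∀ n ≥ N, ω ∉ A n := by
  intro hae
  have h1 : Tendsto (fun k : ℕ => P (⋃ n ∈ Ici k, A n)) atTop
      (nhds (P (⋂ k : ℕ, ⋃ n ∈ Ici k, A n))) := by
    refine tendsto_measure_iInter_atTop (fun k => ?_) (fun i j hij => ?_) ⟨0, measure_ne_top _ _⟩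
    · exact NullMeasurableSet.biUnion (to_countable _) fun n _ => hA n
    · exact biUnion_subset_biUnion_left fun n hn => le_trans hij hn
  have h2 : P (⋂ k : ℕ, ⋃ n ∈ Ici k, A n) = 0 := by
    refine measure_mono_null (fun ω hω => ?_) hae
    simp only [mem_iInter, mem_iUnion, mem_Ici] at hω
    rintro ⟨N, hN⟩
    obtain ⟨n, hn, hn'⟩ := hω N
    exact hN n hn hn'
  rw [h2] at h1
  have h3 : ENNReal.ofReal δ ≤ 0 := by
    refine ge_of_tendsto' h1 fun k => ?_
    rw [← ofReal_measureReal (measure_ne_top _ _)]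
    exact ENNReal.ofReal_le_ofReal (h k)
  simp at h3
  linarith

/-- The small ball estimates behind the integral test for a running maximum `M`. -/
structure SmallBallEstimates {Ω : Type*} [MeasurableSpace Ω] (P : Measure Ω) (M : ℝ → Ω → ℝ)
    (φ : ℝ → ℝ) (h β : ℝ) : Prop where
  h_pos : 0 < h
  beta_pos : 0 < β
  mono : ∀ ω s t, 0 ≤ s → s ≤ t → M s ω ≤ M t ω
  meas : ∀ t > 0, ∀ a, NullMeasurableSet {ω | M t ω ≤ a} P
  scaling : ∀ t > 0, ∀ a, P.real {ω | M t ω ≤ a} = φ (a / t ^ h)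
  lower : ∃ C > 0, ∀ ε ∈ Ioc (0:ℝ) 1, exp (-(C * ε ^ (-(1 / β)))) ≤ φ ε
  upper : ∃ C > 0, ∃ c > 0, ∀ ε ∈ Ioc (0:ℝ) 1, φ ε ≤ C * exp (-(c * ε ^ (-(1 / β))))
  concave : ∀ a > 0, ∀ b > 0, φ a * φ b ≤ φ ((a + b) / 2) ^ 2
  decay : ∃ K > 0, ∃ c > 0, ∀ s > 0, ∀ t > s, ∀ a > 0, ∀ b > 0, b / t ^ h ≤ 1 →
    P.real ({ω | M s ω ≤ a} ∩ {ω | M t ω ≤ b}) ≤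
      K * φ (a / s ^ h) * exp (-(c * (b / t ^ h) ^ (-(1 / β)) * ((t - s) / t)))
  decouple : ∃ K > 0, ∃ C > 0, ∀ s > 0, ∀ t > s, ∀ a > 0, ∀ b > 0, a / s ^ h ≤ 1 → b / t ^ h ≤ 1 →
    C * ((a / s ^ h) ^ (-(1 / β)) + (b / t ^ h) ^ (-(1 / β))) ≤ log (t / s) →
    P.real ({ω | M s ω ≤ a} ∩ {ω | M t ω ≤ b}) ≤ K * φ (a / s ^ h) * φ (b / t ^ h)

namespace SmallBallEstimates

variable {Ω : Type*} [MeasurableSpace Ω] {P : Measure Ω} [IsProbabilityMeasure P]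
  {M : ℝ → Ω → ℝ} {φ : ℝ → ℝ} {h β : ℝ}

theorem phi_eq (E : SmallBallEstimates P M φ h β) (a : ℝ) : φ a = P.real {ω | M 1 ω ≤ a} := by
  rw [E.scaling 1 one_pos]; simp

theorem phi_mono (E : SmallBallEstimates P M φ h β) : Monotone φ := fun a b hab => by
  rw [E.phi_eq, E.phi_eq]
  exact measureReal_mono (fun ω (hω : M 1 ω ≤ a) => hω.trans hab) (measure_ne_top _ _)

theorem phi_le_one (E : SmallBallEstimates P M φ h β) (a : ℝ) : φ a ≤ 1 := by
  rw [E.phi_eq]; exact measureReal_le_one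

theorem phi_pos (E : SmallBallEstimates P M φ h β) {a : ℝ} (ha : 0 < a) : 0 < φ a := by
  obtain ⟨C, hC, hlow⟩ := E.lower
  exact ((exp_pos _).trans_le (hlow (min a 1) ⟨lt_min ha one_pos, min_le_right _ _⟩)).trans_le
    (E.phi_mono (min_le_left _ _))

theorem lower' (E : SmallBallEstimates P M φ h β) :
    ∃ C > 0, ∀ x ≥ 1, exp (-(C * x)) ≤ φ (x ^ (-β)) := by
  obtain ⟨C, hC, hlow⟩ := E.lower
  have hβ := E.beta_pos
  refine ⟨C, hC, fun x hx => ?_⟩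
  have hx0 : 0 < x := by linarith
  have := hlow (x ^ (-β)) ⟨by positivity, rpow_le_one_of_one_le_of_nonpos hx (by linarith)⟩
  rwa [← rpow_mul hx0.le, show -β * -(1 / β) = 1 by field_simp, rpow_one] at this

theorem upper' (E : SmallBallEstimates P M φ h β) :
    ∃ C > 0, ∃ c > 0, ∀ x ≥ 1, φ (x ^ (-β)) ≤ C * exp (-(c * x)) := by
  obtain ⟨C, hC, c, hc, hup⟩ := E.upper
  have hβ := E.beta_pos
  refine ⟨C, hC, c, hc, fun x hx => ?_⟩
  have hx0 : 0 < x := by linarith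
  have := hup (x ^ (-β)) ⟨by positivity, rpow_le_one_of_one_le_of_nonpos hx (by linarith)⟩
  rwa [← rpow_mul hx0.le, show -β * -(1 / β) = 1 by field_simp, rpow_one] at this

theorem phi_anti (E : SmallBallEstimates P M φ h β) {x y : ℝ} (hx : 0 < x) (hxy : x ≤ y) :
    φ (y ^ (-β)) ≤ φ (x ^ (-β)) :=
  E.phi_mono (rpow_le_rpow_of_nonpos hx hxy (by linarith [E.beta_pos]))

/-- Bounded shifts of the frequency change the small ball probability by bounded factors. -/
theorem shift (E : SmallBallEstimates P M φ h β) (D : ℝ) (hD : 0 < D) :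
    ∃ x₀ ≥ 1, ∃ C > 0, ∀ x ≥ x₀, φ (x ^ (-β)) ≤ C * φ ((x + D) ^ (-β)) := by
  obtain ⟨C₁, hC₁, hlow⟩ := E.lower'
  have hβ := E.beta_pos
  -- (1+D/x)^β - 1 ≤ L / x
  obtain ⟨L, hL, hL'⟩ : ∃ L > 0, ∀ x ≥ (1:ℝ), (1 + D / x) ^ β - 1 ≤ L / x := by
    refine ⟨D * β * exp (D * β), by positivity, fun x hx => ?_⟩
    have hx0 : 0 < x := by linarith
    have h1 : (1 + D / x) ^ β ≤ exp (D / x * β) := by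
      rw [exp_mul]
      exact rpow_le_rpow (by positivity) (by linarith [add_one_le_exp (D / x)]) hβ.le
    have h2 : exp (D / x * β) - 1 ≤ D / x * β * exp (D / x * β) := by
      have := add_one_le_exp (-(D / x * β))
      have h3 : exp (D / x * β) * exp (-(D / x * β)) = 1 := by rw [← exp_add]; simp
      nlinarith [exp_pos (D / x * β)]
    have h3 : D / x ≤ D := div_le_self hD.le hx
    calc (1 + D / x) ^ β - 1 ≤ D / x * β * exp (D / x * β) := by linarith
      _ ≤ D / x * β * exp (D * β) := by gcongr
      _ = _ := by ring
  let R := 8 * L * C₁ * (2 ^ (1 / β)) * (1 + D)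
  refine ⟨max 1 (4 * L), le_max_left _ _, exp R, exp_pos _, fun x hx => ?_⟩
  have hx1 : 1 ≤ x := (le_max_left _ _).trans hx
  have hx4 : 4 * L ≤ x := (le_max_right _ _).trans hx
  have hx0 : 0 < x := by linarith
  set u := x ^ (-β) with hu
  set v := (x + D) ^ (-β) with hv
  have hv0 : 0 < v := by positivity
  have huv : u - v ≤ v * (L / x) := by
    have : u = v * (1 + D / x) ^ β := by
      rw [hu, hv, show 1 + D / x = (x + D) / x by field_simp, div_rpow (by positivity) hx0.le,
        rpow_neg hx0.le, rpow_neg (by positivity)]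
      field_simp
    rw [this]
    nlinarith [hL' x hx1]
  have hvu : v ≤ u := rpow_le_rpow_of_nonpos hx0 (by linarith) (by linarith)
  set N := ⌊x / (2 * L)⌋₊ with hN
  have hNle : (N : ℝ) ≤ x / (2 * L) := Nat.floor_le (by positivity)
  have hNge : x / (4 * L) ≤ N := by
    have h1 : x / (2 * L) < N + 1 := Nat.lt_floor_add_one _
    have h2 : 1 ≤ x / (4 * L) := by rw [le_div_iff₀ (by positivity)]; linarith
    have h3 : x / (2 * L) = 2 * (x / (4 * L)) := by field_simp; ring
    linarith
  have hstep : (N : ℝ) * (u - v) ≤ v / 2 := by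
    calc (N : ℝ) * (u - v) ≤ x / (2 * L) * (v * (L / x)) := by
          gcongr
      _ = v / 2 := by field_simp
  let ψ : ℕ → ℝ := fun j => -log (φ (u - j * (u - v)))
  have hpos : ∀ j : ℕ, j ≤ N + 1 → v / 2 ≤ u - j * (u - v) := by
    intro j hj
    have h1 : (j : ℝ) * (u - v) ≤ (N + 1) * (u - v) := by
      refine mul_le_mul_of_nonneg_right ?_ (by linarith)
      exact_mod_cast hj
    linarith
  have hconv : ∀ j, j + 1 ≤ N → ψ (j + 1) - ψ j ≤ ψ (j + 2) - ψ (j + 1) := by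
    intro j hj
    have hp0 := half_pos hv0
    have p0 := hp0.trans_le (hpos j (by omega))
    have p2 := hp0.trans_le (hpos (j + 2) (by omega))
    have p1 := hp0.trans_le (hpos (j + 1) (by omega))
    have h1 := E.concave _ p0 _ p2
    have e1 : (u - j * (u - v) + (u - ((j + 2 : ℕ) : ℝ) * (u - v))) / 2 =
        u - ((j + 1 : ℕ) : ℝ) * (u - v) := by push_cast; ring
    rw [e1] at h1
    have h2 := log_le_log (mul_pos (E.phi_pos p0) (E.phi_pos p2)) h1
    rw [log_mul (E.phi_pos p0).ne' (E.phi_pos p2).ne', log_pow] at h2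
    push_cast at h2
    simp only [ψ]
    push_cast
    linarith
  have hinc : ∀ j, j ≤ N → ψ 1 - ψ 0 ≤ ψ (j + 1) - ψ j := by
    intro j
    induction j with
    | zero => simp
    | succ j ih => exact fun hj => (ih (by omega)).trans (hconv j hj)
  have hsum : ∀ j, j ≤ N → (j : ℝ) * (ψ 1 - ψ 0) ≤ ψ (j + 1) - ψ 1 := by
    intro j
    induction j with
    | zero => simp
    | succ j ih =>
      intro hj
      have h1 := ih (by omega)
      have h2 := hinc (j + 1) hj
      push_cast
      linarith
  have hfin := hsum N le_rfl
  have hψ1 : 0 ≤ ψ 1 := by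
    simp only [ψ]
    rw [neg_nonneg]
    exact log_nonpos (E.phi_pos ((half_pos hv0).trans_le (hpos 1 (by omega)))).le (E.phi_le_one _)
  have hψN : ψ (N + 1) ≤ C₁ * (2 ^ (1 / β) * (x + D)) := by
    simp only [ψ]
    have h1 : φ (v / 2) ≤ φ (u - ((N + 1 : ℕ) : ℝ) * (u - v)) := E.phi_mono (hpos _ le_rfl)
    have e1 : v / 2 = (2 ^ (1 / β) * (x + D)) ^ (-β) := by
      rw [mul_rpow (by positivity) (by positivity), ← rpow_mul (by norm_num),
        show 1 / β * -β = -1 by field_simp, rpow_neg_one, hv]; ring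
    have h2 : 1 ≤ 2 ^ (1 / β) * (x + D) := by
      have : (1:ℝ) ≤ 2 ^ (1 / β) := one_le_rpow (by norm_num) (by positivity)
      nlinarith
    have h3 := hlow _ h2
    rw [← e1] at h3
    have := log_le_log (exp_pos _) (h3.trans h1)
    rw [log_exp] at this
    linarith
  have hkey : ψ 1 - ψ 0 ≤ R := by
    have h1 : (N : ℝ) * (ψ 1 - ψ 0) ≤ C₁ * (2 ^ (1 / β) * (x + D)) := by linarith
    rcases le_or_gt (ψ 1 - ψ 0) 0 with h0 | h0
    · refine h0.trans (by positivity)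
    · have h2 : x / (4 * L) * (ψ 1 - ψ 0) ≤ C₁ * (2 ^ (1 / β) * (x + D)) :=
        (mul_le_mul_of_nonneg_right hNge h0.le).trans h1
      have h3 : x + D ≤ x * (1 + D) := by nlinarith
      have h4 : x / (4 * L) * (ψ 1 - ψ 0) ≤ x / (4 * L) * R := by
        refine h2.trans ?_
        calc C₁ * (2 ^ (1 / β) * (x + D)) ≤ C₁ * (2 ^ (1 / β) * (x * (1 + D))) := by gcongr
          _ ≤ 2 * (C₁ * (2 ^ (1 / β) * (x * (1 + D)))) := by
              have : 0 ≤ C₁ * (2 ^ (1 / β) * (x * (1 + D))) := by positivity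
              linarith
          _ = x / (4 * L) * R := by simp only [R]; field_simp; ring
      exact le_of_mul_le_mul_left h4 (by positivity)
  have e0 : ψ 0 = -log (φ u) := by simp [ψ]
  have e1 : ψ 1 = -log (φ v) := by simp [ψ]
  rw [e0, e1] at hkey
  have hφu : 0 < φ u := E.phi_pos (hv0.trans_le hvu)
  rw [← log_le_log_iff hφu (mul_pos (exp_pos _) (E.phi_pos hv0)),
    log_mul (exp_pos _).ne' (E.phi_pos hv0).ne', log_exp]
  linarith

/-- Comparison of the integrand at comparable times. -/
theorem compare (E : SmallBallEstimates P M φ h β) (D : ℝ) (hD : 0 < D) :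
    ∃ x₀ ≥ 1, ∃ C > 0, ∀ x ≥ x₀, ∀ y ≥ x₀, y ≤ x + D →
      x * φ (x ^ (-β)) ≤ C * (y * φ (y ^ (-β))) := by
  obtain ⟨C₁, hC₁, hlow⟩ := E.lower'
  obtain ⟨C₂, hC₂, c, hc, hup⟩ := E.upper'
  obtain ⟨x₀, hx₀, C, hC, hsh⟩ := E.shift D hD
  set L := 2 * C₁ / c with hL
  have hL0 : 0 < L := by positivity
  refine ⟨x₀, hx₀, L * C + C₂ * (2 / c), by positivity, fun x hx y hy hyx => ?_⟩
  have hx0 : 0 < x := by linarith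
  have hy0 : 0 < y := by linarith
  have hφy := E.phi_pos (rpow_pos_of_pos hy0 (-β))
  have hφx := E.phi_pos (rpow_pos_of_pos hx0 (-β))
  rw [add_mul]
  rcases le_or_gt x (L * y) with h1 | h1
  · have h2 : φ (x ^ (-β)) ≤ C * φ (y ^ (-β)) :=
      (hsh x hx).trans (by gcongr; exact E.phi_anti hy0 hyx)
    have h3 : x * φ (x ^ (-β)) ≤ (L * y) * (C * φ (y ^ (-β))) := by gcongr
    have h4 : 0 ≤ C₂ * (2 / c) * (y * φ (y ^ (-β))) := by positivity
    linarith
  · have h2 : x * exp (-(c * x)) ≤ 2 / c * exp (-(c / 2 * x)) := by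
      have : exp (-(c * x)) = exp (-(c / 2 * x)) * exp (-(c / 2 * x)) := by
        rw [← exp_add]; congr 1; ring
      rw [this, ← mul_assoc]
      gcongr
      rw [exp_neg, ← div_eq_mul_inv, div_le_div_iff₀ (exp_pos _) hc]
      nlinarith [add_one_le_exp (c / 2 * x)]
    have h3 : exp (-(c / 2 * x)) ≤ exp (-(C₁ * y)) := by
      rw [exp_le_exp]
      have : c / 2 * (L * y) = C₁ * y := by rw [hL]; field_simp
      nlinarith
    have h4 : x * φ (x ^ (-β)) ≤ C₂ * (2 / c) * (y * φ (y ^ (-β))) := by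
      calc x * φ (x ^ (-β)) ≤ x * (C₂ * exp (-(c * x))) := by gcongr; exact hup x (by linarith)
        _ = C₂ * (x * exp (-(c * x))) := by ring
        _ ≤ C₂ * (2 / c * exp (-(C₁ * y))) := mul_le_mul_of_nonneg_left
            (h2.trans (by gcongr)) hC₂.le
        _ ≤ C₂ * (2 / c * φ (y ^ (-β))) := by gcongr; exact hlow y (by linarith)
        _ ≤ C₂ * (2 / c) * (y * φ (y ^ (-β))) := by
            rw [mul_assoc]; gcongr; nlinarith
    have h5 : 0 ≤ L * C * (y * φ (y ^ (-β))) := by positivity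
    linarith

end SmallBallEstimates

theorem exp_sub_one_le_mul_exp (y : ℝ) : exp y - 1 ≤ y * exp y := by
  have h1 := add_one_le_exp (-y)
  have h2 : exp y * exp (-y) = 1 := by rw [← exp_add]; simp
  nlinarith [exp_pos y]

/-- A frequency function `w` controlling the mesh of a time grid. -/
structure GridFreq (w : ℝ → ℝ) (T₀ q : ℝ) : Prop where
  T_pos : 0 < T₀
  q_pos : 0 < q
  pos : ∀ t ≥ T₀, 0 < w t
  grow : ∀ s ≥ T₀, ∀ t ≥ s, w t ≤ w s * (t / s) ^ q

namespace GridFreq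

variable {w : ℝ → ℝ} {T₀ q : ℝ}

theorem exp_grow (hw : GridFreq w T₀ q) {s t : ℝ} (hs : T₀ ≤ exp s) (hst : s ≤ t) :
    w (exp t) ≤ w (exp s) * exp (q * (t - s)) := by
  have := hw.grow (exp s) hs (exp t) (exp_le_exp.2 hst)
  rwa [← exp_sub, ← exp_mul, mul_comm (t - s)] at this

/-- The logarithms of the grid points. -/
noncomputable def grid (w : ℝ → ℝ) (s : ℝ) : ℕ → ℝ
  | 0 => s
  | n + 1 => grid w s n + 1 / w (exp (grid w s n))

theorem le_grid (hw : GridFreq w T₀ q) {s : ℝ} (hs : T₀ ≤ exp s) (n : ℕ) : s ≤ grid w s n := by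
  induction n with
  | zero => exact le_rfl
  | succ n ih =>
    have := hw.pos _ (hs.trans (exp_le_exp.2 ih))
    rw [grid]
    linarith [show 0 < 1 / w (exp (grid w s n)) by positivity]

theorem T_le (hw : GridFreq w T₀ q) {s : ℝ} (hs : T₀ ≤ exp s) (n : ℕ) :
    T₀ ≤ exp (grid w s n) := hs.trans (exp_le_exp.2 (hw.le_grid hs n))

theorem grid_lt_succ (hw : GridFreq w T₀ q) {s : ℝ} (hs : T₀ ≤ exp s) (n : ℕ) :
    grid w s n < grid w s (n + 1) := by
  have := hw.pos _ (hw.T_le hs n)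
  rw [grid]
  linarith [show 0 < 1 / w (exp (grid w s n)) by positivity]

theorem grid_strictMono (hw : GridFreq w T₀ q) {s : ℝ} (hs : T₀ ≤ exp s) :
    StrictMono (grid w s) := strictMono_nat_of_lt_succ (hw.grid_lt_succ hs)

theorem grid_tendsto (hw : GridFreq w T₀ q) {s : ℝ} (hs : T₀ ≤ exp s) :
    Tendsto (grid w s) atTop atTop := by
  have hm := (hw.grid_strictMono hs).monotone
  refine tendsto_atTop_atTop_of_monotone hm fun b => ?_
  by_contra! hb
  have hws := hw.pos _ hs
  set d := 1 / (w (exp s) * exp (q * (b - s))) with hd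
  have hd0 : 0 < d := by positivity
  have hstep : ∀ n, grid w s n + d ≤ grid w s (n + 1) := by
    intro n
    rw [grid]
    refine add_le_add le_rfl (one_div_le_one_div_of_le (hw.pos _ (hw.T_le hs n)) ?_)
    · refine (hw.exp_grow hs (hw.le_grid hs n)).trans ?_
      have := hw.q_pos
      have := hb n
      gcongr
  have hlin : ∀ n : ℕ, s + n * d ≤ grid w s n := by
    intro n
    induction n with
    | zero => simp [grid]
    | succ n ih => push_cast; linarith [hstep n]
  obtain ⟨n, hn⟩ := exists_nat_gt ((b - s) / d)
  rw [div_lt_iff₀ hd0] at hn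
  linarith [hlin n, hb n]

theorem exists_grid_mem (hw : GridFreq w T₀ q) {s : ℝ} (hs : T₀ ≤ exp s) {N : ℕ} {r : ℝ}
    (hr : grid w s N ≤ r) : ∃ n ≥ N, grid w s n ≤ r ∧ r < grid w s (n + 1) := by
  classical
  have hex : ∃ n, r < grid w s n := ((hw.grid_tendsto hs).eventually_gt_atTop r).exists
  have h1 := Nat.find_spec hex
  have hpos : N < Nat.find hex := by
    by_contra! h
    have := (hw.grid_strictMono hs).monotone h
    linarith
  refine ⟨Nat.find hex - 1, by omega, ?_, ?_⟩
  · have := Nat.find_min hex (m := Nat.find hex - 1) (by omega)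
    linarith
  · rwa [Nat.sub_add_cancel (by omega)]

/-- Variation of the frequency over one grid step. -/
theorem block (hw : GridFreq w T₀ q) {s : ℝ} (hs : T₀ ≤ exp s) {n : ℕ}
    (h1 : 1 ≤ w (exp (grid w s n))) {r : ℝ} (hr : grid w s n ≤ r) (hr' : r ≤ grid w s (n + 1)) :
    w (exp r) ≤ w (exp (grid w s n)) + q * exp (2 * q) ∧
    w (exp (grid w s (n + 1))) ≤ w (exp r) + q * exp (2 * q) ∧
    w (exp r) ≤ w (exp (grid w s n)) * exp q := by
  set x := w (exp (grid w s n)) with hx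
  have hq := hw.q_pos
  have hx0 : 0 < x := by linarith
  have hst : grid w s (n + 1) - grid w s n = 1 / x := by rw [grid]; ring
  have hinv : 1 / x ≤ 1 := by rw [div_le_one hx0]; exact h1
  have hqx : q * (1 / x) ≤ q := by nlinarith
  have hwr := hw.pos (exp r) ((hw.T_le hs n).trans (exp_le_exp.2 hr))
  have e1 : exp q ≤ exp (2 * q) := exp_le_exp.2 (by linarith)
  have h3 : exp (q * (1 / x)) - 1 ≤ q * (1 / x) * exp q := by
    refine (exp_sub_one_le_mul_exp _).trans ?_
    gcongr
  have h4 : w (exp r) ≤ x * exp (q * (1 / x)) := by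
    refine (hw.exp_grow (hw.T_le hs n) hr).trans ?_
    gcongr
    linarith
  have h5 : w (exp r) ≤ x * exp q := h4.trans (by gcongr)
  refine ⟨?_, ?_, h5⟩
  · have : x * (exp (q * (1 / x)) - 1) ≤ q * exp q := by
      calc x * (exp (q * (1 / x)) - 1) ≤ x * (q * (1 / x) * exp q) := by gcongr
        _ = q * exp q := by field_simp
    nlinarith
  · have h6 : w (exp (grid w s (n + 1))) ≤ w (exp r) * exp (q * (1 / x)) := by
      refine (hw.exp_grow ((hw.T_le hs n).trans (exp_le_exp.2 hr)) hr').trans ?_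
      gcongr
      linarith
    have : w (exp r) * (exp (q * (1 / x)) - 1) ≤ q * exp (2 * q) := by
      calc w (exp r) * (exp (q * (1 / x)) - 1) ≤ (x * exp q) * (q * (1 / x) * exp q) := by
            gcongr
            linarith [one_le_exp (show 0 ≤ q * (1 / x) by positivity)]
        _ = q * (exp q * exp q) := by field_simp
        _ = q * exp (2 * q) := by rw [← exp_add]; ring_nf
    linarith

end GridFreq

namespace SmallBallEstimates

variable {Ω : Type*} [MeasurableSpace Ω] {P : Measure Ω} [IsProbabilityMeasure P]
  {M : ℝ → Ω → ℝ} {φ : ℝ → ℝ} {h β : ℝ}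

/-- Time-changed frequency of a lower function. -/
noncomputable def freq (ξ : ℝ → ℝ) (h β t : ℝ) : ℝ := (ξ t / t ^ h) ^ (-(1 / β))

theorem gridFreq (E : SmallBallEstimates P M φ h β) {ξ : ℝ → ℝ} {T₀ : ℝ} (hT : 0 < T₀)
    (hpos : ∀ t ∈ Ici T₀, 0 < ξ t) (hmono : MonotoneOn ξ (Ici T₀)) :
    GridFreq (freq ξ h β) T₀ (h / β) where
  T_pos := hT
  q_pos := div_pos E.h_pos E.beta_pos
  pos t ht := by
    have := hpos t ht
    have : 0 < t := hT.trans_le ht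
    unfold freq; positivity
  grow s hs t hst := by
    have h1 := hpos s hs
    have hs0 : 0 < s := hT.trans_le hs
    have ht0 : 0 < t := hs0.trans_le hst
    have h2 := hmono hs (hs.trans hst : T₀ ≤ t) hst
    have hβ := E.beta_pos
    have e : (t / s) ^ (h / β) = ((s / t) ^ h) ^ (-(1 / β)) := by
      rw [← rpow_mul (by positivity), show h * -(1 / β) = -(h / β) by ring,
        rpow_neg (by positivity), ← inv_rpow (by positivity), inv_div]
    rw [freq, freq, e, ← mul_rpow (by positivity) (by positivity)]
    refine rpow_le_rpow_of_nonpos (by positivity) ?_ (by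
      have : 0 < 1 / β := by positivity
      linarith)
    rw [div_rpow hs0.le ht0.le]
    calc ξ s / s ^ h * (s ^ h / t ^ h) = ξ s / t ^ h := by field_simp
      _ ≤ ξ t / t ^ h := by gcongr

theorem freq_rpow (E : SmallBallEstimates P M φ h β) {ξ : ℝ → ℝ} {t : ℝ} (ht : 0 < t)
    (hξ : 0 < ξ t) : freq ξ h β t ^ (-β) = ξ t / t ^ h := by
  have hβ := E.beta_pos
  rw [freq, ← rpow_mul (by positivity), show -(1 / β) * -β = 1 by field_simp, rpow_one]

/-- Lower functions grow more slowly than the scaling. -/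
theorem exists_freq_ge (E : SmallBallEstimates P M φ h β) {ξ : ℝ → ℝ} {T₀ : ℝ} (hT : 0 < T₀)
    (hpos : ∀ t ∈ Ici T₀, 0 < ξ t)
    (hae : ∀ᵐ ω ∂P, ∃ t₀ : ℝ, ∀ t : ℝ, t₀ < t → ξ t ≤ M t ω) (x : ℝ) (hx : 0 < x) :
    ∃ T ≥ T₀, ∀ t ≥ T, x ≤ freq ξ h β t := by
  by_contra! hcon
  have hβ := E.beta_pos
  have hsel : ∀ k : ℕ, ∃ t ≥ max T₀ k, freq ξ h β t < x := fun k => hcon _ (le_max_left _ _)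
  choose t ht htx using hsel
  have htT : ∀ k, T₀ ≤ t k := fun k => (le_max_left _ _).trans (ht k)
  have htk : ∀ k : ℕ, (k:ℝ) ≤ t k := fun k => (le_max_right _ _).trans (ht k)
  have ht0 : ∀ k, 0 < t k := fun k => hT.trans_le (htT k)
  let A : ℕ → Set Ω := fun k => {ω | M (t k) ω ≤ ξ (t k) / 2}
  have hA : ∀ k, NullMeasurableSet (A k) P := fun k => E.meas _ (ht0 k) _
  have hδ : 0 < φ (x ^ (-β) / 2) := E.phi_pos (by positivity)
  refine not_ae_eventually_notMem P hA hδ (fun k => ?_) ?_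
  · have h1 : φ (x ^ (-β) / 2) ≤ P.real (A k) := by
      rw [E.scaling _ (ht0 k)]
      refine E.phi_mono ?_
      have hξ := hpos _ (htT k)
      have htk0 := ht0 k
      have h2 : x ^ (-β) ≤ ξ (t k) / t k ^ h := by
        rw [← E.freq_rpow htk0 hξ]
        exact rpow_le_rpow_of_nonpos (by unfold freq; positivity) (htx k).le (by linarith)
      calc x ^ (-β) / 2 ≤ (ξ (t k) / t k ^ h) / 2 := by gcongr
        _ = _ := by ring
    exact h1.trans (measureReal_mono (subset_biUnion_of_mem (u := A) (mem_Ici.2 le_rfl))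
      (measure_ne_top _ _))
  · filter_upwards [hae] with ω hω
    obtain ⟨t₀, h0⟩ := hω
    obtain ⟨N, hN⟩ := exists_nat_gt t₀
    refine ⟨N, fun n hn hA => ?_⟩
    have h1 := h0 (t n) (hN.trans_le ((Nat.cast_le.2 hn).trans (htk n)))
    have h2 := hpos _ (htT n)
    simp only [A, mem_ofPred_eq] at hA
    linarith

end SmallBallEstimates

theorem ofReal_le_setLIntegral_div {F : ℝ → ℝ} {a b A : ℝ} (hab : a ≤ b) (hb : b ≤ a + 1)
    (hA : 0 ≤ A) (hF : ∀ r, a ≤ r → r < b → A ≤ F (exp r)) :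
    ENNReal.ofReal (A * (b - a) / 2) ≤
      ∫⁻ t in Ico (exp a) (exp b), ENNReal.ofReal (F t / t) := by
  calc ENNReal.ofReal (A * (b - a) / 2) ≤ ENNReal.ofReal (A / exp b) * volume (Ico (exp a) (exp b)) := by
        rw [Real.volume_Ico, ← ENNReal.ofReal_mul (by positivity)]
        refine ENNReal.ofReal_le_ofReal ?_
        have h1 : (b - a) / 2 ≤ 1 - exp (-(b - a)) := by
          have h2 : exp (-(b - a)) ≤ 1 / (1 + (b - a)) := by
            rw [exp_neg, one_div]
            exact inv_anti₀ (by linarith) (by linarith [add_one_le_exp (b - a)])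
          have h3 : 1 / (1 + (b - a)) ≤ 1 - (b - a) / 2 := by
            rw [div_le_iff₀ (by linarith)]
            nlinarith
          linarith
        have e : A / exp b * (exp b - exp a) = A * (1 - exp (-(b - a))) := by
          rw [show -(b - a) = a - b by ring, exp_sub]; field_simp
        rw [e, mul_div_assoc]
        gcongr
    _ = ∫⁻ t in Ico (exp a) (exp b), ENNReal.ofReal (A / exp b) := by rw [setLIntegral_const]
    _ ≤ _ := by
        refine setLIntegral_mono' measurableSet_Ico fun t ht => ?_
        have ht0 : 0 < t := (exp_pos a).trans_le ht.1
        have := hF (log t) ((le_log_iff_exp_le ht0).2 ht.1) ((log_lt_iff_lt_exp ht0).2 ht.2)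
        rw [exp_log ht0] at this
        exact ENNReal.ofReal_le_ofReal (div_le_div₀ (hA.trans this) this ht0 ht.2.le)

theorem setLIntegral_div_le_ofReal {F : ℝ → ℝ} {a b A : ℝ} (hab : a ≤ b) (hb : b ≤ a + 1)
    (hA : 0 ≤ A) (hF : ∀ r, a ≤ r → r < b → F (exp r) ≤ A) :
    ∫⁻ t in Ico (exp a) (exp b), ENNReal.ofReal (F t / t) ≤ ENNReal.ofReal (3 * A * (b - a)) := by
  calc _ ≤ ∫⁻ t in Ico (exp a) (exp b), ENNReal.ofReal (A / exp a) := by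
        refine setLIntegral_mono' measurableSet_Ico fun t ht => ?_
        have ht0 : 0 < t := (exp_pos a).trans_le ht.1
        have := hF (log t) ((le_log_iff_exp_le ht0).2 ht.1) ((log_lt_iff_lt_exp ht0).2 ht.2)
        rw [exp_log ht0] at this
        exact ENNReal.ofReal_le_ofReal (div_le_div₀ hA this (exp_pos a) ht.1)
    _ = ENNReal.ofReal (A / exp a) * volume (Ico (exp a) (exp b)) := by rw [setLIntegral_const]
    _ ≤ _ := by
        rw [Real.volume_Ico, ← ENNReal.ofReal_mul (by positivity)]
        refine ENNReal.ofReal_le_ofReal ?_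
        have e : A / exp a * (exp b - exp a) = A * (exp (b - a) - 1) := by
          rw [exp_sub]; field_simp
        have h1 : exp (b - a) - 1 ≤ (b - a) * 3 := by
          refine (exp_sub_one_le_mul_exp _).trans ?_
          refine mul_le_mul_of_nonneg_left ?_ (by linarith)
          calc exp (b - a) ≤ exp 1 := exp_le_exp.2 (by linarith)
            _ ≤ 3 := by linarith [exp_one_lt_d9]
        rw [e]
        calc A * (exp (b - a) - 1) ≤ A * ((b - a) * 3) := by gcongr
          _ = _ := by ring

namespace SmallBallEstimates

variable {Ω : Type*} [MeasurableSpace Ω] {P : Measure Ω} [IsProbabilityMeasure P]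
  {M : ℝ → Ω → ℝ} {φ : ℝ → ℝ} {h β : ℝ}

theorem exists_freq_ge_of_lintegral (E : SmallBallEstimates P M φ h β) {ξ : ℝ → ℝ} {T₀ : ℝ}
    (hT : 0 < T₀) (hpos : ∀ t ∈ Ici T₀, 0 < ξ t) (hmono : MonotoneOn ξ (Ici T₀))
    (hbd : ∃ C : ℝ, ∀ t ∈ Ici T₀, ξ t / t ^ h ≤ C)
    (hInt : ∫⁻ t in Ici T₀, ENNReal.ofReal (freq ξ h β t * φ (ξ t / t ^ h) / t) < ⊤)
    (x : ℝ) (hx : 0 < x) : ∃ T ≥ T₀, ∀ t ≥ T, x ≤ freq ξ h β t := by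
  by_contra! hcon
  have hβ := E.beta_pos
  have hw := E.gridFreq hT hpos hmono
  obtain ⟨C, hC⟩ := hbd
  have hC0 : 0 < C := by
    have h1 := hpos T₀ (mem_Ici.2 le_rfl)
    exact lt_of_lt_of_le (by positivity) (hC T₀ (mem_Ici.2 le_rfl))
  set y := x * exp (h / β) with hy
  have hy0 : 0 < y := by positivity
  set A := C ^ (-(1 / β)) * φ (y ^ (-β)) with hA
  have hA0 : 0 < A := mul_pos (by positivity) (E.phi_pos (by positivity))
  set f := fun t => ENNReal.ofReal (freq ξ h β t * φ (ξ t / t ^ h) / t) with hf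
  have htail : Tendsto (fun k : ℕ => (volume.withDensity f) (Ici T₀ ∩ Ici (k:ℝ))) atTop
      (nhds ((volume.withDensity f) (⋂ k : ℕ, Ici T₀ ∩ Ici (k:ℝ)))) := by
    refine tendsto_measure_iInter_atTop
      (fun k => (measurableSet_Ici.inter measurableSet_Ici).nullMeasurableSet) (fun i j hij => ?_)
      ⟨0, ?_⟩
    · exact inter_subset_inter_right _ (Ici_subset_Ici.2 (Nat.cast_le.2 hij))
    · refine ne_top_of_le_ne_top hInt.ne ?_
      rw [← withDensity_apply _ measurableSet_Ici]
      exact measure_mono inter_subset_left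
  have hemp : (⋂ k : ℕ, Ici T₀ ∩ Ici (k:ℝ)) = ∅ := by
    refine eq_empty_of_forall_notMem fun t ht => ?_
    obtain ⟨k, hk⟩ := exists_nat_gt t
    exact absurd (mem_iInter.1 ht k).2 (not_le.2 hk)
  rw [hemp, measure_empty] at htail
  have hsmall := htail.eventually_lt_const (show 0 < ENNReal.ofReal (A / 2) by simpa using hA0)
  obtain ⟨k, hk⟩ := hsmall.exists
  obtain ⟨s, hs, hsx⟩ := hcon (max T₀ k) (le_max_left _ _)
  have hsT : T₀ ≤ s := (le_max_left _ _).trans hs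
  have hsk : (k:ℝ) ≤ s := (le_max_right _ _).trans hs
  have hs0 : 0 < s := hT.trans_le hsT
  have key := ofReal_le_setLIntegral_div (F := fun t => freq ξ h β t * φ (ξ t / t ^ h))
    (a := log s) (b := log s + 1) (A := A) (by linarith) le_rfl hA0.le (by
    intro r hr hr'
    have hrs : s ≤ exp r := by rwa [log_le_iff_le_exp hs0] at hr
    have hrT : T₀ ≤ exp r := hsT.trans hrs
    have hξ := hpos _ hrT
    have h1 : C ^ (-(1 / β)) ≤ freq ξ h β (exp r) := by
      unfold freq
      refine rpow_le_rpow_of_nonpos (by positivity) (hC _ hrT) (by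
        have : 0 < 1 / β := by positivity
        linarith)
    have h2 : freq ξ h β (exp r) ≤ y := by
      refine (hw.grow s hsT _ hrs).trans ?_
      have h3 : (exp r / s) ^ (h / β) ≤ exp (h / β) := by
        have : exp r / s ≤ exp 1 := by
          rw [div_le_iff₀ hs0]
          calc exp r ≤ exp (log s + 1) := exp_le_exp.2 hr'.le
            _ = exp 1 * s := by rw [exp_add, exp_log hs0]; ring
        calc (exp r / s) ^ (h / β) ≤ (exp 1) ^ (h / β) :=
              rpow_le_rpow (by positivity) this hw.q_pos.le
          _ = _ := by rw [← exp_mul, one_mul]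
      exact mul_le_mul hsx.le h3 (by positivity) hx.le
    have h4 : φ (y ^ (-β)) ≤ φ (ξ (exp r) / exp r ^ h) := by
      rw [← E.freq_rpow (exp_pos r) hξ]
      exact E.phi_anti (hw.pos _ hrT) h2
    exact mul_le_mul h1 h4 (E.phi_pos (by positivity)).le (hw.pos _ hrT).le)
  rw [show A * (log s + 1 - log s) / 2 = A / 2 by ring] at key
  refine absurd hk (not_lt.2 (key.trans ?_))
  rw [← withDensity_apply _ measurableSet_Ico]
  refine measure_mono fun t ht => ?_
  rw [exp_log hs0] at ht
  exact ⟨hsT.trans ht.1, hsk.trans ht.1⟩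

theorem ae_eventually_of_lintegral (E : SmallBallEstimates P M φ h β) {ξ : ℝ → ℝ} {T₀ : ℝ}
    (hT : 0 < T₀) (hpos : ∀ t ∈ Ici T₀, 0 < ξ t) (hmono : MonotoneOn ξ (Ici T₀))
    (hbd : ∃ C : ℝ, ∀ t ∈ Ici T₀, ξ t / t ^ h ≤ C)
    (hInt : ∫⁻ t in Ici T₀, ENNReal.ofReal (freq ξ h β t * φ (ξ t / t ^ h) / t) < ⊤) :
    ∀ᵐ ω ∂P, ∃ t₀ : ℝ, ∀ t : ℝ, t₀ < t → ξ t ≤ M t ω := by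
  have hβ := E.beta_pos
  have hw := E.gridFreq hT hpos hmono
  set w := freq ξ h β with hwdef
  set q := h / β with hq
  have hq0 : 0 < q := hw.q_pos
  set D := q * exp (2 * q) with hD
  obtain ⟨x₁, hx₁, C₁, hC₁, hcmp⟩ := E.compare D (by positivity)
  obtain ⟨x₂, hx₂, C₂, hC₂, hsh⟩ := E.shift D (by positivity)
  obtain ⟨T, hTT, hTw⟩ := E.exists_freq_ge_of_lintegral hT hpos hmono hbd hInt
    (max x₁ (x₂ * exp q)) (lt_of_lt_of_le (by linarith) (le_max_left _ _))
  have hT0 : 0 < T := hT.trans_le hTT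
  set s := log T with hs
  have hsT : T₀ ≤ exp s := by rwa [hs, exp_log hT0]
  set τ := GridFreq.grid w s with hτ
  set x := fun n => w (exp (τ n)) with hx
  have hτT : ∀ n, T ≤ exp (τ n) := fun n => by
    rw [← exp_log hT0]; exact exp_le_exp.2 (hw.le_grid hsT n)
  have hxx : ∀ n, max x₁ (x₂ * exp q) ≤ x n := fun n => hTw _ (hτT n)
  have hxx1 : ∀ n, x₁ ≤ x n := fun n => (le_max_left _ _).trans (hxx n)
  have hxx2 : ∀ n, x₂ * exp q ≤ x n := fun n => (le_max_right _ _).trans (hxx n)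
  have hx1 : ∀ n, 1 ≤ x n := fun n => hx₁.trans (hxx1 n)
  have hx0 : ∀ n, 0 < x n := fun n => by linarith [hx1 n]
  have hstep : ∀ n, τ (n + 1) - τ n = 1 / x n := fun n => by
    rw [hτ, GridFreq.grid]; simp [hx, hτ]
  have hlt := fun n => hw.grid_lt_succ hsT n
  have hstep1 : ∀ n, τ (n + 1) ≤ τ n + 1 := fun n => by
    have := hstep n
    have : 1 / x n ≤ 1 := by rw [div_le_one (hx0 n)]; exact hx1 n
    linarith
  set I := ∫⁻ t in Ici T₀, ENNReal.ofReal (w t * φ (ξ t / t ^ h) / t) with hI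
  have hblock : ∀ n, ENNReal.ofReal (φ (x n ^ (-β)) / (2 * C₁)) ≤
      ∫⁻ t in Ico (exp (τ n)) (exp (τ (n + 1))), ENNReal.ofReal (w t * φ (ξ t / t ^ h) / t) := by
    intro n
    have hφn := E.phi_pos (rpow_pos_of_pos (hx0 n) (-β))
    have hxn := hx0 n
    refine le_trans (le_of_eq ?_) (ofReal_le_setLIntegral_div
      (F := fun t => w t * φ (ξ t / t ^ h)) (hlt n).le (hstep1 n)
      (A := x n * φ (x n ^ (-β)) / C₁) (by positivity) ?_)
    · rw [show GridFreq.grid w s (n + 1) - GridFreq.grid w s n = 1 / x n from hstep n]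
      congr 1; field_simp
    · intro r hr hr'
      have hrT : T ≤ exp r := (hτT n).trans (exp_le_exp.2 hr)
      have h1 := (hw.block hsT (hx1 n) hr hr'.le).1
      have h2 := hcmp (x n) (hxx1 n) (w (exp r)) ((le_max_left _ _).trans (hTw _ hrT)) h1
      rw [E.freq_rpow (exp_pos r) (hpos _ (hTT.le.trans hrT))] at h2
      rw [div_le_iff₀ hC₁]; linarith
  have hdisj : Pairwise (Function.onFun Disjoint fun n => Ico (exp (τ n)) (exp (τ (n + 1)))) :=
    (exp_monotone.comp (hw.grid_strictMono hsT).monotone).pairwise_disjoint_on_Ico_succ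
  have hsumfin : ∑' n, ENNReal.ofReal (φ (x n ^ (-β)) / (2 * C₁)) ≤ I := by
    refine (ENNReal.tsum_le_tsum hblock).trans ?_
    rw [← lintegral_iUnion (fun n => measurableSet_Ico) hdisj]
    refine lintegral_mono_set (iUnion_subset fun n t ht => ?_)
    exact hTT.le.trans ((hτT n).trans ht.1)
  let B : ℕ → Set Ω := fun n => {ω | M (exp (τ n)) ω ≤ ξ (exp (τ (n + 1)))}
  have hB : ∀ n, P (B n) ≤ ENNReal.ofReal (C₂ * (2 * C₁)) *
      ENNReal.ofReal (φ (x (n + 1) ^ (-β)) / (2 * C₁)) := by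
    intro n
    rw [← ENNReal.ofReal_mul (by positivity), ← ofReal_measureReal (measure_ne_top _ _)]
    refine ENNReal.ofReal_le_ofReal ?_
    rw [E.scaling _ (exp_pos _)]
    have hxn := hx0 n
    have hxn1 := hx0 (n + 1)
    have hξ := hpos _ (hTT.le.trans (hτT (n + 1)))
    set y := x (n + 1) * exp (-(q * (1 / x n))) with hy
    have hy0 : 0 < y := by positivity
    have e1 : ξ (exp (τ (n + 1))) / exp (τ n) ^ h = y ^ (-β) := by
      rw [hy, mul_rpow hxn1.le (exp_pos _).le]
      simp only [hx]
      rw [E.freq_rpow (exp_pos _) hξ, ← exp_mul, ← exp_mul, ← exp_mul,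
        show τ (n + 1) = τ n + 1 / x n by linarith [hstep n],
        show -(q * (1 / x n)) * -β = 1 / x n * h by rw [hq]; field_simp,
        show (τ n + 1 / x n) * h = τ n * h + 1 / x n * h by ring, exp_add (τ n * h)]
      have := exp_pos (1 / x n * h)
      field_simp
    have hinv : 1 / x n ≤ 1 := by rw [div_le_one hxn]; exact hx1 n
    have hqx : q * (1 / x n) ≤ q := by nlinarith
    have hyx2 : x₂ ≤ y := by
      have : x₂ = x₂ * exp q * exp (-q) := by rw [mul_assoc, ← exp_add]; simp
      rw [this, hy]
      gcongr
      · exact hxx2 (n + 1)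
    have hyxn : y ≤ x n := by
      have h1 := hw.exp_grow (hw.T_le hsT n) (hlt n).le
      rw [show GridFreq.grid w s (n + 1) - GridFreq.grid w s n = 1 / x n from hstep n] at h1
      have h2 : x (n + 1) ≤ x n * exp (q * (1 / x n)) := h1
      rw [hy, exp_neg, ← div_eq_mul_inv, div_le_iff₀ (exp_pos _)]
      exact h2
    have hle : x (n + 1) ≤ y + D := by
      have h1 : x (n + 1) = y * exp (q * (1 / x n)) := by
        rw [hy, mul_assoc, ← exp_add]; simp
      have h2 : exp (q * (1 / x n)) - 1 ≤ q * (1 / x n) * exp (2 * q) := by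
        refine (exp_sub_one_le_mul_exp _).trans ?_
        exact mul_le_mul_of_nonneg_left (exp_le_exp.2 (by linarith)) (by positivity)
      have h3 : y * (exp (q * (1 / x n)) - 1) ≤ D := by
        calc y * (exp (q * (1 / x n)) - 1) ≤ x n * (q * (1 / x n) * exp (2 * q)) := by
              refine mul_le_mul hyxn h2 ?_ hxn.le
              linarith [one_le_exp (show 0 ≤ q * (1 / x n) by positivity)]
          _ = D := by rw [hD]; field_simp
      linarith
    rw [e1]
    calc φ (y ^ (-β)) ≤ C₂ * φ ((y + D) ^ (-β)) := hsh y hyx2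
      _ ≤ C₂ * φ (x (n + 1) ^ (-β)) := by
          gcongr
          exact E.phi_anti hxn1 hle
      _ = _ := by field_simp
  have hBsum : ∑' n, P (B n) ≠ ⊤ := by
    refine ne_top_of_le_ne_top (b := ENNReal.ofReal (C₂ * (2 * C₁)) * I)
      (ENNReal.mul_ne_top ENNReal.ofReal_ne_top hInt.ne) ?_
    refine (ENNReal.tsum_le_tsum hB).trans ?_
    rw [ENNReal.tsum_mul_left]
    gcongr
    refine le_trans ?_ hsumfin
    exact ENNReal.tsum_comp_le_tsum_of_injective (add_left_injective 1)
      (fun n => ENNReal.ofReal (φ (x n ^ (-β)) / (2 * C₁)))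
  filter_upwards [ae_eventually_notMem hBsum] with ω hω
  obtain ⟨N, hN⟩ := eventually_atTop.1 hω
  refine ⟨exp (τ N), fun t ht => ?_⟩
  have ht0 : 0 < t := (exp_pos _).trans ht
  obtain ⟨n, hn, h1, h2⟩ := hw.exists_grid_mem hsT (N := N) (r := log t)
    ((le_log_iff_exp_le ht0).2 ht.le)
  have h3 := hN n hn
  simp only [B, mem_ofPred_eq, not_le] at h3
  have h4 : exp (τ n) ≤ t := (le_log_iff_exp_le ht0).1 h1
  have h5 : t ≤ exp (τ (n + 1)) := ((log_lt_iff_lt_exp ht0).1 h2).le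
  have h6 : T₀ ≤ t := hTT.le.trans ((hτT n).trans h4)
  calc ξ t ≤ ξ (exp (τ (n + 1))) := hmono h6 (h6.trans h5 : T₀ ≤ _) h5
    _ ≤ M (exp (τ n)) ω := h3.le
    _ ≤ M t ω := E.mono ω _ _ (exp_pos _).le h4

end SmallBallEstimates

namespace SmallBallEstimates

variable {Ω : Type*} [MeasurableSpace Ω] {P : Measure Ω} [IsProbabilityMeasure P]
  {M : ℝ → Ω → ℝ} {φ : ℝ → ℝ} {h β : ℝ}

/-- Summability of the small ball probabilities along the grid bounds the integral. -/
theorem lintegral_lt_top_of_summable (E : SmallBallEstimates P M φ h β) {ξ : ℝ → ℝ} {T₀ : ℝ}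
    (hT : 0 < T₀) (hpos : ∀ t ∈ Ici T₀, 0 < ξ t) (hmono : MonotoneOn ξ (Ici T₀))
    {x₁ C₁ : ℝ} (hx₁ : 1 ≤ x₁) (hC₁ : 0 < C₁)
    (hcmp : ∀ x ≥ x₁, ∀ y ≥ x₁, y ≤ x + h / β * exp (2 * (h / β)) →
      x * φ (x ^ (-β)) ≤ C₁ * (y * φ (y ^ (-β))))
    {T : ℝ} (hTT : T₀ ≤ T) (hTw : ∀ t ≥ T, x₁ ≤ freq ξ h β t)
    (hsum : Summable fun n =>
      φ (freq ξ h β (exp (GridFreq.grid (freq ξ h β) (log T) n)) ^ (-β))) :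
    ∫⁻ t in Ici T₀, ENNReal.ofReal (freq ξ h β t * φ (ξ t / t ^ h) / t) < ⊤ := by
  have hβ := E.beta_pos
  have hw := E.gridFreq hT hpos hmono
  set w := freq ξ h β with hwdef
  set q := h / β with hq
  have hq0 : 0 < q := hw.q_pos
  have hT0 : 0 < T := hT.trans_le hTT
  set s := log T with hs
  have hsT : T₀ ≤ exp s := by rwa [hs, exp_log hT0]
  set τ := GridFreq.grid w s with hτ
  set x := fun n => w (exp (τ n)) with hx
  have hτT : ∀ n, T ≤ exp (τ n) := fun n => by
    rw [← exp_log hT0]; exact exp_le_exp.2 (hw.le_grid hsT n)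
  have hxx1 : ∀ n, x₁ ≤ x n := fun n => hTw _ (hτT n)
  have hx1 : ∀ n, 1 ≤ x n := fun n => hx₁.trans (hxx1 n)
  have hx0 : ∀ n, 0 < x n := fun n => by linarith [hx1 n]
  have hstep : ∀ n, τ (n + 1) - τ n = 1 / x n := fun n => by
    rw [hτ, GridFreq.grid]; simp [hx, hτ]
  have hlt := fun n => hw.grid_lt_succ hsT n
  have hstep1 : ∀ n, τ (n + 1) ≤ τ n + 1 := fun n => by
    have := hstep n
    have : 1 / x n ≤ 1 := by rw [div_le_one (hx0 n)]; exact hx1 n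
    linarith
  set F := fun t => w t * φ (ξ t / t ^ h) with hF
  have hcover : Ici T₀ ⊆ Ico T₀ T ∪ ⋃ n, Ico (exp (τ n)) (exp (τ (n + 1))) := by
    intro t ht
    rcases lt_or_ge t T with h1 | h1
    · exact Or.inl ⟨ht, h1⟩
    · have ht0 : 0 < t := hT0.trans_le h1
      obtain ⟨n, -, h2, h3⟩ := hw.exists_grid_mem hsT (N := 0) (r := log t)
        (log_le_log hT0 h1)
      exact Or.inr (mem_iUnion.2 ⟨n, (le_log_iff_exp_le ht0).1 h2, (log_lt_iff_lt_exp ht0).1 h3⟩)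
  have hStart : ∫⁻ t in Ico T₀ T, ENNReal.ofReal (F t / t) < ⊤ := by
    have hwT : 0 < w T₀ := hw.pos _ le_rfl
    calc ∫⁻ t in Ico T₀ T, ENNReal.ofReal (F t / t)
        ≤ ∫⁻ t in Ico T₀ T, ENNReal.ofReal (w T₀ * (T / T₀) ^ q / T₀) := by
          refine setLIntegral_mono' measurableSet_Ico fun t ht => ENNReal.ofReal_le_ofReal ?_
          have ht0 : 0 < t := hT.trans_le ht.1
          refine div_le_div₀ (by positivity) ?_ hT ht.1
          calc F t ≤ w t * 1 := mul_le_mul_of_nonneg_left (E.phi_le_one _) (hw.pos t ht.1).le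
            _ ≤ w T₀ * (t / T₀) ^ q := by rw [mul_one]; exact hw.grow _ le_rfl _ ht.1
            _ ≤ w T₀ * (T / T₀) ^ q := by
                refine mul_le_mul_of_nonneg_left (rpow_le_rpow (by positivity) ?_ hq0.le) hwT.le
                exact div_le_div_of_nonneg_right ht.2.le hT.le
      _ < ⊤ := by
          rw [setLIntegral_const, Real.volume_Ico]
          exact ENNReal.mul_lt_top ENNReal.ofReal_lt_top ENNReal.ofReal_lt_top
  have hblock : ∀ n, ∫⁻ t in Ico (exp (τ n)) (exp (τ (n + 1))), ENNReal.ofReal (F t / t) ≤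
      ENNReal.ofReal (3 * C₁ * exp q * φ (x (n + 1) ^ (-β))) := by
    intro n
    have hφn := E.phi_pos (rpow_pos_of_pos (hx0 (n + 1)) (-β))
    have hxn := hx0 n
    have hxn1 := hx0 (n + 1)
    refine (setLIntegral_div_le_ofReal (F := F) (hlt n).le (hstep1 n)
      (A := C₁ * (x n * exp q * φ (x (n + 1) ^ (-β)))) (by positivity) ?_).trans (le_of_eq ?_)
    · intro r hr hr'
      have hrT : T ≤ exp r := (hτT n).trans (exp_le_exp.2 hr)
      have h1 := (hw.block hsT (hx1 n) hr hr'.le).2.1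
      have h2 := hcmp (w (exp r)) (hTw _ hrT) (x (n + 1)) (hxx1 _) h1
      rw [E.freq_rpow (exp_pos r) (hpos _ (hTT.trans hrT))] at h2
      refine h2.trans ?_
      have h3 := (hw.block hsT (hx1 n) (hlt n).le le_rfl).2.2
      exact mul_le_mul_of_nonneg_left (mul_le_mul_of_nonneg_right h3 hφn.le) hC₁.le
    · rw [show GridFreq.grid w s (n + 1) - GridFreq.grid w s n = 1 / x n from hstep n]
      congr 1; field_simp
  have hs2 : Summable fun n => 3 * C₁ * exp q * φ (x (n + 1) ^ (-β)) :=
    ((summable_nat_add_iff 1).2 hsum).mul_left _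
  calc _ ≤ ∫⁻ t in Ico T₀ T ∪ ⋃ n, Ico (exp (τ n)) (exp (τ (n + 1))), ENNReal.ofReal (F t / t) :=
        lintegral_mono_set hcover
    _ ≤ (∫⁻ t in Ico T₀ T, ENNReal.ofReal (F t / t)) +
        ∫⁻ t in ⋃ n, Ico (exp (τ n)) (exp (τ (n + 1))), ENNReal.ofReal (F t / t) :=
        lintegral_union_le _ _ _
    _ ≤ (∫⁻ t in Ico T₀ T, ENNReal.ofReal (F t / t)) +
        ∑' n, ENNReal.ofReal (3 * C₁ * exp q * φ (x (n + 1) ^ (-β))) :=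
        add_le_add le_rfl ((lintegral_iUnion_le _ _).trans (ENNReal.tsum_le_tsum hblock))
    _ < ⊤ := ENNReal.add_lt_top.2 ⟨hStart, lt_top_iff_ne_top.2 hs2.tsum_ofReal_ne_top⟩

theorem min_one_div_two_le {r : ℝ} (hr : 0 ≤ r) : min 1 r / 2 ≤ 1 - exp (-r) := by
  have h1 : exp (-r) ≤ 1 / (1 + r) := by
    rw [exp_neg, one_div]
    exact inv_anti₀ (by linarith) (by linarith [add_one_le_exp r])
  have h2 : 1 / (1 + r) ≤ 1 - min 1 r / 2 := by
    rw [div_le_iff₀ (by linarith)]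
    rcases le_total 1 r with h | h
    · rw [min_eq_left h]; nlinarith
    · rw [min_eq_right h]; nlinarith
  linarith

theorem lintegral_lt_top_of_ae_eventually (E : SmallBallEstimates P M φ h β) {ξ : ℝ → ℝ}
    {T₀ : ℝ} (hT : 0 < T₀) (hpos : ∀ t ∈ Ici T₀, 0 < ξ t) (hmono : MonotoneOn ξ (Ici T₀))
    (hae : ∀ᵐ ω ∂P, ∃ t₀ : ℝ, ∀ t : ℝ, t₀ < t → ξ t ≤ M t ω) :
    ∫⁻ t in Ici T₀, ENNReal.ofReal (freq ξ h β t * φ (ξ t / t ^ h) / t) < ⊤ := by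
  have hβ := E.beta_pos
  have hw := E.gridFreq hT hpos hmono
  obtain ⟨x₁, hx₁, C₁, hC₁, hcmp⟩ := E.compare (h / β * exp (2 * (h / β)))
    (mul_pos hw.q_pos (exp_pos _))
  obtain ⟨x₂, hx₂, C₂, hC₂, hsh⟩ := E.shift 1 one_pos
  obtain ⟨C₃, hC₃, hlow⟩ := E.lower'
  obtain ⟨C₄, hC₄, c, hc, hup⟩ := E.upper'
  obtain ⟨K₁, hK₁, c₁, hc₁, hdec⟩ := E.decay
  obtain ⟨K₂, hK₂, C₅, hC₅, hdc⟩ := E.decouple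
  obtain ⟨T, hTT, hTw⟩ := E.exists_freq_ge hT hpos hae (max x₁ x₂)
    (lt_of_lt_of_le (by linarith) (le_max_left _ _))
  by_contra hcon
  have hns := fun hsum => hcon (E.lintegral_lt_top_of_summable hT hpos hmono hx₁ hC₁ hcmp hTT
    (fun t ht => (le_max_left _ _).trans (hTw t ht)) hsum)
  set w := freq ξ h β with hwdef
  have hT0 : 0 < T := hT.trans_le hTT
  set s := log T with hs
  have hsT : T₀ ≤ exp s := by rwa [hs, exp_log hT0]
  set τ := GridFreq.grid w s with hτ
  set x := fun n => w (exp (τ n)) with hx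
  have hτT : ∀ n, T ≤ exp (τ n) := fun n => by
    rw [← exp_log hT0]; exact exp_le_exp.2 (hw.le_grid hsT n)
  have hxx2 : ∀ n, x₂ ≤ x n := fun n => (le_max_right _ _).trans (hTw _ (hτT n))
  have hx1 : ∀ n, 1 ≤ x n := fun n => hx₂.trans (hxx2 n)
  have hx0 : ∀ n, 0 < x n := fun n => by linarith [hx1 n]
  have hx2 : ∀ n, 0 < x n + 1 := fun n => by linarith [hx1 n]
  let f := fun n => φ (x n ^ (-β))
  let a := fun n => exp (τ n) ^ h * (x n + 1) ^ (-β)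
  let A : ℕ → Set Ω := fun n => {ω | M (exp (τ n)) ω ≤ a n}
  have hadiv : ∀ n, a n / exp (τ n) ^ h = (x n + 1) ^ (-β) := fun n => by
    have : 0 < exp (τ n) ^ h := rpow_pos_of_pos (exp_pos _) _
    simp only [a]; field_simp
  have hadiv1 : ∀ n, a n / exp (τ n) ^ h ≤ 1 := fun n => by
    rw [hadiv]; exact rpow_le_one_of_one_le_of_nonpos (by linarith [hx1 n]) (by linarith)
  have hadivf : ∀ n, (a n / exp (τ n) ^ h) ^ (-(1 / β)) = x n + 1 := fun n => by
    rw [hadiv, ← rpow_mul (hx2 n).le, show -β * -(1 / β) = 1 by field_simp, rpow_one]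
  have ha0 : ∀ n, 0 < a n := fun n =>
    mul_pos (rpow_pos_of_pos (exp_pos _) _) (rpow_pos_of_pos (hx2 n) _)
  have hPA : ∀ n, P.real (A n) = φ ((x n + 1) ^ (-β)) := fun n => by
    rw [← hadiv]; exact E.scaling _ (exp_pos _) _
  have hf0 : ∀ n, 0 < f n := fun n => E.phi_pos (rpow_pos_of_pos (hx0 n) _)
  have hφf : ∀ n, φ ((x n + 1) ^ (-β)) ≤ f n := fun n => E.phi_anti (hx0 n) (by linarith)
  have hltt : ∀ n m, n < m → exp (τ n) < exp (τ m) := fun n m hnm =>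
    exp_lt_exp.2 (hw.grid_strictMono hsT hnm)
  obtain ⟨δ, hδ, hδ'⟩ := exists_pos_le_measureReal_iUnion_of_decay P (A := A)
    (fun n => E.meas _ (exp_pos _) _) (τ := τ) (x := x) (f := f) hx1 (fun n => rfl)
    (hw.grid_tendsto hsT) (q := h / β) (c := c) (c₀ := 1 / C₂) (c₄ := c₁ / 2) (C₁ := C₃) (C₂ := C₄)
    (C₅ := 2 * C₅) (K := 1 + K₁ + K₂) hw.q_pos.le
    (fun n m hnm => hw.exp_grow (hw.T_le hsT n) ((hw.grid_strictMono hsT).monotone hnm))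
    hc (by positivity) (by positivity) hC₄ (by positivity) (by positivity)
    (fun n => hlow _ (hx1 n)) (fun n => hup _ (hx1 n)) hns
    (fun n => by
      rw [hPA, div_mul_eq_mul_div, div_le_iff₀ hC₂, one_mul, mul_comm]
      exact hsh _ (hxx2 n))
    (fun n => by rw [hPA]; nlinarith [hφf n, hf0 n])
    (fun n m hnm => by
      refine (hdec _ (exp_pos (τ n)) _ (hltt n m hnm) _ (ha0 n) _ (ha0 m) (hadiv1 m)).trans ?_
      rw [hadiv n, hadivf m]
      have hr : 0 ≤ τ m - τ n := sub_nonneg.2 (hw.grid_strictMono hsT hnm).le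
      have e1 : (exp (τ m) - exp (τ n)) / exp (τ m) = 1 - exp (-(τ m - τ n)) := by
        rw [show -(τ m - τ n) = τ n - τ m by ring, exp_sub, sub_div, div_self (exp_pos _).ne']
      have h1 := min_one_div_two_le hr
      have h2 : 0 ≤ min 1 (τ m - τ n) := le_min zero_le_one hr
      refine mul_le_mul ?_ (exp_le_exp.2 (neg_le_neg ?_)) (exp_pos _).le (by
        have := hf0 n
        positivity)
      · exact mul_le_mul (by linarith) (hφf n) ((E.phi_pos (rpow_pos_of_pos (hx2 n) _)).le)
          (by positivity)
      · rw [e1]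
        calc c₁ / 2 * x m * min 1 (τ m - τ n) = c₁ * x m * (min 1 (τ m - τ n) / 2) := by ring
          _ ≤ c₁ * (x m + 1) * (1 - exp (-(τ m - τ n))) := by
            refine mul_le_mul ?_ h1 (by positivity) (mul_pos hc₁ (hx2 m)).le
            exact mul_le_mul_of_nonneg_left (by linarith) hc₁.le)
    (fun n m hnm h5 => by
      refine (hdc _ (exp_pos (τ n)) _ (hltt n m hnm) _ (ha0 n) _ (ha0 m) (hadiv1 n) (hadiv1 m)
        ?_).trans ?_
      · rw [hadivf, hadivf, ← exp_sub, log_exp]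
        refine le_trans ?_ h5
        nlinarith [hx1 n, hx1 m]
      · rw [hadiv, hadiv]
        have p1 := (E.phi_pos (rpow_pos_of_pos (hx2 n) (-β))).le
        have p2 := (E.phi_pos (rpow_pos_of_pos (hx2 m) (-β))).le
        have := hf0 n
        exact mul_le_mul (mul_le_mul (by linarith) (hφf n) p1 (by positivity)) (hφf m) p2
          (by positivity))
  refine not_ae_eventually_notMem P (A := A) (fun n => E.meas _ (exp_pos _) _) hδ hδ' ?_
  filter_upwards [hae] with ω hω
  obtain ⟨t₀, h0⟩ := hω
  obtain ⟨N, hN⟩ := ((hw.grid_tendsto hsT).eventually_gt_atTop t₀).exists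
  refine ⟨N, fun n hn hA => ?_⟩
  have h1 : t₀ < exp (τ n) := by
    have h2 := (hw.grid_strictMono hsT).monotone hn
    have h3 := add_one_le_exp (τ n)
    have h4 : GridFreq.grid w s n = τ n := rfl
    linarith
  have h2 := h0 _ h1
  have h3 : M (exp (τ n)) ω ≤ a n := hA
  have hξ := hpos _ (hTT.le.trans (hτT n))
  have h4 := E.freq_rpow (exp_pos (τ n)) hξ
  have h5 : (x n + 1) ^ (-β) < x n ^ (-β) :=
    rpow_lt_rpow_of_neg (hx0 n) (by linarith) (by linarith)
  have hp : 0 < exp (τ n) ^ h := rpow_pos_of_pos (exp_pos _) _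
  have h6 : ξ (exp (τ n)) = exp (τ n) ^ h * x n ^ (-β) := by
    simp only [hx]
    rw [h4]; field_simp
  have h7 : a n < ξ (exp (τ n)) := by
    rw [h6]; exact mul_lt_mul_of_pos_left h5 hp
  linarith

/-- Integral test for the lower class of a self-similar running maximum. -/
theorem integral_test (E : SmallBallEstimates P M φ h β) {ξ : ℝ → ℝ} {T₀ : ℝ} (hT : 0 < T₀)
    (hpos : ∀ t ∈ Ici T₀, 0 < ξ t) (hmono : MonotoneOn ξ (Ici T₀)) :
    (∀ᵐ ω ∂P, ∃ t₀ : ℝ, ∀ t : ℝ, t₀ < t → ξ t ≤ M t ω) ↔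
    ((∃ C : ℝ, ∀ t ∈ Ici T₀, ξ t / t ^ h ≤ C) ∧
      ∫⁻ t in Ici T₀,
        ENNReal.ofReal ((ξ t / t ^ h) ^ (-(1 / β)) * φ (ξ t / t ^ h) / t) < ⊤) := by
  refine ⟨fun hae => ⟨?_, E.lintegral_lt_top_of_ae_eventually hT hpos hmono hae⟩,
    fun hh => E.ae_eventually_of_lintegral hT hpos hmono hh.1 hh.2⟩
  obtain ⟨T, hTT, hTw⟩ := E.exists_freq_ge hT hpos hae 1 one_pos
  have hβ := E.beta_pos
  refine ⟨max 1 (ξ T / T₀ ^ h), fun t ht => ?_⟩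
  have ht0 : 0 < t := hT.trans_le ht
  rcases le_total t T with h1 | h1
  · refine le_max_of_le_right (div_le_div₀ (hpos T hTT).le (hmono ht hTT h1)
      (by positivity) (rpow_le_rpow hT.le ht E.h_pos.le))
  · refine le_max_of_le_left ?_
    rw [← E.freq_rpow ht0 (hpos t ht)]
    exact rpow_le_one_of_one_le_of_nonpos (hTw t h1) (by linarith)

end SmallBallEstimates

/-- The dyadic grid of level `n` on `[0, t]`. -/
noncomputable def gridPts (t : ℝ) (n : ℕ) : Finset ℝ :=
  (Finset.range (2 ^ n + 1)).image fun i : ℕ => t * (i / 2 ^ n)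

theorem mem_gridPts {t : ℝ} {n : ℕ} {s : ℝ} :
    s ∈ gridPts t n ↔ ∃ i : ℕ, i ≤ 2 ^ n ∧ t * (i / 2 ^ n) = s := by
  simp [gridPts, Nat.lt_succ_iff]

theorem gridPts_subset {t : ℝ} (ht : 0 ≤ t) (n : ℕ) {s : ℝ} (hs : s ∈ gridPts t n) : s ∈ Icc 0 t := by
  obtain ⟨i, hi, rfl⟩ := mem_gridPts.1 hs
  have h1 : (i:ℝ) / 2 ^ n ≤ 1 := by
    rw [div_le_one (by positivity)]; exact_mod_cast hi
  exact ⟨by positivity, by nlinarith⟩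

theorem gridPts_mono (t : ℝ) : Monotone (gridPts t) := by
  refine monotone_nat_of_le_succ fun n s hs => ?_
  obtain ⟨i, hi, rfl⟩ := mem_gridPts.1 hs
  refine mem_gridPts.2 ⟨2 * i, by rw [pow_succ]; omega, ?_⟩
  push_cast
  rw [pow_succ]
  field_simp

theorem exists_gridPts_near {t : ℝ} (ht : 0 ≤ t) (n : ℕ) {s : ℝ} (hs : s ∈ Icc 0 t) :
    ∃ r ∈ gridPts t n, |s - r| ≤ t / 2 ^ n := by
  rcases ht.eq_or_lt with rfl | ht
  · exact ⟨0, mem_gridPts.2 ⟨0, Nat.zero_le _, by simp⟩, by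
      have : s = 0 := le_antisymm hs.2 hs.1
      simp [this]⟩
  · have h0 : 0 ≤ s / t * 2 ^ n := by have := hs.1; positivity
    have h1 := Nat.floor_le h0
    have h2 := Nat.lt_floor_add_one (s / t * 2 ^ n)
    set i := ⌊s / t * 2 ^ n⌋₊
    have h3 : s = t * ((s / t * 2 ^ n) / 2 ^ n) := by field_simp
    refine ⟨t * (i / 2 ^ n), mem_gridPts.2 ⟨i, ?_, rfl⟩, ?_⟩
    · have : s / t * 2 ^ n ≤ 2 ^ n := by
        have : s / t ≤ 1 := by rw [div_le_one ht]; exact hs.2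
        nlinarith [show (0:ℝ) < 2 ^ n by positivity]
      exact_mod_cast h1.trans this
    · have e : s - t * (i / 2 ^ n) = t * ((s / t * 2 ^ n - i) / 2 ^ n) := by field_simp
      rw [e, abs_of_nonneg (by
        have : 0 ≤ s / t * 2 ^ n - i := by linarith
        positivity), ← mul_one_div t]
      gcongr
      linarith

section RunSup

variable {Ω : Type*} {Y : ℝ → Ω → ℝ} {ω : Ω}

theorem bddAbove_runSup (hc : ContinuousOn (fun t => Y t ω) (Ici 0)) (t : ℝ) :
    BddAbove (range fun s : Icc (0:ℝ) t => |Y s.1 ω|) := by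
  have : ContinuousOn (fun s => |Y s ω|) (Icc 0 t) :=
    continuous_abs.comp_continuousOn (hc.mono Icc_subset_Ici_self)
  obtain ⟨B, hB⟩ := (isCompact_Icc.image_of_continuousOn this).bddAbove
  refine ⟨B, ?_⟩
  rintro _ ⟨s, rfl⟩
  exact hB ⟨s.1, s.2, rfl⟩

theorem abs_le_runSup (hc : ContinuousOn (fun t => Y t ω) (Ici 0)) {s t : ℝ} (hs : s ∈ Icc 0 t) :
    |Y s ω| ≤ runSup Y t ω :=
  le_ciSup (bddAbove_runSup hc t) (⟨s, hs⟩ : Icc (0:ℝ) t)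

theorem runSup_le_iff (hc : ContinuousOn (fun t => Y t ω) (Ici 0)) {t a : ℝ} (ht : 0 ≤ t) :
    runSup Y t ω ≤ a ↔ ∀ s ∈ Icc 0 t, |Y s ω| ≤ a := by
  have : Nonempty (Icc (0:ℝ) t) := ⟨⟨0, le_rfl, ht⟩⟩
  exact ⟨fun h s hs => (abs_le_runSup hc hs).trans h, fun h => ciSup_le fun s => h s.1 s.2⟩

theorem runSup_mono (hc : ContinuousOn (fun t => Y t ω) (Ici 0)) {s t : ℝ} (hs : 0 ≤ s)
    (hst : s ≤ t) : runSup Y s ω ≤ runSup Y t ω :=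
  (runSup_le_iff hc hs).2 fun _ hr => abs_le_runSup hc ⟨hr.1, hr.2.trans hst⟩

theorem setOf_runSup_le (hc : ∀ ω, ContinuousOn (fun t => Y t ω) (Ici 0)) {t : ℝ} (ht : 0 ≤ t)
    (a : ℝ) : {ω | runSup Y t ω ≤ a} = ⋂ n, procBox Y (gridPts t n) fun _ => a := by
  ext ω
  rw [mem_ofPred_eq, runSup_le_iff (hc ω) ht]
  constructor
  · intro h
    exact mem_iInter.2 fun n s hs => h s (gridPts_subset ht n hs)
  · intro h s hs
    choose r hr hrs using fun n => exists_gridPts_near ht n hs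
    have hlim : Tendsto r atTop (nhds s) := by
      rw [tendsto_iff_dist_tendsto_zero]
      refine squeeze_zero (g := fun n : ℕ => t / 2 ^ n) (fun _ => dist_nonneg) (fun n => ?_)
        ((tendsto_const_nhds (x := t)).div_atTop (tendsto_pow_atTop_atTop_of_one_lt one_lt_two))
      rw [dist_comm, dist_eq]; exact hrs n
    have hlim' : Tendsto r atTop (nhdsWithin s (Ici 0)) :=
      tendsto_nhdsWithin_iff.2 ⟨hlim, .of_forall fun n => (gridPts_subset ht n (hr n)).1⟩
    have h1 := ((hc ω).abs s hs.1).tendsto.comp hlim'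
    exact le_of_tendsto h1 (.of_forall fun n => mem_iInter.1 h n (r n) (hr n))

end RunSup

/-- A continuous self-similar Gaussian process. -/
structure IsSelfSimGauss {Ω E : Type*} [MeasurableSpace Ω] [NormedAddCommGroup E]
    [InnerProductSpace ℝ E] (P : Measure Ω) (Y : ℝ → Ω → ℝ) (K : ℝ → E) (h : ℝ) : Prop where
  proc : IsGaussProcOn P Y K (Ici 0)
  cont : ∀ ω, ContinuousOn (fun t => Y t ω) (Ici 0)
  scaling : ∀ l > 0, ∀ (n : ℕ) (t c : Fin n → ℝ), (∀ i, 0 ≤ t i) →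
    ‖∑ i, c i • K (l * t i)‖ = l ^ h * ‖∑ i, c i • K (t i)‖

namespace IsSelfSimGauss

variable {Ω E : Type*} [MeasurableSpace Ω] [NormedAddCommGroup E]
    [InnerProductSpace ℝ E] {P : Measure Ω} {Y : ℝ → Ω → ℝ} {K : ℝ → E} {h : ℝ}

theorem grid_mem {t : ℝ} (ht : 0 ≤ t) (n : ℕ) : ∀ s ∈ gridPts t n, s ∈ Ici (0:ℝ) :=
  fun _ hs => (gridPts_subset ht n hs).1

theorem nullMeasurableSet (hY : IsSelfSimGauss P Y K h) {t : ℝ} (ht : 0 ≤ t) (a : ℝ) :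
    NullMeasurableSet {ω | runSup Y t ω ≤ a} P := by
  rw [setOf_runSup_le hY.cont ht]
  exact .iInter fun n => hY.proc.nullMeasurableSet_procBox (grid_mem ht n) _

theorem tendsto_procBox [IsFiniteMeasure P] (hY : IsSelfSimGauss P Y K h) {t : ℝ} (ht : 0 ≤ t)
    (a : ℝ) : Tendsto (fun n => P (procBox Y (gridPts t n) fun _ => a)) atTop
      (nhds (P {ω | runSup Y t ω ≤ a})) := by
  rw [setOf_runSup_le hY.cont ht]
  refine tendsto_measure_iInter_atTop (fun n => hY.proc.nullMeasurableSet_procBox (grid_mem ht n) _)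
    (fun n m hnm ω hω s hs => hω s (gridPts_mono t hnm hs)) ⟨0, measure_ne_top _ _⟩

theorem rescale (hY : IsSelfSimGauss P Y K h) {l : ℝ} (hl : 0 < l) :
    IsGaussProcOn P (fun t ω => (l ^ h)⁻¹ * Y (l * t) ω) K (Ici 0) where
  meas t ht := (hY.proc.meas _ (mul_nonneg hl.le ht : 0 ≤ l * t)).const_mul _
  law n t ht c := by
    have h1 := hY.proc.law n (fun i => l * t i) (fun i => (mul_nonneg hl.le (ht i) : 0 ≤ l * t i))
      (fun i => c i * (l ^ h)⁻¹)
    have h2 := hY.scaling l hl n t (fun i => c i * (l ^ h)⁻¹) ht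
    have hp : 0 < l ^ h := rpow_pos_of_pos hl _
    have h3 : ‖∑ i, (c i * (l ^ h)⁻¹) • K (l * t i)‖₊ = ‖∑ i, c i • K (t i)‖₊ := by
      ext
      rw [coe_nnnorm, coe_nnnorm, h2]
      have : ∑ i, (c i * (l ^ h)⁻¹) • K (t i) = (l ^ h)⁻¹ • ∑ i, c i • K (t i) := by
        rw [Finset.smul_sum]
        exact Finset.sum_congr rfl fun i _ => by rw [smul_smul, mul_comm]
      rw [this, norm_smul, norm_of_nonneg (by positivity)]
      field_simp
    rw [h3] at h1
    rw [← h1]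
    congr 1
    ext ω
    exact Finset.sum_congr rfl fun i _ => by ring

theorem measure_procBox_scale (hY : IsSelfSimGauss P Y K h) {l : ℝ} (hl : 0 < l) (n : ℕ) (a : ℝ) :
    P (procBox Y (gridPts l n) fun _ => a) = P (procBox Y (gridPts 1 n) fun _ => a / l ^ h) := by
  have hp : 0 < l ^ h := rpow_pos_of_pos hl _
  have hr := hY.rescale hl
  have e1 : procBox Y (gridPts l n) (fun _ => a) =
      procBox (fun t ω => (l ^ h)⁻¹ * Y (l * t) ω) (gridPts 1 n) fun _ => a / l ^ h := by
    ext ω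
    have key : ∀ x : ℝ, |(l ^ h)⁻¹ * x| ≤ a / l ^ h ↔ |x| ≤ a := fun x => by
      rw [abs_mul, abs_of_pos (inv_pos.2 hp), inv_mul_eq_div, div_le_div_iff_of_pos_right hp]
    simp only [procBox, mem_ofPred_eq, key, gridPts, Finset.mem_image]
    constructor
    · rintro hh _ ⟨i, hi, rfl⟩
      exact hh _ ⟨i, hi, by ring⟩
    · rintro hh _ ⟨i, hi, rfl⟩
      have := hh _ ⟨i, hi, rfl⟩
      rwa [one_mul] at this
  rw [e1, hr.measure_procBox (grid_mem zero_le_one n),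
    hY.proc.measure_procBox (grid_mem zero_le_one n)]
  congr 1
  exact (hr.isGaussLaw _ fun i => grid_mem zero_le_one n _ i.2).ext
    (hY.proc.isGaussLaw _ fun i => grid_mem zero_le_one n _ i.2) fun _ => rfl

theorem measure_runSup_le [IsFiniteMeasure P] (hY : IsSelfSimGauss P Y K h) {t : ℝ} (ht : 0 < t)
    (a : ℝ) : P {ω | runSup Y t ω ≤ a} = P {ω | runSup Y 1 ω ≤ a / t ^ h} := by
  refine tendsto_nhds_unique (hY.tendsto_procBox ht.le a) ?_
  simp_rw [hY.measure_procBox_scale ht]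
  exact hY.tendsto_procBox zero_le_one _

theorem measureReal_runSup_le [IsFiniteMeasure P] (hY : IsSelfSimGauss P Y K h) {t : ℝ} (ht : 0 < t)
    (a : ℝ) : P.real {ω | runSup Y t ω ≤ a} = smallBall P Y (a / t ^ h) := by
  rw [measureReal_def, hY.measure_runSup_le ht]; rfl

theorem concave [IsProbabilityMeasure P] (hY : IsSelfSimGauss P Y K h) (a b : ℝ) :
    smallBall P Y a * smallBall P Y b ≤ smallBall P Y ((a + b) / 2) ^ 2 := by
  have ht := fun a => (ENNReal.tendsto_toReal (measure_ne_top P _)).comp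
    (hY.tendsto_procBox zero_le_one a)
  refine le_of_tendsto_of_tendsto' ((ht a).mul (ht b)) ((ht ((a + b) / 2)).pow 2) fun n => ?_
  have h1 := hY.proc.sqrt_mul_sqrt_le (grid_mem zero_le_one n) a b
  rw [← ENNReal.mul_rpow_of_nonneg _ _ (by norm_num)] at h1
  have h2 := ENNReal.rpow_le_rpow h1 (show (0:ℝ) ≤ 2 by norm_num)
  rw [← ENNReal.rpow_mul, show (1 / 2 : ℝ) * 2 = 1 by norm_num, ENNReal.rpow_one,
    ENNReal.rpow_two] at h2
  have h3 := ENNReal.toReal_mono (by finiteness) h2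
  rwa [ENNReal.toReal_mul, ENNReal.toReal_pow] at h3

end IsSelfSimGauss

/-- Quantitative nondeterminism: `K t` has a component orthogonal to the past up to time `s`. -/
def IsNondetKernel {E : Type*} [NormedAddCommGroup E] [InnerProductSpace ℝ E] (K : ℝ → E) (h β : ℝ) : Prop :=
  ∃ c > 0, ∀ s ≥ 0, ∀ t > s, ∃ p q : E, K t = p + q ∧
    (∀ r, 0 ≤ r → r ≤ s → inner ℝ (K r) q = 0) ∧ inner ℝ p q = 0 ∧
    c * t ^ h * ((t - s) / t) ^ β ≤ ‖q‖

namespace IsSelfSimGauss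

variable {Ω E : Type*} [MeasurableSpace Ω] [NormedAddCommGroup E]
    [InnerProductSpace ℝ E] {P : Measure Ω} [IsProbabilityMeasure P] {Y : ℝ → Ω → ℝ} {K : ℝ → E}
    {h β : ℝ}

theorem measure_inter_le_pow (hY : IsSelfSimGauss P Y K h) {s t a b δ : ℝ} (hs : 0 ≤ s) (hst : s < t)
    (hb : 0 < b) {N : ℕ} (hδ : 0 < δ) (hN : s + N * δ ≤ t)
    (hq : ∀ k : ℕ, k < N → ∃ p q : E, K (s + (k + 1) * δ) = p + q ∧
      (∀ r, 0 ≤ r → r ≤ s + k * δ → inner ℝ (K r) q = 0) ∧ inner ℝ p q = 0 ∧ 2 * b ≤ ‖q‖) :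
    P ({ω | runSup Y s ω ≤ a} ∩ {ω | runSup Y t ω ≤ b}) ≤
      (1 / 2) ^ N * P {ω | runSup Y s ω ≤ a} := by
  classical
  let c : ℝ → ℝ := fun r => if r ≤ s then a else b
  have key : ∀ n k : ℕ, k ≤ N → ∃ F : Finset ℝ, (∀ r ∈ F, 0 ≤ r ∧ r ≤ s + k * δ) ∧
      (∀ r ∈ F, r ∈ gridPts s n ∨ s < r) ∧
      P (procBox Y F c) ≤ (1 / 2) ^ k * P (procBox Y (gridPts s n) fun _ => a) := by
    intro n k
    induction k with
    | zero =>
      intro _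
      refine ⟨gridPts s n, fun r hr => ?_, fun r hr => Or.inl hr, ?_⟩
      · have := gridPts_subset hs n hr
        exact ⟨this.1, by simpa using this.2⟩
      · rw [pow_zero, one_mul]
        refine measure_mono fun ω hω r hr => ?_
        have h1 := hω r hr
        simp only [c] at h1
        rwa [if_pos (gridPts_subset hs n hr).2] at h1
    | succ k ih =>
      intro hk
      obtain ⟨F, hF1, hF2, hF3⟩ := ih (by omega)
      obtain ⟨p, q, h1, h2, h3, h4⟩ := hq k (by omega)
      have hpos : 0 < ((k:ℝ) + 1) * δ := by positivity
      have hc : c (s + (k + 1) * δ) = b := if_neg (by linarith)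
      refine ⟨insert (s + (k + 1) * δ) F, ?_, ?_, ?_⟩
      · intro r hr
        push_cast
        rcases Finset.mem_insert.1 hr with rfl | hr
        · exact ⟨by linarith, le_rfl⟩
        · have := hF1 r hr
          exact ⟨this.1, by nlinarith⟩
      · intro r hr
        rcases Finset.mem_insert.1 hr with rfl | hr
        · exact Or.inr (by linarith)
        · exact hF2 r hr
      · have h5 := hY.proc.measure_insert_le (F := F) (fun r hr => (hF1 r hr).1)
          (i₀ := s + (k + 1) * δ) (by simp only [mem_Ici]; linarith) h1
          (fun j hj => h2 j (hF1 j hj).1 (hF1 j hj).2) h3 (c := c) (by rw [hc]; exact hb)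
          (by rw [hc]; exact h4)
        calc _ ≤ 1 / 2 * P (procBox Y F c) := h5
          _ ≤ 1 / 2 * ((1 / 2) ^ k * P (procBox Y (gridPts s n) fun _ => a)) := by gcongr
          _ = _ := by rw [pow_succ]; ring
  have hle : ∀ n, P ({ω | runSup Y s ω ≤ a} ∩ {ω | runSup Y t ω ≤ b}) ≤
      (1 / 2) ^ N * P (procBox Y (gridPts s n) fun _ => a) := by
    intro n
    obtain ⟨F, hF1, hF2, hF3⟩ := key n N le_rfl
    refine le_trans (measure_mono ?_) hF3
    rintro ω ⟨h1, h2⟩ r hr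
    rw [mem_ofPred_eq, runSup_le_iff (hY.cont ω) hs] at h1
    rw [mem_ofPred_eq, runSup_le_iff (hY.cont ω) (hs.trans hst.le)] at h2
    have h0 := hF1 r hr
    by_cases hrs : r ≤ s
    · simp only [c, if_pos hrs]
      exact h1 r ⟨h0.1, hrs⟩
    · simp only [c, if_neg hrs]
      exact h2 r ⟨h0.1, h0.2.trans hN⟩
  exact ge_of_tendsto' (ENNReal.Tendsto.const_mul (hY.tendsto_procBox hs a)
    (Or.inr (ENNReal.pow_ne_top (by norm_num)))) hle

theorem exists_decay (hY : IsSelfSimGauss P Y K h) (hK : IsNondetKernel K h β) (hβ : 0 < β) (hhβ : h ≤ β) :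
    ∃ c > 0, ∀ s ≥ 0, ∀ t > s, ∀ a, ∀ b > 0,
      P.real ({ω | runSup Y s ω ≤ a} ∩ {ω | runSup Y t ω ≤ b}) ≤
        2 * P.real {ω | runSup Y s ω ≤ a} *
          exp (-(c * (b / t ^ h) ^ (-(1 / β)) * ((t - s) / t))) := by
  obtain ⟨c, hc, hK⟩ := hK
  refine ⟨log 2 * (c / 2) ^ (1 / β), by have := log_pos one_lt_two; positivity,
    fun s hs t hst a b hb => ?_⟩
  have ht : 0 < t := hs.trans_lt hst
  have hts : 0 < t - s := sub_pos.2 hst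
  set x := (b / t ^ h) ^ (-(1 / β)) with hx
  have hx0 : 0 < x := by positivity
  set z := (c / 2) ^ (1 / β) * x * ((t - s) / t) with hz
  have hz0 : 0 < z := by positivity
  set N := ⌊z⌋₊ with hN
  have hNz : (N:ℝ) ≤ z := Nat.floor_le hz0.le
  have hzN : z < N + 1 := Nat.lt_floor_add_one z
  have hmain : P ({ω | runSup Y s ω ≤ a} ∩ {ω | runSup Y t ω ≤ b}) ≤
      (1 / 2) ^ N * P {ω | runSup Y s ω ≤ a} := by
    rcases Nat.eq_zero_or_pos N with h0 | h0
    · rw [h0, pow_zero, one_mul]; exact measure_mono inter_subset_left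
    · have hN0 : (0:ℝ) < N := by exact_mod_cast h0
      refine hY.measure_inter_le_pow (δ := (t - s) / N) hs hst hb (by positivity)
        (by rw [mul_div_cancel₀ _ hN0.ne']; linarith) fun k hk => ?_
      have hkN : (k:ℝ) + 1 ≤ N := by exact_mod_cast hk
      set δ := (t - s) / N with hδ
      have hδ0 : 0 < δ := by positivity
      have hNδ : N * δ = t - s := by rw [hδ]; field_simp
      set r := s + (k + 1) * δ with hr
      have hr0 : 0 < r := by positivity
      have hrt : r ≤ t := by nlinarith
      obtain ⟨p, q, h1, h2, h3, h4⟩ := hK (s + k * δ) (by positivity) r (by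
        rw [hr]; nlinarith)
      refine ⟨p, q, h1, h2, h3, le_trans ?_ h4⟩
      rw [show r - (s + k * δ) = δ by rw [hr]; ring, div_rpow hδ0.le hr0.le]
      have e1 : c * t ^ h * (δ ^ β / t ^ β) ≤ c * r ^ h * (δ ^ β / r ^ β) := by
        have : t ^ h / t ^ β ≤ r ^ h / r ^ β := by
          rw [← rpow_sub ht, ← rpow_sub hr0]
          exact rpow_le_rpow_of_nonpos hr0 hrt (by linarith)
        calc c * t ^ h * (δ ^ β / t ^ β) = c * δ ^ β * (t ^ h / t ^ β) := by ring
          _ ≤ c * δ ^ β * (r ^ h / r ^ β) := by gcongr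
          _ = _ := by ring
      refine le_trans ?_ e1
      have e2 : N ^ β ≤ z ^ β := rpow_le_rpow hN0.le hNz hβ.le
      have e3 : z ^ β = (c / 2) * (b / t ^ h)⁻¹ * ((t - s) / t) ^ β := by
        rw [hz, mul_rpow (by positivity) (by positivity), mul_rpow (by positivity) (by positivity),
          hx, ← rpow_mul (by positivity), ← rpow_mul (by positivity),
          show 1 / β * β = 1 by field_simp, show -(1 / β) * β = -1 by field_simp, rpow_one,
          rpow_neg_one]
      rw [e3, div_rpow hts.le ht.le] at e2
      rw [hδ, div_rpow hts.le hN0.le]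
      have hth : 0 < t ^ h := by positivity
      have htβ : 0 < t ^ β := by positivity
      have hNβ : 0 < (N:ℝ) ^ β := by positivity
      have hsβ : 0 < (t - s) ^ β := by positivity
      rw [inv_div] at e2
      have e4 : 2 * b * (N:ℝ) ^ β ≤ c * t ^ h * ((t - s) ^ β / t ^ β) := by
        calc 2 * b * (N:ℝ) ^ β ≤ 2 * b * (c / 2 * (t ^ h / b) * ((t - s) ^ β / t ^ β)) := by gcongr
          _ = _ := by field_simp
      calc 2 * b = 2 * b * (N:ℝ) ^ β / (N:ℝ) ^ β := by field_simp
        _ ≤ c * t ^ h * ((t - s) ^ β / t ^ β) / (N:ℝ) ^ β := by gcongr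
        _ = _ := by ring
  have h1 := ENNReal.toReal_mono (by finiteness) hmain
  rw [ENNReal.toReal_mul, ENNReal.toReal_pow] at h1
  have h2 : ((1 / 2 : ENNReal).toReal) ^ N ≤ 2 * exp (-(log 2 * z)) := by
    rw [show (1 / 2 : ENNReal).toReal = 1 / 2 by simp]
    have : (1 / 2 : ℝ) ^ N = 2 * exp (-(log 2 * (N + 1))) := by
      rw [show -(log 2 * ((N:ℝ) + 1)) = -(log 2) * (N + 1 : ℕ) by push_cast; ring, exp_mul,
        rpow_natCast, exp_neg, exp_log two_pos, pow_succ]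
      simp
      ring
    rw [this]
    have := log_pos one_lt_two
    gcongr
  calc P.real _ ≤ _ := h1
    _ ≤ 2 * exp (-(log 2 * z)) * P.real {ω | runSup Y s ω ≤ a} :=
        mul_le_mul_of_nonneg_right h2 measureReal_nonneg
    _ = _ := by rw [hz]; ring_nf

end IsSelfSimGauss

/-- A log-concave function with a stretched exponential lower bound at zero changes by bounded
factors under small shifts. -/
theorem exists_shift_le_of_concave {φ : ℝ → ℝ} {β : ℝ} (hβ : 0 < β) (hmono : Monotone φ)
    (h1 : ∀ a, φ a ≤ 1) (hconc : ∀ a > 0, ∀ b > 0, φ a * φ b ≤ φ ((a + b) / 2) ^ 2) {C : ℝ}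
    (hC : 0 < C) (hlow : ∀ ε ∈ Ioc (0:ℝ) 1, exp (-(C * ε ^ (-(1 / β)))) ≤ φ ε) {D : ℝ} (hD : 0 < D) :
    ∃ k > 0, ∀ u ∈ Ioc (0:ℝ) 1, φ (u + D * u ^ (1 + 1 / β)) ≤ k * φ u := by
  have hpos : ∀ a > 0, 0 < φ a := fun a ha =>
    ((exp_pos _).trans_le (hlow (min a 1) ⟨lt_min ha one_pos, min_le_right _ _⟩)).trans_le
      (hmono (min_le_left _ _))
  set R := 4 * D * (C * 2 ^ (1 / β)) with hR
  have hR0 : 0 < R := by positivity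
  refine ⟨exp R, by positivity, fun u hu => ?_⟩
  have hu0 := hu.1
  set x := u ^ (-(1 / β)) with hx
  have hx1 : 1 ≤ x := one_le_rpow_of_pos_of_le_one_of_nonpos hu.1 hu.2 (by
    have : 0 < 1 / β := by positivity
    linarith)
  have hx0 : 0 < x := by linarith
  set d := D * u ^ (1 + 1 / β) with hd
  have hdx : d * x = D * u := by
    rw [hd, hx, mul_assoc, ← rpow_add hu0]
    simp
  have hd0 : 0 < d := by positivity
  have hu2 : exp (-(C * 2 ^ (1 / β) * x)) ≤ φ (u / 2) := by
    have := hlow (u / 2) ⟨by positivity, by linarith [hu.2]⟩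
    rw [div_rpow hu0.le two_pos.le, ← hx, rpow_neg two_pos.le, div_inv_eq_mul] at this
    refine le_trans (le_of_eq ?_) this
    ring_nf
  rcases lt_or_ge x (2 * D) with hxD | hxD
  · refine (h1 _).trans ?_
    have h3 : exp (-R) ≤ φ u := by
      refine le_trans ?_ (hu2.trans (hmono (by linarith)))
      refine exp_le_exp.2 (neg_le_neg ?_)
      rw [hR, mul_comm]
      refine mul_le_mul_of_nonneg_right ?_ (by positivity)
      linarith
    calc (1:ℝ) = exp R * exp (-R) := by rw [← exp_add]; simp
      _ ≤ _ := by gcongr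
  set N := ⌊x / (2 * D)⌋₊ with hN
  have hN1 : (N:ℝ) ≤ x / (2 * D) := Nat.floor_le (by positivity)
  have hN2 : x / (4 * D) ≤ N := by
    have h3 : x / (2 * D) < N + 1 := Nat.lt_floor_add_one _
    have h4 : 1 ≤ (N:ℝ) := by
      have : 1 ≤ N := (Nat.one_le_floor_iff _).2 (by rw [le_div_iff₀ (by positivity)]; linarith)
      exact_mod_cast this
    have h5 : x / (2 * D) = 2 * (x / (4 * D)) := by field_simp; ring
    linarith
  have hNd : N * d ≤ u / 2 := by
    calc N * d ≤ x / (2 * D) * d := by gcongr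
      _ = (d * x) / (2 * D) := by ring
      _ = u / 2 := by rw [hdx]; field_simp
  let g : ℕ → ℝ := fun j => φ (u + d - j * d)
  have hge : ∀ j ≤ N, u / 2 ≤ u + d - (j + 1 : ℕ) * d := by
    intro j hj
    have : (j:ℝ) * d ≤ N * d := mul_le_mul_of_nonneg_right (by exact_mod_cast hj) hd0.le
    push_cast
    linarith
  have hge' : ∀ j ≤ N + 1, 0 < u + d - j * d := by
    intro j hj
    rcases j with _ | j
    · simp; positivity
    · linarith [hge j (by omega)]
  have hg : ∀ j ≤ N + 1, 0 < g j := fun j hj => hpos _ (hge' j hj)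
  have hst : ∀ j ≤ N, g 0 * g (j + 1) ≤ g 1 * g j := by
    intro j
    induction j with
    | zero => intro _; exact (mul_comm _ _).le
    | succ j ih =>
      intro hj
      have h3 := ih (by omega)
      have h4 := hconc _ (hge' j (by omega)) _ (hge' (j + 2) (by omega))
      rw [show (u + d - (j:ℝ) * d + (u + d - ((j + 2 : ℕ):ℝ) * d)) / 2 =
        u + d - ((j + 1 : ℕ):ℝ) * d by push_cast; ring] at h4
      change g j * g (j + 2) ≤ g (j + 1) ^ 2 at h4
      have hj0 := hg j (by omega)
      refine le_of_mul_le_mul_left ?_ hj0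
      calc g j * (g 0 * g (j + 2)) = g 0 * (g j * g (j + 2)) := by ring
        _ ≤ g 0 * g (j + 1) ^ 2 := mul_le_mul_of_nonneg_left h4 (hg 0 (by omega)).le
        _ = (g 0 * g (j + 1)) * g (j + 1) := by ring
        _ ≤ (g 1 * g j) * g (j + 1) := mul_le_mul_of_nonneg_right h3 (hg _ (by omega)).le
        _ = _ := by ring
  have hg0 := hg 0 (by omega)
  have hg1 := hg 1 (by omega)
  have hpow : ∀ j ≤ N, g 0 ^ j * g (j + 1) ≤ g 1 ^ j * g 1 := by
    intro j
    induction j with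
    | zero => simp
    | succ j ih =>
      intro hj
      calc g 0 ^ (j + 1) * g (j + 1 + 1) = g 0 ^ j * (g 0 * g (j + 1 + 1)) := by ring
        _ ≤ g 0 ^ j * (g 1 * g (j + 1)) := mul_le_mul_of_nonneg_left (hst _ hj) (by positivity)
        _ = g 1 * (g 0 ^ j * g (j + 1)) := by ring
        _ ≤ g 1 * (g 1 ^ j * g 1) := mul_le_mul_of_nonneg_left (ih (by omega)) hg1.le
        _ = _ := by ring
  have hfin := hpow N le_rfl
  have hgN : exp (-(C * 2 ^ (1 / β) * x)) ≤ g (N + 1) := hu2.trans (hmono (hge N le_rfl))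
  have e0 : g 0 = φ (u + d) := by simp [g]
  have e1 : g 1 = φ u := by simp [g]
  rw [← e0, ← e1]
  have hg11 : g 1 ≤ 1 := h1 _
  have hlog : N * log (g 0) - C * 2 ^ (1 / β) * x ≤ N * log (g 1) := by
    have h3 : g 0 ^ N * exp (-(C * 2 ^ (1 / β) * x)) ≤ g 1 ^ N := by
      calc _ ≤ g 0 ^ N * g (N + 1) := by gcongr
        _ ≤ g 1 ^ N * g 1 := hfin
        _ ≤ g 1 ^ N * 1 := by gcongr
        _ = _ := mul_one _
    have h4 := log_le_log (by positivity) h3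
    rw [log_mul (by positivity) (by positivity), log_pow, log_pow, log_exp] at h4
    linarith
  rw [← log_le_log_iff hg0 (by positivity), log_mul (by positivity) hg1.ne', log_exp]
  by_contra hcon
  push Not at hcon
  have hRN : C * 2 ^ (1 / β) * x ≤ N * R := by
    calc C * 2 ^ (1 / β) * x = x / (4 * D) * R := by rw [hR]; field_simp
      _ ≤ _ := by gcongr
  have hN0 : (0:ℝ) < N := lt_of_lt_of_le (by positivity) hN2
  nlinarith

section

variable {Ω E : Type*} [MeasurableSpace Ω] [NormedAddCommGroup E]
    [InnerProductSpace ℝ E] {P : Measure Ω} {Y : ℝ → Ω → ℝ} {K : ℝ → E} {h β : ℝ}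

/-- The kernel splits orthogonally at every scale `L`, with small remainders. -/
def HasKernelTails (K : ℝ → E) (h : ℝ) : Prop :=
  ∃ κ > (0:ℝ), ∃ C > (0:ℝ), ∀ L > 0, ∃ a b : ℝ → E, (∀ r ≥ 0, K r = a r + b r) ∧
    (∀ r ≥ 0, ∀ s ≥ 0, inner ℝ (a r) (b s) = 0) ∧
    (∀ r s, 0 ≤ r → r ≤ s → s ≤ L → ‖b r‖ ^ 2 ≤ C * s ^ (2 * h) * (s / L) ^ κ) ∧
    (∀ r s, 0 ≤ r → r ≤ s → L ≤ s → ‖a r‖ ^ 2 ≤ C * s ^ (2 * h) * (L / s) ^ κ)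

/-- A weak-type estimate for the modulus of continuity. -/
def HasModulus (P : Measure Ω) (Y : ℝ → Ω → ℝ) (h : ℝ) : Prop :=
  ∃ C > (0:ℝ), ∃ δ > (0:ℝ), ∀ t > 0, ∀ l > 0,
    P {ω | ∃ s ∈ Icc 0 t, ∃ r ∈ Icc 0 t, l * t ^ h * (|s - r| / t) ^ δ < |Y s ω - Y r ω|} ≤
      ENNReal.ofReal (C / l)

namespace IsSelfSimGauss

theorem measure_procBox_grid_le [IsProbabilityMeasure P] (hY : IsSelfSimGauss P Y K h)
    {C δ : ℝ} (hδ : 0 < δ)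
    (hmod : ∀ t > 0, ∀ l > 0,
      P {ω | ∃ s ∈ Icc 0 t, ∃ r ∈ Icc 0 t, l * t ^ h * (|s - r| / t) ^ δ < |Y s ω - Y r ω|} ≤
      ENNReal.ofReal (C / l)) {t l : ℝ} (ht : 0 < t) (hl : 0 < l) (n : ℕ) (c : ℝ) :
    P (procBox Y (gridPts t n) fun _ => c) ≤
      P {ω | runSup Y t ω ≤ c + l * t ^ h * (1 / 2 ^ n) ^ δ} + ENNReal.ofReal (C / l) := by
  refine le_trans (measure_mono ?_) ((measure_union_le _ _).trans (add_le_add le_rfl (hmod t ht l hl)))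
  intro ω hω
  by_cases hm : ∃ s ∈ Icc 0 t, ∃ r ∈ Icc 0 t, l * t ^ h * (|s - r| / t) ^ δ < |Y s ω - Y r ω|
  · exact Or.inr hm
  · left
    push Not at hm
    rw [mem_ofPred_eq, runSup_le_iff (hY.cont ω) ht.le]
    intro s hs
    obtain ⟨r, hr, hsr⟩ := exists_gridPts_near ht.le n hs
    have h1 := hm s hs r (gridPts_subset ht.le n hr)
    have h2 := hω r hr
    have h3 : (|s - r| / t) ^ δ ≤ (1 / 2 ^ n) ^ δ := by
      refine rpow_le_rpow (by positivity) ?_ hδ.le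
      rw [div_le_iff₀ ht]
      calc _ ≤ _ := hsr
        _ = _ := by ring
    have h4 : l * t ^ h * (|s - r| / t) ^ δ ≤ l * t ^ h * (1 / 2 ^ n) ^ δ := by gcongr
    have h5 : |Y s ω| ≤ |Y r ω| + |Y s ω - Y r ω| := by
      have := abs_add_le (Y r ω) (Y s ω - Y r ω)
      simpa using this
    linarith

theorem smallBall_mono [IsProbabilityMeasure P] : Monotone (smallBall P Y) := fun a b hab =>
  ENNReal.toReal_mono (measure_ne_top _ _)
    (measure_mono fun ω (hω : runSup Y 1 ω ≤ a) => hω.trans hab)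

theorem smallBall_le_one [IsProbabilityMeasure P] (a : ℝ) : smallBall P Y a ≤ 1 :=
  measureReal_le_one

theorem measure_runSup_eq [IsProbabilityMeasure P] (hY : IsSelfSimGauss P Y K h) {t : ℝ}
    (ht : 0 < t) (a : ℝ) :
    P {ω | runSup Y t ω ≤ a} = ENNReal.ofReal (smallBall P Y (a / t ^ h)) := by
  rw [← hY.measureReal_runSup_le ht, ofReal_measureReal]

theorem exists_decouple [IsProbabilityMeasure P] (hY : IsSelfSimGauss P Y K h)
    (htail : HasKernelTails K h) (hmod : HasModulus P Y h) (hβ : 0 < β) {C₀ : ℝ} (hC₀ : 0 < C₀)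
    (hlow : ∀ ε ∈ Ioc (0:ℝ) 1, exp (-(C₀ * ε ^ (-(1 / β)))) ≤ smallBall P Y ε) :
    ∃ k > 0, ∃ C > 0, ∀ s > 0, ∀ t > s, ∀ a > 0, ∀ b > 0, a / s ^ h ≤ 1 → b / t ^ h ≤ 1 →
      C * ((a / s ^ h) ^ (-(1 / β)) + (b / t ^ h) ^ (-(1 / β))) ≤ log (t / s) →
      P.real ({ω | runSup Y s ω ≤ a} ∩ {ω | runSup Y t ω ≤ b}) ≤
        k * smallBall P Y (a / s ^ h) * smallBall P Y (b / t ^ h) := by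
  classical
  obtain ⟨κ, hκ, C₁, hC₁, htail⟩ := htail
  obtain ⟨C₂, hC₂, δ, hδ, hmod⟩ := hmod
  obtain ⟨k, hk, hshift⟩ := exists_shift_le_of_concave hβ (smallBall_mono (P := P) (Y := Y))
    smallBall_le_one (fun a _ b _ => hY.concave a b) hC₀ hlow (D := 3) (by norm_num)
  set B := β + 1 with hB
  set A := (C₀ + B) / δ with hA
  have hB0 : 0 < B := by positivity
  have hA0 : 0 < A := by positivity
  set C := 2 / κ * (A + 2 * B + C₀) with hC
  refine ⟨(k + C₂ + 3 * C₁) * (k + C₂ + 3 * C₁) + 6 * C₁, by positivity, C, by positivity,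
    fun s hs t hst a ha b hb hu hv hlog => ?_⟩
  have ht : 0 < t := hs.trans hst
  have hsh : 0 < s ^ h := by positivity
  have hth : 0 < t ^ h := by positivity
  set u := a / s ^ h with hu'
  set v := b / t ^ h with hv'
  have hu0 : 0 < u := by positivity
  have hv0 : 0 < v := by positivity
  set φ := smallBall P Y with hφ
  have hβi : -(1 / β) ≤ 0 := by
    have : 0 < 1 / β := by positivity
    linarith
  have hx1 : 1 ≤ u ^ (-(1 / β)) := one_le_rpow_of_pos_of_le_one_of_nonpos hu0 hu hβi
  have hy1 : 1 ≤ v ^ (-(1 / β)) := one_le_rpow_of_pos_of_le_one_of_nonpos hv0 hv hβi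
  set z := u ^ (-(1 / β)) + v ^ (-(1 / β)) with hz
  have hz0 : 0 < z := by positivity
  have hφu : 0 < φ u := (exp_pos _).trans_le (hlow u ⟨hu0, hu⟩)
  have hφv : 0 < φ v := (exp_pos _).trans_le (hlow v ⟨hv0, hv⟩)
  set η := exp (-(C₀ * z)) with hη
  have hη0 : 0 < η := exp_pos _
  have hηφ : η ≤ φ u * φ v := by
    calc η = exp (-(C₀ * u ^ (-(1 / β)))) * exp (-(C₀ * v ^ (-(1 / β)))) := by
          rw [← exp_add, hη, hz]; ring_nf
      _ ≤ _ := mul_le_mul (hlow u ⟨hu0, hu⟩) (hlow v ⟨hv0, hv⟩) (exp_pos _).le hφu.le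
  have hηu : η ≤ φ u := hηφ.trans (mul_le_of_le_one_right hφu.le (smallBall_le_one _))
  have hηv : η ≤ φ v := hηφ.trans (mul_le_of_le_one_left hφv.le (smallBall_le_one _))
  -- the grid
  have hl2 := log_pos one_lt_two
  set n := ⌈A * z / log 2⌉₊ with hn
  have hn1 : exp (A * z) ≤ 2 ^ n := by
    have h1 : A * z / log 2 ≤ n := Nat.le_ceil _
    rw [div_le_iff₀ hl2] at h1
    calc exp (A * z) ≤ exp (n * log 2) := exp_le_exp.2 h1
      _ = 2 ^ n := by rw [mul_comm, exp_mul, exp_log two_pos, rpow_natCast]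
  have hn2 : (2:ℝ) ^ n ≤ 2 * exp (A * z) := by
    have h1 : (n:ℝ) < A * z / log 2 + 1 := Nat.ceil_lt_add_one (by positivity)
    have h2 : (n:ℝ) * log 2 ≤ log 2 + A * z := by
      have : (n:ℝ) * log 2 ≤ (A * z / log 2 + 1) * log 2 := by gcongr
      have e : (A * z / log 2 + 1) * log 2 = log 2 + A * z := by field_simp; ring
      linarith
    calc (2:ℝ) ^ n = exp (n * log 2) := by rw [mul_comm, exp_mul, exp_log two_pos, rpow_natCast]
      _ ≤ exp (log 2 + A * z) := exp_le_exp.2 h2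
      _ = _ := by rw [exp_add, exp_log two_pos]
  have hn3 : (2:ℝ) ^ n + 1 ≤ 3 * exp (A * z) := by
    have : 1 ≤ exp (A * z) := one_le_exp (by positivity)
    linarith
  -- the shift
  set ζ := exp (-(B * z)) with hζ
  have hζ0 : 0 < ζ := exp_pos _
  have hgrid : ∀ r > 0, ∀ w ∈ Ioc (0:ℝ) 1, w ^ (-(1 / β)) ≤ z → η ≤ φ w →
      P (procBox Y (gridPts r n) fun _ => w * r ^ h + 2 * (ζ * r ^ h)) ≤
        ENNReal.ofReal ((k + C₂) * φ w) := by
    intro r hr w hw hwz hηw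
    have hrh : 0 < r ^ h := by positivity
    refine (hY.measure_procBox_grid_le hδ hmod hr (exp_pos (C₀ * z)) n _).trans ?_
    rw [hY.measure_runSup_eq hr, ← ENNReal.ofReal_add (show 0 ≤ smallBall P Y _ from ENNReal.toReal_nonneg) (by positivity)]
    refine ENNReal.ofReal_le_ofReal ?_
    rw [add_mul]
    refine add_le_add ?_ ?_
    · refine le_trans (smallBall_mono ?_) (hshift w hw)
      have h1 : exp (C₀ * z) * (1 / 2 ^ n) ^ δ ≤ ζ := by
        have : ((1:ℝ) / 2 ^ n) ^ δ ≤ exp (-(A * z)) ^ δ := by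
          refine rpow_le_rpow (by positivity) ?_ hδ.le
          rw [exp_neg, ← one_div]
          exact one_div_le_one_div_of_le (exp_pos _) hn1
        calc _ ≤ exp (C₀ * z) * exp (-(A * z)) ^ δ := by gcongr
          _ = ζ := by
            rw [← exp_mul, ← exp_add, hζ, hA]
            congr 1
            field_simp
            ring
      have h2 : ζ ≤ w ^ (1 + 1 / β) := by
        have h3 : exp (-z) ≤ w ^ (1 / β) := by
          rw [exp_neg, inv_le_comm₀ (exp_pos _) (rpow_pos_of_pos hw.1 _), ← rpow_neg hw.1.le]
          linarith [add_one_le_exp z]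
        calc ζ = exp (-z) ^ B := by rw [← exp_mul, hζ]; ring_nf
          _ ≤ (w ^ (1 / β)) ^ B := rpow_le_rpow (exp_pos _).le h3 hB0.le
          _ = _ := by
            rw [← rpow_mul hw.1.le, hB]
            congr 1
            field_simp
      rw [div_le_iff₀ hrh]
      calc w * r ^ h + 2 * (ζ * r ^ h) + exp (C₀ * z) * r ^ h * (1 / 2 ^ n) ^ δ
          = (w + 2 * ζ + exp (C₀ * z) * (1 / 2 ^ n) ^ δ) * r ^ h := by ring
        _ ≤ (w + 2 * w ^ (1 + 1 / β) + w ^ (1 + 1 / β)) * r ^ h :=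
          mul_le_mul_of_nonneg_right (by linarith) hrh.le
        _ = _ := by ring
    · rw [div_eq_mul_inv, ← exp_neg]
      exact mul_le_mul_of_nonneg_left hηw hC₂.le
  -- the decoupling
  set L := √(s * t) with hL
  have hL0 : 0 < L := sqrt_pos.2 (by positivity)
  have hLs : s ≤ L := le_sqrt_of_sq_le (by nlinarith)
  have hLt : L ≤ t := (sqrt_le_left ht.le).2 (by nlinarith)
  have hrat : (s / t) ^ (κ / 2) ≤ exp (-((A + 2 * B + C₀) * z)) := by
    rw [← exp_log (div_pos hs ht), ← exp_mul]
    refine exp_le_exp.2 ?_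
    have h1 : log (s / t) = -log (t / s) := by rw [← log_inv, inv_div]
    rw [h1]
    have h2 : κ / 2 * (C * z) ≤ κ / 2 * log (t / s) := by gcongr
    have h3 : κ / 2 * (C * z) = (A + 2 * B + C₀) * z := by rw [hC]; field_simp
    linarith
  have hsL : (s / L) ^ κ = (s / t) ^ (κ / 2) := by
    rw [show s / t = (s / L) ^ (2:ℝ) by
      rw [rpow_two, div_pow, hL, sq_sqrt (by positivity)]; field_simp, ← rpow_mul (by positivity)]
    congr 1; ring
  have hLt' : (L / t) ^ κ = (s / t) ^ (κ / 2) := by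
    rw [show s / t = (L / t) ^ (2:ℝ) by
      rw [rpow_two, div_pow, hL, sq_sqrt (by positivity)]; field_simp, ← rpow_mul (by positivity)]
    congr 1; ring
  obtain ⟨p, q, hpq, horth, hq, hp⟩ := htail L hL0
  have hsum : ∀ r > 0, ∀ f : ℝ → E, (∀ i ∈ gridPts r n, ‖f i‖ ^ 2 ≤
      C₁ * r ^ (2 * h) * (s / t) ^ (κ / 2)) →
      ∑ i ∈ gridPts r n, ‖f i‖ ^ 2 / (ζ * r ^ h) ^ 2 ≤ 3 * C₁ * η := by
    intro r hr f hf
    have hrh : 0 < r ^ h := by positivity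
    have hcard : ((gridPts r n).card : ℝ) ≤ 2 ^ n + 1 := by
      have : (gridPts r n).card ≤ 2 ^ n + 1 := by
        refine Finset.card_image_le.trans ?_
        simp
      exact_mod_cast this
    have h1 : ∀ i ∈ gridPts r n, ‖f i‖ ^ 2 / (ζ * r ^ h) ^ 2 ≤
        C₁ * exp (-((A + C₀) * z)) := by
      intro i hi
      rw [div_le_iff₀ (by positivity)]
      refine (hf i hi).trans ?_
      have e1 : r ^ (2 * h) = (r ^ h) ^ 2 := by rw [two_mul, rpow_add hr, sq]
      have e2 : exp (-((A + 2 * B + C₀) * z)) = exp (-((A + C₀) * z)) * ζ ^ 2 := by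
        rw [hζ, sq, ← exp_add, ← exp_add]; ring_nf
      calc _ ≤ C₁ * r ^ (2 * h) * exp (-((A + 2 * B + C₀) * z)) := by gcongr
        _ = _ := by rw [e1, e2]; ring
    calc _ ≤ ∑ i ∈ gridPts r n, C₁ * exp (-((A + C₀) * z)) := Finset.sum_le_sum h1
      _ = (gridPts r n).card * (C₁ * exp (-((A + C₀) * z))) := by rw [Finset.sum_const, nsmul_eq_mul]
      _ ≤ (3 * exp (A * z)) * (C₁ * exp (-((A + C₀) * z))) := by
          gcongr; exact hcard.trans hn3
      _ = 3 * C₁ * (exp (A * z) * exp (-((A + C₀) * z))) := by ring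
      _ = _ := by rw [← exp_add, hη]; ring_nf
  have hmain := hY.proc.measure_inter_le (a := p) (b := q) hpq horth
    (F := gridPts s n) (F' := gridPts t n) (grid_mem hs.le n) (grid_mem ht.le n)
    (c := a) (c' := b) (d := ζ * s ^ h) (d' := ζ * t ^ h) (by positivity) (by positivity)
    (hsum s hs q fun i hi => by
      have := gridPts_subset hs.le n hi
      rw [← hsL]
      exact hq i s this.1 this.2 hLs)
    (hsum t ht p fun i hi => by
      have := gridPts_subset ht.le n hi
      rw [← hLt']
      exact hp i t this.1 this.2 hLt)
  have ea : a = u * s ^ h := by rw [hu']; field_simp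
  have eb : b = v * t ^ h := by rw [hv']; field_simp
  have hincl : ({ω | runSup Y s ω ≤ a} ∩ {ω | runSup Y t ω ≤ b}) ⊆
      procBox Y (gridPts s n) (fun _ => a) ∩ procBox Y (gridPts t n) fun _ => b := by
    rintro ω ⟨h1, h2⟩
    exact ⟨fun r hr => (abs_le_runSup (hY.cont ω) (gridPts_subset hs.le n hr)).trans h1,
      fun r hr => (abs_le_runSup (hY.cont ω) (gridPts_subset ht.le n hr)).trans h2⟩
  have hg1 := hgrid s hs u ⟨hu0, hu⟩ (by linarith) hηu
  have hg2 := hgrid t ht v ⟨hv0, hv⟩ (by linarith) hηv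
  rw [← ea] at hg1
  rw [← eb] at hg2
  refine ENNReal.toReal_le_of_le_ofReal (by positivity) ?_
  refine (measure_mono hincl).trans (hmain.trans ?_)
  have k1 : P (procBox Y (gridPts s n) fun _ => a + 2 * (ζ * s ^ h)) +
      ENNReal.ofReal (3 * C₁ * η) ≤ ENNReal.ofReal ((k + C₂ + 3 * C₁) * φ u) := by
    refine (add_le_add hg1 le_rfl).trans ?_
    rw [← ENNReal.ofReal_add (by positivity) (by positivity)]
    refine ENNReal.ofReal_le_ofReal ?_
    have : 3 * C₁ * η ≤ 3 * C₁ * φ u := by gcongr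
    linarith
  have k2 : P (procBox Y (gridPts t n) fun _ => b + 2 * (ζ * t ^ h)) +
      ENNReal.ofReal (3 * C₁ * η) ≤ ENNReal.ofReal ((k + C₂ + 3 * C₁) * φ v) := by
    refine (add_le_add hg2 le_rfl).trans ?_
    rw [← ENNReal.ofReal_add (by positivity) (by positivity)]
    refine ENNReal.ofReal_le_ofReal ?_
    have : 3 * C₁ * η ≤ 3 * C₁ * φ v := by gcongr
    linarith
  refine (add_le_add (mul_le_mul' k1 k2) le_rfl).trans ?_
  rw [← ENNReal.ofReal_mul (by positivity), ← ENNReal.ofReal_add (by positivity) (by positivity),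
    ← ENNReal.ofReal_add (by positivity) (by positivity)]
  refine ENNReal.ofReal_le_ofReal ?_
  have : 6 * C₁ * η ≤ 6 * C₁ * (φ u * φ v) := by gcongr
  linarith

end IsSelfSimGauss

end

theorem gaussianReal_one_Icc_le {v : NNReal} {σ a : ℝ} (hσ : 0 < σ) (hv : (v:ℝ) ≤ σ ^ 2) (ha : 0 < a) :
    gaussianReal 0 1 (Icc (-(a / σ)) (a / σ)) ≤ gaussianReal 0 v (Icc (-a) a) := by
  have h1 := gaussianReal_map_const_mul (μ := 0) (v := 1) (√(v:ℝ))
  have h2 : (NNReal.mk (√(v:ℝ) ^ 2) (sq_nonneg _)) * 1 = v := by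
    ext; simp
  rw [h2, mul_zero] at h1
  rw [← h1, Measure.map_apply (by fun_prop) measurableSet_Icc]
  refine measure_mono fun x hx => ?_
  have hs : √(v:ℝ) ≤ σ := by
    rw [← sqrt_sq hσ.le]; exact sqrt_le_sqrt hv
  have hx' : |x| ≤ a / σ := abs_le.2 hx
  rw [le_div_iff₀ hσ] at hx'
  rw [mem_preimage, mem_Icc, ← abs_le, abs_mul, abs_of_nonneg (sqrt_nonneg _)]
  calc √(v:ℝ) * |x| ≤ σ * |x| := by gcongr
    _ ≤ a := by linarith

theorem ofReal_mul_le_gaussianReal_one_Icc {r : ℝ} (hr : 0 < r) (hr2 : r ≤ 2) :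
    ENNReal.ofReal (r * gaussianPDFReal 0 1 1) ≤ gaussianReal 0 1 (Icc (-r) r) := by
  refine le_trans ?_ (measure_mono (Icc_subset_Icc (show -r ≤ -(r / 2) by linarith)
    (show r / 2 ≤ r by linarith)))
  rw [gaussianReal_apply _ one_ne_zero]
  have hp := gaussianPDFReal_nonneg 0 1 1
  have h1 : ∀ x ∈ Icc (-(r / 2)) (r / 2),
      ENNReal.ofReal (gaussianPDFReal 0 1 1) ≤ gaussianPDF 0 1 x := by
    intro x hx
    rw [gaussianPDF_def]
    refine ENNReal.ofReal_le_ofReal ?_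
    simp only [gaussianPDFReal]
    have hx1 : |x| ≤ 1 := (abs_le.2 hx).trans (by linarith)
    have : x ^ 2 ≤ 1 := by rw [← sq_abs]; nlinarith [abs_nonneg x]
    refine mul_le_mul_of_nonneg_left (exp_le_exp.2 ?_) (by positivity)
    simp only [sub_zero, NNReal.coe_one]
    linarith
  calc _ = ∫⁻ _ in Icc (-(r / 2)) (r / 2), ENNReal.ofReal (gaussianPDFReal 0 1 1) := by
        rw [setLIntegral_const, Real.volume_Icc, ← ENNReal.ofReal_mul hp]
        congr 1; ring
    _ ≤ _ := setLIntegral_mono (measurable_gaussianPDF 0 1) h1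

theorem exists_gaussianReal_one_compl_le {p : ℝ} (hp : 0 < p) :
    ∃ C > 0, ∀ r > 0, gaussianReal 0 1 (Icc (-r) r)ᶜ ≤ ENNReal.ofReal (C * r ^ (-p)) := by
  set m := ∫⁻ x, ENNReal.ofReal (|x| ^ p) ∂gaussianReal 0 1 with hm
  have hmt : m ≠ ⊤ := by
    have h1 := (memLp_id_gaussianReal' (μ := 0) (v := 1) (ENNReal.ofReal p) ENNReal.ofReal_ne_top)
    have h2 := h1.integrable_norm_rpow (by simpa using hp) (by simp)
    have h3 := h2.lintegral_lt_top
    simp only [id_eq, norm_eq_abs, ENNReal.toReal_ofReal hp.le] at h3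
    exact h3.ne
  refine ⟨m.toReal + 1, by have := ENNReal.toReal_nonneg (a := m); linarith, fun r hr => ?_⟩
  have hrp : 0 < r ^ p := by positivity
  have h1 := mul_meas_ge_le_lintegral (μ := gaussianReal 0 1)
    (f := fun x : ℝ => ENNReal.ofReal (|x| ^ p)) (by fun_prop) (ENNReal.ofReal (r ^ p))
  have h2 : (Icc (-r) r)ᶜ ⊆ {x : ℝ | ENNReal.ofReal (r ^ p) ≤ ENNReal.ofReal (|x| ^ p)} := by
    intro x hx
    rw [mem_compl_iff, mem_Icc, ← abs_le, not_le] at hx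
    exact ENNReal.ofReal_le_ofReal (rpow_le_rpow hr.le hx.le hp.le)
  refine (measure_mono h2).trans ?_
  rw [rpow_neg hr.le, ← div_eq_mul_inv, ENNReal.ofReal_div_of_pos hrp]
  rw [ENNReal.le_div_iff_mul_le (by left; simpa using hrp) (by left; simp), mul_comm]
  refine h1.trans ?_
  rw [← hm]
  conv_lhs => rw [← ENNReal.ofReal_toReal hmt]
  exact ENNReal.ofReal_le_ofReal (by linarith)

/-- Centred intervals have Gaussian probability bounded below, with any power of the ratio of the
standard deviation to the length in the exponent. -/
theorem exists_exp_le_gaussianReal {p : ℝ} (hp : 0 < p) :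
    ∃ C > 0, ∀ (v : NNReal) (σ a : ℝ), 0 < σ → 0 < a → (v:ℝ) ≤ σ ^ 2 →
      ENNReal.ofReal (exp (-(C * (σ / a) ^ p))) ≤ gaussianReal 0 v (Icc (-a) a) := by
  obtain ⟨m, hm, hcomp⟩ := exists_gaussianReal_one_compl_le hp
  set c := gaussianPDFReal 0 1 1 with hc
  have hc0 : 0 < c := gaussianPDFReal_pos 0 1 1 one_ne_zero
  have hcp : 0 < c ^ p := by positivity
  refine ⟨c ^ (-p) / p + (2:ℝ) ^ p * exp 1 + 2 * m, by positivity,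
    fun v σ a hσ ha hv => (le_trans ?_ (gaussianReal_one_Icc_le hσ hv ha))⟩
  set r := a / σ with hr
  have hr0 : 0 < r := by positivity
  have hrr : (σ / a) ^ p = r ^ (-p) := by
    rw [rpow_neg hr0.le, ← inv_rpow hr0.le, hr, inv_div]
  rw [hrr]
  have hrp : 0 < r ^ (-p) := by positivity
  rcases le_or_gt r 2 with h2 | h2
  · refine le_trans (ENNReal.ofReal_le_ofReal ?_) (ofReal_mul_le_gaussianReal_one_Icc hr0 h2)
    rw [← hc]
    set x := r * c with hx
    have hx0 : 0 < x := by positivity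
    have h3 : exp (-(c ^ (-p) / p * r ^ (-p))) ≤ x := by
      have h4 : -log x * p + 1 ≤ x ^ (-p) := by
        rw [rpow_def_of_pos hx0]
        have := add_one_le_exp (log x * -p)
        linarith
      have h5 : x ^ (-p) = r ^ (-p) * c ^ (-p) := by rw [hx, mul_rpow hr0.le hc0.le]
      rw [← le_log_iff_exp_le hx0]
      have h6 : c ^ (-p) / p * r ^ (-p) = x ^ (-p) / p := by rw [h5]; ring
      rw [h6, neg_le, le_div_iff₀ hp]
      linarith
    refine le_trans (exp_le_exp.2 (neg_le_neg ?_)) h3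
    refine mul_le_mul_of_nonneg_right ?_ hrp.le
    have : 0 < (2:ℝ) ^ p * exp 1 := by positivity
    linarith
  · set q := ((gaussianReal 0 1) (Icc (-r) r)ᶜ).toReal with hq
    have hq0 : 0 ≤ q := ENNReal.toReal_nonneg
    have hq1 : q ≤ 1 / 4 := by
      refine ENNReal.toReal_le_of_le_ofReal (by norm_num) ?_
      refine le_trans (measure_mono ?_) ((gaussianReal_abs_gt_le 1 hr0).trans
        (ENNReal.ofReal_le_ofReal ?_))
      · intro x hx
        rwa [mem_compl_iff, mem_Icc, ← abs_le, not_le] at hx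
      · rw [NNReal.coe_one]
        refine one_div_le_one_div_of_le (by norm_num) (by nlinarith)
    have hq2 : q ≤ m * r ^ (-p) := ENNReal.toReal_le_of_le_ofReal (by positivity) (hcomp r hr0)
    have h3 : gaussianReal 0 1 (Icc (-r) r) = ENNReal.ofReal (1 - q) := by
      have h4 := prob_compl_eq_one_sub (μ := gaussianReal 0 1) (measurableSet_Icc (a := -r) (b := r)).compl
      rw [compl_compl] at h4
      rw [h4, hq, ENNReal.ofReal_sub _ ENNReal.toReal_nonneg, ENNReal.ofReal_one,
        ENNReal.ofReal_toReal (measure_ne_top _ _)]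
    rw [h3]
    refine ENNReal.ofReal_le_ofReal ?_
    have h4 : exp (-(2 * q)) ≤ 1 - q := by
      have h5 := add_one_le_exp (2 * q)
      rw [exp_neg, inv_le_comm₀ (exp_pos _) (by linarith)]
      refine le_trans ?_ h5
      rw [inv_le_iff_one_le_mul₀ (by linarith)]
      nlinarith
    refine le_trans (exp_le_exp.2 (neg_le_neg ?_)) h4
    have h5 : 2 * m * r ^ (-p) ≤ (c ^ (-p) / p + (2:ℝ) ^ p * exp 1 + 2 * m) * r ^ (-p) := by
      refine mul_le_mul_of_nonneg_right ?_ hrp.le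
      have : 0 < (2:ℝ) ^ p * exp 1 := by positivity
      have : 0 < c ^ (-p) / p := by positivity
      linarith
    linarith

/-- The Lagrange basis at the nodes `i / m`, as functions. -/
theorem exists_nodal_basis {m : ℕ} (hm : 0 < m) : ∃ L : Fin m → ℝ → ℝ, (∀ l, Continuous (L l)) ∧
    (∀ (e z : ℝ) (l : Fin m), L l ((e + z) / 2) = ∑ i : Fin m, L i z * L l ((e + (i:ℕ) / m) / 2)) ∧
    (∀ l : Fin m, L l 0 = if (l:ℕ) = 0 then 1 else 0) ∧
    (∀ n < m, ∀ y : ℝ, ∑ l : Fin m, L l y * ((l:ℕ) / m : ℝ) ^ n = y ^ n) := by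
  have hm0 : (m:ℝ) ≠ 0 := by exact_mod_cast hm.ne'
  let v : Fin m → ℝ := fun i => (i:ℕ) / m
  have hv : Set.InjOn v (Finset.univ : Finset (Fin m)) := by
    intro i _ j _ hij
    simp only [v, div_left_inj' hm0, Nat.cast_inj] at hij
    exact Fin.ext hij
  let b : Fin m → Polynomial ℝ := Lagrange.basis Finset.univ v
  have hrep : ∀ q : Polynomial ℝ, q.degree < m → ∀ y, ∑ i, (b i).eval y * q.eval (v i) = q.eval y := by
    intro q hq y
    have h1 := Lagrange.eq_interpolate hv (f := q) (by simpa using hq)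
    conv_rhs => rw [h1]
    rw [Lagrange.interpolate_apply, Polynomial.eval_finsetSum]
    refine Finset.sum_congr rfl fun i _ => ?_
    simp [b, mul_comm]
  refine ⟨fun l y => (b l).eval y, fun l => (b l).continuous, fun e z l => ?_, fun l => ?_,
    fun n hn y => ?_⟩
  · have h1 := hrep ((b l).comp (Polynomial.C (1 / 2) * Polynomial.X + Polynomial.C (e / 2))) ?_ z
    · simp only [Polynomial.eval_comp, Polynomial.eval_add, Polynomial.eval_mul, Polynomial.eval_C,
        Polynomial.eval_X] at h1
      beta_reduce
      rw [show (e + z) / 2 = 1 / 2 * z + e / 2 by ring, ← h1]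
      refine Finset.sum_congr rfl fun i _ => ?_
      rw [show (e + ((i:ℕ):ℝ) / m) / 2 = 1 / 2 * v i + e / 2 by simp only [v]; ring]
    · refine lt_of_le_of_lt Polynomial.degree_le_natDegree ?_
      rw [Polynomial.natDegree_comp]
      have h2 : (b l).natDegree = m - 1 := by
        rw [Lagrange.natDegree_basis hv (Finset.mem_univ l)]; simp
      have h3 : (Polynomial.C (1 / 2 : ℝ) * Polynomial.X + Polynomial.C (e / 2)).natDegree ≤ 1 := by
        compute_degree
      have h4 : (b l).natDegree * (Polynomial.C (1 / 2 : ℝ) * Polynomial.X +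
          Polynomial.C (e / 2)).natDegree < m := by
        rw [h2]
        calc _ ≤ (m - 1) * 1 := Nat.mul_le_mul_left _ h3
          _ < m := by omega
      exact_mod_cast h4
  · have h0 : (0:ℝ) = v ⟨0, hm⟩ := by simp [v]
    by_cases hl : (l:ℕ) = 0
    · have : l = ⟨0, hm⟩ := Fin.ext hl
      rw [if_pos hl, h0, this]
      exact Lagrange.eval_basis_self hv (Finset.mem_univ _)
    · have hne : l ≠ ⟨0, hm⟩ := fun h => hl (by rw [h])
      have h1 : (b l).eval (v ⟨0, hm⟩) = 0 :=
        Lagrange.eval_basis_of_ne (F := ℝ) (s := Finset.univ) (v := v) hne (Finset.mem_univ _)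
      rw [← h0] at h1
      rw [if_neg hl]
      exact h1
  · have h1 := hrep (Polynomial.X ^ n) (by rw [Polynomial.degree_X_pow]; exact_mod_cast hn) y
    simpa [v] using h1

/-- The hierarchical decomposition of a function at a dyadic point, in terms of its interpolation
errors. -/
theorem hierarchical_sum {m : ℕ} (hm : 0 < m) {L : Fin m → ℝ → ℝ}
    (hL : ∀ (e z : ℝ) (l : Fin m),
      L l ((e + z) / 2) = ∑ i : Fin m, L i z * L l ((e + (i:ℕ) / m) / 2))
    (hL0 : ∀ l : Fin m, L l 0 = if (l:ℕ) = 0 then 1 else 0) {J i₀ : ℕ} (hi : i₀ < 2 ^ J) :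
    ∃ (z : ℕ → ℝ) (k e : ℕ → ℕ), (∀ j, z j ∈ Icc (0:ℝ) 1) ∧ (∀ j < J, k j < 2 ^ j) ∧
      (∀ j, e j < 2) ∧ ∀ f : ℝ → ℝ,
      f (i₀ / 2 ^ J) = ∑ l, L l (z 0) * f ((l:ℕ) / m) +
        ∑ j ∈ Finset.range J, ∑ i : Fin m, L i (z (j + 1)) *
          (f ((k j + (e j + (i:ℕ) / m) / 2) / 2 ^ j) -
            ∑ l : Fin m, L l ((e j + (i:ℕ) / m) / 2) * f ((k j + (l:ℕ) / m) / 2 ^ j)) := by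
  let k : ℕ → ℕ := fun j => i₀ / 2 ^ (J - j)
  let z : ℕ → ℝ := fun j => (i₀ % 2 ^ (J - j) : ℕ) / 2 ^ (J - j)
  let e : ℕ → ℕ := fun j => k (j + 1) % 2
  have hk : ∀ j < J, k (j + 1) = 2 * k j + e j := by
    intro j hj
    have : k j = k (j + 1) / 2 := by
      simp only [k]
      rw [Nat.div_div_eq_div_mul, ← pow_succ]
      congr 2; omega
    have h2 := Nat.div_add_mod (k (j + 1)) 2
    simp only [e]
    omega
  have hkz : ∀ j ≤ J, (k j + z j) / 2 ^ j = (i₀:ℝ) / 2 ^ J := by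
    intro j hj
    have h1 := Nat.div_add_mod i₀ (2 ^ (J - j))
    have h2 : (i₀:ℝ) = 2 ^ (J - j) * k j + (i₀ % 2 ^ (J - j) : ℕ) := by
      conv_lhs => rw [← h1]
      push_cast
      rfl
    have h3 : (2:ℝ) ^ J = 2 ^ j * 2 ^ (J - j) := by rw [← pow_add]; congr 1; omega
    rw [h2, h3]
    simp only [z]
    field_simp
  have hz : ∀ j < J, z j = (e j + z (j + 1)) / 2 := by
    intro j hj
    have h1 := hkz j hj.le
    rw [← hkz (j + 1) hj, hk j hj, pow_succ] at h1
    push_cast at h1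
    field_simp at h1
    linarith
  refine ⟨z, k, e, fun j => ⟨by positivity, ?_⟩, fun j hj => ?_, fun j => Nat.mod_lt _ two_pos,
    fun f => ?_⟩
  · rw [div_le_one (by positivity)]
    exact_mod_cast (Nat.mod_lt i₀ (by positivity)).le
  · refine Nat.div_lt_of_lt_mul ?_
    rwa [← pow_add, show J - j + j = J by omega]
  · let Q : ℕ → ℝ := fun j => ∑ l : Fin m, L l (z j) * f ((k j + (l:ℕ) / m) / 2 ^ j)
    have hstep : ∀ j < J, Q (j + 1) - Q j = ∑ i : Fin m, L i (z (j + 1)) *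
          (f ((k j + (e j + (i:ℕ) / m) / 2) / 2 ^ j) -
            ∑ l : Fin m, L l ((e j + (i:ℕ) / m) / 2) * f ((k j + (l:ℕ) / m) / 2 ^ j)) := by
      intro j hj
      simp only [mul_sub, Finset.sum_sub_distrib]
      congr 1
      · refine Finset.sum_congr rfl fun i _ => ?_
        rw [hk j hj, pow_succ]
        push_cast
        congr 2
        field_simp
        ring
      · have h1 : ∀ l, L l (z j) = ∑ i : Fin m, L i (z (j + 1)) * L l ((e j + (i:ℕ) / m) / 2) :=
          fun l => by rw [hz j hj, hL]
        simp only [Q, h1, Finset.mul_sum, Finset.sum_mul]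
        rw [Finset.sum_comm]
        exact Finset.sum_congr rfl fun i _ => Finset.sum_congr rfl fun l _ => by ring
    have h0 : Q 0 = ∑ l, L l (z 0) * f ((l:ℕ) / m) := by
      simp [Q, k, Nat.div_eq_of_lt hi]
    have hJ : Q J = f (i₀ / 2 ^ J) := by
      have hz0 : z J = 0 := by simp [z, Nat.mod_one]
      have hkJ : k J = i₀ := by simp [k]
      simp only [Q, hz0, hL0, ite_mul, one_mul, zero_mul, hkJ]
      rw [Finset.sum_eq_single ⟨0, hm⟩]
      · simp only [if_true, Nat.cast_zero, zero_div, add_zero]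
      · intro l _ hl
        rw [if_neg fun h => hl (Fin.ext h)]
      · exact fun h => absurd (Finset.mem_univ _) h
    rw [← h0, ← hJ, ← Finset.sum_congr rfl fun j hj => hstep j (Finset.mem_range.1 hj),
      Finset.sum_range_sub]
    ring

theorem sum_range_rpow_neg_le {s : ℝ} (hs0 : 0 ≤ s) (hs : s < 1) (n : ℕ) :
    ∑ k ∈ Finset.range n, ((k:ℝ) + 1) ^ (-s) ≤ (1 - s)⁻¹ * (n:ℝ) ^ (1 - s) := by
  have h1s : 0 < 1 - s := by linarith
  induction n with
  | zero => simp [zero_rpow h1s.ne']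
  | succ n ih =>
    rw [Finset.sum_range_succ]
    have hn : (0:ℝ) < n + 1 := by positivity
    have h1 := rpow_one_add_le_one_add_mul_self (s := -1 / ((n:ℝ) + 1)) (p := 1 - s)
      (by rw [le_div_iff₀ hn]; have : (0:ℝ) ≤ n := n.cast_nonneg
          linarith) h1s.le (by linarith)
    have e1 : 1 + -1 / ((n:ℝ) + 1) = n / (n + 1) := by field_simp; ring
    rw [e1, div_rpow n.cast_nonneg hn.le, div_le_iff₀ (by positivity)] at h1
    have e2 : ((n:ℝ) + 1) ^ (1 - s) = (n + 1) * ((n:ℝ) + 1) ^ (-s) := by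
      rw [sub_eq_add_neg, rpow_add hn, rpow_one]
    have e3 : (1 + (1 - s) * (-1 / ((n:ℝ) + 1))) * ((n:ℝ) + 1) ^ (1 - s) =
        ((n:ℝ) + 1) ^ (1 - s) - (1 - s) * ((n:ℝ) + 1) ^ (-s) := by
      rw [e2]; field_simp; ring
    rw [e3] at h1
    push_cast
    calc _ ≤ (1 - s)⁻¹ * (n:ℝ) ^ (1 - s) + ((n:ℝ) + 1) ^ (-s) := by gcongr
      _ = (1 - s)⁻¹ * ((n:ℝ) ^ (1 - s) + (1 - s) * ((n:ℝ) + 1) ^ (-s)) := by field_simp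
      _ ≤ _ := by
        refine mul_le_mul_of_nonneg_left ?_ (by positivity)
        linarith

/-- The distance of natural numbers. -/
def natGap (j i : ℕ) : ℕ := (j - i) + (i - j)

theorem sum_pow_natGap_le {c : ℝ} (hc0 : 0 ≤ c) (hc : c < 1) (i J : ℕ) :
    ∑ j ∈ Finset.range J, c ^ natGap j i ≤ 2 / (1 - c) := by
  have hgeo : ∀ n : ℕ, ∑ j ∈ Finset.range n, c ^ j ≤ 1 / (1 - c) := by
    intro n
    rw [one_div, ← tsum_geometric_of_lt_one hc0 hc]
    exact (summable_geometric_of_lt_one hc0 hc).sum_le_tsum _ fun _ _ => by positivity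
  have h1 : ∑ j ∈ Finset.range J, c ^ natGap j i ≤ ∑ j ∈ Finset.range (i + J), c ^ natGap j i :=
    Finset.sum_le_sum_of_subset_of_nonneg (Finset.range_mono (by omega)) fun _ _ _ => by positivity
  refine h1.trans ?_
  rw [Finset.sum_range_add, show (2:ℝ) / (1 - c) = 1 / (1 - c) + 1 / (1 - c) by ring]
  refine add_le_add ?_ ?_
  · rw [← Finset.sum_range_reflect]
    refine le_trans (Finset.sum_le_sum fun j hj => ?_) (hgeo i)
    refine pow_le_pow_of_le_one hc0 hc.le ?_
    have := Finset.mem_range.1 hj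
    simp only [natGap]; omega
  · refine le_trans (Finset.sum_le_sum fun j hj => ?_) (hgeo J)
    refine pow_le_pow_of_le_one hc0 hc.le ?_
    simp only [natGap]; omega

/-- A choice of thresholds for the hierarchical functionals. -/
theorem exists_thresholds {h γ β : ℝ} (hh : 0 < h) (hγ : 0 ≤ γ) (hβ : β = h + γ / 2) :
    ∃ p₁ > (0:ℝ), ∃ p₂ > (0:ℝ), ∃ C > (0:ℝ), ∀ ε ∈ Ioc (0:ℝ) 1, ∃ (a : ℕ → ℝ) (q : ℕ → ℝ),
      (∀ j, 0 < a j) ∧ (∀ j, q j = p₁ ∨ q j = p₂) ∧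
      (∀ J : ℕ, ∑ j ∈ Finset.range J, a j ≤ C * ε) ∧
      ∀ J : ℕ, ∑ j ∈ Finset.range J, ∑ k ∈ Finset.range (2 ^ j),
        (((2:ℝ) ^ j)⁻¹ ^ h * ((k:ℝ) + 1) ^ (-(γ / 2)) / a j) ^ q j ≤ C * ε ^ (-(1 / β)) := by
  have hβ0 : 0 < β := by rw [hβ]; positivity
  set η := h / 3 with hη
  have hη0 : 0 < η := by positivity
  set p₁ := 1 / (2 * (β + η)) with hp₁
  set p₂ := 1 / (γ / 2 + η) with hp₂
  have hp₁0 : 0 < p₁ := by positivity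
  have hp₂0 : 0 < p₂ := by positivity
  have hs₁ : γ / 2 * p₁ < 1 := by
    rw [hp₁, mul_one_div, div_lt_one (by positivity)]; linarith
  have hs₂ : γ / 2 * p₂ < 1 := by
    rw [hp₂, mul_one_div, div_lt_one (by positivity)]; linarith
  have hr₂ : 0 < p₂ * (β - η) - 1 := by
    have : p₂ * (β - η) - 1 = (h / 3) / (γ / 2 + η) := by
      rw [hp₂, hβ, hη]; field_simp; ring
    rw [this]; positivity
  set ρ := min (1 / 2) (p₂ * (β - η) - 1) with hρ
  have hρ0 : 0 < ρ := lt_min (by norm_num) hr₂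
  have hc1 : (2:ℝ) ^ (-ρ) < 1 := rpow_lt_one_of_one_lt_of_neg (by norm_num) (by linarith)
  have hc2 : (2:ℝ) ^ (-η) < 1 := rpow_lt_one_of_one_lt_of_neg (by norm_num) (by linarith)
  set B := max (1 - γ / 2 * p₁)⁻¹ (1 - γ / 2 * p₂)⁻¹ with hB
  have hB0 : 0 < B := lt_of_lt_of_le (inv_pos.2 (by linarith)) (le_max_left _ _)
  set C := max (2 / (1 - (2:ℝ) ^ (-η))) (B * (2 / (1 - (2:ℝ) ^ (-ρ))) * 2) with hC
  have hC0 : 0 < C := lt_of_lt_of_le (div_pos two_pos (by linarith)) (le_max_left _ _)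
  refine ⟨p₁, hp₁0, p₂, hp₂0, C, hC0, fun ε hε => ?_⟩
  have hε0 := hε.1
  -- the critical level
  obtain ⟨j₀, hj1, hj2⟩ : ∃ j₀ : ℕ, ε⁻¹ ≤ (2:ℝ) ^ (j₀ * β) ∧ (2:ℝ) ^ (j₀:ℝ) ≤ 2 * ε ^ (-(1 / β)) := by
    have h0 : 0 ≤ logb 2 ε⁻¹ / β :=
      div_nonneg (logb_nonneg (by norm_num) (one_le_inv_iff₀.2 hε)) hβ0.le
    refine ⟨⌈logb 2 ε⁻¹ / β⌉₊, ?_, ?_⟩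
    · have h1 := Nat.le_ceil (logb 2 ε⁻¹ / β)
      rw [div_le_iff₀ hβ0] at h1
      rwa [← logb_le_iff_le_rpow (by norm_num) (by positivity)]
    · have h1 := (Nat.ceil_lt_add_one h0).le
      calc (2:ℝ) ^ ((⌈logb 2 ε⁻¹ / β⌉₊ : ℕ):ℝ) ≤ 2 ^ (logb 2 ε⁻¹ / β + 1) :=
            rpow_le_rpow_of_exponent_le (by norm_num) h1
        _ = 2 * (2 ^ (logb 2 ε⁻¹)) ^ (1 / β) := by
            rw [rpow_add two_pos, rpow_one, div_eq_mul_one_div, rpow_mul two_pos.le, mul_comm]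
        _ = 2 * ε ^ (-(1 / β)) := by
            rw [rpow_logb two_pos (by norm_num) (by positivity), inv_rpow hε0.le, rpow_neg hε0.le]
  have hcast : ∀ (x : ℝ) (n : ℕ), ((2:ℝ) ^ (-x)) ^ n = 2 ^ (-x * n) := fun x n => by
    rw [← rpow_natCast, ← rpow_mul two_pos.le]
  refine ⟨fun j => ε * ((2:ℝ) ^ (-η)) ^ natGap j j₀, fun j => if j < j₀ then p₁ else p₂,
    fun j => by positivity, fun j => ?_, fun J => ?_, fun J => ?_⟩
  · by_cases hj : j < j₀ <;> simp [hj]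
  · rw [← Finset.mul_sum, mul_comm]
    exact mul_le_mul_of_nonneg_right ((sum_pow_natGap_le (by positivity) hc2 _ _).trans
      (le_max_left _ _)) hε0.le
  · have key : ∀ j : ℕ, ∑ k ∈ Finset.range (2 ^ j),
        (((2:ℝ) ^ j)⁻¹ ^ h * ((k:ℝ) + 1) ^ (-(γ / 2)) / (ε * ((2:ℝ) ^ (-η)) ^ natGap j j₀)) ^
          (if j < j₀ then p₁ else p₂) ≤ B * 2 ^ (j₀:ℝ) * ((2:ℝ) ^ (-ρ)) ^ natGap j j₀ := by
      intro j
      set p := if j < j₀ then p₁ else p₂ with hp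
      have hp0 : 0 < p := by rw [hp]; split_ifs <;> assumption
      have hsp : γ / 2 * p < 1 := by rw [hp]; split_ifs <;> assumption
      have hBp : (1 - γ / 2 * p)⁻¹ ≤ B := by
        rw [hp, hB]; split_ifs
        · exact le_max_left _ _
        · exact le_max_right _ _
      have hexp : (j:ℝ) + p * ((j₀ - j) * β + η * natGap j j₀) ≤ j₀ + -ρ * natGap j j₀ := by
        by_cases hj : j < j₀
        · have e : (natGap j j₀ : ℝ) = j₀ - j := by
            rw [natGap, Nat.sub_eq_zero_of_le hj.le, zero_add, Nat.cast_sub hj.le]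
          have hd : (0:ℝ) ≤ j₀ - j := by
            have : (j:ℝ) ≤ j₀ := by exact_mod_cast hj.le
            linarith
          have e2 : p * (β + η) = 1 / 2 := by
            rw [hp, if_pos hj, hp₁]; field_simp
          have h3 : ρ ≤ 1 / 2 := min_le_left _ _
          rw [e]
          have e4 : (j:ℝ) + p * ((j₀ - j) * β + η * (j₀ - j)) = j + (p * (β + η)) * (j₀ - j) := by ring
          rw [e4, e2]
          nlinarith
        · push Not at hj
          have e : (natGap j j₀ : ℝ) = j - j₀ := by
            rw [natGap, Nat.sub_eq_zero_of_le hj, add_zero, Nat.cast_sub hj]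
          have hd : (0:ℝ) ≤ j - j₀ := by
            have : (j₀:ℝ) ≤ j := by exact_mod_cast hj
            linarith
          have h3 : ρ ≤ p * (β - η) - 1 := by
            rw [hp, if_neg (not_lt.2 hj)]; exact min_le_right _ _
          rw [e]
          nlinarith
      have hterm : ∀ k : ℕ, (((2:ℝ) ^ j)⁻¹ ^ h * ((k:ℝ) + 1) ^ (-(γ / 2)) /
          (ε * ((2:ℝ) ^ (-η)) ^ natGap j j₀)) ^ p ≤
          2 ^ (p * (j₀ * β - j * h + η * natGap j j₀)) * ((k:ℝ) + 1) ^ (-(γ / 2 * p)) := by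
        intro k
        have hk : (0:ℝ) < k + 1 := by positivity
        have e1 : ((2:ℝ) ^ j)⁻¹ ^ h = 2 ^ (-(j * h)) := by
          rw [← rpow_natCast, ← rpow_neg two_pos.le, ← rpow_mul two_pos.le, neg_mul]
        calc _ ≤ (2 ^ (j₀ * β - j * h + η * natGap j j₀) * ((k:ℝ) + 1) ^ (-(γ / 2))) ^ p := by
              refine rpow_le_rpow (by positivity) ?_ hp0.le
              rw [hcast, e1, div_eq_mul_inv, mul_inv, ← rpow_neg two_pos.le]
              calc _ = ε⁻¹ * (2 ^ (-(j * h)) * 2 ^ (-(-η * (natGap j j₀ : ℝ)))) *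
                    ((k:ℝ) + 1) ^ (-(γ / 2)) := by ring
                _ ≤ 2 ^ (j₀ * β) * (2 ^ (-(j * h)) * 2 ^ (-(-η * (natGap j j₀ : ℝ)))) *
                    ((k:ℝ) + 1) ^ (-(γ / 2)) := by gcongr
                _ = _ := by
                    rw [← rpow_add two_pos, ← rpow_add two_pos]
                    congr 2; ring
          _ = _ := by
              rw [mul_rpow (by positivity) (by positivity), ← rpow_mul two_pos.le, ← rpow_mul hk.le]
              congr 2 <;> ring
      calc _ ≤ ∑ k ∈ Finset.range (2 ^ j), 2 ^ (p * (j₀ * β - j * h + η * natGap j j₀)) *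
            ((k:ℝ) + 1) ^ (-(γ / 2 * p)) := Finset.sum_le_sum fun k _ => hterm k
        _ ≤ 2 ^ (p * (j₀ * β - j * h + η * natGap j j₀)) * (B * 2 ^ (j * (1 - γ / 2 * p))) := by
            rw [← Finset.mul_sum]
            refine mul_le_mul_of_nonneg_left ?_ (by positivity)
            refine (sum_range_rpow_neg_le (by positivity) hsp _).trans ?_
            push_cast
            rw [← rpow_natCast, ← rpow_mul two_pos.le]
            gcongr
        _ = B * 2 ^ ((j:ℝ) + p * ((j₀ - j) * β + η * natGap j j₀)) := by
            rw [mul_left_comm, ← rpow_add two_pos]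
            congr 2
            rw [hβ]; ring
        _ ≤ B * 2 ^ ((j₀:ℝ) + -ρ * natGap j j₀) := by
            refine mul_le_mul_of_nonneg_left ?_ hB0.le
            exact rpow_le_rpow_of_exponent_le (by norm_num) hexp
        _ = _ := by rw [rpow_add two_pos, hcast, mul_assoc]
    calc _ ≤ ∑ j ∈ Finset.range J, B * 2 ^ (j₀:ℝ) * ((2:ℝ) ^ (-ρ)) ^ natGap j j₀ :=
          Finset.sum_le_sum fun j _ => key j
      _ ≤ B * 2 ^ (j₀:ℝ) * (2 / (1 - (2:ℝ) ^ (-ρ))) := by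
          rw [← Finset.mul_sum]
          exact mul_le_mul_of_nonneg_left (sum_pow_natGap_le (by positivity) hc1 _ _) (by positivity)
      _ ≤ B * (2 * ε ^ (-(1 / β))) * (2 / (1 - (2:ℝ) ^ (-ρ))) := by
          have : 0 ≤ 2 / (1 - (2:ℝ) ^ (-ρ)) := div_nonneg two_pos.le (by linarith)
          gcongr
      _ = (B * (2 / (1 - (2:ℝ) ^ (-ρ))) * 2) * ε ^ (-(1 / β)) := by ring
      _ ≤ _ := mul_le_mul_of_nonneg_right (le_max_right _ _) (by positivity)

/-- The kernel `K` is well approximated by polynomials: functionals on `[0, 1]` annihilating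
polynomials of low degree are small on the translates of `K` by natural numbers. -/
def HasInterp {E : Type*} [NormedAddCommGroup E] [InnerProductSpace ℝ E] (K : ℝ → E) (γ : ℝ) :
    Prop :=
  ∃ m : ℕ, 0 < m ∧ ∀ A : ℝ →₀ ℝ, (∀ x ∈ A.support, x ∈ Icc (0:ℝ) 1) →
    (∀ d < m, Finsupp.linearCombination ℝ (fun x : ℝ => x ^ d) A = 0) →
    ∃ C > (0:ℝ), ∀ k : ℕ,
      ‖Finsupp.linearCombination ℝ (fun x : ℝ => K (k + x)) A‖ ^ 2 ≤ C * ((k:ℝ) + 1) ^ (-γ)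

section

variable {Ω T E : Type*} [MeasurableSpace Ω] [NormedAddCommGroup E] [InnerProductSpace ℝ E]
  {P : Measure Ω}

/-- Šidák's inequality for finitely supported functionals. -/
theorem IsGaussProcOn.prod_le_measure_linearCombination [DecidableEq T] [IsProbabilityMeasure P]
    {Z : T → Ω → ℝ} {h : T → E} {S : Set T} {κ : Type*} [Fintype κ] (hZ : IsGaussProcOn P Z h S)
    (A : κ → T →₀ ℝ) (hA : ∀ i, ∀ t ∈ (A i).support, t ∈ S) (c : κ → ℝ) :
    ∏ i, gaussianReal 0 (‖Finsupp.linearCombination ℝ h (A i)‖₊ ^ 2) (Icc (-c i) (c i)) ≤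
      P {ω | ∀ i, |Finsupp.linearCombination ℝ (fun t => Z t ω) (A i)| ≤ c i} := by
  have key : ∀ {F : Type _} [AddCommGroup F] [Module ℝ F] (g : T → F) (i : κ),
      Finsupp.linearCombination ℝ g (A i) =
        ∑ t ∈ Finset.univ.biUnion fun i => (A i).support, A i t • g t := by
    intro F _ _ g i
    rw [Finsupp.linearCombination_apply]
    exact Finsupp.sum_of_support_subset _
      (Finset.subset_biUnion_of_mem (fun i => (A i).support) (Finset.mem_univ i)) _ (by simp)
  have h1 := hZ.prod_le_measure (Finset.univ.biUnion fun i => (A i).support) (by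
    intro t ht
    obtain ⟨i, -, hi⟩ := Finset.mem_biUnion.1 ht
    exact hA i t hi) (fun i => ⇑(A i)) c
  convert h1 using 4 with i
  · rw [key]
  · refine forall_congr' fun i => ?_
    rw [Finsupp.linearCombination_apply, Finsupp.sum_of_support_subset _
      (Finset.subset_biUnion_of_mem (fun i => (A i).support) (Finset.mem_univ i)) _ (by simp)]
    rfl

variable {Y : ℝ → Ω → ℝ} {K : ℝ → E} {h : ℝ}

theorem IsSelfSimGauss.norm_linearCombination_scale (hY : IsSelfSimGauss P Y K h) {l : ℝ}
    (hl : 0 < l) (A : ℝ →₀ ℝ) (hA : ∀ x ∈ A.support, 0 ≤ x) :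
    ‖Finsupp.linearCombination ℝ (fun x => K (l * x)) A‖ =
      l ^ h * ‖Finsupp.linearCombination ℝ K A‖ := by
  let e := A.support.equivFin
  have key : ∀ g : ℝ → E, Finsupp.linearCombination ℝ g A =
      ∑ i, A (e.symm i) • g (e.symm i) := by
    intro g
    rw [Finsupp.linearCombination_apply, Finsupp.sum, ← Finset.sum_coe_sort]
    exact Fintype.sum_equiv e _ _ fun x => by simp
  rw [key, key]
  exact hY.scaling l hl _ (fun i => (e.symm i : ℝ)) (fun i => A (e.symm i)) fun i => hA _ (e.symm i).2

end

theorem exists_exp_le_gaussianReal_mul {p D : ℝ} (hp : 0 < p) (hD : 0 < D) :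
    ∃ C > (0:ℝ), ∀ (v : NNReal) (s a : ℝ), 0 < s → 0 < a → (v:ℝ) ≤ D * s ^ 2 →
      ENNReal.ofReal (exp (-(C * (s / a) ^ p))) ≤ gaussianReal 0 v (Icc (-a) a) := by
  obtain ⟨C, hC, h⟩ := exists_exp_le_gaussianReal hp
  refine ⟨C * (√D) ^ p, by positivity, fun v s a hs ha hv => ?_⟩
  have h1 := h v (√D * s) a (by positivity) ha (by rwa [mul_pow, sq_sqrt hD.le])
  rwa [mul_div_assoc, mul_rpow (by positivity) (by positivity), ← mul_assoc] at h1

section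

variable {Ω E : Type*} [MeasurableSpace Ω] [NormedAddCommGroup E] [InnerProductSpace ℝ E]
  {P : Measure Ω} {Y : ℝ → Ω → ℝ} {K : ℝ → E} {h γ β : ℝ}

/-- The lower bound for the probability that the process is small on a dyadic grid. -/
theorem IsSelfSimGauss.exists_exp_le_measure_dyadic [IsProbabilityMeasure P]
    (hY : IsSelfSimGauss P Y K h) (hK : HasInterp K γ) (hh : 0 < h) (hγ : 0 ≤ γ)
    (hβ : β = h + γ / 2) :
    ∃ C > (0:ℝ), ∃ D > (0:ℝ), ∀ ε ∈ Ioc (0:ℝ) 1, ∀ J : ℕ,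
      ENNReal.ofReal (exp (-(C * ε ^ (-(1 / β))))) ≤
        P {ω | ∀ i < 2 ^ J, |Y ((i:ℕ) / 2 ^ J) ω| ≤ D * ε} := by
  classical
  have hβ0 : 0 < β := by rw [hβ]; positivity
  obtain ⟨m, hm, hInt⟩ := hK
  have hm0 : (0:ℝ) < m := by exact_mod_cast hm
  obtain ⟨L, hLc, hL, hL0, hLp⟩ := exists_nodal_basis hm
  -- the functionals
  let x : Fin 2 → Fin m → ℝ := fun e i => ((e:ℕ) + (i:ℕ) / m) / 2
  let A : Fin 2 → Fin m → ℝ →₀ ℝ := fun e i =>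
    Finsupp.single (x e i) 1 - ∑ l : Fin m, L l (x e i) • Finsupp.single ((l:ℕ) / m : ℝ) 1
  have hnode : ∀ l : Fin m, ((l:ℕ) / m : ℝ) ∈ Icc (0:ℝ) 1 := fun l =>
    ⟨by positivity, by rw [div_le_one hm0]; exact_mod_cast l.2.le⟩
  have hx : ∀ e i, x e i ∈ Icc (0:ℝ) 1 := fun e i => by
    have h1 := hnode i
    have h2 : ((e:ℕ):ℝ) ≤ 1 := by exact_mod_cast Nat.lt_succ_iff.1 e.2
    have h3 : (0:ℝ) ≤ (e:ℕ) := by positivity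
    constructor
    · have := h1.1; simp only [x]; linarith
    · have := h1.2; simp only [x]; linarith
  have hAs : ∀ e i, ∀ y ∈ (A e i).support, y ∈ Icc (0:ℝ) 1 := by
    intro e i
    have : A e i ∈ Finsupp.supported ℝ ℝ (Icc (0:ℝ) 1) :=
      Submodule.sub_mem _ (Finsupp.single_mem_supported ℝ _ (hx e i))
        (Submodule.sum_mem _ fun l _ => Submodule.smul_mem _ _
          (Finsupp.single_mem_supported ℝ _ (hnode l)))
    exact fun y hy => (Finsupp.mem_supported _ _).1 this hy
  have hAv' : ∀ (g : ℝ → ℝ) (e i), Finsupp.linearCombination ℝ g (A e i) =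
        g (x e i) - ∑ l : Fin m, L l (x e i) * g ((l:ℕ) / m) := by
    intro g e i
    simp [A, map_sub, map_sum]
  have hAC : ∀ e i, ∃ C > (0:ℝ), ∀ k : ℕ,
      ‖Finsupp.linearCombination ℝ (fun x : ℝ => K (k + x)) (A e i)‖ ^ 2 ≤
        C * ((k:ℝ) + 1) ^ (-γ) := by
    intro e i
    refine hInt (A e i) (hAs e i) fun d hd => ?_
    rw [hAv', hLp d hd, sub_self]
  choose C' hC'0 hC' using hAC
  set V := 1 + ∑ e, ∑ i, C' e i + ∑ i : Fin m, ‖K ((i:ℕ) / m)‖ ^ 2 with hV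
  have hCV : ∀ e i, C' e i ≤ V := by
    intro e i
    have h1 : C' e i ≤ ∑ i, C' e i :=
      Finset.single_le_sum (f := fun i => C' e i) (fun i _ => (hC'0 e i).le) (Finset.mem_univ i)
    have h2 : ∑ i, C' e i ≤ ∑ e, ∑ i, C' e i :=
      Finset.single_le_sum (f := fun e => ∑ i, C' e i)
        (fun e _ => Finset.sum_nonneg fun i _ => (hC'0 e i).le) (Finset.mem_univ e)
    have h3 : 0 ≤ ∑ i : Fin m, ‖K ((i:ℕ) / m)‖ ^ 2 := Finset.sum_nonneg fun _ _ => by positivity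
    linarith
  have hKV : ∀ i : Fin m, ‖K ((i:ℕ) / m)‖ ^ 2 ≤ V := by
    intro i
    have h1 : ‖K ((i:ℕ) / m)‖ ^ 2 ≤ ∑ i : Fin m, ‖K ((i:ℕ) / m)‖ ^ 2 :=
      Finset.single_le_sum (f := fun i : Fin m => ‖K ((i:ℕ) / m)‖ ^ 2) (fun i _ => by positivity)
        (Finset.mem_univ i)
    have h3 : 0 ≤ ∑ e, ∑ i, C' e i :=
      Finset.sum_nonneg fun e _ => Finset.sum_nonneg fun i _ => (hC'0 e i).le
    linarith
  have hV0 : 0 < V := by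
    have h1 : 0 ≤ ∑ i : Fin m, ‖K ((i:ℕ) / m)‖ ^ 2 := Finset.sum_nonneg fun _ _ => by positivity
    have h3 : 0 ≤ ∑ e, ∑ i, C' e i :=
      Finset.sum_nonneg fun e _ => Finset.sum_nonneg fun i _ => (hC'0 e i).le
    linarith
  -- a bound of the nodal basis
  obtain ⟨Λ, hΛ0, hΛ⟩ : ∃ Λ > (0:ℝ), ∀ l, ∀ z ∈ Icc (0:ℝ) 1, |L l z| ≤ Λ := by
    have h1 : ∀ l, ∃ B : ℝ, ∀ z ∈ Icc (0:ℝ) 1, |L l z| ≤ B := fun l => by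
      obtain ⟨B, hB⟩ := isCompact_Icc.exists_bound_of_continuousOn (hLc l).continuousOn
      exact ⟨B, fun z hz => hB z hz⟩
    choose B hB using h1
    refine ⟨1 + ∑ l, |B l|, by positivity, fun l z hz => ?_⟩
    have h2 : |B l| ≤ ∑ l, |B l| :=
      Finset.single_le_sum (f := fun l => |B l|) (fun _ _ => abs_nonneg _) (Finset.mem_univ l)
    linarith [hB l z hz, le_abs_self (B l)]
  obtain ⟨p₁, hp₁, p₂, hp₂, Ca, hCa, hthr⟩ := exists_thresholds hh hγ hβ
  obtain ⟨c₀, hc₀, hg₀⟩ := exists_exp_le_gaussianReal_mul (p := 1 / β) (by positivity) hV0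
  obtain ⟨c₁, hc₁, hg₁⟩ := exists_exp_le_gaussianReal_mul hp₁ hV0
  obtain ⟨c₂, hc₂, hg₂⟩ := exists_exp_le_gaussianReal_mul hp₂ hV0
  set c := max c₁ c₂ with hc
  have hc0 : 0 < c := lt_of_lt_of_le hc₁ (le_max_left _ _)
  have hg : ∀ q, (q = p₁ ∨ q = p₂) → ∀ (v : NNReal) (s a : ℝ), 0 < s → 0 < a →
      (v:ℝ) ≤ V * s ^ 2 →
      ENNReal.ofReal (exp (-(c * (s / a) ^ q))) ≤ gaussianReal 0 v (Icc (-a) a) := by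
    rintro q (rfl | rfl) v s a hs ha hv
    · refine le_trans (ENNReal.ofReal_le_ofReal (exp_le_exp.2 (neg_le_neg ?_))) (hg₁ v s a hs ha hv)
      exact mul_le_mul_of_nonneg_right (le_max_left _ _) (by positivity)
    · refine le_trans (ENNReal.ofReal_le_ofReal (exp_le_exp.2 (neg_le_neg ?_))) (hg₂ v s a hs ha hv)
      exact mul_le_mul_of_nonneg_right (le_max_right _ _) (by positivity)
  refine ⟨m * c₀ + 2 * m * c * Ca, by positivity, m * Λ * (1 + Ca), by positivity,
    fun ε hε J => ?_⟩
  have hε0 := hε.1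
  obtain ⟨a, q, ha, hq, hsum, hS⟩ := hthr ε hε
  let B : Fin m ⊕ (Σ j : Fin J, Fin (2 ^ (j:ℕ)) × Fin 2 × Fin m) → ℝ →₀ ℝ := fun t => match t with
    | .inl i => Finsupp.single ((i:ℕ) / m : ℝ) 1
    | .inr ⟨j, k, e, i⟩ => (A e i).mapDomain fun y => ((2:ℝ) ^ (j:ℕ))⁻¹ * ((k:ℕ) + y)
  let b : Fin m ⊕ (Σ j : Fin J, Fin (2 ^ (j:ℕ)) × Fin 2 × Fin m) → ℝ := fun t => match t with
    | .inl _ => ε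
    | .inr ⟨j, _⟩ => a j
  let U : Fin m ⊕ (Σ j : Fin J, Fin (2 ^ (j:ℕ)) × Fin 2 × Fin m) → ℝ := fun t => match t with
    | .inl _ => c₀ * ε ^ (-(1 / β))
    | .inr ⟨j, k, _⟩ => c * ((((2:ℝ) ^ (j:ℕ))⁻¹ ^ h * ((k:ℕ) + (1:ℝ)) ^ (-(γ / 2))) / a j) ^ q j
  have hsid := hY.proc.prod_le_measure_linearCombination B (by
    rintro (i | ⟨j, k, e, i⟩) t ht
    · have := Finsupp.support_single_subset ht
      rw [Finset.mem_singleton.1 this]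
      exact (hnode i).1
    · obtain ⟨y, hy, rfl⟩ := Finset.mem_image.1 (Finsupp.mapDomain_support ht)
      have := (hAs e i y hy).1
      exact mem_Ici.2 (by positivity)) b
  refine le_trans ?_ (hsid.trans (measure_mono fun ω hω => ?_))
  · -- the product of the one-dimensional probabilities
    have h1 : ∀ t, ENNReal.ofReal (exp (-U t)) ≤
        gaussianReal 0 (‖Finsupp.linearCombination ℝ K (B t)‖₊ ^ 2) (Icc (-b t) (b t)) := by
      rintro (i | ⟨j, k, e, i⟩)
      · have h2 := hg₀ (‖Finsupp.linearCombination ℝ K (B (.inl i))‖₊ ^ 2) 1 ε one_pos hε0 (by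
          simp only [B, Finsupp.linearCombination_single, one_smul, one_pow, mul_one]
          push_cast
          exact hKV i)
        rwa [one_div ε, inv_rpow hε0.le, ← rpow_neg hε0.le] at h2
      · have hk : (0:ℝ) < (k:ℕ) + 1 := by positivity
        refine hg (q j) (hq j) _ _ _ (by positivity) (ha j) ?_
        push_cast
        simp only [B, Finsupp.linearCombination_mapDomain]
        have h2 := hY.norm_linearCombination_scale (l := ((2:ℝ) ^ (j:ℕ))⁻¹) (by positivity)
          ((A e i).mapDomain fun y => (k:ℕ) + y) (by
            intro t ht
            obtain ⟨y, hy, rfl⟩ := Finset.mem_image.1 (Finsupp.mapDomain_support ht)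
            have := (hAs e i y hy).1
            positivity)
        simp only [Finsupp.linearCombination_mapDomain] at h2
        have h3 := hC' e i k
        change ‖Finsupp.linearCombination ℝ (fun y => K (((2:ℝ) ^ (j:ℕ))⁻¹ * ((k:ℕ) + y))) (A e i)‖ ^ 2
          ≤ _
        change ‖Finsupp.linearCombination ℝ (fun y => K (((2:ℝ) ^ (j:ℕ))⁻¹ * ((k:ℕ) + y))) (A e i)‖
          = _ * ‖Finsupp.linearCombination ℝ (fun y => K ((k:ℕ) + y)) (A e i)‖ at h2
        rw [h2, mul_pow, mul_pow, mul_left_comm]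
        refine mul_le_mul_of_nonneg_left (h3.trans ?_) (by positivity)
        have e1 : (((k:ℕ):ℝ) + 1) ^ (-γ) = ((((k:ℕ):ℝ) + 1) ^ (-(γ / 2))) ^ 2 := by
          rw [← rpow_natCast, ← rpow_mul hk.le]; congr 1; push_cast; ring
        rw [e1]
        exact mul_le_mul_of_nonneg_right (hCV e i) (by positivity)
    refine le_trans ?_ (Finset.prod_le_prod' fun t _ => h1 t)
    rw [← ENNReal.ofReal_prod_of_nonneg (fun _ _ => (exp_pos _).le), ← exp_sum]
    refine ENNReal.ofReal_le_ofReal (exp_le_exp.2 ?_)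
    rw [Finset.sum_neg_distrib]
    refine neg_le_neg ?_
    rw [Fintype.sum_sum_type, Fintype.sum_sigma]
    simp only [U, Fintype.sum_prod_type, Finset.sum_const, Finset.card_univ, Fintype.card_fin,
      Fintype.card_prod, nsmul_eq_mul]
    have h4 : ∀ j : Fin J, ∑ k : Fin (2 ^ (j:ℕ)), ((2 * m : ℕ):ℝ) *
        (c * ((((2:ℝ) ^ (j:ℕ))⁻¹ ^ h * ((k:ℕ) + (1:ℝ)) ^ (-(γ / 2))) / a j) ^ q j) =
        2 * m * c * ∑ k ∈ Finset.range (2 ^ (j:ℕ)),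
          ((((2:ℝ) ^ (j:ℕ))⁻¹ ^ h * ((k:ℕ) + (1:ℝ)) ^ (-(γ / 2))) / a j) ^ q j := by
      intro j
      rw [← Fin.sum_univ_eq_sum_range (fun k : ℕ =>
        ((((2:ℝ) ^ (j:ℕ))⁻¹ ^ h * ((k:ℕ) + (1:ℝ)) ^ (-(γ / 2))) / a j) ^ q j), Finset.mul_sum]
      exact Finset.sum_congr rfl fun k _ => by push_cast; ring
    rw [Finset.sum_congr rfl fun j _ => h4 j, ← Finset.mul_sum,
      Fin.sum_univ_eq_sum_range (fun j : ℕ => ∑ k ∈ Finset.range (2 ^ j),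
          ((((2:ℝ) ^ j)⁻¹ ^ h * ((k:ℕ) + (1:ℝ)) ^ (-(γ / 2))) / a j) ^ q j) J]
    have h5 := mul_le_mul_of_nonneg_left (hS J) (show 0 ≤ 2 * m * c by positivity)
    linarith
  · -- on the event the process is small
    intro i₀ hi₀
    obtain ⟨z, k, e, hz, hk, he, hf⟩ := hierarchical_sum hm hL hL0 hi₀
    rw [hf fun t => Y t ω]
    have hin : ∀ i : Fin m, |Y ((i:ℕ) / m) ω| ≤ ε := fun i => by
      have := hω (.inl i)
      simpa only [B, b, Finsupp.linearCombination_single, one_smul] using this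
    have hjn : ∀ j < J, ∀ i : Fin m, |Y ((k j + (e j + (i:ℕ) / m) / 2) / 2 ^ j) ω -
            ∑ l : Fin m, L l ((e j + (i:ℕ) / m) / 2) * Y ((k j + (l:ℕ) / m) / 2 ^ j) ω| ≤ a j := by
      intro j hj i
      have := hω (.inr ⟨⟨j, hj⟩, ⟨k j, hk j hj⟩, ⟨e j, he j⟩, i⟩)
      simp only [B, b, Finsupp.linearCombination_mapDomain, hAv'] at this
      simpa only [Function.comp, x, inv_mul_eq_div] using this
    have h1 : |∑ l, L l (z 0) * Y ((l:ℕ) / m) ω| ≤ m * Λ * ε := by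
      refine (Finset.abs_sum_le_sum_abs _ _).trans ((Finset.sum_le_card_nsmul _ _ (Λ * ε)
        fun l _ => ?_).trans (by simp [mul_assoc]))
      rw [abs_mul]
      exact mul_le_mul (hΛ l _ (hz 0)) (hin l) (abs_nonneg _) hΛ0.le
    have h2 : ∀ j ∈ Finset.range J, |∑ i : Fin m, L i (z (j + 1)) *
          (Y ((k j + (e j + (i:ℕ) / m) / 2) / 2 ^ j) ω -
            ∑ l : Fin m, L l ((e j + (i:ℕ) / m) / 2) * Y ((k j + (l:ℕ) / m) / 2 ^ j) ω)| ≤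
          m * Λ * a j := by
      intro j hj
      refine (Finset.abs_sum_le_sum_abs _ _).trans ((Finset.sum_le_card_nsmul _ _ (Λ * a j)
        fun l _ => ?_).trans (by simp [mul_assoc]))
      rw [abs_mul]
      exact mul_le_mul (hΛ l _ (hz _)) (hjn j (Finset.mem_range.1 hj) l) (abs_nonneg _) hΛ0.le
    refine (abs_add_le _ _).trans ((add_le_add h1 ((Finset.abs_sum_le_sum_abs _ _).trans
      (Finset.sum_le_sum h2))).trans ?_)
    rw [← Finset.mul_sum]
    have h3 := mul_le_mul_of_nonneg_left (hsum J) (show 0 ≤ m * Λ by positivity)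
    linarith

/-- The lower bound for the small ball probability. -/
theorem IsSelfSimGauss.exists_exp_le_smallBall [IsProbabilityMeasure P]
    (hY : IsSelfSimGauss P Y K h) (hK : HasInterp K γ) (hh : 0 < h) (hγ : 0 ≤ γ)
    (hβ : β = h + γ / 2) :
    ∃ C > (0:ℝ), ∀ ε ∈ Ioc (0:ℝ) 1, exp (-(C * ε ^ (-(1 / β)))) ≤ smallBall P Y ε := by
  obtain ⟨C, hC, D, hD, hdy⟩ := hY.exists_exp_le_measure_dyadic hK hh hγ hβ
  have key : ∀ ε ∈ Ioc (0:ℝ) 1, exp (-(C * ε ^ (-(1 / β)))) ≤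
      smallBall P Y (D * ε / (1 / 2) ^ h) := by
    intro ε hε
    rw [← hY.measureReal_runSup_le (by norm_num), measureReal_def,
      ← ENNReal.ofReal_le_iff_le_toReal (measure_ne_top _ _)]
    refine ge_of_tendsto' (hY.tendsto_procBox (by norm_num) (D * ε)) fun n => ?_
    refine (hdy ε hε (n + 1)).trans (measure_mono fun ω hω s hs => ?_)
    obtain ⟨i, hi, rfl⟩ := mem_gridPts.1 hs
    have h1 := hω i (by rw [pow_succ]; have : 0 < 2 ^ n := by positivity
                        omega)
    convert h1 using 4
    rw [pow_succ]; field_simp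
  set D' := max 1 (D / (1 / 2) ^ h) with hD'
  have hD'0 : 0 < D' := lt_of_lt_of_le one_pos (le_max_left _ _)
  refine ⟨C * D' ^ (1 / β), by positivity, fun ε hε => ?_⟩
  have hε0 := hε.1
  have h1 := key (ε / D') ⟨by positivity, (div_le_one hD'0).2 (hε.2.trans (le_max_left _ _))⟩
  have e1 : C * D' ^ (1 / β) * ε ^ (-(1 / β)) = C * (ε / D') ^ (-(1 / β)) := by
    rw [div_rpow hε0.le hD'0.le, rpow_neg hD'0.le, div_inv_eq_mul]; ring
  rw [e1]
  refine h1.trans (smallBall_mono ?_)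
  have h2 : D / (1 / 2) ^ h ≤ D' := le_max_right _ _
  calc D * (ε / D') / (1 / 2) ^ h = D / (1 / 2) ^ h * (ε / D') := by ring
    _ ≤ D' * (ε / D') := mul_le_mul_of_nonneg_right h2 (by positivity)
    _ = ε := by field_simp

end

/-- The weighted kernel of the generalized fractional Brownian motion. -/
noncomputable def gfbmKernel (α γ s u : ℝ) : ℝ :=
  ((max (s - u) 0) ^ α - (max (-u) 0) ^ α) * |u| ^ (-(γ / 2))

theorem measurable_gfbmKernel (α γ : ℝ) : Measurable fun p : ℝ × ℝ => gfbmKernel α γ p.1 p.2 := by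
  unfold gfbmKernel
  fun_prop

theorem measurable_gfbmKernel_right (α γ s : ℝ) : Measurable (gfbmKernel α γ s) :=
  (measurable_gfbmKernel α γ).comp (measurable_const.prodMk measurable_id)

theorem gfbmKernel_mul (α γ : ℝ) {l : ℝ} (hl : 0 < l) (s u : ℝ) :
    gfbmKernel α γ (l * s) (l * u) = l ^ (α - γ / 2) * gfbmKernel α γ s u := by
  have h1 : max (l * s - l * u) 0 = l * max (s - u) 0 := by
    rw [mul_max_of_nonneg _ _ hl.le, mul_zero, mul_sub]
  have h2 : max (-(l * u)) 0 = l * max (-u) 0 := by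
    rw [mul_max_of_nonneg _ _ hl.le, mul_zero, mul_neg]
  rw [gfbmKernel, gfbmKernel, h1, h2, mul_rpow hl.le (le_max_right _ _),
    mul_rpow hl.le (le_max_right _ _), abs_mul, abs_of_pos hl, mul_rpow hl.le (abs_nonneg _),
    sub_eq_add_neg α, rpow_add hl]
  ring

theorem gfbmKernel_of_le {α γ s u : ℝ} (hα : α ≠ 0) (hu : 0 ≤ u) (hsu : s ≤ u) :
    gfbmKernel α γ s u = 0 := by
  rw [gfbmKernel, max_eq_right (by linarith), max_eq_right (by linarith), sub_self, zero_mul]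

theorem gfbmKernel_of_pos {α γ s u : ℝ} (hα : α ≠ 0) (hu : 0 ≤ u) :
    gfbmKernel α γ s u = (max (s - u) 0) ^ α * u ^ (-(γ / 2)) := by
  rw [gfbmKernel, max_eq_right (a := -u) (by linarith), zero_rpow hα, sub_zero, abs_of_nonneg hu]

theorem gfbmKernel_neg {α γ s v : ℝ} (hs : 0 ≤ s) (hv : 0 ≤ v) :
    gfbmKernel α γ s (-v) = ((s + v) ^ α - v ^ α) * v ^ (-(γ / 2)) := by
  rw [gfbmKernel, sub_neg_eq_add, neg_neg, max_eq_left (by linarith), max_eq_left hv, abs_neg,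
    abs_of_nonneg hv]

theorem abs_rpow_add_sub_rpow_le {α v x : ℝ} (hα : α ≤ 1) (hv : 0 < v) (hx : 0 ≤ x) :
    |(x + v) ^ α - v ^ α| ≤ |α| * v ^ (α - 1) * x := by
  have h1 := (convex_Icc v (x + v)).norm_image_sub_le_of_norm_hasDerivWithin_le (𝕜 := ℝ)
    (f := fun y : ℝ => y ^ α) (f' := fun y => α * y ^ (α - 1)) (C := |α| * v ^ (α - 1))
    (x := v) (y := x + v)
    (fun y hy => (hasDerivAt_rpow_const (Or.inl (hv.trans_le hy.1).ne')).hasDerivWithinAt)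
    (fun y hy => by
      have hy0 : 0 < y := hv.trans_le hy.1
      rw [norm_mul, norm_eq_abs, norm_eq_abs, abs_of_pos (rpow_pos_of_pos hy0 _)]
      exact mul_le_mul_of_nonneg_left (rpow_le_rpow_of_nonpos hv hy.1 (by linarith))
        (abs_nonneg _)) ⟨le_rfl, by linarith⟩ ⟨by linarith, le_rfl⟩
  simpa [norm_eq_abs, abs_of_nonneg hx] using h1

/-- Parameters for which the weighted kernel is square integrable. -/
structure KernelParams (α γ : ℝ) : Prop where
  ne : α ≠ 0
  lt₁ : -1 < 2 * α
  lt₂ : γ < 1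
  lt₃ : -1 < 2 * α - γ
  lt₄ : 2 * α - γ < 1
  lt₅ : 2 * α < 2

theorem sq_rpow_half {x : ℝ} (hx : 0 ≤ x) (a : ℝ) : (x ^ (-(a / 2))) ^ 2 = x ^ (-a) := by
  rw [← rpow_mul_natCast hx]; congr 1; push_cast; ring

theorem sq_rpow {x : ℝ} (hx : 0 ≤ x) (a : ℝ) : (x ^ a) ^ 2 = x ^ (2 * a) := by
  rw [← rpow_mul_natCast hx]; congr 1; push_cast; ring

theorem KernelParams.integrable_sq_one {α γ : ℝ} (h : KernelParams α γ) :
    Integrable (fun u => gfbmKernel α γ 1 u ^ 2) := by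
  have hm : Measurable fun u => gfbmKernel α γ 1 u ^ 2 :=
    (measurable_gfbmKernel_right α γ 1).pow_const 2
  have hInt : ∀ {a : ℝ}, -1 < a → IntegrableOn (fun u : ℝ => u ^ a) (Ioc 0 1) := fun {a} ha => by
    have := intervalIntegral.intervalIntegrable_rpow' (a := 0) (b := 1) ha
    exact (intervalIntegrable_iff_integrableOn_Ioc_of_le zero_le_one).1 this
  have hInt' : IntegrableOn (fun u : ℝ => (1 - u) ^ (2 * α)) (Ioc 0 1) := by
    have := (intervalIntegral.intervalIntegrable_rpow' (a := 0) (b := 1) h.lt₁).comp_sub_left 1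
    simp only [sub_zero, sub_self] at this
    exact (intervalIntegrable_iff_integrableOn_Ioc_of_le zero_le_one).1 this.symm
  have hpow2 : ∀ {x : ℝ}, 1 / 2 ≤ x → x ≤ 2 → ∀ a : ℝ, |a| ≤ 2 → x ^ a ≤ 4 := by
    intro x hx1 hx2 a ha
    rcases le_total 1 x with hx | hx
    · calc x ^ a ≤ x ^ (2:ℝ) := rpow_le_rpow_of_exponent_le hx (le_of_abs_le ha)
        _ ≤ 4 := by rw [rpow_two]; nlinarith
    · have hx0 : 0 < x := by linarith
      calc x ^ a ≤ x ^ (-2:ℝ) := rpow_le_rpow_of_exponent_ge hx0 hx (neg_le_of_abs_le ha)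
        _ ≤ 4 := by
          rw [rpow_neg hx0.le, rpow_two]
          rw [inv_le_comm₀ (by positivity) (by norm_num)]
          nlinarith
  have hα2 : |2 * α| ≤ 2 := abs_le.2 ⟨by linarith [h.lt₁], by linarith [h.lt₅]⟩
  have hγ2 : -γ ≤ 2 := by linarith [h.lt₄, h.lt₁]
  -- the positive half-line
  have hpos : IntegrableOn (fun u => gfbmKernel α γ 1 u ^ 2) (Ioi 0) := by
    rw [← Ioc_union_Ioi_eq_Ioi zero_le_one]
    refine IntegrableOn.union ?_ ?_
    · refine Integrable.mono' (((hInt (a := -γ) (by linarith [h.lt₂])).add hInt').const_mul 4)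
        hm.aestronglyMeasurable ?_
      refine (ae_restrict_iff' measurableSet_Ioc).2 (Eventually.of_forall fun u hu => ?_)
      rw [norm_of_nonneg (sq_nonneg _), gfbmKernel_of_pos h.ne hu.1.le,
        max_eq_left (by linarith [hu.2]), mul_pow, sq_rpow_half hu.1.le,
        sq_rpow (by linarith [hu.2])]
      have p1 : 0 ≤ (1 - u) ^ (2 * α) := rpow_nonneg (by linarith [hu.2]) _
      have p2 : 0 ≤ u ^ (-γ) := rpow_nonneg hu.1.le _
      simp only [Pi.add_apply]
      rcases le_total u (1 / 2) with hu2 | hu2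
      · have := hpow2 (x := 1 - u) (by linarith) (by linarith [hu.1]) _ hα2
        nlinarith
      · have h3 : u ^ (-γ) ≤ 4 := by
          rcases le_total 0 γ with hγ | hγ
          · exact hpow2 hu2 (by linarith [hu.2]) _ (abs_le.2 ⟨by linarith [h.lt₂], hγ2⟩)
          · linarith [rpow_le_one hu.1.le hu.2 (by linarith : 0 ≤ -γ)]
        nlinarith
    · refine (integrableOn_zero).congr_fun (fun u hu => ?_) measurableSet_Ioi
      rw [gfbmKernel_of_le h.ne (by linarith [mem_Ioi.1 hu]) (mem_Ioi.1 hu).le]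
      simp
  -- the negative half-line
  have hneg : IntegrableOn (fun v => gfbmKernel α γ 1 (-v) ^ 2) (Ioi 0) := by
    rw [← Ioc_union_Ioi_eq_Ioi zero_le_one]
    refine IntegrableOn.union ?_ ?_
    · refine Integrable.mono' (((hInt (a := -γ) (by linarith [h.lt₂])).add
        (hInt (a := 2 * α - γ) h.lt₃)).const_mul 8) (hm.comp measurable_neg).aestronglyMeasurable ?_
      refine (ae_restrict_iff' measurableSet_Ioc).2 (Eventually.of_forall fun u hu => ?_)
      rw [norm_of_nonneg (sq_nonneg _), gfbmKernel_neg zero_le_one hu.1.le, mul_pow,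
        sq_rpow_half hu.1.le]
      have p2 : 0 ≤ u ^ (-γ) := rpow_nonneg hu.1.le _
      have h3 : ((1 + u) ^ α - u ^ α) ^ 2 ≤ 8 * (1 + u ^ (2 * α)) := by
        have h4 := hpow2 (x := 1 + u) (by linarith [hu.1]) (by linarith [hu.2]) _ hα2
        rw [← sq_rpow (by linarith [hu.1])] at h4
        rw [← sq_rpow hu.1.le]
        nlinarith [sq_nonneg ((1 + u) ^ α + u ^ α)]
      simp only [Pi.add_apply]
      rw [sub_eq_add_neg (2 * α), rpow_add hu.1]
      nlinarith
    · refine Integrable.mono' ((integrableOn_Ioi_rpow_of_lt (a := 2 * α - γ - 2)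
        (by linarith [h.lt₄]) one_pos).const_mul (|α| ^ 2))
        (hm.comp measurable_neg).aestronglyMeasurable ?_
      refine (ae_restrict_iff' measurableSet_Ioi).2 (Eventually.of_forall fun u hu => ?_)
      have hu0 : 0 < u := by linarith [mem_Ioi.1 hu]
      rw [norm_of_nonneg (sq_nonneg _), gfbmKernel_neg zero_le_one hu0.le, mul_pow,
        sq_rpow_half hu0.le]
      have h4 := abs_rpow_add_sub_rpow_le (α := α) (by linarith [h.lt₅]) hu0 zero_le_one
      rw [mul_one] at h4
      calc _ ≤ (|α| * u ^ (α - 1)) ^ 2 * u ^ (-γ) := by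
            refine mul_le_mul_of_nonneg_right ?_ (by positivity)
            rw [← sq_abs]
            exact pow_le_pow_left₀ (abs_nonneg _) h4 2
        _ = |α| ^ 2 * u ^ (2 * α - γ - 2) := by
            rw [mul_pow, sq_rpow hu0.le, mul_assoc, ← rpow_add hu0]; congr 2; ring
  rw [← integrableOn_univ, ← Iic_union_Ioi (a := (0:ℝ))]
  refine IntegrableOn.union ?_ hpos
  have h5 : IntegrableOn (fun v => gfbmKernel α γ 1 (-v) ^ 2) (Ici (-0)) := by
    rw [neg_zero, integrableOn_Ici_iff_integrableOn_Ioi]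
    exact hneg
  simpa using h5.comp_neg_Iic

/-- The Hilbert space of square integrable functions on the line. -/
abbrev L2R : Type := Lp ℝ 2 (volume : Measure ℝ)

theorem inner_toLp {f g : ℝ → ℝ} (hf : MemLp f 2 volume) (hg : MemLp g 2 volume) :
    inner ℝ (hf.toLp f : L2R) (hg.toLp g) = ∫ u, f u * g u := by
  rw [L2.inner_def]
  refine integral_congr_ae ?_
  filter_upwards [hf.coeFn_toLp, hg.coeFn_toLp] with u h1 h2
  rw [h1, h2]
  simp [mul_comm]

theorem norm_toLp_sq {f : ℝ → ℝ} (hf : MemLp f 2 volume) :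
    ‖(hf.toLp f : L2R)‖ ^ 2 = ∫ u, f u ^ 2 := by
  rw [← real_inner_self_eq_norm_sq, inner_toLp]
  simp [pow_two]

theorem norm_sq_eq_integral (f : L2R) : ‖f‖ ^ 2 = ∫ u, f u ^ 2 := by
  rw [← norm_toLp_sq (Lp.memLp f), Lp.toLp_coeFn]

theorem inner_eq_integral (f g : L2R) : inner ℝ f g = ∫ u, f u * g u := by
  rw [← inner_toLp (Lp.memLp f) (Lp.memLp g), Lp.toLp_coeFn, Lp.toLp_coeFn]

/-- Restriction of a function to a measurable set. -/
noncomputable def restrL2 (A : Set ℝ) (hA : MeasurableSet A) : L2R →L[ℝ] L2R :=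
  LinearMap.mkContinuous
    { toFun := fun f => ((Lp.memLp f).indicator hA).toLp (A.indicator f)
      map_add' := fun f g => by
        rw [← MemLp.toLp_add]
        refine MemLp.toLp_congr _ _ ?_
        filter_upwards [Lp.coeFn_add f g] with u hu
        by_cases h : u ∈ A
        · simp only [h, indicator_of_mem, Pi.add_apply]
          exact hu
        · simp [h]
      map_smul' := fun c f => by
        rw [RingHom.id_apply, ← MemLp.toLp_const_smul]
        refine MemLp.toLp_congr _ _ ?_
        filter_upwards [Lp.coeFn_smul c f] with u hu
        by_cases h : u ∈ A
        · simp only [h, indicator_of_mem, Pi.smul_apply]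
          exact hu
        · simp [h] } 1 (fun f => by
    rw [one_mul]
    change ‖((Lp.memLp f).indicator hA).toLp (A.indicator f)‖ ≤ ‖f‖
    rw [Lp.norm_toLp, Lp.norm_def]
    exact ENNReal.toReal_mono (Lp.memLp f).2.ne (eLpNorm_indicator_le _))

section restr

variable {A B : Set ℝ} {hA : MeasurableSet A} {hB : MeasurableSet B}

theorem restrL2_apply (f : L2R) :
    restrL2 A hA f = ((Lp.memLp f).indicator hA).toLp (A.indicator f) := rfl

theorem coeFn_restrL2 (f : L2R) : restrL2 A hA f =ᵐ[volume] A.indicator f := by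
  rw [restrL2_apply]
  exact MemLp.coeFn_toLp _

theorem norm_restrL2_sq (f : L2R) : ‖restrL2 A hA f‖ ^ 2 = ∫ u in A, f u ^ 2 := by
  rw [norm_sq_eq_integral, ← integral_indicator hA]
  refine integral_congr_ae ?_
  filter_upwards [coeFn_restrL2 (hA := hA) f] with u h1
  rw [h1]
  by_cases h : u ∈ A <;> simp [h]

theorem restrL2_add_compl (f : L2R) : restrL2 A hA f + restrL2 Aᶜ hA.compl f = f := by
  refine Lp.ext ?_
  filter_upwards [coeFn_restrL2 (hA := hA) f, coeFn_restrL2 (hA := hA.compl) f,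
    Lp.coeFn_add (restrL2 A hA f) (restrL2 Aᶜ hA.compl f)] with u h1 h2 h3
  rw [h3, Pi.add_apply, h1, h2]
  by_cases h : u ∈ A <;> simp [h]

theorem inner_restrL2_compl (f g : L2R) :
    inner ℝ (restrL2 A hA f) (restrL2 Aᶜ hA.compl g) = 0 := by
  rw [inner_eq_integral]
  refine integral_eq_zero_of_ae ?_
  filter_upwards [coeFn_restrL2 (hA := hA) f, coeFn_restrL2 (hA := hA.compl) g] with u h1 h2
  rw [h1, h2]
  by_cases h : u ∈ A <;> simp [h]

theorem inner_restrL2_left (f g : L2R) :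
    inner ℝ (restrL2 A hA f) g = inner ℝ f (restrL2 A hA g) := by
  rw [inner_eq_integral, inner_eq_integral]
  refine integral_congr_ae ?_
  filter_upwards [coeFn_restrL2 (hA := hA) f, coeFn_restrL2 (hA := hA) g] with u h1 h2
  rw [h1, h2]
  by_cases h : u ∈ A <;> simp [h]

end restr

section kernel

variable {α γ : ℝ}

theorem integral_comp_mul_pos (g : ℝ → ℝ) {l : ℝ} (hl : 0 < l) :
    ∫ u, g u = l * ∫ u, g (l * u) := by
  rw [Measure.integral_comp_mul_left, abs_of_pos (by positivity), smul_eq_mul,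
    mul_inv_cancel_left₀ hl.ne']

theorem KernelParams.memLp (h : KernelParams α γ) {s : ℝ} (hs : 0 ≤ s) :
    MemLp (gfbmKernel α γ s) 2 volume := by
  rw [memLp_two_iff_integrable_sq (measurable_gfbmKernel_right α γ s).aestronglyMeasurable]
  rcases hs.eq_or_lt with rfl | hs
  · have : (fun u => gfbmKernel α γ 0 u ^ 2) = fun _ => 0 := by
      ext u; simp [gfbmKernel]
    rw [this]; exact integrable_zero _ _ _
  · have h1 := (h.integrable_sq_one.comp_mul_left' (inv_pos.2 hs).ne').const_mul
      ((s ^ (α - γ / 2)) ^ 2)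
    refine h1.congr (Eventually.of_forall fun u => ?_)
    beta_reduce
    rw [← mul_pow, ← gfbmKernel_mul α γ hs, mul_one, mul_inv_cancel_left₀ hs.ne']

/-- The kernel as an element of the Hilbert space. -/
noncomputable def gfbmVec (α γ s : ℝ) : L2R :=
  open Classical in
  if h : MemLp (gfbmKernel α γ s) 2 volume then h.toLp (gfbmKernel α γ s) else 0

theorem KernelParams.gfbmVec_eq (h : KernelParams α γ) {s : ℝ} (hs : 0 ≤ s) :
    gfbmVec α γ s = (h.memLp hs).toLp (gfbmKernel α γ s) := dif_pos (h.memLp hs)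

theorem KernelParams.coeFn_gfbmVec (h : KernelParams α γ) {s : ℝ} (hs : 0 ≤ s) :
    gfbmVec α γ s =ᵐ[volume] gfbmKernel α γ s := by
  rw [h.gfbmVec_eq hs]; exact MemLp.coeFn_toLp _

theorem KernelParams.inner_gfbmVec (h : KernelParams α γ) {s t : ℝ} (hs : 0 ≤ s) (ht : 0 ≤ t) :
    inner ℝ (gfbmVec α γ s) (gfbmVec α γ t) = ∫ u, gfbmKernel α γ s u * gfbmKernel α γ t u := by
  rw [h.gfbmVec_eq hs, h.gfbmVec_eq ht, inner_toLp]

theorem KernelParams.inner_gfbmVec_eq_gfbmCov (h : KernelParams α γ) {s t : ℝ} (hs : 0 ≤ s)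
    (ht : 0 ≤ t) : inner ℝ (gfbmVec α γ s) (gfbmVec α γ t) = gfbmCov α γ s t := by
  rw [h.inner_gfbmVec hs ht, gfbmCov]
  refine integral_congr_ae (Eventually.of_forall fun u => ?_)
  have := sq_rpow_half (abs_nonneg u) γ
  simp only [gfbmKernel]
  rw [← this]; ring

theorem KernelParams.inner_gfbmVec_scale (h : KernelParams α γ) {l s t : ℝ} (hl : 0 < l)
    (hs : 0 ≤ s) (ht : 0 ≤ t) : inner ℝ (gfbmVec α γ (l * s)) (gfbmVec α γ (l * t)) =
      l ^ (2 * (α - γ / 2 + 1 / 2)) * inner ℝ (gfbmVec α γ s) (gfbmVec α γ t) := by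
  rw [h.inner_gfbmVec (by positivity) (by positivity), h.inner_gfbmVec hs ht,
    integral_comp_mul_pos _ hl]
  simp only [gfbmKernel_mul α γ hl]
  rw [← integral_const_mul, ← integral_const_mul]
  congr 1; ext u
  rw [show 2 * (α - γ / 2 + 1 / 2) = 1 + 2 * (α - γ / 2) by ring, rpow_add hl, rpow_one,
    ← sq_rpow hl.le]
  ring

/-- Norms of the kernel away from a neighbourhood of the origin. -/
theorem KernelParams.norm_restr_sq (h : KernelParams α γ) {A : Set ℝ} (hA : MeasurableSet A)
    {s : ℝ} (hs : 0 ≤ s) :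
    ‖restrL2 A hA (gfbmVec α γ s)‖ ^ 2 = ∫ u in A, gfbmKernel α γ s u ^ 2 := by
  rw [norm_restrL2_sq]
  refine integral_congr_ae (ae_restrict_of_ae ?_)
  filter_upwards [h.coeFn_gfbmVec hs] with u hu
  rw [hu]

theorem KernelParams.integral_sq_scale (h : KernelParams α γ) {s : ℝ} (hs : 0 < s) :
    ∫ u, gfbmKernel α γ s u ^ 2 =
      s ^ (2 * (α - γ / 2 + 1 / 2)) * ∫ u, gfbmKernel α γ 1 u ^ 2 := by
  have h1 := h.inner_gfbmVec_scale hs zero_le_one zero_le_one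
  rw [mul_one, h.inner_gfbmVec hs.le hs.le, h.inner_gfbmVec zero_le_one zero_le_one] at h1
  simpa only [pow_two] using h1

end kernel

theorem gfbmKernel_sq_eq {α γ δ s u : ℝ} (hu : u ≠ 0) :
    gfbmKernel α γ s u ^ 2 = |u| ^ (-(γ - δ)) * gfbmKernel α δ s u ^ 2 := by
  rw [gfbmKernel, gfbmKernel, mul_pow, mul_pow, sq_rpow_half (abs_nonneg _),
    sq_rpow_half (abs_nonneg _), show -γ = -(γ - δ) + -δ by ring, rpow_add (abs_pos.2 hu)]
  ring

theorem gfbmVec_zero (α γ : ℝ) : gfbmVec α γ 0 = 0 := by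
  have h0 : gfbmKernel α γ 0 = 0 := by ext u; simp [gfbmKernel]
  have h1 : MemLp (gfbmKernel α γ 0) 2 volume := by rw [h0]; exact MemLp.zero
  rw [gfbmVec, dif_pos h1, ← norm_eq_zero, ← sq_eq_zero_iff, norm_toLp_sq, h0]
  simp

/-- The kernels are concentrated on the scale of their index. -/
theorem exists_norm_restr_gfbmVec_le {α γ : ℝ} (hα : α ≠ 0) (hγ0 : 0 ≤ γ) (hγ : γ < 1)
    (hα1 : -(1 / 2) + γ / 2 < α) (hα2 : α < 1 / 2) :
    ∃ κ > (0:ℝ), κ ≤ 2 * (α - γ / 2 + 1 / 2) ∧ ∃ C > (0:ℝ), ∀ L > (0:ℝ), ∀ x ≥ (0:ℝ),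
      ∀ (A : Set ℝ) (hA : MeasurableSet A),
      ((∀ u ∈ A, L ≤ |u|) →
        ‖restrL2 A hA (gfbmVec α γ x)‖ ^ 2 ≤ C * (x ^ (2 * (α - γ / 2 + 1 / 2) + κ) / L ^ κ)) ∧
      ((∀ u ∈ A, |u| ≤ L) →
        ‖restrL2 A hA (gfbmVec α γ x)‖ ^ 2 ≤ C * (x ^ (2 * (α - γ / 2 + 1 / 2) - κ) * L ^ κ)) := by
  set κ := min ((1 - γ) / 2) (min ((2 * α - γ + 1) / 2) ((1 - (2 * α - γ)) / 2)) with hκ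
  have h1 : κ ≤ (1 - γ) / 2 := min_le_left _ _
  have h2 : κ ≤ (2 * α - γ + 1) / 2 := (min_le_right _ _).trans (min_le_left _ _)
  have h3 : κ ≤ (1 - (2 * α - γ)) / 2 := (min_le_right _ _).trans (min_le_right _ _)
  have hκ0 : 0 < κ := lt_min (by linarith) (lt_min (by linarith) (by linarith))
  have hp : KernelParams α γ := ⟨hα, by linarith, hγ, by linarith, by linarith, by linarith⟩
  have hpm : KernelParams α (γ - κ) :=
    ⟨hα, by linarith, by linarith, by linarith, by linarith, by linarith⟩
  have hpp : KernelParams α (γ + κ) :=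
    ⟨hα, by linarith, by linarith, by linarith, by linarith, by linarith⟩
  set Nm := ∫ u, gfbmKernel α (γ - κ) 1 u ^ 2 with hNm
  set Np := ∫ u, gfbmKernel α (γ + κ) 1 u ^ 2 with hNp
  have hNm0 : 0 ≤ Nm := integral_nonneg fun _ => sq_nonneg _
  have hNp0 : 0 ≤ Np := integral_nonneg fun _ => sq_nonneg _
  refine ⟨κ, hκ0, by linarith, 1 + Nm + Np, by positivity, fun L hL x hx A hA => ?_⟩
  rcases hx.eq_or_lt with rfl | hx
  · rw [gfbmVec_zero, map_zero, norm_zero]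
    refine ⟨fun _ => ?_, fun _ => ?_⟩ <;>
    · rw [zero_pow two_ne_zero]; positivity
  have key : ∀ (δ c : ℝ), KernelParams α δ → 0 ≤ c → (∀ u ∈ A, u ≠ 0 → |u| ^ (-(γ - δ)) ≤ c) →
      ‖restrL2 A hA (gfbmVec α γ x)‖ ^ 2 ≤
        c * (x ^ (2 * (α - δ / 2 + 1 / 2)) * ∫ u, gfbmKernel α δ 1 u ^ 2) := by
    intro δ c hδ hc hA'
    have hi : Integrable fun u => gfbmKernel α δ x u ^ 2 := (hδ.memLp hx.le).integrable_sq
    rw [hp.norm_restr_sq hA hx.le, ← hδ.integral_sq_scale hx, ← integral_const_mul]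
    refine le_trans ?_ (setIntegral_le_integral (s := A) (hi.const_mul c)
      (Eventually.of_forall fun u => mul_nonneg hc (sq_nonneg _)))
    refine integral_mono_ae ((hp.memLp hx.le).integrable_sq.restrict) (hi.const_mul c).restrict ?_
    have hne : ∀ᵐ u : ℝ, u ≠ 0 := by simp [ae_iff]
    filter_upwards [ae_restrict_mem hA, ae_restrict_of_ae hne] with u hu hu0
    rw [gfbmKernel_sq_eq hu0 (δ := δ)]
    exact mul_le_mul_of_nonneg_right (hA' u hu hu0) (sq_nonneg _)
  constructor
  · intro hAL
    refine (key (γ - κ) (L ^ (-κ)) hpm (by positivity) fun u hu hu0 => ?_).trans ?_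
    · rw [sub_sub_cancel]
      exact rpow_le_rpow_of_nonpos hL (hAL u hu) (by linarith)
    · rw [← hNm, rpow_neg hL.le, show 2 * (α - (γ - κ) / 2 + 1 / 2) =
        2 * (α - γ / 2 + 1 / 2) + κ by ring]
      have : 0 ≤ x ^ (2 * (α - γ / 2 + 1 / 2) + κ) / L ^ κ := by positivity
      calc _ = Nm * (x ^ (2 * (α - γ / 2 + 1 / 2) + κ) / L ^ κ) := by field_simp
        _ ≤ _ := mul_le_mul_of_nonneg_right (by linarith) this
  · intro hAL
    refine (key (γ + κ) (L ^ κ) hpp (by positivity) fun u hu hu0 => ?_).trans ?_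
    · rw [sub_add_cancel_left, neg_neg]
      exact rpow_le_rpow (abs_nonneg _) (hAL u hu) hκ0.le
    · rw [← hNp, show 2 * (α - (γ + κ) / 2 + 1 / 2) = 2 * (α - γ / 2 + 1 / 2) - κ by ring]
      have : 0 ≤ x ^ (2 * (α - γ / 2 + 1 / 2) - κ) * L ^ κ := by positivity
      calc _ = Np * (x ^ (2 * (α - γ / 2 + 1 / 2) - κ) * L ^ κ) := by ring
        _ ≤ _ := mul_le_mul_of_nonneg_right (by linarith) this

section link

variable {Ω E : Type*} [MeasurableSpace Ω] [NormedAddCommGroup E] [InnerProductSpace ℝ E]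
  {P : Measure Ω} {X : ℝ → Ω → ℝ} {K : ℝ → E}

theorem norm_sq_sum_smul {n : ℕ} (c : Fin n → ℝ) (g : Fin n → E) :
    ‖∑ i, c i • g i‖ ^ 2 = ∑ i, ∑ j, c i * c j * inner ℝ (g i) (g j) := by
  rw [← real_inner_self_eq_norm_sq, sum_inner]
  refine Finset.sum_congr rfl fun i _ => ?_
  rw [inner_sum]
  refine Finset.sum_congr rfl fun j _ => ?_
  rw [inner_smul_left, inner_smul_right]
  simp [mul_assoc]

/-- A centered Gaussian process with covariance given by a kernel. -/
theorem IsCenteredGaussianProcess.isGaussProcOn [IsProbabilityMeasure P]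
    (hX : IsCenteredGaussianProcess P X) {S : Set ℝ}
    (hcov : ∀ s ∈ S, ∀ t ∈ S, ∫ ω, X s ω * X t ω ∂P = inner ℝ (K s) (K t)) :
    IsGaussProcOn P X K S := by
  have hlaw : ∀ (n : ℕ) (t : Fin n → ℝ) (c : Fin n → ℝ), ∃ v : NNReal,
      P.map (fun ω => ∑ i, c i * X (t i) ω) = gaussianReal 0 v ∧
      AEMeasurable (fun ω => ∑ i, c i * X (t i) ω) P ∧
      MemLp (fun ω => ∑ i, c i * X (t i) ω) 2 P ∧
      ∫ ω, (∑ i, c i * X (t i) ω) ^ 2 ∂P = v := by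
    intro n t c
    obtain ⟨v, hv⟩ := hX n t c
    have hm : AEMeasurable (fun ω => ∑ i, c i * X (t i) ω) P := by
      refine AEMeasurable.of_map_ne_zero ?_
      rw [hv]
      exact IsProbabilityMeasure.ne_zero _
    refine ⟨v, hv, hm, ?_, ?_⟩
    · have h1 : MemLp id 2 (P.map fun ω => ∑ i, c i * X (t i) ω) := by
        rw [hv]; exact memLp_id_gaussianReal 2
      exact (memLp_map_measure_iff (by fun_prop) hm).1 h1
    · have h1 : ∫ x, x ^ 2 ∂(P.map fun ω => ∑ i, c i * X (t i) ω) = v := by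
        rw [hv]
        have h2 := variance_id_gaussianReal (μ := 0) (v := v)
        rw [variance_eq_sub (memLp_id_gaussianReal 2)] at h2
        simpa using h2
      rw [integral_map hm (by fun_prop)] at h1
      exact h1
  have h1 : ∀ s, AEMeasurable (X s) P ∧ MemLp (X s) 2 P := by
    intro s
    obtain ⟨v, -, hm, hL, -⟩ := hlaw 1 (fun _ => s) (fun _ => 1)
    simp only [Finset.univ_unique, Finset.sum_singleton, one_mul] at hm hL
    exact ⟨hm, hL⟩
  refine ⟨fun s _ => (h1 s).1, fun n t ht c => ?_⟩
  obtain ⟨v, hv, -, -, hv2⟩ := hlaw n t c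
  rw [hv]
  congr 1
  refine NNReal.coe_injective ?_
  rw [← hv2]
  push_cast
  rw [norm_sq_sum_smul]
  have h2 : ∀ ω, (∑ i, c i * X (t i) ω) ^ 2 =
      ∑ i, ∑ j, c i * c j * (X (t i) ω * X (t j) ω) := by
    intro ω
    rw [pow_two, Finset.sum_mul_sum]
    exact Finset.sum_congr rfl fun i _ => Finset.sum_congr rfl fun j _ => by ring
  have hInt : ∀ i j, Integrable (fun ω => c i * c j * (X (t i) ω * X (t j) ω)) P := fun i j =>
    ((h1 (t i)).2.integrable_mul (h1 (t j)).2).const_mul _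
  simp only [h2]
  rw [integral_finsetSum _ fun i _ => integrable_finsetSum _ fun j _ => hInt i j]
  refine Finset.sum_congr rfl fun i _ => ?_
  rw [integral_finsetSum _ fun j _ => hInt i j]
  refine Finset.sum_congr rfl fun j _ => ?_
  rw [integral_const_mul, hcov _ (ht i) _ (ht j)]

theorem IsGaussProcOn.integral_cos [IsProbabilityMeasure P] {S : Set ℝ} (hX : IsGaussProcOn P X K S)
    {s t : ℝ} (hs : s ∈ S) (ht : t ∈ S) :
    ∫ ω, cos (X t ω - X s ω) ∂P = exp (-(‖K t - K s‖ ^ 2 / 2)) := by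
  have h1 := hX.law 2 ![t, s] (by intro i; fin_cases i <;> assumption) ![1, -1]
  simp only [Fin.sum_univ_two, Matrix.cons_val_zero, Matrix.cons_val_one, one_mul, neg_mul,
    one_smul, neg_smul, ← sub_eq_add_neg] at h1
  have hm : AEMeasurable (fun ω => X t ω - X s ω) P := (hX.meas t ht).sub (hX.meas s hs)
  have h2 : charFun (P.map fun ω => X t ω - X s ω) 1 = charFun (gaussianReal 0 (‖K t - K s‖₊ ^ 2)) 1 := by
    rw [h1]
  rw [charFun_gaussianReal, charFun_apply_real, integral_map hm (by fun_prop)] at h2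
  have h3 := congrArg Complex.re h2
  have hi : Integrable (fun ω => Complex.exp (((1:ℝ):ℂ) * ((X t ω - X s ω : ℝ):ℂ) * Complex.I)) P := by
    refine Integrable.of_bound (C := 1) ?_ (Eventually.of_forall fun ω => ?_)
    · exact (AEMeasurable.aestronglyMeasurable (by fun_prop))
    · rw [← Complex.ofReal_mul, Complex.norm_exp_ofReal_mul_I]
  have h4 : (∫ ω, Complex.exp (((1:ℝ):ℂ) * ((X t ω - X s ω : ℝ):ℂ) * Complex.I) ∂P).re =
      ∫ ω, cos (X t ω - X s ω) ∂P := by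
    have := integral_re (𝕜 := ℂ) hi
    simp only [RCLike.re_to_complex] at this
    rw [← this]
    congr 1; ext ω
    rw [← Complex.ofReal_mul, Complex.exp_ofReal_mul_I_re, one_mul]
  rw [h4] at h3
  rw [h3]
  have : (((1:ℝ):ℂ) * ((0:ℝ):ℂ) * Complex.I - (((‖K t - K s‖₊ ^ 2 : NNReal):ℝ):ℂ) * ((1:ℝ):ℂ) ^ 2 / 2) =
      ((-(‖K t - K s‖ ^ 2 / 2) : ℝ) : ℂ) := by
    push_cast; simp
  rw [this, ← Complex.ofReal_exp, Complex.ofReal_re]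

/-- The kernel of a Gaussian process with continuous paths is continuous. -/
theorem IsGaussProcOn.continuousOn_kernel [IsProbabilityMeasure P] {S : Set ℝ}
    (hX : IsGaussProcOn P X K S) (hc : ∀ ω, ContinuousOn (fun t => X t ω) S) :
    ContinuousOn K S := by
  intro s hs
  have h1 : Tendsto (fun t => ∫ ω, cos (X t ω - X s ω) ∂P) (nhdsWithin s S) (nhds (∫ _, 1 ∂P)) := by
    refine tendsto_integral_filter_of_dominated_convergence (fun _ => 1) ?_ ?_
      (integrable_const _) ?_
    · filter_upwards [self_mem_nhdsWithin] with t ht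
      exact (measurable_cos.comp_aemeasurable ((hX.meas t ht).sub (hX.meas s hs))).aestronglyMeasurable
    · exact Eventually.of_forall fun t => Eventually.of_forall fun ω => by
        rw [norm_eq_abs]; exact abs_cos_le_one _
    · refine Eventually.of_forall fun ω => ?_
      have h2 : Tendsto (fun t => X t ω - X s ω) (nhdsWithin s S) (nhds (X s ω - X s ω)) :=
        (hc ω s hs).sub tendsto_const_nhds
      rw [sub_self] at h2
      have := (continuous_cos.tendsto 0).comp h2
      rwa [cos_zero] at this
  have h2 : Tendsto (fun t => exp (-(‖K t - K s‖ ^ 2 / 2))) (nhdsWithin s S) (nhds 1) := by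
    have : ∫ _ : Ω, (1:ℝ) ∂P = 1 := by simp
    rw [this] at h1
    refine h1.congr' ?_
    filter_upwards [self_mem_nhdsWithin] with t ht
    exact hX.integral_cos hs ht
  have h3 := ((continuousAt_log one_ne_zero).tendsto.comp h2)
  rw [log_one] at h3
  have h4 : Tendsto (fun t => ‖K t - K s‖) (nhdsWithin s S) (nhds 0) := by
    have h5 := (continuous_sqrt.tendsto 0).comp (by simpa using h3.const_mul (-2))
    rw [sqrt_zero] at h5
    refine h5.congr fun t => ?_
    simp only [Function.comp, log_exp]
    rw [show 2 * (‖K t - K s‖ ^ 2 / 2) = ‖K t - K s‖ ^ 2 by ring, sqrt_sq (norm_nonneg _)]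
  exact tendsto_iff_norm_sub_tendsto_zero.2 h4

end link

section fracVec

variable {F : Type*} [NormedAddCommGroup F] [NormedSpace ℝ F]

theorem intervalIntegrable_sub_rpow {θ : ℝ} (hθ : 0 < θ) (t a b : ℝ) :
    IntervalIntegrable (fun u => (t - u) ^ (θ - 1)) volume a b := by
  have := (intervalIntegral.intervalIntegrable_rpow' (a := t - a) (b := t - b)
    (r := θ - 1) (by linarith)).comp_sub_left t
  simpa using this

/-- The fractional integral of a vector valued function. -/
noncomputable def fracVec (θ : ℝ) (g : ℝ → F) (t : ℝ) : F :=
  (Gamma θ)⁻¹ • ∫ u in (0:ℝ)..t, (t - u) ^ (θ - 1) • g u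

theorem intervalIntegrable_smul_of_continuousOn {θ : ℝ} (hθ : 0 < θ) {g : ℝ → F}
    (hg : ContinuousOn g (Ici 0)) {t a b : ℝ} (ha : 0 ≤ a) (hb : 0 ≤ b) :
    IntervalIntegrable (fun u => (t - u) ^ (θ - 1) • g u) volume a b :=
  (intervalIntegrable_sub_rpow hθ t a b).smul_continuousOn
    (hg.mono fun _ hu => le_trans (le_min ha hb) hu.1)

theorem tendsto_riemann_smul [CompleteSpace F] {w : ℝ → ℝ} {g : ℝ → F} {t : ℝ} (ht : 0 ≤ t)
    (hw : IntervalIntegrable w volume 0 t) (hg : ContinuousOn g (Icc 0 t)) :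
    Tendsto (fun n : ℕ => ∑ i ∈ Finset.range n,
      (∫ u in (t * (i / n))..(t * ((i + 1 : ℕ) / n)), w u) • g (t * (i / n))) atTop
      (nhds (∫ u in (0:ℝ)..t, w u • g u)) := by
  rw [Metric.tendsto_atTop]
  intro ε hε
  set W := ∫ u in (0:ℝ)..t, |w u| with hW
  have hW0 : 0 ≤ W := intervalIntegral.integral_nonneg ht fun _ _ => abs_nonneg _
  obtain ⟨δ, hδ, huc⟩ := Metric.uniformContinuousOn_iff.1
    (isCompact_Icc.uniformContinuousOn_of_continuous hg) (ε / (W + 1)) (by positivity)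
  obtain ⟨N, hN⟩ := exists_nat_gt (t / δ)
  refine ⟨N + 1, fun n hn => ?_⟩
  have hn0 : (0:ℝ) < n := by
    have : 0 < n := by omega
    exact_mod_cast this
  have hstep : t / n < δ := by
    have h1 : (N:ℝ) ≤ n := by exact_mod_cast (by omega : N ≤ n)
    rw [div_lt_iff₀ hδ] at hN
    rw [div_lt_iff₀ hn0]
    nlinarith
  let a : ℕ → ℝ := fun i => t * (i / n)
  have hamono : Monotone a := by
    intro i j hij
    have : (i:ℝ) ≤ j := by exact_mod_cast hij
    simp only [a]; gcongr
  have ha0 : a 0 = 0 := by simp [a]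
  have han : a n = t := by simp [a, hn0.ne']
  have hsub : ∀ i < n, a i ∈ Icc 0 t ∧ a (i + 1) ∈ Icc 0 t := by
    intro i hi
    rw [← ha0, ← han]
    exact ⟨⟨hamono (Nat.zero_le _), hamono hi.le⟩, ⟨hamono (Nat.zero_le _), hamono hi⟩⟩
  have hwi : ∀ i < n, IntervalIntegrable w volume (a i) (a (i + 1)) := fun i hi =>
    hw.mono_set (by
      rw [uIcc_of_le (hamono (Nat.le_succ i)), uIcc_of_le ht]
      exact Icc_subset_Icc (hsub i hi).1.1 (hsub i hi).2.2)
  have hwg : ∀ i < n, IntervalIntegrable (fun u => w u • g u) volume (a i) (a (i + 1)) :=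
    fun i hi => (hwi i hi).smul_continuousOn (hg.mono (by
      rw [uIcc_of_le (hamono (Nat.le_succ i))]
      exact Icc_subset_Icc (hsub i hi).1.1 (hsub i hi).2.2))
  have e1 : ∫ u in (0:ℝ)..t, w u • g u =
      ∑ i ∈ Finset.range n, ∫ u in (a i)..(a (i + 1)), w u • g u := by
    rw [intervalIntegral.sum_integral_adjacent_intervals hwg, ha0, han]
  have e2 : W = ∑ i ∈ Finset.range n, ∫ u in (a i)..(a (i + 1)), |w u| := by
    rw [intervalIntegral.sum_integral_adjacent_intervals (fun i hi => (hwi i hi).abs), ha0, han]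
  rw [dist_eq_norm, e1, ← Finset.sum_sub_distrib]
  have hterm : ∀ i ∈ Finset.range n,
      ‖(∫ u in (a i)..(a (i + 1)), w u) • g (a i) - ∫ u in (a i)..(a (i + 1)), w u • g u‖ ≤
        ε / (W + 1) * ∫ u in (a i)..(a (i + 1)), |w u| := by
    intro i hi
    have hi := Finset.mem_range.1 hi
    rw [← intervalIntegral.integral_smul_const, ← intervalIntegral.integral_sub
      ((hwi i hi).smul_continuousOn continuousOn_const) (hwg i hi), ← intervalIntegral.integral_const_mul]
    refine intervalIntegral.norm_integral_le_of_norm_le (hamono (Nat.le_succ i)) ?_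
      ((hwi i hi).norm.const_mul _)
    refine Eventually.of_forall fun u hu => ?_
    rw [← smul_sub, norm_smul, mul_comm, norm_eq_abs]
    refine mul_le_mul_of_nonneg_right ?_ (abs_nonneg _)
    rw [← dist_eq_norm]
    refine (huc _ (hsub i hi).1 u ⟨(hsub i hi).1.1.trans hu.1.le, hu.2.trans (hsub i hi).2.2⟩ ?_).le
    rw [dist_comm, dist_eq, abs_of_nonneg (by linarith [hu.1])]
    have : a (i + 1) - a i = t / n := by simp only [a]; push_cast; ring
    linarith [hu.2]
  refine (norm_sum_le_of_le _ hterm).trans_lt ?_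
  rw [← Finset.mul_sum, ← e2, div_mul_eq_mul_div, div_lt_iff₀ (by positivity)]
  nlinarith

/-- The finitely supported functionals approximating the fractional integral. -/
noncomputable def fracFinsupp (θ t : ℝ) (n : ℕ) : ℝ →₀ ℝ :=
  (Gamma θ)⁻¹ • ∑ i ∈ Finset.range n,
    (∫ u in (t * (i / n))..(t * ((i + 1 : ℕ) / n)), (t - u) ^ (θ - 1)) •
      Finsupp.single (t * (i / n)) 1

theorem fracFinsupp_mem (θ : ℝ) {t : ℝ} (ht : 0 ≤ t) (n : ℕ) :
    fracFinsupp θ t n ∈ Finsupp.supported ℝ ℝ (Ici (0:ℝ)) :=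
  Submodule.smul_mem _ _ (Submodule.sum_mem _ fun i _ => Submodule.smul_mem _ _
    (Finsupp.single_mem_supported ℝ _ (mem_Ici.2 (by positivity))))

theorem tendsto_fracFinsupp [CompleteSpace F] {θ : ℝ} (hθ : 0 < θ) {g : ℝ → F} (hg : ContinuousOn g (Ici 0)) {t : ℝ}
    (ht : 0 ≤ t) : Tendsto (fun n => Finsupp.linearCombination ℝ g (fracFinsupp θ t n)) atTop
      (nhds (fracVec θ g t)) := by
  simp only [fracFinsupp, map_smul, map_sum, Finsupp.linearCombination_single, one_smul]
  exact (tendsto_riemann_smul ht (intervalIntegrable_sub_rpow hθ t 0 t)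
    (hg.mono Icc_subset_Ici_self)).const_smul _

theorem fracVec_scale (θ : ℝ) (g : ℝ → F) {l t : ℝ} (hl : 0 < l) (ht : 0 ≤ t) :
    fracVec θ g (l * t) = l ^ θ • fracVec θ (fun u => g (l * u)) t := by
  rw [fracVec, fracVec, smul_comm (l ^ θ)]
  congr 1
  have h1 := intervalIntegral.smul_integral_comp_mul_left (a := 0) (b := t)
    (fun u => (l * t - u) ^ (θ - 1) • g u) l
  rw [mul_zero] at h1
  rw [← h1, ← intervalIntegral.integral_smul, ← intervalIntegral.integral_smul]
  refine intervalIntegral.integral_congr fun u hu => ?_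
  rw [uIcc_of_le ht] at hu
  beta_reduce
  rw [smul_smul, smul_smul, ← mul_sub, mul_rpow hl.le (by linarith [hu.2]), ← mul_assoc]
  congr 2
  nth_rewrite 1 [← rpow_one l]
  rw [← rpow_add hl]; congr 1; ring

theorem map_fracVec [CompleteSpace F] {G : Type*} [NormedAddCommGroup G] [NormedSpace ℝ G]
    [CompleteSpace G] (L : F →L[ℝ] G) {θ : ℝ} (hθ : 0 < θ) {g : ℝ → F}
    (hg : ContinuousOn g (Ici 0)) {t : ℝ} (ht : 0 ≤ t) :
    L (fracVec θ g t) = fracVec θ (fun u => L (g u)) t := by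
  rw [fracVec, fracVec, map_smul, ← L.intervalIntegral_comp_comm
    (intervalIntegrable_smul_of_continuousOn hθ hg le_rfl ht)]
  simp only [map_smul]

theorem norm_fracVec_le {θ : ℝ} (hθ : 0 < θ) {g : ℝ → F} {t B : ℝ} (ht : 0 ≤ t)
    (hB : ∀ u ∈ Icc 0 t, ‖g u‖ ≤ B) : ‖fracVec θ g t‖ ≤ (Gamma θ)⁻¹ * (t ^ θ / θ * B) := by
  have hG := Gamma_pos_of_pos hθ
  rw [fracVec, norm_smul, norm_of_nonneg (inv_pos.2 hG).le]
  refine mul_le_mul_of_nonneg_left ?_ (inv_pos.2 hG).le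
  have e : ∫ u in (0:ℝ)..t, (t - u) ^ (θ - 1) = t ^ θ / θ := by
    rw [intervalIntegral.integral_comp_sub_left (fun u => u ^ (θ - 1)), sub_self, sub_zero,
      integral_rpow (Or.inl (by linarith)), sub_add_cancel, zero_rpow hθ.ne', sub_zero]
  rw [← e, ← intervalIntegral.integral_mul_const]
  refine intervalIntegral.norm_integral_le_of_norm_le ht (Eventually.of_forall fun u hu => ?_)
    ((intervalIntegrable_sub_rpow hθ t 0 t).mul_const B)
  rw [norm_smul, norm_of_nonneg (rpow_nonneg (by linarith [hu.2]) _)]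
  exact mul_le_mul_of_nonneg_left (hB u ⟨hu.1.le, hu.2⟩) (rpow_nonneg (by linarith [hu.2]) _)

end fracVec

section inner

variable {E : Type*} [NormedAddCommGroup E] [InnerProductSpace ℝ E] [CompleteSpace E]

theorem inner_fracVec_left {θ : ℝ} (hθ : 0 < θ) {g : ℝ → E} (hg : ContinuousOn g (Ici 0))
    {t : ℝ} (ht : 0 ≤ t) (f : E) :
    inner ℝ f (fracVec θ g t) = fracVec θ (fun u => (inner ℝ f (g u) : ℝ)) t :=
  map_fracVec (F := E) (G := ℝ) (innerSL ℝ f : E →L[ℝ] ℝ) hθ hg ht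

theorem fracVec_const_mul (θ : ℝ) {g g' : ℝ → ℝ} {t c : ℝ} (ht : 0 ≤ t)
    (h : ∀ u, 0 ≤ u → g' u = c * g u) : fracVec θ g' t = c * fracVec θ g t := by
  rw [fracVec, fracVec, smul_eq_mul, smul_eq_mul, mul_left_comm,
    ← intervalIntegral.integral_const_mul c]
  refine congrArg ((Gamma θ)⁻¹ * ·) (intervalIntegral.integral_congr fun u hu => ?_)
  rw [uIcc_of_le ht] at hu
  simp only [smul_eq_mul, h u hu.1]; ring

theorem inner_fracVec_fracVec_mul {θ : ℝ} (hθ : 0 < θ) {g g' : ℝ → E}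
    (hg : ContinuousOn g (Ici 0)) (hg' : ContinuousOn g' (Ici 0)) {c : ℝ}
    (h : ∀ u v, 0 ≤ u → 0 ≤ v → inner ℝ (g' u) (g' v) = c * inner ℝ (g u) (g v)) {s t : ℝ}
    (hs : 0 ≤ s) (ht : 0 ≤ t) :
    inner ℝ (fracVec θ g' s) (fracVec θ g' t) = c * inner ℝ (fracVec θ g s) (fracVec θ g t) := by
  rw [inner_fracVec_left hθ hg' ht, inner_fracVec_left hθ hg ht]
  refine fracVec_const_mul θ ht fun u hu => ?_
  rw [real_inner_comm, inner_fracVec_left hθ hg' hs, real_inner_comm, inner_fracVec_left hθ hg hs]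
  exact fracVec_const_mul θ hs fun v hv => h u v hu hv

end inner

section gauss

variable {Ω E : Type*} [MeasurableSpace Ω] [NormedAddCommGroup E] [InnerProductSpace ℝ E]
  {P : Measure Ω} {X : ℝ → Ω → ℝ} {K : ℝ → E} {S : Set ℝ}

theorem IsGaussProcOn.law_linearCombination (hX : IsGaussProcOn P X K S) {A : ℝ →₀ ℝ}
    (hA : A ∈ Finsupp.supported ℝ ℝ S) :
    AEMeasurable (fun ω => Finsupp.linearCombination ℝ (fun t => X t ω) A) P ∧
    P.map (fun ω => Finsupp.linearCombination ℝ (fun t => X t ω) A) =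
      gaussianReal 0 (‖Finsupp.linearCombination ℝ K A‖₊ ^ 2) := by
  let e := A.support.equivFin
  have hA' : ∀ x ∈ A.support, x ∈ S := fun x hx => (Finsupp.mem_supported _ _).1 hA hx
  have key : ∀ g : ℝ → E, Finsupp.linearCombination ℝ g A =
      ∑ i, A (e.symm i) • g (e.symm i) := by
    intro g
    rw [Finsupp.linearCombination_apply, Finsupp.sum, ← Finset.sum_coe_sort]
    exact Fintype.sum_equiv e _ _ fun x => by simp
  have key' : ∀ g : ℝ → ℝ, Finsupp.linearCombination ℝ g A =
      ∑ i, A (e.symm i) * g (e.symm i) := by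
    intro g
    rw [Finsupp.linearCombination_apply, Finsupp.sum, ← Finset.sum_coe_sort]
    exact Fintype.sum_equiv e _ _ fun x => by simp
  simp only [key, key']
  refine ⟨Finset.aemeasurable_fun_sum _ fun i _ =>
    (hX.meas _ (hA' _ (e.symm i).2)).const_mul _, ?_⟩
  exact hX.law _ (fun i => (e.symm i : ℝ)) (fun i => hA' _ (e.symm i).2) fun i => A (e.symm i)

theorem IsGaussProcOn.law_of_tendsto [IsProbabilityMeasure P] (hX : IsGaussProcOn P X K S)
    {A : ℕ → ℝ →₀ ℝ} (hA : ∀ n, A n ∈ Finsupp.supported ℝ ℝ S) {Z : Ω → ℝ} {v : E}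
    (hZ : ∀ ω, Tendsto (fun n => Finsupp.linearCombination ℝ (fun t => X t ω) (A n)) atTop
      (nhds (Z ω)))
    (hv : Tendsto (fun n => Finsupp.linearCombination ℝ K (A n)) atTop (nhds v)) :
    AEMeasurable Z P ∧ P.map Z = gaussianReal 0 (‖v‖₊ ^ 2) := by
  have hm : AEMeasurable Z P := aemeasurable_of_tendsto_metrizable_ae' 
    (fun n => (hX.law_linearCombination (hA n)).1) (Eventually.of_forall hZ)
  refine ⟨hm, ?_⟩
  have : IsProbabilityMeasure (P.map Z) := Measure.isProbabilityMeasure_map hm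
  refine Measure.ext_of_charFun (funext fun x => ?_)
  have h1 : Tendsto (fun n => charFun (P.map fun ω =>
      Finsupp.linearCombination ℝ (fun t => X t ω) (A n)) x) atTop (nhds (charFun (P.map Z) x)) := by
    simp only [charFun_apply_real]
    rw [integral_map hm (by fun_prop)]
    simp only [integral_map (hX.law_linearCombination (hA _)).1 
      (by fun_prop : AEStronglyMeasurable (fun y : ℝ => Complex.exp (x * y * Complex.I)) _)]
    refine tendsto_integral_of_dominated_convergence (fun _ => 1) (fun n => ?_)
      (integrable_const _) (fun n => ?_) (Eventually.of_forall fun ω => ?_)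
    · have := (hX.law_linearCombination (hA n)).1
      exact AEMeasurable.aestronglyMeasurable (by fun_prop)
    · refine Eventually.of_forall fun ω => ?_
      rw [← Complex.ofReal_mul, Complex.norm_exp_ofReal_mul_I]
    · have h2 : Continuous fun y : ℝ => Complex.exp (x * y * Complex.I) := by fun_prop
      exact (h2.tendsto _).comp (hZ ω)
  have h3 : Tendsto (fun n => charFun (P.map fun ω =>
      Finsupp.linearCombination ℝ (fun t => X t ω) (A n)) x) atTop
      (nhds (charFun (gaussianReal 0 (‖v‖₊ ^ 2)) x)) := by
    simp only [(hX.law_linearCombination (hA _)).2, charFun_gaussianReal]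
    have h4 : Continuous fun w : E =>
      Complex.exp (x * ((0:ℝ):ℂ) * Complex.I - (((‖w‖₊ ^ 2 : NNReal) : ℝ) : ℂ) * x ^ 2 / 2) := by
      fun_prop
    exact (h4.tendsto v).comp hv
  exact tendsto_nhds_unique h1 h3

theorem fracInt_eq_fracVec (θ : ℝ) (X : ℝ → Ω → ℝ) (t : ℝ) (ω : Ω) :
    fracInt θ X t ω = fracVec θ (fun u => X u ω) t := rfl

/-- The fractional integral of a Gaussian process. -/
theorem IsGaussProcOn.fracInt [CompleteSpace E] [IsProbabilityMeasure P] (hX : IsGaussProcOn P X K (Ici 0))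
    (hc : ∀ ω, ContinuousOn (fun t => X t ω) (Ici 0)) {θ : ℝ} (hθ : 0 < θ) :
    IsGaussProcOn P (fracInt θ X) (fracVec θ K) (Ici 0) := by
  have hK := hX.continuousOn_kernel hc
  refine ⟨fun t ht => (hX.law_of_tendsto (fracFinsupp_mem θ ht)
    (fun ω => tendsto_fracFinsupp hθ (hc ω) ht) (tendsto_fracFinsupp hθ hK ht)).1,
    fun n t ht c => ?_⟩
  refine (hX.law_of_tendsto (A := fun k => ∑ i, c i • fracFinsupp θ (t i) k)
    (fun k => Submodule.sum_mem _ fun i _ => Submodule.smul_mem _ _ (fracFinsupp_mem θ (ht i) k))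
    (fun ω => ?_) ?_).2
  · simp only [map_sum, map_smul]
    exact tendsto_finsetSum _ fun i _ => (tendsto_fracFinsupp hθ (hc ω) (ht i)).const_smul (c i)
  · simp only [map_sum, map_smul]
    exact tendsto_finsetSum _ fun i _ => (tendsto_fracFinsupp hθ hK (ht i)).const_smul (c i)

end gauss

section modulus

theorem rpow_sub_rpow_le_one {θ s t : ℝ} (hθ : 0 < θ) (hs : 0 ≤ s) (hst : s ≤ t) (ht : t ≤ 1) :
    t ^ θ - s ^ θ ≤ max 1 θ * (t - s) ^ min θ 1 := by
  rcases le_total θ 1 with h | h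
  · rw [max_eq_left h, min_eq_left h, one_mul]
    have := rpow_add_le_add_rpow (sub_nonneg.2 hst) hs hθ.le h
    rw [sub_add_cancel] at this
    linarith
  · rw [max_eq_right h, min_eq_right h, rpow_one]
    rcases hst.eq_or_lt with rfl | hlt
    · simp
    obtain ⟨c, hc1, hc2⟩ := exists_hasDerivAt_eq_slope (fun x : ℝ => x ^ θ)
      (fun x => θ * x ^ (θ - 1)) hlt
      (fun x _ => (hasDerivAt_rpow_const (Or.inr h)).continuousAt.continuousWithinAt)
      (fun x _ => hasDerivAt_rpow_const (Or.inr h))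
    have h1 : c ^ (θ - 1) ≤ 1 :=
      rpow_le_one (hs.trans hc1.1.le) (hc1.2.le.trans ht) (by linarith)
    rw [eq_div_iff (by linarith)] at hc2
    rw [← hc2]
    have : θ * c ^ (θ - 1) ≤ θ := by nlinarith
    exact mul_le_mul_of_nonneg_right this (by linarith)

theorem abs_fracVec_sub_le_aux {θ : ℝ} (hθ : 0 < θ) {f : ℝ → ℝ} (hf : ContinuousOn f (Ici 0))
    {s t B : ℝ} (hs : 0 ≤ s) (hst : s ≤ t) (hB : ∀ u ∈ Icc 0 t, |f u| ≤ B) :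
    |fracVec θ f t - fracVec θ f s| ≤
      (Gamma θ)⁻¹ * (B * (|t ^ θ - s ^ θ| + 2 * (t - s) ^ θ) / θ) := by
  have hG := Gamma_pos_of_pos hθ
  have ht := hs.trans hst
  have hi : ∀ {a b : ℝ}, 0 ≤ a → 0 ≤ b → IntervalIntegrable
      (fun u => (t - u) ^ (θ - 1) • f u) volume a b :=
    intervalIntegrable_smul_of_continuousOn (F := ℝ) hθ hf
  have e1 : ∀ a b c : ℝ, ∫ u in a..b, (c - u) ^ (θ - 1) = ((c - a) ^ θ - (c - b) ^ θ) / θ := by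
    intro a b c
    rw [intervalIntegral.integral_comp_sub_left (fun u => u ^ (θ - 1)),
      integral_rpow (Or.inl (by linarith)), sub_add_cancel]
  have hB0 : 0 ≤ B := (abs_nonneg _).trans (hB 0 ⟨le_rfl, ht⟩)
  have hd : ∀ u ∈ Ioo 0 s, 
      |(t - u) ^ (θ - 1) - (s - u) ^ (θ - 1)| =
        SignType.sign (θ - 1) * ((t - u) ^ (θ - 1) - (s - u) ^ (θ - 1)) := by
    intro u hu
    rcases lt_trichotomy θ 1 with h | h | h
    · rw [sign_neg (by linarith)]
      have : (t - u) ^ (θ - 1) ≤ (s - u) ^ (θ - 1) :=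
        rpow_le_rpow_of_nonpos (by linarith [hu.2]) (by linarith) (by linarith)
      rw [abs_of_nonpos (by linarith)]; simp
    · simp [h]
    · rw [sign_pos (by linarith)]
      have : (s - u) ^ (θ - 1) ≤ (t - u) ^ (θ - 1) :=
        rpow_le_rpow (by linarith [hu.2]) (by linarith) (by linarith)
      rw [abs_of_nonneg (by linarith)]; simp
  have hI1 : |∫ u in (0:ℝ)..s, ((t - u) ^ (θ - 1) - (s - u) ^ (θ - 1)) * f u| ≤
      B * (|t ^ θ - s ^ θ| + (t - s) ^ θ) / θ := by
    have hInt := (intervalIntegrable_sub_rpow hθ t 0 s).sub (intervalIntegrable_sub_rpow hθ s 0 s)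
    have h1 : |∫ u in (0:ℝ)..s, ((t - u) ^ (θ - 1) - (s - u) ^ (θ - 1)) * f u| ≤
        ∫ u in (0:ℝ)..s, SignType.sign (θ - 1) * ((t - u) ^ (θ - 1) - (s - u) ^ (θ - 1)) * B := by
      rw [← norm_eq_abs]
      refine intervalIntegral.norm_integral_le_of_norm_le hs ?_
        ((hInt.const_mul _).mul_const B)
      filter_upwards [compl_mem_ae_iff.2 (measure_singleton s)] with u hus hu
      rw [norm_eq_abs, abs_mul, hd u ⟨hu.1, lt_of_le_of_ne hu.2 hus⟩]
      refine mul_le_mul_of_nonneg_left (hB u ⟨hu.1.le, hu.2.trans hst⟩) ?_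
      rw [← hd u ⟨hu.1, lt_of_le_of_ne hu.2 hus⟩]
      exact abs_nonneg _
    refine h1.trans ?_
    rw [intervalIntegral.integral_mul_const, intervalIntegral.integral_const_mul,
      intervalIntegral.integral_sub (intervalIntegrable_sub_rpow hθ t 0 s)
      (intervalIntegrable_sub_rpow hθ s 0 s), e1, e1, sub_zero, sub_zero, sub_self,
      zero_rpow hθ.ne', sub_zero, mul_comm, mul_div_assoc]
    refine mul_le_mul_of_nonneg_left ?_ hB0
    have hp : 0 ≤ (t - s) ^ θ := rpow_nonneg (by linarith) _
    have hx : ∀ σ : SignType, ∀ x : ℝ, σ * x ≤ |x| := by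
      intro σ x
      cases σ <;> simp [neg_le_abs, le_abs_self]
    refine (hx _ _).trans ?_
    rw [← sub_div, abs_div, abs_of_pos hθ]
    gcongr
    rw [show t ^ θ - (t - s) ^ θ - s ^ θ = (t ^ θ - s ^ θ) - (t - s) ^ θ by ring]
    exact (abs_sub _ _).trans_eq (by rw [abs_of_nonneg hp])
  have hI2 : |∫ u in s..t, (t - u) ^ (θ - 1) * f u| ≤ B * (t - s) ^ θ / θ := by
    have h1 : |∫ u in s..t, (t - u) ^ (θ - 1) * f u| ≤ ∫ u in s..t, (t - u) ^ (θ - 1) * B := by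
      rw [← norm_eq_abs]
      refine intervalIntegral.norm_integral_le_of_norm_le hst (Eventually.of_forall fun u hu => ?_)
        ((intervalIntegrable_sub_rpow hθ t s t).mul_const B)
      have := rpow_nonneg (by linarith [hu.2] : 0 ≤ t - u) (θ - 1)
      rw [norm_eq_abs, abs_mul, abs_of_nonneg this]
      exact mul_le_mul_of_nonneg_left (hB u ⟨hs.trans hu.1.le, hu.2⟩) this
    refine h1.trans_eq ?_
    rw [intervalIntegral.integral_mul_const, e1, sub_self, zero_rpow hθ.ne']
    ring
  have e : fracVec θ f t - fracVec θ f s = (Gamma θ)⁻¹ *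
      ((∫ u in (0:ℝ)..s, ((t - u) ^ (θ - 1) - (s - u) ^ (θ - 1)) * f u) +
        ∫ u in s..t, (t - u) ^ (θ - 1) * f u) := by
    rw [fracVec, fracVec, smul_eq_mul, smul_eq_mul, ← mul_sub,
      ← intervalIntegral.integral_add_adjacent_intervals (hi le_rfl hs) (hi hs ht), add_sub_right_comm,
      ← intervalIntegral.integral_sub (hi le_rfl hs)
        (intervalIntegrable_smul_of_continuousOn hθ hf le_rfl hs)]
    simp only [smul_eq_mul, sub_mul]
  rw [e, abs_mul, abs_of_pos (inv_pos.2 hG)]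
  refine mul_le_mul_of_nonneg_left ((abs_add_le _ _).trans ((add_le_add hI1 hI2).trans_eq ?_))
    (inv_pos.2 hG).le
  ring

/-- Fractional integrals of bounded functions are Hölder continuous. -/
theorem exists_abs_fracVec_sub_le {θ : ℝ} (hθ : 0 < θ) : ∃ C > (0:ℝ), ∀ f : ℝ → ℝ,
    ContinuousOn f (Ici 0) → ∀ T > 0, ∀ B, (∀ u ∈ Icc 0 T, |f u| ≤ B) → ∀ s ∈ Icc 0 T,
    ∀ t ∈ Icc 0 T, |fracVec θ f t - fracVec θ f s| ≤
      C * (B * T ^ θ * (|t - s| / T) ^ min θ 1) := by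
  have hG := Gamma_pos_of_pos hθ
  refine ⟨(Gamma θ)⁻¹ * ((max 1 θ + 2) / θ), by positivity, ?_⟩
  intro f hf T hT B hB
  have key : ∀ s t, 0 ≤ s → s ≤ t → t ≤ T → |fracVec θ f t - fracVec θ f s| ≤
      (Gamma θ)⁻¹ * ((max 1 θ + 2) / θ) * (B * T ^ θ * ((t - s) / T) ^ min θ 1) := by
    intro s t hs hst htT
    have h1 := abs_fracVec_sub_le_aux hθ hf hs hst fun u hu => hB u ⟨hu.1, hu.2.trans htT⟩
    refine h1.trans ?_
    rw [mul_assoc]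
    refine mul_le_mul_of_nonneg_left ?_ (inv_pos.2 hG).le
    have hB0 : 0 ≤ B := (abs_nonneg _).trans (hB 0 ⟨le_rfl, hT.le⟩)
    have ht := hs.trans hst
    have h2 := rpow_sub_rpow_le_one hθ (div_nonneg hs hT.le) (div_le_div_of_nonneg_right hst hT.le)
      ((div_le_one hT).2 htT)
    rw [div_rpow ht hT.le, div_rpow hs hT.le, ← sub_div, ← sub_div,
      div_le_iff₀ (rpow_pos_of_pos hT _)] at h2
    have h3 : (t - s) ^ θ ≤ ((t - s) / T) ^ min θ 1 * T ^ θ := by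
      rw [← div_le_iff₀ (rpow_pos_of_pos hT _), ← div_rpow (by linarith) hT.le]
      have hx1 : (t - s) / T ≤ 1 := (div_le_one hT).2 (by linarith)
      exact rpow_le_rpow_of_exponent_ge_of_imp (div_nonneg (by linarith) hT.le) hx1 (min_le_left _ _)
        (fun _ h0 => absurd h0 hθ.ne')
    rw [abs_of_nonneg (sub_nonneg.2 (rpow_le_rpow hs hst hθ.le))]
    have h4 : t ^ θ - s ^ θ + 2 * (t - s) ^ θ ≤
        (max 1 θ + 2) * (((t - s) / T) ^ min θ 1 * T ^ θ) := by linarith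
    calc B * (t ^ θ - s ^ θ + 2 * (t - s) ^ θ) / θ
        ≤ B * ((max 1 θ + 2) * (((t - s) / T) ^ min θ 1 * T ^ θ)) / θ := by gcongr
      _ = _ := by ring
  intro s hs t ht
  rcases le_total s t with h | h
  · rw [abs_of_nonneg (sub_nonneg.2 h : 0 ≤ t - s)]
    exact key s t hs.1 h ht.2
  · rw [abs_sub_comm, abs_sub_comm t s, abs_of_nonneg (sub_nonneg.2 h : 0 ≤ s - t)]
    exact key t s ht.1 h hs.2

theorem continuousOn_fracVec {θ : ℝ} (hθ : 0 < θ) {f : ℝ → ℝ} (hf : ContinuousOn f (Ici 0)) :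
    ContinuousOn (fracVec θ f) (Ici 0) := by
  obtain ⟨C, hC, h⟩ := exists_abs_fracVec_sub_le hθ
  intro s hs
  have hs0 : 0 ≤ s := hs
  obtain ⟨B, hB⟩ := ((isCompact_Icc (a := (0:ℝ)) (b := s + 1)).image_of_continuousOn
    ((continuous_abs.comp_continuousOn (hf.mono Icc_subset_Ici_self)))).bddAbove
  have h1 : ∀ t ∈ Icc 0 (s + 1), |fracVec θ f t - fracVec θ f s| ≤
      C * (B * (s + 1) ^ θ * (|t - s| / (s + 1)) ^ min θ 1) := fun t ht =>
    h f hf (s + 1) (by linarith) B (fun u hu => hB ⟨u, hu, rfl⟩) s ⟨hs0, by linarith⟩ t ht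
  have hm : (0:ℝ) < min θ 1 := lt_min hθ one_pos
  refine tendsto_iff_dist_tendsto_zero.2 (squeeze_zero' (Eventually.of_forall fun _ => dist_nonneg)
    (g := fun t => C * (B * (s + 1) ^ θ * (|t - s| / (s + 1)) ^ min θ 1)) ?_ ?_)
  · filter_upwards [self_mem_nhdsWithin, mem_nhdsWithin_of_mem_nhds (Iio_mem_nhds (lt_add_one s))]
      with t ht1 ht2
    exact h1 t ⟨ht1, le_of_lt ht2⟩
  · have : Continuous fun t => C * (B * (s + 1) ^ θ * (|t - s| / (s + 1)) ^ min θ 1) := by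
      have h2 : Continuous fun t => (|t - s| / (s + 1)) ^ min θ 1 :=
        ((by fun_prop : Continuous fun t => |t - s| / (s + 1))).rpow_const fun _ => Or.inr hm.le
      fun_prop
    have h3 := this.tendsto s
    simp only [sub_self, abs_zero, zero_div, zero_rpow hm.ne', mul_zero] at h3
    exact h3.mono_left nhdsWithin_le_nhds

end modulus

section tail

variable {Ω E : Type*} [MeasurableSpace Ω] [NormedAddCommGroup E] [InnerProductSpace ℝ E]
  {P : Measure Ω} [IsProbabilityMeasure P] {X : ℝ → Ω → ℝ} {K : ℝ → E} {h : ℝ}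

theorem IsSelfSimGauss.exists_runSup_gt_le (hX : IsSelfSimGauss P X K h) :
    ∃ C > (0:ℝ), ∀ t > 0, ∀ x > 0, P {ω | x * t ^ h < runSup X t ω} ≤ ENNReal.ofReal (C / x) := by
  obtain ⟨r, hr0, hr⟩ : ∃ r > (0:ℝ), 2 / 3 ≤ P {ω | runSup X 1 ω ≤ r} := by
    have h1 : Tendsto (fun n : ℕ => P {ω | runSup X 1 ω ≤ n}) atTop
        (nhds (P (⋃ n : ℕ, {ω | runSup X 1 ω ≤ n}))) := by
      refine tendsto_measure_iUnion_atTop fun n m hnm ω hω => ?_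
      have : (n:ℝ) ≤ m := by exact_mod_cast hnm
      exact le_trans (show runSup X 1 ω ≤ n from hω) this
    have h2 : (⋃ n : ℕ, {ω | runSup X 1 ω ≤ n}) = univ :=
      eq_univ_of_forall fun ω => mem_iUnion.2 (exists_nat_ge (runSup X 1 ω))
    rw [h2, measure_univ] at h1
    have h3 : (2 / 3 : ENNReal) < 1 := by
      rw [ENNReal.div_lt_iff (by simp) (by simp)]; norm_num
    obtain ⟨n, hn1, hn2⟩ := ((h1.eventually_const_lt h3).and (eventually_ge_atTop 1)).exists
    exact ⟨n, by exact_mod_cast hn2, hn1.le⟩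
  have key : ∀ τ > 1, P {ω | τ * r < runSup X 1 ω} ≤ ENNReal.ofReal (2 / τ) := by
    intro τ hτ
    have hgr := IsSelfSimGauss.grid_mem (zero_le_one (α := ℝ))
    have h1 : ∀ n, P (procBox X (gridPts 1 n) fun _ => τ * r)ᶜ ≤ ENNReal.ofReal (2 / τ) := by
      intro n
      refine (hX.proc.measure_compl_le (hgr n) hτ (hr.trans (measure_mono ?_))).trans
        (ENNReal.ofReal_le_ofReal ?_)
      · rw [setOf_runSup_le hX.cont zero_le_one]
        exact iInter_subset _ n
      · rw [one_div, inv_rpow zero_le_two, ← one_div, div_le_div_iff₀ (by positivity) (by linarith)]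
        have h2 := one_add_mul_self_le_rpow_one_add (s := 1) (by norm_num) (p := (τ + 1) / 2)
          (by linarith)
        norm_num at h2
        linarith
    have h2 : {ω | τ * r < runSup X 1 ω} = ⋃ n, (procBox X (gridPts 1 n) fun _ => τ * r)ᶜ := by
      rw [← compl_iInter, ← setOf_runSup_le hX.cont zero_le_one]
      ext ω; simp
    rw [h2]
    refine le_of_tendsto' (tendsto_measure_iUnion_atTop fun n m hnm => ?_) h1
    exact compl_subset_compl.2 fun ω hω s hs => hω s (gridPts_mono 1 hnm hs)
  refine ⟨2 * r, by positivity, fun t ht x hx => ?_⟩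
  have e : P {ω | x * t ^ h < runSup X t ω} = P {ω | x < runSup X 1 ω} := by
    have h1 := hX.measure_runSup_le ht (x * t ^ h)
    rw [mul_div_cancel_right₀ _ (rpow_pos_of_pos ht h).ne'] at h1
    have h2 := prob_compl_eq_one_sub₀ (hX.nullMeasurableSet ht.le (x * t ^ h))
    have h3 := prob_compl_eq_one_sub₀ (hX.nullMeasurableSet zero_le_one x)
    rw [h1, ← h3] at h2
    simpa only [compl_ofPred, not_le] using h2
  rw [e]
  rcases le_or_gt (x / r) 1 with hxr | hxr
  · refine prob_le_one.trans ?_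
    rw [← ENNReal.ofReal_one]
    refine ENNReal.ofReal_le_ofReal ?_
    rw [div_le_one hr0] at hxr
    rw [le_div_iff₀ hx]; linarith
  · have := key _ hxr
    rw [div_mul_cancel₀ _ hr0.ne'] at this
    refine this.trans_eq ?_
    congr 1; field_simp

theorem IsSelfSimGauss.hasModulus_fracInt (hX : IsSelfSimGauss P X K h) {θ : ℝ} (hθ : 0 < θ) :
    HasModulus P (fracInt θ X) (h + θ) := by
  obtain ⟨C, hC, hle⟩ := exists_abs_fracVec_sub_le hθ
  obtain ⟨D, hD, htail⟩ := hX.exists_runSup_gt_le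
  refine ⟨D * C, by positivity, min θ 1, lt_min hθ one_pos, fun t ht l hl => ?_⟩
  refine (measure_mono ?_).trans ((htail t ht (l / C) (by positivity)).trans_eq ?_)
  · rintro ω ⟨s, hs, r, hr, hlt⟩
    have h1 := hle (fun u => X u ω) (hX.cont ω) t ht (runSup X t ω)
      (fun u hu => abs_le_runSup (hX.cont ω) hu) r hr s hs
    rw [← fracInt_eq_fracVec, ← fracInt_eq_fracVec] at h1
    have h2 := hlt.trans_le h1
    rw [rpow_add ht] at h2
    have hp := rpow_pos_of_pos ht θ
    have hd : 0 < (|s - r| / t) ^ min θ 1 := by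
      rcases (rpow_nonneg (div_nonneg (abs_nonneg (s - r)) ht.le) (min θ 1)).eq_or_lt with h0 | h0
      · rw [← h0] at h2; simp at h2
      · exact h0
    have h3 : l * t ^ h * (t ^ θ * (|s - r| / t) ^ min θ 1) <
        C * runSup X t ω * (t ^ θ * (|s - r| / t) ^ min θ 1) := by
      calc _ = _ := by ring
        _ < _ := h2
        _ = _ := by ring
    have h4 := lt_of_mul_lt_mul_right h3 (by positivity)
    rw [mem_ofPred_eq, div_mul_eq_mul_div, div_lt_iff₀ hC]
    linarith
  · congr 1; field_simp

end tail

section gfbm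

variable {Ω : Type*} [MeasurableSpace Ω] {P : Measure Ω} [IsProbabilityMeasure P] {α γ : ℝ}
  {X : ℝ → Ω → ℝ}

theorem norm_sum_smul_scale {E : Type*} [NormedAddCommGroup E] [InnerProductSpace ℝ E]
    {K : ℝ → E} {h l : ℝ} (hl : 0 < l)
    (hK : ∀ s t, 0 ≤ s → 0 ≤ t → inner ℝ (K (l * s)) (K (l * t)) = l ^ (2 * h) * inner ℝ (K s) (K t))
    (n : ℕ) (t c : Fin n → ℝ) (ht : ∀ i, 0 ≤ t i) :
    ‖∑ i, c i • K (l * t i)‖ = l ^ h * ‖∑ i, c i • K (t i)‖ := by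
  have hp := (rpow_pos_of_pos hl h).le
  rw [← sq_eq_sq₀ (norm_nonneg _) (by positivity), mul_pow, norm_sq_sum_smul, norm_sq_sum_smul,
    Finset.mul_sum]
  refine Finset.sum_congr rfl fun i _ => ?_
  rw [Finset.mul_sum]
  refine Finset.sum_congr rfl fun j _ => ?_
  rw [hK _ _ (ht i) (ht j), ← sq_rpow hl.le]
  ring

theorem IsGFBM.isSelfSimGauss (hX : IsGFBM P α γ X) (hp : KernelParams α γ) :
    IsSelfSimGauss P X (gfbmVec α γ) (α - γ / 2 + 1 / 2) where
  proc := hX.1.isGaussProcOn fun s hs t ht => by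
    rw [hX.2.2.2 s t hs ht, hp.inner_gfbmVec_eq_gfbmCov hs ht]
  cont := hX.2.1
  scaling l hl := norm_sum_smul_scale hl fun s t hs ht => hp.inner_gfbmVec_scale hl hs ht

theorem IsGFBM.continuousOn_gfbmVec (hX : IsGFBM P α γ X) (hp : KernelParams α γ) :
    ContinuousOn (gfbmVec α γ) (Ici 0) :=
  (hX.isSelfSimGauss hp).proc.continuousOn_kernel hX.2.1

theorem IsGFBM.isSelfSimGauss_fracInt (hX : IsGFBM P α γ X) (hp : KernelParams α γ) {θ : ℝ}
    (hθ : 0 < θ) : IsSelfSimGauss P (fracInt θ X) (fracVec θ (gfbmVec α γ))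
      (α - γ / 2 + 1 / 2 + θ) where
  proc := (hX.isSelfSimGauss hp).proc.fracInt hX.2.1 hθ
  cont ω := continuousOn_fracVec hθ (hX.2.1 ω)
  scaling l hl := norm_sum_smul_scale hl fun s t hs ht => by
    have hc := hX.continuousOn_gfbmVec hp
    have hc' : ContinuousOn (fun u => gfbmVec α γ (l * u)) (Ici 0) :=
      hc.comp (by fun_prop) fun u hu => mul_nonneg hl.le hu
    rw [fracVec_scale _ _ hl hs, fracVec_scale _ _ hl ht, inner_smul_left, inner_smul_right,
      inner_fracVec_fracVec_mul hθ hc hc' (fun u v hu hv => hp.inner_gfbmVec_scale hl hu hv) hs ht,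
      mul_add 2 _ θ, rpow_add hl, show 2 * θ = θ + θ by ring, rpow_add hl]
    simp only [conj_trivial]
    ring

end gfbm

theorem integral_abs_le_of_L2R (f : L2R) {A : Set ℝ} (hA : MeasurableSet A) (hA' : volume A < ⊤) :
    IntegrableOn f A volume ∧ ∫ u in A, |f u| ≤ ‖f‖ ^ 2 + volume.real A := by
  have h1 := (Lp.memLp f).integrable_sq
  have hf : AEStronglyMeasurable f (volume.restrict A) := (Lp.memLp f).1.restrict
  have hb : IntegrableOn (fun u => f u ^ 2 + 1) A := 
    h1.integrableOn.add (integrableOn_const hA'.ne)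
  have hle : ∀ u, |f u| ≤ f u ^ 2 + 1 := fun u => by
    nlinarith [sq_nonneg (|f u| - 1), sq_abs (f u), abs_nonneg (f u)]
  have hi : IntegrableOn f A volume := hb.mono' hf (Eventually.of_forall hle)
  refine ⟨hi, (setIntegral_mono hi.abs hb hle).trans ?_⟩
  rw [integral_add h1.integrableOn (integrableOn_const hA'.ne), norm_sq_eq_integral]
  refine add_le_add (setIntegral_le_integral h1 (Eventually.of_forall fun u => sq_nonneg _)) ?_
  simp [Measure.real]

/-- The values of a fractional integral in `L²` are the pointwise fractional integrals. -/
theorem coeFn_fracVec {θ : ℝ} (hθ : 0 < θ) {g : ℝ → L2R} (hg : ContinuousOn g (Ici 0))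
    {G : ℝ → ℝ → ℝ} (hG : Measurable (Function.uncurry G))
    (hgG : ∀ s, 0 ≤ s → g s =ᵐ[volume] G s) {t : ℝ} (ht : 0 ≤ t) :
    ((fracVec θ g t : L2R) : ℝ → ℝ) =ᵐ[volume] fun u => fracVec θ (fun s => G s u) t := by
  obtain ⟨M, hM⟩ := (isCompact_Icc (a := (0:ℝ)) (b := t)).bddAbove_image
    ((hg.mono Icc_subset_Ici_self).norm)
  have hM' : ∀ s ∈ Icc 0 t, ‖g s‖ ^ 2 ≤ M ^ 2 := fun s hs =>
    pow_le_pow_left₀ (norm_nonneg _) (hM ⟨s, hs, rfl⟩) 2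
  have hw := (intervalIntegrable_iff_integrableOn_Ioc_of_le ht).1 (intervalIntegrable_sub_rpow hθ t 0 t)
  have hInt : ∀ A : Set ℝ, MeasurableSet A → volume A < ⊤ →
      Integrable (fun p : ℝ × ℝ => (t - p.1) ^ (θ - 1) * G p.1 p.2)
        ((volume.restrict (Ioc 0 t)).prod (volume.restrict A)) := by
    intro A hA hA'
    have hm : Measurable (fun p : ℝ × ℝ => (t - p.1) ^ (θ - 1) * G p.1 p.2) :=
      Measurable.mul (by fun_prop) hG
    refine (integrable_prod_iff hm.aestronglyMeasurable).2 ⟨?_, ?_⟩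
    · refine (ae_restrict_iff' measurableSet_Ioc).2 (Eventually.of_forall fun s hs => ?_)
      exact ((integral_abs_le_of_L2R (g s) hA hA').1.congr
        (ae_restrict_of_ae (hgG s hs.1.le))).const_mul ((t - s) ^ (θ - 1))
    · refine (hw.norm.mul_const (M ^ 2 + volume.real A)).mono'
        hm.norm.aestronglyMeasurable.integral_prod_right' ?_
      refine (ae_restrict_iff' measurableSet_Ioc).2 (Eventually.of_forall fun s hs => ?_)
      simp only [norm_mul, integral_const_mul, norm_norm]
      refine mul_le_mul_of_nonneg_left ?_ (norm_nonneg _)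
      rw [norm_of_nonneg (integral_nonneg fun _ => norm_nonneg _)]
      have h1 := (integral_abs_le_of_L2R (g s) hA hA').2
      have h2 : ∫ u in A, ‖G s u‖ = ∫ u in A, |g s u| := by
        refine integral_congr_ae (ae_restrict_of_ae ?_)
        filter_upwards [hgG s hs.1.le] with u hu
        rw [hu, norm_eq_abs]
      rw [h2]
      exact h1.trans (add_le_add_left (hM' s ⟨hs.1.le, hs.2⟩) _)
  have e : ∀ u, fracVec θ (fun s => G s u) t =
      (Gamma θ)⁻¹ * ∫ s in Ioc 0 t, (t - s) ^ (θ - 1) * G s u := fun u => by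
    rw [fracVec, intervalIntegral.integral_of_le ht]; rfl
  refine ae_eq_of_forall_setIntegral_eq_of_sigmaFinite
    (fun A hA hA' => (integral_abs_le_of_L2R _ hA hA').1) (fun A hA hA' => ?_) fun A hA hA' => ?_
  · simp only [e]
    exact (hInt A hA hA').integral_prod_right.const_mul _
  · simp only [e]
    rw [integral_const_mul, ← L2.inner_indicatorConstLp_one (𝕜 := ℝ) hA hA'.ne,
      inner_fracVec_left hθ hg ht, fracVec, intervalIntegral.integral_of_le ht, smul_eq_mul]
    congr 1
    rw [← integral_integral_swap (hInt A hA hA')]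
    refine setIntegral_congr_fun measurableSet_Ioc fun s hs => ?_
    simp only [smul_eq_mul, integral_const_mul]
    rw [L2.inner_indicatorConstLp_one]
    congr 1
    exact integral_congr_ae (ae_restrict_of_ae (hgG s hs.1.le))

theorem fracVec_rpow_pos {α θ : ℝ} (hα : -1 < α) (hθ : 0 < θ) :
    0 < fracVec θ (fun s : ℝ => s ^ α) 1 := by
  have h1 := lintegral_betaPDF (α := α + 1) (β := θ)
  rw [lintegral_betaPDF_eq_one (by linarith) hθ] at h1
  have hb := beta_pos (show 0 < α + 1 by linarith) hθ
  have h2 := integral_eq_lintegral_of_nonneg_ae (μ := volume.restrict (Ioo (0:ℝ) 1))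
    (f := fun x => 1 / beta (α + 1) θ * x ^ (α + 1 - 1) * (1 - x) ^ (θ - 1))
    ((ae_restrict_iff' measurableSet_Ioo).2 (Eventually.of_forall fun x hx => by
      have h3 := rpow_nonneg hx.1.le (α + 1 - 1)
      have h4 := rpow_nonneg (by linarith [hx.2] : 0 ≤ 1 - x) (θ - 1)
      simp only [Pi.zero_apply]
      positivity))
    (Measurable.aestronglyMeasurable (by fun_prop))
  rw [← h1, ENNReal.toReal_one] at h2
  simp only [mul_assoc] at h2
  rw [integral_const_mul] at h2
  have h3 : 0 < ∫ x in Ioo (0:ℝ) 1, x ^ (α + 1 - 1) * (1 - x) ^ (θ - 1) := by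
    by_contra hc
    push Not at hc
    have := mul_nonpos_of_nonneg_of_nonpos (show 0 ≤ 1 / beta (α + 1) θ by positivity) hc
    linarith
  rw [fracVec, intervalIntegral.integral_of_le zero_le_one, smul_eq_mul, integral_Ioc_eq_integral_Ioo]
  refine mul_pos (inv_pos.2 (Gamma_pos_of_pos hθ)) (h3.trans_eq ?_)
  simp [mul_comm]

theorem fracVec_gfbmKernel {α γ θ u t : ℝ} (hα : α ≠ 0) (hu : 0 ≤ u) (ht : 0 ≤ t) :
    fracVec θ (fun s => gfbmKernel α γ s u) t = if u < t then
      fracVec θ (fun s : ℝ => s ^ α) 1 * (t - u) ^ (α + θ) * u ^ (-(γ / 2)) else 0 := by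
  split_ifs with hut
  · have hd : 0 < t - u := by linarith
    have h1 : fracVec θ (fun s => s ^ α) (t - u) = (t - u) ^ (α + θ) * fracVec θ (fun s => s ^ α) 1 := by
      have := fracVec_scale θ (fun s : ℝ => s ^ α) hd zero_le_one
      rw [mul_one] at this
      rw [this, smul_eq_mul, fracVec_const_mul θ zero_le_one (g := fun s : ℝ => s ^ α)
        (c := (t - u) ^ α) fun v hv => mul_rpow hd.le hv, ← mul_assoc, ← rpow_add hd, add_comm α]
    rw [mul_comm (fracVec _ _ _), ← h1, fracVec, fracVec, smul_eq_mul, smul_eq_mul, mul_assoc,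
      ← intervalIntegral.integral_mul_const, intervalIntegral.integral_of_le ht]
    congr 1
    have h2 : ∫ s in Ioc 0 t, (t - s) ^ (θ - 1) • gfbmKernel α γ s u =
        ∫ s in Ioc u t, (t - s) ^ (θ - 1) • gfbmKernel α γ s u := by
      refine (setIntegral_eq_of_subset_of_forall_sdiff_eq_zero measurableSet_Ioc
        (Ioc_subset_Ioc_left hu) fun s hs => ?_)
      have : s ≤ u := by
        by_contra hc
        exact hs.2 ⟨not_le.1 hc, hs.1.2⟩
      rw [gfbmKernel_of_le hα hu this, smul_zero]
    rw [h2, ← intervalIntegral.integral_of_le hut.le]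
    have h3 := intervalIntegral.integral_comp_add_right (a := 0) (b := t - u)
      (fun s => (t - s) ^ (θ - 1) • gfbmKernel α γ s u) u
    rw [zero_add, sub_add_cancel] at h3
    rw [← h3]
    refine intervalIntegral.integral_congr fun s hs => ?_
    rw [uIcc_of_le hd.le] at hs
    simp only [smul_eq_mul]
    rw [gfbmKernel_of_pos hα hu, add_sub_cancel_right, max_eq_left hs.1, ← mul_assoc]
    congr 3; ring
  · rw [fracVec, intervalIntegral.integral_of_le ht]
    have : ∫ s in Ioc 0 t, (t - s) ^ (θ - 1) • gfbmKernel α γ s u = 0 := by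
      refine setIntegral_eq_zero_of_forall_eq_zero fun s hs => ?_
      rw [gfbmKernel_of_le hα hu (hs.2.trans (not_lt.1 hut)), smul_zero]
    rw [this, smul_zero]

section kernel

variable {α γ θ : ℝ}

theorem KernelParams.coeFn_fracVec (h : KernelParams α γ) (hc : ContinuousOn (gfbmVec α γ) (Ici 0))
    (hθ : 0 < θ) {t : ℝ} (ht : 0 ≤ t) :
    ((fracVec θ (gfbmVec α γ) t : L2R) : ℝ → ℝ) =ᵐ[volume]
      fun u => fracVec θ (fun s => gfbmKernel α γ s u) t :=
  _root_.coeFn_fracVec (G := gfbmKernel α γ) hθ hc (measurable_gfbmKernel α γ) (fun _ hs => h.coeFn_gfbmVec hs) ht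

theorem KernelParams.restr_gfbmVec_Ioi (h : KernelParams α γ) {r s : ℝ} (hr : 0 ≤ r) (hrs : r ≤ s) :
    restrL2 (Ioi s) measurableSet_Ioi (gfbmVec α γ r) = 0 := by
  rw [← norm_eq_zero, ← sq_eq_zero_iff, h.norm_restr_sq _ hr]
  refine setIntegral_eq_zero_of_forall_eq_zero fun u hu => ?_
  have hu : s < u := hu
  rw [gfbmKernel_of_le h.ne (by linarith) (by linarith)]
  simp

theorem KernelParams.restr_fracVec_Ioi (h : KernelParams α γ)
    (hc : ContinuousOn (gfbmVec α γ) (Ici 0)) (hθ : 0 < θ) {r s : ℝ} (hr : 0 ≤ r) (hrs : r ≤ s) :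
    restrL2 (Ioi s) measurableSet_Ioi (fracVec θ (gfbmVec α γ) r) = 0 := by
  rw [map_fracVec _ hθ hc hr, ← norm_le_zero_iff]
  refine (norm_fracVec_le hθ hr (B := 0) fun u hu => ?_).trans_eq (by ring)
  rw [h.restr_gfbmVec_Ioi hu.1 (hu.2.trans hrs), norm_zero]

theorem KernelParams.isNondetKernel (h : KernelParams α γ)
    (hc : ContinuousOn (gfbmVec α γ) (Ici 0)) (hθ : 0 < θ) (hγ : 0 ≤ γ) :
    IsNondetKernel (fracVec θ (gfbmVec α γ)) (α - γ / 2 + 1 / 2 + θ) (α + θ + 1 / 2) := by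
  have hB := fracVec_rpow_pos (show -1 < α by linarith [h.lt₁]) hθ
  set B := fracVec θ (fun s : ℝ => s ^ α) 1
  have ha : 0 < 2 * (α + θ) + 1 := by linarith [h.lt₁]
  refine ⟨B / √(2 * (α + θ) + 1), by positivity, fun s hs t hst => ?_⟩
  have ht : 0 < t := by linarith
  refine ⟨restrL2 (Ioi s)ᶜ measurableSet_Ioi.compl (fracVec θ (gfbmVec α γ) t),
    restrL2 (Ioi s) measurableSet_Ioi (fracVec θ (gfbmVec α γ) t),
    (by rw [add_comm]; exact (restrL2_add_compl _).symm), fun r hr hrs => ?_,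
    (by rw [real_inner_comm]; exact inner_restrL2_compl _ _), ?_⟩
  · rw [← inner_restrL2_left, h.restr_fracVec_Ioi hc hθ hr hrs, inner_zero_left]
  · have hd : 0 < t - s := by linarith
    refine le_of_sq_le_sq ?_ (norm_nonneg _)
    rw [norm_restrL2_sq]
    have hInt : Integrable (fun u => (fracVec θ (gfbmVec α γ) t) u ^ 2) := (Lp.memLp _).integrable_sq
    have h1 : ∫ u in Ioc s t, B ^ 2 * t ^ (-γ) * (t - u) ^ (2 * (α + θ)) ≤
        ∫ u in Ioi s, (fracVec θ (gfbmVec α γ) t) u ^ 2 := by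
      refine le_trans ?_ (setIntegral_mono_set hInt.integrableOn
        (Eventually.of_forall fun u => sq_nonneg _) (show Ioc s t ⊆ Ioi s from fun u hu => hu.1).eventuallyLE)
      have hi := (intervalIntegrable_sub_rpow (show 0 < 2 * (α + θ) + 1 from ha) t s t)
      rw [add_sub_cancel_right, intervalIntegrable_iff_integrableOn_Ioc_of_le hst.le] at hi
      refine setIntegral_mono_on_ae (hi.const_mul _) hInt.integrableOn measurableSet_Ioc ?_
      filter_upwards [h.coeFn_fracVec hc hθ ht.le, compl_mem_ae_iff.2 (measure_singleton t)]
        with u hu hut huI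
      have hut' : u < t := lt_of_le_of_ne huI.2 hut
      have hu0 : 0 < u := by linarith [huI.1]
      rw [hu, fracVec_gfbmKernel h.ne hu0.le ht.le, if_pos hut', mul_pow, mul_pow,
        sq_rpow_half hu0.le, sq_rpow (by linarith)]
      have h2 : t ^ (-γ) ≤ u ^ (-γ) := rpow_le_rpow_of_nonpos hu0 hut'.le (by linarith)
      have h3 : 0 ≤ (t - u) ^ (2 * (α + θ)) := rpow_nonneg (by linarith) _
      calc _ = B ^ 2 * (t - u) ^ (2 * (α + θ)) * t ^ (-γ) := by ring
        _ ≤ _ := by gcongr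
    refine le_trans (le_of_eq ?_) h1
    rw [integral_const_mul, ← intervalIntegral.integral_of_le hst.le,
      intervalIntegral.integral_comp_sub_left (fun u => u ^ (2 * (α + θ))), sub_self,
      integral_rpow (Or.inl (by linarith)), zero_rpow ha.ne', sub_zero, mul_pow, mul_pow, div_pow,
      sq_sqrt ha.le, sq_rpow ht.le, sq_rpow (by positivity), div_rpow hd.le ht.le,
      show 2 * (α - γ / 2 + 1 / 2 + θ) = -γ + (2 * (α + θ) + 1) by ring, rpow_add ht,
      show 2 * (α + θ + 1 / 2) = 2 * (α + θ) + 1 by ring]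
    have := (rpow_pos_of_pos ht (2 * (α + θ) + 1)).ne'
    field_simp

theorem hasKernelTails_fracVec (hα : α ≠ 0) (hγ0 : 0 ≤ γ) (hγ : γ < 1)
    (hα1 : -(1 / 2) + γ / 2 < α) (hα2 : α < 1 / 2)
    (hc : ContinuousOn (gfbmVec α γ) (Ici 0)) (hθ : 0 < θ) :
    HasKernelTails (fracVec θ (gfbmVec α γ)) (α - γ / 2 + 1 / 2 + θ) := by
  obtain ⟨κ, hκ, hκH, C, hC, hle⟩ := exists_norm_restr_gfbmVec_le hα hγ0 hγ hα1 hα2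
  set H := α - γ / 2 + 1 / 2 with hH
  have hG := Gamma_pos_of_pos hθ
  refine ⟨κ, hκ, ((Gamma θ)⁻¹ / θ) ^ 2 * C, by positivity, fun L hL => ?_⟩
  have hA : MeasurableSet (Icc (-L) L) := measurableSet_Icc
  have key : ∀ (A : Set ℝ) (hA : MeasurableSet A) (r s D : ℝ), 0 ≤ r → r ≤ s → 0 ≤ D →
      (∀ u ∈ Icc 0 r, ‖restrL2 A hA (gfbmVec α γ u)‖ ^ 2 ≤ C * (s ^ (2 * H) * D)) →
      ‖restrL2 A hA (fracVec θ (gfbmVec α γ) r)‖ ^ 2 ≤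
        ((Gamma θ)⁻¹ / θ) ^ 2 * C * s ^ (2 * (H + θ)) * D := by
    intro A hA r s D hr hrs hD hb
    have hs := hr.trans hrs
    have h0 : 0 ≤ C * (s ^ (2 * H) * D) := by positivity
    have h1 := norm_fracVec_le (g := fun u => restrL2 A hA (gfbmVec α γ u)) hθ hr
      (B := √(C * (s ^ (2 * H) * D))) fun u hu => le_sqrt_of_sq_le (hb u hu)
    rw [← map_fracVec _ hθ hc hr] at h1
    refine (pow_le_pow_left₀ (norm_nonneg _) h1 2).trans ?_
    rw [mul_pow, mul_pow, sq_sqrt h0, div_pow]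
    have h2 : r ^ θ ≤ s ^ θ := rpow_le_rpow hr hrs hθ.le
    have h3 : 0 ≤ r ^ θ := rpow_nonneg hr _
    rcases hs.eq_or_lt with rfl | hs
    · have : r = 0 := le_antisymm hrs hr
      rw [this, zero_rpow hθ.ne']
      simp only [ne_eq, OfNat.ofNat_ne_zero, not_false_eq_true, zero_pow, zero_div, zero_mul,
        mul_zero]
      positivity
    · rw [mul_add 2 H θ, rpow_add hs, ← sq_rpow hs.le θ]
      calc (Gamma θ)⁻¹ ^ 2 * ((r ^ θ) ^ 2 / θ ^ 2 * (C * (s ^ (2 * H) * D)))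
          ≤ (Gamma θ)⁻¹ ^ 2 * ((s ^ θ) ^ 2 / θ ^ 2 * (C * (s ^ (2 * H) * D))) := by gcongr
        _ = _ := by ring
  refine ⟨fun r => restrL2 _ hA (fracVec θ (gfbmVec α γ) r),
    fun r => restrL2 _ hA.compl (fracVec θ (gfbmVec α γ) r),
    fun r _ => (restrL2_add_compl _).symm, fun r _ s _ => inner_restrL2_compl _ _,
    fun r s hr hrs hsL => key _ _ r s _ hr hrs
      (rpow_nonneg (div_nonneg (hr.trans hrs) hL.le) _) fun u hu => ?_,
    fun r s hr hrs hsL => key _ _ r s _ hr hrs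
      (rpow_nonneg (div_nonneg hL.le (hr.trans hrs)) _) fun u hu => ?_⟩
  · have hs := hr.trans hrs
    refine ((hle L hL u hu.1 _ hA.compl).1 fun v hv => ?_).trans ?_
    · by_contra hcon
      exact hv (abs_le.1 (not_le.1 hcon).le)
    · rcases hs.eq_or_lt with rfl | hs
      · have hu0 : u = 0 := le_antisymm (hu.2.trans hrs) hu.1
        rw [hu0, zero_rpow (by linarith : 2 * H + κ ≠ 0)]
        rw [zero_div, mul_zero]; positivity
      · rw [div_rpow hs.le hL.le, ← mul_div_assoc (s ^ (2 * H)), ← rpow_add hs]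
        have : u ^ (2 * H + κ) ≤ s ^ (2 * H + κ) :=
          rpow_le_rpow hu.1 (hu.2.trans hrs) (by linarith)
        gcongr
  · have hs : 0 < s := hL.trans_le hsL
    refine ((hle L hL u hu.1 _ hA).2 fun v hv => abs_le.2 hv).trans ?_
    rw [div_rpow hL.le hs.le, ← mul_div_assoc, mul_comm (s ^ _), mul_div_assoc, ← rpow_sub hs,
      mul_comm (L ^ κ)]
    have : u ^ (2 * H - κ) ≤ s ^ (2 * H - κ) :=
      rpow_le_rpow hu.1 (hu.2.trans hrs) (by linarith)
    gcongr

end kernel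

/-- `f` agrees on `[0, 1]` with a polynomial of degree less than `m` with coefficients bounded by
`C` up to an error `C z ^ m`. -/
def HasExpansion (m : ℕ) (C : ℝ) (f : ℝ → ℝ) : Prop :=
  ∃ p : ℕ → ℝ, (∀ n, |p n| ≤ C) ∧
    ∀ z ∈ Icc (0:ℝ) 1, |f z - ∑ n ∈ Finset.range m, p n * z ^ n| ≤ C * z ^ m

theorem hasExpansion_one {m : ℕ} (hm : 0 < m) : HasExpansion m 1 fun _ => 1 := by
  refine ⟨fun n => if n = 0 then 1 else 0, fun n => by dsimp only; split_ifs <;> simp,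
    fun z hz => ?_⟩
  have : ∑ n ∈ Finset.range m, (if n = 0 then (1:ℝ) else 0) * z ^ n = 1 := by
    rw [Finset.sum_eq_single 0] <;> simp +contextual [hm.ne']
  rw [this, sub_self, abs_zero]
  exact mul_nonneg zero_le_one (pow_nonneg hz.1 _)

theorem exists_hasExpansion_rpow (a : ℝ) {m : ℕ} (hm : 0 < m) :
    ∃ C > (0:ℝ), HasExpansion m C fun z => (1 + z) ^ a := by
  obtain ⟨n, rfl⟩ := Nat.exists_eq_succ_of_ne_zero hm.ne'
  have hc : ContDiffOn ℝ (n + 1) (fun z : ℝ => (1 + z) ^ a) (Icc 0 1) :=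
    ContDiffOn.rpow_const_of_ne (by fun_prop) fun z hz => by linarith [hz.1]
  obtain ⟨C, hC⟩ := exists_taylor_mean_remainder_bound zero_le_one hc
  have hp : ∃ p : ℕ → ℝ, ∀ z, taylorWithinEval (fun z : ℝ => (1 + z) ^ a) n (Icc 0 1) 0 z =
      ∑ j ∈ Finset.range (n + 1), p j * z ^ j :=
    ⟨fun j => if j ∈ Finset.range (n + 1) then (j.factorial : ℝ)⁻¹ *
        iteratedDerivWithin j (fun z : ℝ => (1 + z) ^ a) (Icc 0 1) 0 else 0, fun z => by
      rw [taylor_within_apply]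
      refine Finset.sum_congr rfl fun j hj => ?_
      beta_reduce
      rw [if_pos hj, smul_eq_mul, sub_zero]
      ring⟩
  obtain ⟨p, hp⟩ := hp
  refine ⟨|C| + ∑ j ∈ Finset.range (n + 1), |p j| + 1, by positivity,
    fun j => if j ∈ Finset.range (n + 1) then p j else 0, fun j => ?_, fun z hz => ?_⟩
  · dsimp only
    split_ifs with hj
    · have := Finset.single_le_sum (f := fun j => |p j|) (fun i _ => abs_nonneg (p i)) hj
      have h2 := abs_nonneg C
      linarith
    · rw [abs_zero]; positivity
  · have h1 := hC z hz
    rw [hp, norm_eq_abs, sub_zero] at h1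
    have h2 : ∑ j ∈ Finset.range (n + 1), (if j ∈ Finset.range (n + 1) then p j else 0) * z ^ j =
        ∑ j ∈ Finset.range (n + 1), p j * z ^ j :=
      Finset.sum_congr rfl fun j hj => by rw [if_pos hj]
    rw [h2]
    refine h1.trans (mul_le_mul_of_nonneg_right ?_ (pow_nonneg hz.1 _))
    have h3 : 0 ≤ ∑ j ∈ Finset.range (n + 1), |p j| := Finset.sum_nonneg fun i _ => abs_nonneg _
    linarith [le_abs_self C]

/-- The shifted and dilated power function has an expansion of size comparable to the dilation. -/
theorem HasExpansion.comp_mul {α C : ℝ} {m : ℕ} (hm : 0 < m)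
    (h : HasExpansion m C fun z => (1 + z) ^ α) {ρ : ℝ} (hρ : ρ ∈ Icc (0:ℝ) 1) (b : ℝ) :
    HasExpansion m (C * ρ + |1 - b|) fun z => (1 + ρ * z) ^ α - b := by
  obtain ⟨p, hp, hle⟩ := h
  have hC : 0 ≤ C := (abs_nonneg _).trans (hp 0)
  have hpow : ∀ n, 0 < n → ρ ^ n ≤ ρ := fun n hn => by
    simpa using pow_le_pow_of_le_one hρ.1 hρ.2 (Nat.succ_le_of_lt hn)
  have h0 : p 0 = 1 := by
    have h1 := hle 0 ⟨le_rfl, zero_le_one⟩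
    beta_reduce at h1
    rw [zero_pow hm.ne', mul_zero, add_zero, one_rpow, Finset.sum_eq_single 0
      (fun n _ hn => by rw [zero_pow hn, mul_zero]) (by simp [hm])] at h1
    have := abs_nonpos_iff.1 h1
    rw [pow_zero, mul_one] at this
    linarith
  refine ⟨fun n => if n = 0 then 1 - b else p n * ρ ^ n, fun n => ?_, fun z hz => ?_⟩
  · dsimp only
    split_ifs with hn
    · have := mul_nonneg hC hρ.1
      linarith
    · rw [abs_mul, abs_of_nonneg (pow_nonneg hρ.1 _)]
      have := mul_le_mul (hp n) (hpow n (Nat.pos_of_ne_zero hn)) (pow_nonneg hρ.1 _) hC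
      linarith [abs_nonneg (1 - b)]
  · have h1 := hle (ρ * z) ⟨mul_nonneg hρ.1 hz.1, mul_le_one₀ hρ.2 hz.1 hz.2⟩
    have h2 : ∑ n ∈ Finset.range m, (if n = 0 then 1 - b else p n * ρ ^ n) * z ^ n =
        ∑ n ∈ Finset.range m, p n * (ρ * z) ^ n - b := by
      obtain ⟨n, rfl⟩ := Nat.exists_eq_succ_of_ne_zero hm.ne'
      rw [Finset.sum_range_succ', Finset.sum_range_succ', h0]
      simp only [Nat.add_eq_zero_iff, one_ne_zero, and_false, if_false, if_true, pow_zero, mul_one,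
        mul_pow, mul_assoc]
      ring
    rw [h2, sub_sub_sub_cancel_right]
    refine h1.trans ?_
    rw [mul_pow, ← mul_assoc]
    refine mul_le_mul_of_nonneg_right ?_ (pow_nonneg hz.1 _)
    have := mul_le_mul_of_nonneg_left (hpow m hm) hC
    linarith [abs_nonneg (1 - b)]

/-- A functional annihilating polynomials of degree less than `m` is small on products of functions
with expansions. -/
theorem HasExpansion.abs_sum_mul_le {m : ℕ} {C D : ℝ} {F G : ℝ → ℝ} (hF : HasExpansion m C F)
    (hG : HasExpansion m D G) {S : Finset ℝ} {a : ℝ → ℝ} (hS : ∀ x ∈ S, x ∈ Icc (0:ℝ) 1)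
    (ha : ∀ d < m, ∑ x ∈ S, a x * x ^ d = 0) {k : ℝ} (hk : 1 ≤ k) :
    |∑ x ∈ S, a x * (F (x / k) * G (x / k))| ≤
      (∑ x ∈ S, |a x|) * ((m + 1) ^ 2 * (C * D)) / k ^ m := by
  obtain ⟨p, hp, hpF⟩ := hF
  obtain ⟨q, hq, hqG⟩ := hG
  have hk0 : 0 < k := by linarith
  have hC : 0 ≤ C := (abs_nonneg _).trans (hp 0)
  have hD : 0 ≤ D := (abs_nonneg _).trans (hq 0)
  have hz : ∀ x ∈ S, x / k ∈ Icc (0:ℝ) 1 := fun x hx =>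
    ⟨div_nonneg (hS x hx).1 hk0.le, (div_le_one hk0).2 ((hS x hx).2.trans hk)⟩
  have hzm : ∀ x ∈ S, (x / k) ^ m ≤ (k ^ m)⁻¹ := fun x hx => by
    rw [div_pow, div_eq_mul_inv]
    exact mul_le_of_le_one_left (by positivity) (pow_le_one₀ (hS x hx).1 (hS x hx).2)
  have hpoly : ∀ (r : ℕ → ℝ) (B : ℝ), (∀ n, |r n| ≤ B) → ∀ z ∈ Icc (0:ℝ) 1,
      |∑ n ∈ Finset.range m, r n * z ^ n| ≤ m * B := by
    intro r B hr z hz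
    refine (Finset.abs_sum_le_sum_abs _ _).trans ((Finset.sum_le_card_nsmul _ _ B fun n _ => ?_).trans
      (by simp))
    rw [abs_mul, abs_of_nonneg (pow_nonneg hz.1 _)]
    exact (mul_le_of_le_one_right (abs_nonneg _) (pow_le_one₀ hz.1 hz.2)).trans (hr n)
  set N := ∑ x ∈ S, |a x| with hN
  have hN0 : 0 ≤ N := Finset.sum_nonneg fun _ _ => abs_nonneg _
  have hsum : ∀ (f : ℝ → ℝ) (B : ℝ), (∀ x ∈ S, |f x| ≤ B) → |∑ x ∈ S, a x * f x| ≤ N * B := by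
    intro f B hf
    rw [hN, Finset.sum_mul]
    refine (Finset.abs_sum_le_sum_abs _ _).trans (Finset.sum_le_sum fun x hx => ?_)
    rw [abs_mul]
    exact mul_le_mul_of_nonneg_left (hf x hx) (abs_nonneg _)
  set P : ℝ → ℝ := fun z => ∑ n ∈ Finset.range m, p n * z ^ n with hP
  set Q : ℝ → ℝ := fun z => ∑ n ∈ Finset.range m, q n * z ^ n with hQ
  have hmono : ∀ d : ℕ, |∑ x ∈ S, a x * (x / k) ^ d| ≤ N * (k ^ m)⁻¹ := by
    intro d
    rcases lt_or_ge d m with hd | hd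
    · have : ∑ x ∈ S, a x * (x / k) ^ d = (k ^ d)⁻¹ * ∑ x ∈ S, a x * x ^ d := by
        rw [Finset.mul_sum]
        exact Finset.sum_congr rfl fun x _ => by rw [div_pow]; ring
      rw [this, ha d hd, mul_zero, abs_zero]
      positivity
    · refine hsum _ _ fun x hx => ?_
      rw [abs_of_nonneg (pow_nonneg (hz x hx).1 _)]
      exact (pow_le_pow_of_le_one (hz x hx).1 (hz x hx).2 hd).trans (hzm x hx)
  have h1 : |∑ x ∈ S, a x * (P (x / k) * Q (x / k))| ≤ m * (m * (C * D * (N * (k ^ m)⁻¹))) := by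
    have e : ∑ x ∈ S, a x * (P (x / k) * Q (x / k)) = ∑ i ∈ Finset.range m, ∑ j ∈ Finset.range m,
        p i * q j * ∑ x ∈ S, a x * (x / k) ^ (i + j) := by
      simp only [Finset.mul_sum, hP, hQ, Finset.sum_mul]
      rw [Finset.sum_comm]
      simp only [Finset.sum_comm (s := S)]
      rw [Finset.sum_comm]
      refine Finset.sum_congr rfl fun i _ => Finset.sum_congr rfl fun j _ =>
        Finset.sum_congr rfl fun x _ => by ring
    rw [e]
    refine (Finset.abs_sum_le_sum_abs _ _).trans ((Finset.sum_le_card_nsmul _ _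
      (m * (C * D * (N * (k ^ m)⁻¹))) fun i _ => ?_).trans (by simp))
    refine (Finset.abs_sum_le_sum_abs _ _).trans ((Finset.sum_le_card_nsmul _ _
      (C * D * (N * (k ^ m)⁻¹)) fun j _ => ?_).trans (by simp))
    rw [abs_mul, abs_mul]
    exact mul_le_mul (mul_le_mul (hp i) (hq j) (abs_nonneg _) hC) (hmono _) (abs_nonneg _)
      (by positivity)
  have h2 : |∑ x ∈ S, a x * ((F (x / k) - P (x / k)) * G (x / k))| ≤
      N * (C * (k ^ m)⁻¹ * ((m + 1) * D)) := by
    refine hsum _ _ fun x hx => ?_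
    rw [abs_mul]
    refine mul_le_mul ((hpF _ (hz x hx)).trans (mul_le_mul_of_nonneg_left (hzm x hx) hC)) ?_
      (abs_nonneg _) (by positivity)
    have h3 := hqG _ (hz x hx)
    have h4 := hpoly q D hq _ (hz x hx)
    have h5 : D * (x / k) ^ m ≤ D :=
      mul_le_of_le_one_right hD (pow_le_one₀ (hz x hx).1 (hz x hx).2)
    have h6 := abs_sub_abs_le_abs_sub (G (x / k)) (Q (x / k))
    linarith
  have h3 : |∑ x ∈ S, a x * (P (x / k) * (G (x / k) - Q (x / k)))| ≤
      N * (m * C * (D * (k ^ m)⁻¹)) := by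
    refine hsum _ _ fun x hx => ?_
    rw [abs_mul]
    exact mul_le_mul (hpoly p C hp _ (hz x hx))
      ((hqG _ (hz x hx)).trans (mul_le_mul_of_nonneg_left (hzm x hx) hD))
      (abs_nonneg _) (by positivity)
  have e : ∑ x ∈ S, a x * (F (x / k) * G (x / k)) =
      ∑ x ∈ S, a x * (P (x / k) * Q (x / k)) +
      ∑ x ∈ S, a x * ((F (x / k) - P (x / k)) * G (x / k)) +
      ∑ x ∈ S, a x * (P (x / k) * (G (x / k) - Q (x / k))) := by
    rw [← Finset.sum_add_distrib, ← Finset.sum_add_distrib]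
    exact Finset.sum_congr rfl fun x _ => by ring
  rw [e]
  refine (abs_add_three _ _ _).trans ((add_le_add (add_le_add h1 h2) h3).trans_eq ?_)
  rw [div_eq_mul_inv]; ring

/-- Near `0` the function `1 - (1 - ρ) ^ α` is at least linear. -/
theorem exists_le_mul_abs_one_sub_rpow {α : ℝ} (hα : α ≠ 0) (h1 : -1 < α) (h2 : α < 1) :
    ∃ D > (0:ℝ), ∀ ρ ∈ Ico (0:ℝ) 1, ρ ≤ D * |1 - (1 - ρ) ^ α| := by
  refine ⟨|α|⁻¹, inv_pos.2 (abs_pos.2 hα), fun ρ hρ => ?_⟩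
  rw [inv_mul_eq_div, le_div_iff₀ (abs_pos.2 hα)]
  have hp : 0 < 1 - ρ := by linarith [hρ.2]
  rcases lt_or_gt_of_ne hα with hn | hpos
  · have h3 := rpow_one_add_le_one_add_mul_self (s := -ρ) (p := -α) (by linarith [hρ.2])
      (by linarith) (by linarith)
    rw [← sub_eq_add_neg, rpow_neg hp.le] at h3
    have h4 := rpow_pos_of_pos hp α
    rw [abs_of_neg hn, abs_sub_comm]
    refine le_trans ?_ (le_abs_self _)
    have h5 : 1 ≤ (1 + -α * -ρ) * (1 - ρ) ^ α := by
      have := mul_le_mul_of_nonneg_right h3 h4.le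
      rwa [inv_mul_cancel₀ h4.ne'] at this
    have h6 : -α * ρ < 1 := by nlinarith [hρ.1, hρ.2]
    nlinarith [mul_nonneg (by linarith : 0 ≤ -α) hρ.1]
  · have h3 := rpow_one_add_le_one_add_mul_self (s := -ρ) (p := α) (by linarith [hρ.2])
      (by linarith) (by linarith)
    rw [← sub_eq_add_neg] at h3
    rw [abs_of_pos hpos]
    refine le_trans ?_ (le_abs_self _)
    linarith

theorem coeFn_sum_smul (S : Finset ℝ) (a : ℝ → ℝ) (f : ℝ → L2R) :
    ((∑ x ∈ S, a x • f x : L2R) : ℝ → ℝ) =ᵐ[volume] fun u => ∑ x ∈ S, a x * f x u := by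
  classical
  induction S using Finset.induction_on with
  | empty =>
    simp only [Finset.sum_empty]
    exact Lp.coeFn_zero _ _ _
  | insert x S hx ih =>
    simp only [Finset.sum_insert hx]
    filter_upwards [Lp.coeFn_add (a x • f x) (∑ y ∈ S, a y • f y), Lp.coeFn_smul (a x) (f x), ih]
      with u h1 h2 h3
    rw [h1, Pi.add_apply, h2, h3, Pi.smul_apply, smul_eq_mul]

theorem sum_smul_fracVec {θ : ℝ} (hθ : 0 < θ) (S : Finset ℝ) (a : ℝ → ℝ) {g : ℝ → ℝ → L2R}
    (hg : ∀ x ∈ S, ContinuousOn (g x) (Ici 0)) {t : ℝ} (ht : 0 ≤ t) :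
    ∑ x ∈ S, a x • fracVec θ (g x) t = fracVec θ (fun y => ∑ x ∈ S, a x • g x y) t := by
  have h1 : ∀ y, (t - y) ^ (θ - 1) • ∑ x ∈ S, a x • g x y =
      ∑ x ∈ S, a x • ((t - y) ^ (θ - 1) • g x y) := fun y => by
    rw [Finset.smul_sum]
    exact Finset.sum_congr rfl fun x _ => smul_comm _ _ _
  simp only [fracVec, h1]
  rw [intervalIntegral.integral_finsetSum
    (f := fun x y => a x • ((t - y) ^ (θ - 1) • g x y)) fun x hx =>
    (intervalIntegrable_smul_of_continuousOn hθ (hg x hx) le_rfl ht).smul (a x), Finset.smul_sum]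
  refine Finset.sum_congr rfl fun x _ => ?_
  rw [intervalIntegral.integral_smul, smul_comm]

section kernel

variable {α γ θ : ℝ}

/-- The contribution of the negative half-line. -/
theorem KernelParams.exists_norm_restr_neg_le (h : KernelParams α γ) (hα : α < 1)
    (hc : ContinuousOn (gfbmVec α γ) (Ici 0)) (hθ : 0 < θ) {m : ℕ} (hm : 0 < m)
    {S : Finset ℝ} {a : ℝ → ℝ} (hS : ∀ x ∈ S, x ∈ Icc (0:ℝ) 1)
    (ha : ∀ d < m, ∑ x ∈ S, a x * x ^ d = 0) :
    ∃ C > (0:ℝ), ∀ k : ℝ, 1 ≤ k →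
      ‖restrL2 (Iio 0) measurableSet_Iio (∑ x ∈ S, a x • fracVec θ (gfbmVec α γ) (k + x))‖ ≤
        C * (k ^ (θ - m + (α - γ / 2 + 1 / 2))) := by
  obtain ⟨C₁, hC₁, hF⟩ := exists_hasExpansion_rpow θ hm
  obtain ⟨C₂, hC₂, hG⟩ := exists_hasExpansion_rpow α hm
  obtain ⟨D, hD, hρD⟩ := exists_le_mul_abs_one_sub_rpow h.ne (by linarith [h.lt₁]) hα
  set N := ∑ x ∈ S, |a x| with hN
  have hN0 : 0 ≤ N := Finset.sum_nonneg fun _ _ => abs_nonneg _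
  set H := α - γ / 2 + 1 / 2 with hH
  have hH0 : 0 < H := by linarith [h.lt₃]
  set c := N * ((m + 1) ^ 2 * (C₁ * (C₂ * D + 1))) with hcdef
  have hc0 : 0 ≤ c := by positivity
  have hΓ := Gamma_pos_of_pos hθ
  set n1 := ‖gfbmVec α γ 1‖ with hn1
  refine ⟨(Gamma θ)⁻¹ * (1 / θ * (c * n1)) + 1, by positivity, fun k hk => ?_⟩
  have hk0 : 0 < k := by linarith
  have hscale : ∀ t, 0 ≤ t → t ≤ k → ‖gfbmVec α γ t‖ ≤ k ^ H * n1 := by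
    intro t ht htk
    rcases ht.eq_or_lt with rfl | ht
    · rw [gfbmVec_zero, norm_zero]; positivity
    · have h1 := h.inner_gfbmVec_scale ht zero_le_one zero_le_one
      rw [mul_one, real_inner_self_eq_norm_sq, real_inner_self_eq_norm_sq, ← sq_rpow ht.le,
        ← mul_pow] at h1
      rw [(sq_eq_sq₀ (norm_nonneg _) (by positivity)).1 h1]
      gcongr
  have e1 : ∀ x ∈ S, a x • fracVec θ (gfbmVec α γ) (k + x) =
      (a x * (k + x) ^ θ) • fracVec θ (fun y => gfbmVec α γ ((k + x) * y)) 1 := fun x hx => by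
    have hkx : 0 < k + x := by linarith [(hS x hx).1]
    have := fracVec_scale θ (gfbmVec α γ) hkx zero_le_one
    rw [mul_one] at this
    rw [this, smul_smul]
  have hcx : ∀ x ∈ S, ContinuousOn (fun y => gfbmVec α γ ((k + x) * y)) (Ici 0) := fun x hx =>
    hc.comp (by fun_prop) fun y hy =>
      mul_nonneg (show 0 ≤ k + x by linarith [(hS x hx).1]) hy
  rw [Finset.sum_congr rfl e1, sum_smul_fracVec (g := fun x y => gfbmVec α γ ((k + x) * y)) hθ S
    (fun x => a x * (k + x) ^ θ) hcx zero_le_one,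
    map_fracVec (g := fun y => ∑ x ∈ S, (a x * (k + x) ^ θ) • gfbmVec α γ ((k + x) * y)) _ hθ
    (continuousOn_finsetSum _ fun x hx => (hcx x hx).const_smul (a x * (k + x) ^ θ)) zero_le_one]
  have hbound : ∀ y ∈ Icc (0:ℝ) 1, ‖restrL2 (Iio 0) measurableSet_Iio
      (∑ x ∈ S, (a x * (k + x) ^ θ) • gfbmVec α γ ((k + x) * y))‖ ≤
        c * k ^ (θ - m) * (k ^ H * n1) := by
    intro y hy
    rcases hy.1.eq_or_lt with rfl | hy0
    · simp only [mul_zero, gfbmVec_zero, smul_zero, Finset.sum_const_zero, map_zero, norm_zero]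
      positivity
    have hky : 0 < k * y := by positivity
    refine le_trans (Lp.norm_le_mul_norm_of_ae_le_mul (c := c * k ^ (θ - m))
      (g := gfbmVec α γ (k * y)) ?_) (mul_le_mul_of_nonneg_left
        (hscale _ hky.le (mul_le_of_le_one_right hk0.le hy.2)) (by positivity))
    have hae : ∀ᵐ u, ∀ x ∈ S, gfbmVec α γ ((k + x) * y) u = gfbmKernel α γ ((k + x) * y) u :=
      (Finset.eventually_all S).2 fun x hx => h.coeFn_gfbmVec
        (mul_nonneg (by linarith [(hS x hx).1]) hy.1)
    filter_upwards [coeFn_restrL2 (A := Iio 0) (hA := measurableSet_Iio)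
      (∑ x ∈ S, (a x * (k + x) ^ θ) • gfbmVec α γ ((k + x) * y)),
      coeFn_sum_smul S (fun x => a x * (k + x) ^ θ) (fun x => gfbmVec α γ ((k + x) * y)),
      hae, h.coeFn_gfbmVec hky.le] with u hu1 hu2 hu3 hu4
    rw [hu1]
    by_cases hu : u ∈ Iio (0:ℝ)
    · rw [indicator_of_mem hu, hu2, hu4]
      obtain ⟨v, rfl⟩ : ∃ v, u = -v := ⟨-u, by ring⟩
      have hv : 0 < v := by simpa using hu
      set w := k * y + v with hw
      have hw0 : 0 < w := by positivity
      set ρ := k * y / w with hρ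
      have hρ0 : 0 ≤ ρ := by positivity
      have hρ1 : ρ < 1 := (div_lt_one hw0).2 (by linarith)
      have hvw : v = w * (1 - ρ) := by rw [hρ]; field_simp; ring
      have h1 : ∀ x ∈ S, a x * (k + x) ^ θ * gfbmVec α γ ((k + x) * y) (-v) =
          k ^ θ * w ^ α * v ^ (-(γ / 2)) *
            (a x * ((1 + x / k) ^ θ * ((1 + ρ * (x / k)) ^ α - (1 - ρ) ^ α))) := by
        intro x hx
        have hx0 := (hS x hx).1
        rw [hu3 x hx, gfbmKernel_neg (mul_nonneg (by linarith) hy.1) hv.le]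
        have e2 : (k + x) * y + v = w * (1 + ρ * (x / k)) := by
          rw [hρ, hw]; field_simp; ring
        have e3 : k + x = k * (1 + x / k) := by field_simp
        have e4 : v ^ α = w ^ α * (1 - ρ) ^ α := by
          rw [← mul_rpow hw0.le (by linarith), ← hvw]
        rw [e2, e4, e3, mul_rpow hk0.le (by positivity), mul_rpow hw0.le (by positivity)]
        ring
      rw [Finset.sum_congr rfl h1, ← Finset.mul_sum, gfbmKernel_neg hky.le hv.le, ← hw]
      have h2 := hF.abs_sum_mul_le (hG.comp_mul hm ⟨hρ0, hρ1.le⟩ ((1 - ρ) ^ α)) hS ha hk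
      rw [← hN] at h2
      have h3 : w ^ α - v ^ α = w ^ α * (1 - (1 - ρ) ^ α) := by
        rw [hvw, mul_rpow hw0.le (by linarith)]; ring
      rw [h3, norm_mul, norm_mul, norm_mul, norm_mul, norm_mul, norm_of_nonneg (rpow_nonneg hk0.le θ),
        norm_of_nonneg (rpow_nonneg hw0.le α), norm_of_nonneg (rpow_nonneg hv.le _), norm_eq_abs,
        norm_eq_abs]
      have h4 := hρD ρ ⟨hρ0, hρ1⟩
      have h5 : k ^ (θ - m) = k ^ θ / k ^ m := by rw [rpow_sub hk0, rpow_natCast]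
      have h6 : C₂ * ρ + |1 - (1 - ρ) ^ α| ≤ (C₂ * D + 1) * |1 - (1 - ρ) ^ α| := by
        nlinarith [mul_le_mul_of_nonneg_left h4 hC₂.le]
      calc k ^ θ * w ^ α * v ^ (-(γ / 2)) *
            |∑ x ∈ S, a x * ((1 + x / k) ^ θ * ((1 + ρ * (x / k)) ^ α - (1 - ρ) ^ α))|
          ≤ k ^ θ * w ^ α * v ^ (-(γ / 2)) * (N * ((m + 1) ^ 2 *
            (C₁ * ((C₂ * D + 1) * |1 - (1 - ρ) ^ α|))) / k ^ m) := by
            refine mul_le_mul_of_nonneg_left (h2.trans ?_) (by positivity)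
            gcongr
        _ = _ := by rw [h5, hcdef]; ring
    · rw [indicator_of_notMem hu, norm_zero]
      positivity
  refine (norm_fracVec_le hθ zero_le_one hbound).trans ?_
  rw [one_rpow, rpow_add hk0 (θ - m) H, add_mul, one_mul]
  have h1 : 0 ≤ k ^ (θ - m) * k ^ H := by positivity
  exact le_add_of_le_of_nonneg (le_of_eq (by ring)) h1

end kernel

section kernel

variable {α γ θ : ℝ}

theorem rpow_mul_inv_sq_sq_le {γ u y : ℝ} (hγ0 : 0 ≤ γ) (hγ : γ < 1) (hu : 0 < u) (hy : 1 ≤ y) :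
    ((y ^ 2)⁻¹) ^ 2 * u ^ (-γ) ≤
      (y + u) ^ (-γ) * (2 * y ^ (-2 : ℝ) + (Ioc (0:ℝ) 1).indicator (fun u => 2 * u ^ (-γ)) u) := by
  have hy0 : 0 < y := by linarith
  have hyu : 0 < y + u := by linarith
  have h0 : (y + u) ^ (-γ) * (y + u) ^ γ = 1 := by rw [← rpow_add hyu]; simp
  have hle : ∀ x : ℝ, 1 ≤ x → x ^ γ ≤ x := fun x hx => by
    simpa using rpow_le_rpow_of_exponent_le hx hγ.le
  have e2 : y ^ (-2 : ℝ) = (y ^ 2)⁻¹ := by rw [rpow_neg hy0.le]; norm_cast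
  have hy2 : (y ^ 2)⁻¹ * y ≤ 1 := by
    rw [inv_mul_le_iff₀ (by positivity)]; nlinarith
  have hy3 : (y ^ 2)⁻¹ ≤ 1 := inv_le_one_of_one_le₀ (one_le_pow₀ hy)
  have hi : 0 ≤ (y ^ 2)⁻¹ := by positivity
  suffices ((y ^ 2)⁻¹) ^ 2 * (u ^ (-γ) * (y + u) ^ γ) ≤
      2 * y ^ (-2 : ℝ) + (Ioc (0:ℝ) 1).indicator (fun u => 2 * u ^ (-γ)) u by
    calc ((y ^ 2)⁻¹) ^ 2 * u ^ (-γ)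
        = (y + u) ^ (-γ) * (((y ^ 2)⁻¹) ^ 2 * (u ^ (-γ) * (y + u) ^ γ)) := by
          linear_combination (-((y ^ 2)⁻¹) ^ 2 * u ^ (-γ)) * h0
      _ ≤ _ := mul_le_mul_of_nonneg_left this (by positivity)
  rw [e2]
  rcases le_or_gt u 1 with h | h
  · rw [indicator_of_mem (show u ∈ Ioc (0:ℝ) 1 from ⟨hu, h⟩)]
    have h1 : (y + u) ^ γ ≤ 2 * y := (hle _ (by linarith)).trans (by linarith)
    have h2 : 0 ≤ u ^ (-γ) := by positivity
    calc ((y ^ 2)⁻¹) ^ 2 * (u ^ (-γ) * (y + u) ^ γ)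
        ≤ ((y ^ 2)⁻¹) ^ 2 * (u ^ (-γ) * (2 * y)) := by gcongr
      _ = (y ^ 2)⁻¹ * ((y ^ 2)⁻¹ * y) * (2 * u ^ (-γ)) := by ring
      _ ≤ 1 * 1 * (2 * u ^ (-γ)) := by gcongr
      _ ≤ _ := by linarith
  · rw [indicator_of_notMem (fun hc => not_le.2 h hc.2), add_zero]
    have h1 : u ^ (-γ) * (y + u) ^ γ ≤ 2 * y := by
      rw [rpow_neg hu.le, inv_mul_eq_div, ← div_rpow hyu.le hu.le]
      have h3 : (y + u) / u ≤ 2 * y := by rw [div_le_iff₀ hu]; nlinarith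
      exact (hle _ (by rw [le_div_iff₀ hu]; linarith)).trans h3
    calc ((y ^ 2)⁻¹) ^ 2 * (u ^ (-γ) * (y + u) ^ γ) ≤ ((y ^ 2)⁻¹) ^ 2 * (2 * y) := by gcongr
      _ = (y ^ 2)⁻¹ * 2 * ((y ^ 2)⁻¹ * y) := by ring
      _ ≤ (y ^ 2)⁻¹ * 2 * 1 := by gcongr
      _ = _ := by ring

/-- The contribution of the past that is at least one unit away. -/
theorem KernelParams.exists_norm_restr_Ioc_le (h : KernelParams α γ) (hγ : 0 ≤ γ)
    (hc : ContinuousOn (gfbmVec α γ) (Ici 0)) (hθ : 0 < θ) {m : ℕ} (hm : 0 < m)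
    (hmα : α + θ + 2 ≤ m) {S : Finset ℝ} {a : ℝ → ℝ} (hS : ∀ x ∈ S, x ∈ Icc (0:ℝ) 1)
    (ha : ∀ d < m, ∑ x ∈ S, a x * x ^ d = 0) :
    ∃ C > (0:ℝ), ∀ k : ℝ, 2 ≤ k →
      ‖restrL2 (Ioc 0 (k - 1)) measurableSet_Ioc
        (∑ x ∈ S, a x • fracVec θ (gfbmVec α γ) (k + x))‖ ^ 2 ≤ C * k ^ (-γ) := by
  obtain ⟨C₁, hC₁, hF⟩ := exists_hasExpansion_rpow (α + θ) hm
  set N := ∑ x ∈ S, |a x| with hN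
  have hN0 : 0 ≤ N := Finset.sum_nonneg fun _ _ => abs_nonneg _
  set B := fracVec θ (fun s : ℝ => s ^ α) 1
  set c := B * (N * ((m + 1) ^ 2 * (C₁ * 1))) with hcdef
  have hγ1 := h.lt₂
  refine ⟨c ^ 2 * (2 * 1 + 2 * (1 / (1 - γ))) + 1, ?_, fun k hk => ?_⟩
  · have : 0 < 1 - γ := by linarith
    positivity
  have hk0 : 0 < k := by linarith
  set φ : ℝ → ℝ := fun u => 2 * (k - u) ^ (-2 : ℝ) +
    (Ioc (0:ℝ) 1).indicator (fun u => 2 * u ^ (-γ)) u with hφ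
  have hi1 : IntervalIntegrable (fun u : ℝ => (k - u) ^ (-2 : ℝ)) volume 0 (k - 1) := by
    refine ContinuousOn.intervalIntegrable ?_
    rw [uIcc_of_le (by linarith)]
    exact ContinuousOn.rpow_const (by fun_prop) fun u hu => Or.inl (by linarith [hu.2])
  have hi2 : IntervalIntegrable (fun u : ℝ => u ^ (-γ)) volume 0 1 :=
    intervalIntegral.intervalIntegrable_rpow' (by linarith)
  have hi2' : Integrable ((Ioc (0:ℝ) 1).indicator (fun u => 2 * u ^ (-γ))) volume :=
    (integrable_indicator_iff measurableSet_Ioc).2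
      (((intervalIntegrable_iff_integrableOn_Ioc_of_le zero_le_one).1 hi2).const_mul 2)
  have hi1' := ((intervalIntegrable_iff_integrableOn_Ioc_of_le (by linarith)).1 hi1).const_mul 2
  have hφi : IntegrableOn φ (Ioc 0 (k - 1)) := hi1'.add hi2'.integrableOn
  have hφint : ∫ u in Ioc 0 (k - 1), φ u ≤ 2 * 1 + 2 * (1 / (1 - γ)) := by
    rw [hφ, integral_add hi1' hi2'.integrableOn]
    refine add_le_add ?_ ?_
    · rw [integral_const_mul, ← intervalIntegral.integral_of_le (by linarith),
        intervalIntegral.integral_comp_sub_left (fun x => x ^ (-2 : ℝ)), sub_zero, sub_sub_cancel,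
        integral_rpow (Or.inr ⟨by norm_num, by
          rw [uIcc_of_le (by linarith)]; exact fun hc => by linarith [hc.1]⟩)]
      have : 0 ≤ k ^ (-2 + 1 : ℝ) := by positivity
      rw [one_rpow]
      have e : (k ^ (-2 + 1 : ℝ) - 1) / (-2 + 1) = 1 - k ^ (-2 + 1 : ℝ) := by ring
      rw [e]; linarith
    · refine (setIntegral_le_integral hi2' (Eventually.of_forall fun u =>
        indicator_nonneg (fun v hv => by have := rpow_nonneg hv.1.le (-γ); positivity) u)).trans ?_
      rw [integral_indicator measurableSet_Ioc, integral_const_mul,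
        ← intervalIntegral.integral_of_le zero_le_one, integral_rpow (Or.inl (by linarith)),
        one_rpow, zero_rpow (by linarith), sub_zero, neg_add_eq_sub]
  rw [norm_restrL2_sq]
  have hInt := (Lp.memLp (∑ x ∈ S, a x • fracVec θ (gfbmVec α γ) (k + x) : L2R)).integrable_sq
  have hae : ∀ᵐ u, ∀ x ∈ S, fracVec θ (gfbmVec α γ) (k + x) u =
      fracVec θ (fun s => gfbmKernel α γ s u) (k + x) :=
    (Finset.eventually_all S).2 fun x hx => h.coeFn_fracVec hc hθ (by linarith [(hS x hx).1])
  have hle : ∫ u in Ioc 0 (k - 1), (∑ x ∈ S, a x • fracVec θ (gfbmVec α γ) (k + x) : L2R) u ^ 2 ≤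
      ∫ u in Ioc 0 (k - 1), c ^ 2 * k ^ (-γ) * φ u := by
    refine setIntegral_mono_on_ae hInt.integrableOn (hφi.const_mul _) measurableSet_Ioc ?_
    filter_upwards [hae, coeFn_sum_smul S a fun x => fracVec θ (gfbmVec α γ) (k + x)]
      with u hu1 hu2 hu
    obtain ⟨y, hy⟩ : ∃ y, y = k - u := ⟨_, rfl⟩
    have hy1 : 1 ≤ y := by linarith [hu.2]
    have hy0 : 0 < y := by linarith
    have h1 : ∀ x ∈ S, a x * fracVec θ (gfbmVec α γ) (k + x) u =
        B * u ^ (-(γ / 2)) * y ^ (α + θ) * (a x * ((1 + x / y) ^ (α + θ) * 1)) := by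
      intro x hx
      have hx0 := (hS x hx).1
      have e : k + x - u = y * (1 + x / y) := by
        have : k = y + u := by linarith
        rw [this]; field_simp; ring
      rw [hu1 x hx, fracVec_gfbmKernel h.ne hu.1.le (by linarith), if_pos (by linarith), e,
        mul_rpow hy0.le (by positivity)]
      ring
    rw [hu2, Finset.sum_congr rfl h1, ← Finset.mul_sum]
    have h2 := hF.abs_sum_mul_le (hasExpansion_one hm) hS ha hy1
    rw [← hN] at h2
    have h3 : y ^ (α + θ) / y ^ m ≤ (y ^ 2)⁻¹ := by
      have e : (y ^ 2)⁻¹ = y ^ (-2 : ℝ) := by rw [rpow_neg hy0.le]; norm_cast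
      rw [← rpow_natCast, ← rpow_sub hy0, e]
      exact rpow_le_rpow_of_exponent_le hy1 (by linarith)
    have h4 := rpow_mul_inv_sq_sq_le hγ hγ1 hu.1 hy1
    have e5 : y + u = k := by linarith
    rw [e5] at h4
    have hu0 := rpow_nonneg hu.1.le (-γ)
    have hk' : 0 ≤ y ^ (α + θ) / y ^ m := by positivity
    rw [mul_pow, mul_pow, mul_pow, sq_rpow_half hu.1.le, ← sq_abs (∑ x ∈ S, _)]
    calc B ^ 2 * u ^ (-γ) * (y ^ (α + θ)) ^ 2 *
          |∑ x ∈ S, a x * ((1 + x / y) ^ (α + θ) * 1)| ^ 2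
        ≤ B ^ 2 * u ^ (-γ) * (y ^ (α + θ)) ^ 2 *
          (N * ((m + 1) ^ 2 * (C₁ * 1)) / y ^ m) ^ 2 := by gcongr
      _ = c ^ 2 * ((y ^ (α + θ) / y ^ m) ^ 2 * u ^ (-γ)) := by rw [hcdef]; ring
      _ ≤ c ^ 2 * ((y ^ 2)⁻¹ ^ 2 * u ^ (-γ)) := by gcongr
      _ ≤ c ^ 2 * (k ^ (-γ) * (2 * y ^ (-2 : ℝ) +
          (Ioc (0:ℝ) 1).indicator (fun u => 2 * u ^ (-γ)) u)) := by gcongr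
      _ = _ := by rw [hφ, hy]; ring
  refine hle.trans ?_
  rw [integral_const_mul]
  have h6 : 0 ≤ k ^ (-γ) := by positivity
  calc c ^ 2 * k ^ (-γ) * ∫ u in Ioc 0 (k - 1), φ u
      ≤ c ^ 2 * k ^ (-γ) * (2 * 1 + 2 * (1 / (1 - γ))) := by gcongr
    _ ≤ _ := by rw [add_mul, one_mul]; linarith [show c ^ 2 * k ^ (-γ) * (2 * 1 + 2 * (1 / (1 - γ))) =
      c ^ 2 * (2 * 1 + 2 * (1 / (1 - γ))) * k ^ (-γ) by ring]

/-- The contribution of the recent past. -/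
theorem KernelParams.exists_norm_restr_recent_le (h : KernelParams α γ) (hγ : 0 ≤ γ)
    (hc : ContinuousOn (gfbmVec α γ) (Ici 0)) (hθ : 0 < θ) :
    ∃ C > (0:ℝ), ∀ k : ℝ, 2 ≤ k → ∀ x ∈ Icc (0:ℝ) 1,
      ‖restrL2 (Ioi (k - 1)) measurableSet_Ioi (fracVec θ (gfbmVec α γ) (k + x))‖ ^ 2 ≤
        C * (k - 1) ^ (-γ) := by
  have hB := fracVec_rpow_pos (show -1 < α by linarith [h.lt₁]) hθ
  set B := fracVec θ (fun s : ℝ => s ^ α) 1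
  have hb : 0 < 2 * (α + θ) + 1 := by linarith [h.lt₁]
  refine ⟨B ^ 2 * (2 ^ (2 * (α + θ) + 1) / (2 * (α + θ) + 1)), by positivity, fun k hk x hx => ?_⟩
  have hk1 : 0 < k - 1 := by linarith
  have hkx : k - 1 ≤ k + x := by linarith [hx.1]
  have hInt := (Lp.memLp (fracVec θ (gfbmVec α γ) (k + x))).integrable_sq
  have hi := intervalIntegrable_sub_rpow hb (k + x) (k - 1) (k + x)
  rw [add_sub_cancel_right, intervalIntegrable_iff_integrableOn_Ioc_of_le hkx] at hi
  have hi' : Integrable ((Ioc (k - 1) (k + x)).indicator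
      fun u => B ^ 2 * (k - 1) ^ (-γ) * (k + x - u) ^ (2 * (α + θ))) volume :=
    (integrable_indicator_iff measurableSet_Ioc).2 (hi.const_mul _)
  have hnn : ∀ u, 0 ≤ (Ioc (k - 1) (k + x)).indicator
      (fun u => B ^ 2 * (k - 1) ^ (-γ) * (k + x - u) ^ (2 * (α + θ))) u := fun u =>
    indicator_nonneg (fun v hv => by
      have := rpow_nonneg (show 0 ≤ k + x - v by linarith [hv.2]) (2 * (α + θ))
      positivity) u
  rw [norm_restrL2_sq]
  refine (setIntegral_mono_on_ae (g := (Ioc (k - 1) (k + x)).indicator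
    fun u => B ^ 2 * (k - 1) ^ (-γ) * (k + x - u) ^ (2 * (α + θ))) hInt.integrableOn
    hi'.integrableOn measurableSet_Ioi ?_).trans ?_
  · filter_upwards [h.coeFn_fracVec hc hθ (show 0 ≤ k + x by linarith [hx.1])] with u hu huI
    have huI' : k - 1 < u := huI
    have hu0 : 0 < u := by linarith
    rw [hu, fracVec_gfbmKernel h.ne hu0.le (by linarith [hx.1])]
    split_ifs with hux
    · rw [indicator_of_mem (show u ∈ Ioc (k - 1) (k + x) from ⟨huI', hux.le⟩), mul_pow, mul_pow,
        sq_rpow_half hu0.le, sq_rpow (by linarith)]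
      have h2 : u ^ (-γ) ≤ (k - 1) ^ (-γ) := rpow_le_rpow_of_nonpos hk1 huI'.le (by linarith)
      have h3 : 0 ≤ (k + x - u) ^ (2 * (α + θ)) := rpow_nonneg (by linarith) _
      calc _ = B ^ 2 * u ^ (-γ) * (k + x - u) ^ (2 * (α + θ)) := by ring
        _ ≤ _ := by gcongr
    · rw [zero_pow two_ne_zero]
      exact hnn u
  · refine (setIntegral_le_integral hi' (Eventually.of_forall hnn)).trans ?_
    rw [integral_indicator measurableSet_Ioc, integral_const_mul,
      ← intervalIntegral.integral_of_le hkx,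
      intervalIntegral.integral_comp_sub_left (fun u => u ^ (2 * (α + θ))), sub_self,
      integral_rpow (Or.inl (by linarith)), zero_rpow hb.ne', sub_zero]
    have h4 : (k + x - (k - 1)) ^ (2 * (α + θ) + 1) ≤ 2 ^ (2 * (α + θ) + 1) :=
      rpow_le_rpow (by linarith) (by linarith [hx.2]) hb.le
    calc _ ≤ B ^ 2 * (k - 1) ^ (-γ) * (2 ^ (2 * (α + θ) + 1) / (2 * (α + θ) + 1)) := by gcongr
      _ = _ := by ring

theorem KernelParams.hasInterp_fracVec (h : KernelParams α γ) (hα : α < 1) (hγ : 0 ≤ γ)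
    (hc : ContinuousOn (gfbmVec α γ) (Ici 0)) (hθ : 0 < θ) :
    HasInterp (fracVec θ (gfbmVec α γ)) γ := by
  set H := α - γ / 2 + 1 / 2 with hH
  obtain ⟨m, hm'⟩ := exists_nat_ge (max (max (α + θ + 2) (θ + H + γ)) 1)
  have hm1 : α + θ + 2 ≤ m := ((le_max_left _ _).trans (le_max_left _ _)).trans hm'
  have hm2 : θ + H + γ ≤ m := ((le_max_right _ _).trans (le_max_left _ _)).trans hm'
  have hm : 0 < m := by
    have : (1:ℝ) ≤ m := (le_max_right _ _).trans hm'
    exact_mod_cast zero_lt_one.trans_le this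
  refine ⟨m, hm, fun A hS ha => ?_⟩
  simp only [Finsupp.linearCombination_apply, Finsupp.sum, smul_eq_mul] at ha ⊢
  obtain ⟨C₁, hC₁, h1⟩ := h.exists_norm_restr_neg_le hα hc hθ hm hS ha
  obtain ⟨C₂, hC₂, h2⟩ := h.exists_norm_restr_Ioc_le hγ hc hθ hm hm1 hS ha
  obtain ⟨C₃, hC₃, h3⟩ := h.exists_norm_restr_recent_le hγ hc hθ
  set N := ∑ x ∈ A.support, |A x| with hN
  have hN0 : 0 ≤ N := Finset.sum_nonneg fun _ _ => abs_nonneg _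
  set V : ℝ → L2R := fun k => ∑ x ∈ A.support, A x • fracVec θ (gfbmVec α γ) (k + x) with hV
  have htail : ∀ k : ℝ, 2 ≤ k → ‖restrL2 (Ioi (k - 1)) measurableSet_Ioi (V k)‖ ^ 2 ≤
      N ^ 2 * C₃ * (k - 1) ^ (-γ) := by
    intro k hk
    have hk1 : 0 < k - 1 := by linarith
    have h4 : ‖restrL2 (Ioi (k - 1)) measurableSet_Ioi (V k)‖ ≤ N * √(C₃ * (k - 1) ^ (-γ)) := by
      rw [hV, map_sum, hN, Finset.sum_mul]
      refine (norm_sum_le _ _).trans (Finset.sum_le_sum fun x hx => ?_)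
      rw [map_smul, norm_smul, norm_eq_abs]
      exact mul_le_mul_of_nonneg_left (le_sqrt_of_sq_le (h3 k hk x (hS x hx))) (abs_nonneg _)
    refine (pow_le_pow_left₀ (norm_nonneg _) h4 2).trans_eq ?_
    rw [mul_pow, sq_sqrt (by positivity)]; ring
  have hsplit : ∀ k : ℝ, 2 ≤ k → ‖V k‖ ^ 2 =
      ‖restrL2 (Iio 0) measurableSet_Iio (V k)‖ ^ 2 +
      ‖restrL2 (Ioc 0 (k - 1)) measurableSet_Ioc (V k)‖ ^ 2 +
      ‖restrL2 (Ioi (k - 1)) measurableSet_Ioi (V k)‖ ^ 2 := by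
    intro k hk
    have hInt := (Lp.memLp (V k)).integrable_sq
    have hdis : Disjoint (Ioc 0 (k - 1)) (Ioi (k - 1)) :=
      Set.disjoint_left.2 fun u hu hu' => not_lt.2 hu.2 hu'
    rw [norm_restrL2_sq, norm_restrL2_sq, norm_restrL2_sq, norm_sq_eq_integral, add_assoc,
      ← setIntegral_union hdis measurableSet_Ioi hInt.integrableOn hInt.integrableOn, Ioc_union_Ioi_eq_Ioi (by linarith),
      ← integral_Iic_eq_integral_Iio, ← compl_Iic, integral_add_compl measurableSet_Iic hInt]
  set D := C₁ ^ 2 + C₂ + N ^ 2 * C₃ with hD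
  have hD0 : 0 < D := by positivity
  have hbig : ∀ k : ℝ, 2 ≤ k → ‖V k‖ ^ 2 ≤ 3 * D * (k + 1) ^ (-γ) := by
    intro k hk
    have hk0 : 0 < k := by linarith
    have hk1 : 0 < k - 1 := by linarith
    have e1 : k ^ (-γ) ≤ (k - 1) ^ (-γ) := rpow_le_rpow_of_nonpos hk1 (by linarith) (by linarith)
    have e2 : (k ^ (θ - m + H)) ^ 2 ≤ k ^ (-γ) := by
      rw [sq_rpow hk0.le]
      exact rpow_le_rpow_of_exponent_le (by linarith) (by linarith)
    have e3 : (k - 1) ^ (-γ) ≤ 3 * (k + 1) ^ (-γ) := by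
      have e4 : (3 * (k - 1)) ^ (-γ) ≤ (k + 1) ^ (-γ) :=
        rpow_le_rpow_of_nonpos (by linarith) (by linarith) (by linarith)
      rw [mul_rpow (by norm_num) hk1.le] at e4
      have e5 : (3:ℝ) ^ (-1 : ℝ) ≤ 3 ^ (-γ) :=
        rpow_le_rpow_of_exponent_le (by norm_num) (by linarith [h.lt₂])
      rw [rpow_neg_one] at e5
      have e6 : 0 ≤ (k - 1) ^ (-γ) := by positivity
      nlinarith [mul_le_mul_of_nonneg_right e5 e6]
    rw [hsplit k hk]
    have f1 : ‖restrL2 (Iio 0) measurableSet_Iio (V k)‖ ^ 2 ≤ C₁ ^ 2 * (k - 1) ^ (-γ) := by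
      refine (pow_le_pow_left₀ (norm_nonneg _) (h1 k (by linarith)) 2).trans ?_
      rw [mul_pow]
      exact mul_le_mul_of_nonneg_left (e2.trans e1) (by positivity)
    have f2 := (h2 k hk).trans (mul_le_mul_of_nonneg_left e1 hC₂.le)
    have f3 := htail k hk
    calc _ ≤ C₁ ^ 2 * (k - 1) ^ (-γ) + C₂ * (k - 1) ^ (-γ) + N ^ 2 * C₃ * (k - 1) ^ (-γ) :=
          add_le_add (add_le_add f1 f2) f3
      _ = D * (k - 1) ^ (-γ) := by rw [hD]; ring
      _ ≤ D * (3 * (k + 1) ^ (-γ)) := by gcongr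
      _ = _ := by ring
  refine ⟨3 * D + 2 * ‖V 0‖ ^ 2 + 2 * ‖V 1‖ ^ 2, by positivity, fun k => ?_⟩
  change ‖V k‖ ^ 2 ≤ _
  have hp : (0:ℝ) ≤ ((k:ℝ) + 1) ^ (-γ) := by positivity
  have e0 : 0 ≤ ‖V 0‖ ^ 2 := sq_nonneg _
  have e1 : 0 ≤ ‖V 1‖ ^ 2 := sq_nonneg _
  rcases lt_or_ge k 2 with hk | hk
  · have hk' : (k:ℝ) + 1 ≤ 2 := by
      have : (k:ℝ) ≤ 1 := by exact_mod_cast Nat.lt_succ_iff.1 hk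
      linarith
    have h5 : 1 ≤ 2 * ((k:ℝ) + 1) ^ (-γ) := by
      have h6 : (2:ℝ) ^ (-1 : ℝ) ≤ ((k:ℝ) + 1) ^ (-γ) :=
        (rpow_le_rpow_of_exponent_le one_le_two (by linarith [h.lt₂])).trans
          (rpow_le_rpow_of_nonpos (by positivity) hk' (by linarith))
      rw [rpow_neg_one] at h6
      linarith
    have h7 : ‖V k‖ ^ 2 ≤ ‖V 0‖ ^ 2 + ‖V 1‖ ^ 2 := by
      interval_cases k
      · rw [Nat.cast_zero]; linarith
      · rw [Nat.cast_one]; linarith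
    nlinarith [mul_nonneg hD0.le hp]
  · refine (hbig k (by exact_mod_cast hk)).trans (mul_le_mul_of_nonneg_right ?_ hp)
    linarith

end kernel

section LowerClass

variable {Ω : Type*} [MeasurableSpace Ω] {P : Measure Ω} [IsProbabilityMeasure P]
  {α γ θ : ℝ} {X : ℝ → Ω → ℝ}

theorem IsGFBM.smallBallEstimates (hX : IsGFBM P α γ X) (hα0 : α ≠ 0) (hγ : γ ∈ Ico (0:ℝ) 1)
    (hα : α ∈ Ioo (-1/2 + γ/2) (1/2)) (hθ : 0 < θ) :
    SmallBallEstimates P (runSup (fracInt θ X)) (smallBall P (fracInt θ X))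
      (α - γ / 2 + 1 / 2 + θ) (α + θ + 1 / 2) := by
  obtain ⟨hγ0, hγ1⟩ := hγ
  obtain ⟨hα1, hα2⟩ := hα
  have hp : KernelParams α γ := by constructor <;> first | assumption | linarith
  have hY := hX.isSelfSimGauss_fracInt hp hθ
  have hc := hX.continuousOn_gfbmVec hp
  have hh : 0 < α - γ / 2 + 1 / 2 + θ := by linarith
  have hβ : 0 < α + θ + 1 / 2 := by linarith
  obtain ⟨c, hcpos, hdecay⟩ := hY.exists_decay (hp.isNondetKernel hc hθ hγ0) hβ (by linarith)
  obtain ⟨C₀, hC₀, hlow⟩ := hY.exists_exp_le_smallBall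
    (hp.hasInterp_fracVec (by linarith) hγ0 hc hθ) hh hγ0
    (show α + θ + 1 / 2 = α - γ / 2 + 1 / 2 + θ + γ / 2 by ring)
  refine ⟨hh, hβ, fun ω s t hs hst => runSup_mono (hY.cont ω) hs hst,
    fun t ht a => hY.nullMeasurableSet ht.le a, fun t ht a => hY.measureReal_runSup_le ht a,
    ⟨C₀, hC₀, hlow⟩, ⟨2, two_pos, c, hcpos, fun ε hε => ?_⟩, fun a _ b _ => hY.concave a b,
    ⟨2, two_pos, c, hcpos, fun s hs t hst a _ b hb _ => ?_⟩,
    hY.exists_decouple (hasKernelTails_fracVec hα0 hγ0 hγ1 (by linarith) hα2 hc hθ)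
      ((hX.isSelfSimGauss hp).hasModulus_fracInt hθ) hβ hC₀ hlow⟩
  · have h1 := hdecay 0 le_rfl 1 one_pos ε ε hε.1
    have hsub : {ω | runSup (fracInt θ X) 1 ω ≤ ε} ⊆ {ω | runSup (fracInt θ X) 0 ω ≤ ε} :=
      fun ω hω => (runSup_mono (hY.cont ω) le_rfl zero_le_one).trans hω
    rw [inter_eq_right.2 hsub, one_rpow, div_one, sub_zero, div_one, mul_one,
      hY.measureReal_runSup_le one_pos, one_rpow, div_one] at h1
    refine h1.trans ?_
    gcongr
    linarith [measureReal_le_one (μ := P) (s := {ω | runSup (fracInt θ X) 0 ω ≤ ε})]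
  · rw [← hY.measureReal_runSup_le hs]
    exact hdecay s hs.le t hst a b hb

/-- For `α = 0` the kernel of a generalized fractional Brownian motion vanishes. -/
theorem IsGFBM.ae_runSup_eq_zero (hX : IsGFBM P 0 γ X) :
    ∀ᵐ ω ∂P, ∀ t, runSup (fracInt θ X) t ω = 0 := by
  have hG : IsGaussProcOn P X (fun _ => (0:ℝ)) (Ici 0) :=
    hX.1.isGaussProcOn fun s hs t ht => by rw [hX.2.2.2 s t hs ht]; simp [gfbmCov]
  have hz : ∀ s ∈ Ici (0:ℝ), ∀ᵐ ω ∂P, X s ω = 0 := fun s hs => by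
    have h1 := hG.law 1 (fun _ => s) (fun _ => hs) fun _ => 1
    simp only [Finset.univ_unique, Finset.sum_const, Finset.card_singleton, one_smul, one_mul,
      nnnorm_zero, ne_eq, OfNat.ofNat_ne_zero, not_false_eq_true, zero_pow,
      gaussianReal_zero_var] at h1
    refine ae_of_ae_map (f := X s) (p := fun x => x = 0) (hG.meas s hs) ?_
    rw [show P.map (X s) = Measure.dirac 0 by simpa using h1]
    simp
  filter_upwards [ae_all_iff.2 fun q : ℚ => hz |(q:ℝ)| (mem_Ici.2 (abs_nonneg _))] with ω hω t
  have hcont : Continuous fun u : ℝ => X |u| ω :=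
    (hX.2.1 ω).comp_continuous continuous_abs fun u => abs_nonneg u
  have h0 : (fun u : ℝ => X |u| ω) = fun _ => 0 :=
    Rat.denseRange_cast.equalizer hcont continuous_const (funext hω)
  have hF : ∀ s ∈ Icc 0 t, fracInt θ X s ω = 0 := fun s hs => by
    rw [fracInt, intervalIntegral.integral_congr (g := fun _ => (0:ℝ)) fun u hu => ?_]
    · simp
    · rw [uIcc_of_le hs.1] at hu
      have := congrFun h0 u
      simp only [abs_of_nonneg hu.1] at this
      simp [this]
  rw [runSup]
  simp only [fun s : Icc 0 t => hF s.1 s.2, abs_zero, Real.iSup_const_zero]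

theorem IsGFBM.lowerClass_iff_of_zero (hX : IsGFBM P 0 γ X) {ξ : ℝ → ℝ} {T₀ h β : ℝ}
    (hT : 0 < T₀) (hβ : 0 < β) (hpos : ∀ t ∈ Ici T₀, 0 < ξ t) :
    (∀ᵐ ω ∂P, ∃ t₀ : ℝ, ∀ t : ℝ, t₀ < t → ξ t ≤ runSup (fracInt θ X) t ω) ↔
    ((∃ C : ℝ, ∀ t ∈ Ici T₀, ξ t / t ^ h ≤ C) ∧
      ∫⁻ t in Ici T₀, ENNReal.ofReal ((ξ t / t ^ h) ^ (-(1 / β)) *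
        smallBall P (fracInt θ X) (ξ t / t ^ h) / t) < ⊤) := by
  have hM := hX.ae_runSup_eq_zero (θ := θ)
  constructor
  · intro hae
    obtain ⟨ω, ⟨t₀, h1⟩, h2⟩ := (hae.and hM).exists
    have h3 := h1 (max (t₀ + 1) T₀) ((lt_add_one t₀).trans_le (le_max_left _ _))
    rw [h2] at h3
    exact absurd h3 (hpos _ (mem_Ici.2 (le_max_right _ _))).not_ge
  · rintro ⟨⟨C, hC⟩, hfin⟩
    have hφ : ∀ x : ℝ, 0 ≤ x → smallBall P (fracInt θ X) x = 1 := fun x hx => by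
      have : P {ω | runSup (fracInt θ X) 1 ω ≤ x} = 1 := by
        rw [← measure_univ (μ := P)]
        refine measure_congr (eventuallyEq_univ.2 ?_)
        filter_upwards [hM] with ω hω
        exact (hω 1).trans_le hx
      simp [smallBall, this]
    have hq : ∀ t ∈ Ici T₀, 0 < ξ t / t ^ h := fun t ht =>
      div_pos (hpos t ht) (rpow_pos_of_pos (hT.trans_le ht) _)
    have hC0 : 0 < C := (hq T₀ self_mem_Ici).trans_le (hC T₀ self_mem_Ici)
    have hD : 0 < C ^ (-(1 / β)) := rpow_pos_of_pos hC0 _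
    have hle : ∫⁻ t in Ici T₀, ENNReal.ofReal (C ^ (-(1 / β)) * t⁻¹) < ⊤ := by
      refine (setLIntegral_mono' measurableSet_Ici fun t ht => ?_).trans_lt hfin
      have ht0 : 0 < t := hT.trans_le ht
      rw [hφ _ (hq t ht).le, mul_one, div_eq_mul_inv]
      refine ENNReal.ofReal_le_ofReal (mul_le_mul_of_nonneg_right ?_ (by positivity))
      exact rpow_le_rpow_of_nonpos (hq t ht) (hC t ht) (by simp [hβ.le])
    have hInt : IntegrableOn (fun t : ℝ => C ^ (-(1 / β)) * t⁻¹) (Ici T₀) :=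
      (lintegral_ofReal_ne_top_iff_integrable (by fun_prop)
        ((ae_restrict_mem measurableSet_Ici).mono fun t ht =>
          mul_nonneg hD.le (inv_nonneg.2 (hT.le.trans ht)))).1 hle.ne
    refine absurd ?_ (not_integrableOn_Ici_inv (a := T₀))
    have := hInt.const_mul (C ^ (-(1 / β)))⁻¹
    simp only [← mul_assoc, inv_mul_cancel₀ hD.ne', one_mul] at this
    exact this

end LowerClass

/-- Integral test for the lower class of `M` at infinity. -/
theorem lowerClassInfinity_iff
    {Ω : Type*} [MeasurableSpace Ω] (P : Measure Ω) [IsProbabilityMeasure P]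
    (γ α θ H β : ℝ) (hγ : γ ∈ Set.Ico (0:ℝ) 1)
    (hα : α ∈ Set.Ioo (-1/2 + γ/2) (1/2)) (hθ : 0 < θ)
    (hH : H = α - γ/2 + 1/2) (hβ : β = α + θ + 1/2)
    (X : ℝ → Ω → ℝ) (hX : IsGFBM P α γ X)
    (Y : ℝ → Ω → ℝ) (hY : Y = fracInt θ X)
    (M : ℝ → Ω → ℝ) (hM : M = runSup Y)
    (φ : ℝ → ℝ) (hφ : φ = smallBall P Y)
    (ξ : ℝ → ℝ)
    (hξpos : ∀ t ∈ Set.Ici (Real.exp (Real.exp 1)), 0 < ξ t)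
    (hξmono : MonotoneOn ξ (Set.Ici (Real.exp (Real.exp 1))))
    (hξcont : ContinuousOn ξ (Set.Ici (Real.exp (Real.exp 1)))) :
    (∀ᵐ ω ∂P, ∃ t₀ : ℝ, ∀ t : ℝ, t₀ < t → ξ t ≤ M t ω) ↔
    ((∃ C : ℝ, ∀ t ∈ Set.Ici (Real.exp (Real.exp 1)), ξ t / t ^ (H + θ) ≤ C) ∧
      ∫⁻ t in Set.Ici (Real.exp (Real.exp 1)),
        ENNReal.ofReal ((ξ t / t ^ (H + θ)) ^ (-(1/β)) * φ (ξ t / t ^ (H + θ)) / t) < ⊤) := by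
  subst hH hβ hY hM hφ
  rcases eq_or_ne α 0 with rfl | hα0
  · exact hX.lowerClass_iff_of_zero (exp_pos _) (by linarith) hξpos
  · exact (hX.smallBallEstimates hα0 hγ hα hθ).integral_test (exp_pos _) hξpos hξmono
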